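/- Let g be the simple complex Lie algebra of type X, where X is any of E₆, E₇, E₈, F₄, G₂. Then g has the Panyushev property: for every sl₂-triple (e,h,f) in g, the element e is reachable (i.e. e ∈ [g_e, g_e]) if and only if the Lie subalgebra of g generated by g(1)_e is equal to g(≥1)_e. -/

import Mathlib

namespace PaperStmt

open LieAlgebra Module

variable (R : Type*) {L : Type*} [CommRing R] [LieRing L] [LieAlgebra R L]

/-- The centralizer `g_x = {y ∈ g | ⁅y, x⁆ = 0}` of an element of a Lie algebra,
as a Lie subalgebra. -/
def centralizerOf (x : L) : LieSubalgebra R L where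
  carrier := {y : L | ⁅y, x⁆ = 0}
  add_mem' := fun {a b} (ha : ⁅a, x⁆ = 0) (hb : ⁅b, x⁆ = 0) => by
    show ⁅a + b, x⁆ = 0
    rw [add_lie, ha, hb, add_zero]
  zero_mem' := zero_lie x
  smul_mem' := fun c a (ha : ⁅a, x⁆ = 0) => by
    show ⁅c • a, x⁆ = 0
    rw [smul_lie, ha, smul_zero]
  lie_mem' := fun {a b} (ha : ⁅a, x⁆ = 0) (hb : ⁅b, x⁆ = 0) => by
    show ⁅⁅a, b⁆, x⁆ = 0
    rw [lie_lie, ha, hb, lie_zero, lie_zero, sub_zero]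

/-- The subspace spanned by the brackets `⁅x, y⁆` with `x ∈ A`, `y ∈ B`. -/
def bracketSpan (A B : Submodule R L) : Submodule R L :=
  Submodule.span R {z : L | ∃ x ∈ A, ∃ y ∈ B, z = ⁅x, y⁆}

/-- The derived subalgebra `[k, k]` of a Lie subalgebra `k`, as a subspace of the
ambient Lie algebra: the span of all brackets `⁅a, b⁆` with `a, b ∈ k`. -/
def derivedOf (K : LieSubalgebra R L) : Submodule R L :=
  bracketSpan R K.toSubmodule K.toSubmodule

/-- An element `e` of a Lie algebra is reachable if `e ∈ [g_e, g_e]`. -/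
def IsReachable (e : L) : Prop :=
  e ∈ derivedOf R (centralizerOf R e)

/-- `g(k)`, the `k`-eigenspace of `ad h`. -/
def gradePiece (h : L) (k : ℤ) : Submodule R L :=
  Module.End.eigenspace (LieAlgebra.ad R L h) (k : R)

/-- `g(k)_e = g(k) ∩ g_e`. -/
def gradePieceCent (e h : L) (k : ℤ) : Submodule R L :=
  gradePiece R h k ⊓ (centralizerOf R e).toSubmodule

/-- `g(≥1)_e`, the sum of the subspaces `g(k)_e` over all `k ≥ 1`. -/
def gradeGeOneCent (e h : L) : Submodule R L :=
  ⨆ k ∈ {k : ℤ | 1 ≤ k}, gradePieceCent R e h k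

/-- A Lie algebra has the Panyushev property if for every `sl₂`-triple `(e,h,f)`, the
element `e` is reachable if and only if the Lie subalgebra generated by `g(1)_e`
equals `g(≥1)_e`. -/
def PanyushevProperty (R L : Type*) [CommRing R] [LieRing L] [LieAlgebra R L] : Prop :=
  ∀ e h f : L, IsSl2Triple h e f →
    (IsReachable R e ↔
      (LieSubalgebra.lieSpan R L (gradePieceCent R e h 1 : Set L)).toSubmodule
        = gradeGeOneCent R e h)

end PaperStmt

namespace PaperStmt.Sl2
open Module

variable {V : Type*} [AddCommGroup V] [Module ℂ V]

/-- Operators satisfying the `sl₂` relations. -/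
structure S2 (e h f : End ℂ V) : Prop where
  he : ∀ v, h (e v) = e (h v) + (2 : ℂ) • e v
  hf : ∀ v, h (f v) = f (h v) - (2 : ℂ) • f v
  ef : ∀ v, e (f v) = f (e v) + h v

variable {e h f : End ℂ V}

lemma S2.swap (s : S2 e h f) : S2 f (-h) e where
  he v := by simp only [LinearMap.neg_apply, s.hf, map_neg]; abel
  hf v := by simp only [LinearMap.neg_apply, s.he, map_neg]; abel
  ef v := by simp only [LinearMap.neg_apply, s.ef]; abel

lemma S2.h_pow (s : S2 e h f) (k : ℕ) (v : V) :
    h ((e ^ k) v) = (e ^ k) (h v) + (2 * k : ℂ) • (e ^ k) v := by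
  induction k with
  | zero => simp
  | succ k ih =>
    rw [pow_succ', Module.End.mul_apply, s.he, ih]
    simp only [Module.End.mul_apply, map_add, map_smul]
    push_cast
    module

lemma S2.f_pow (s : S2 e h f) (k : ℕ) (v : V) :
    f ((e ^ (k + 1)) v) =
      (e ^ (k + 1)) (f v) - ((k : ℂ) + 1) • (e ^ k) (h v + (k : ℂ) • v) := by
  induction k with
  | zero =>
    have := s.ef v
    simp [this]
  | succ k ih =>
    have h1 := s.ef ((e ^ (k + 1)) v)
    rw [pow_succ' e (k+1), Module.End.mul_apply, Module.End.mul_apply, eq_sub_of_add_eq h1.symm, ih, s.h_pow]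
    simp only [map_add, map_smul, map_sub]
    rw [← Module.End.mul_apply e (e ^ k), ← pow_succ', ← Module.End.mul_apply e (e ^ k), ← pow_succ']
    push_cast
    module

lemma S2.nilp [FiniteDimensional ℂ V] (s : S2 e h f) : ∃ N, ∀ v, (e ^ N) v = 0 := by
  by_contra hcon
  push Not at hcon
  let D : End ℂ (End ℂ V) := LinearMap.mulLeft ℂ h - LinearMap.mulRight ℂ h
  have hev : ∀ k : ℕ, D.HasEigenvalue (2 * k : ℂ) := by
    intro k
    refine Module.End.hasEigenvalue_of_hasEigenvector (x := e ^ k) ⟨?_, ?_⟩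
    · rw [Module.End.mem_eigenspace_iff]
      ext v
      simp [D, s.h_pow]
    · obtain ⟨v, hv⟩ := hcon k
      intro h0
      exact hv (by simp [h0])
  have hfin : (Set.range fun k : ℕ => (2 * k : ℂ)).Finite :=
    (Module.End.finite_hasEigenvalue D).subset (by rintro _ ⟨k, rfl⟩; exact hev k)
  refine Set.infinite_range_of_injective ?_ hfin
  intro a b hab
  simpa using hab

/-- The product `h (h+1) ⋯ (h+k-1)`. -/
def pp (h : End ℂ V) : ℕ → End ℂ V
  | 0 => 1
  | k + 1 => pp h k * (h + (k : ℂ) • (1 : End ℂ V))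

lemma pp_succ_apply (h : End ℂ V) (k : ℕ) (v : V) :
    pp h (k + 1) v = pp h k (h v + (k : ℂ) • v) := by
  simp [pp]

lemma pp_comm (h : End ℂ V) (k : ℕ) : ∀ v, h (pp h k v) = pp h k (h v) := by
  induction k with
  | zero => intro v; simp [pp]
  | succ k ih => intro v; rw [pp_succ_apply, ih, pp_succ_apply]; simp

lemma S2.pp_zero (s : S2 e h f) (k : ℕ) : ∀ w, f w = 0 → (e ^ k) w = 0 → pp h k w = 0 := by
  induction k with
  | zero => intro w _ hw; simpa [pp] using hw
  | succ k ih =>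
    intro w hf hw
    rw [pp_succ_apply]
    apply ih
    · have := s.hf w
      rw [hf] at this
      simp only [map_zero, smul_zero, sub_zero] at this
      simp [← this, hf]
    · have := s.f_pow k w
      rw [hw, hf] at this
      simp only [map_zero, zero_sub] at this
      have h2 := neg_eq_zero.mp this.symm
      exact (smul_eq_zero.mp h2).resolve_left (by exact_mod_cast Nat.succ_ne_zero k)

lemma pp_diag (h : End ℂ V) (k : ℕ) : ∀ w, pp h k w = 0 →
    w ∈ ⨆ j : Fin k, End.eigenspace h (-(j : ℂ)) := by
  induction k with
  | zero => intro w hw; simp [pp] at hw; simp [hw]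
  | succ k ih =>
    intro w hw
    rw [pp_succ_apply] at hw
    have hu := ih _ hw
    have key : ∀ u ∈ ⨆ j : Fin k, End.eigenspace h (-(j : ℂ)),
        ∃ w' ∈ ⨆ j : Fin k, End.eigenspace h (-(j : ℂ)), h w' + (k : ℂ) • w' = u := by
      intro u hu
      refine Submodule.iSup_induction _ (motive := fun u => ∃ w' ∈ ⨆ j : Fin k, End.eigenspace h (-(j : ℂ)), h w' + (k : ℂ) • w' = u) hu ?_ ?_ ?_
      · intro j x hx
        have hne : (k : ℂ) - (j : ℕ) ≠ 0 := by
          rw [sub_ne_zero]; exact_mod_cast j.2.ne'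
        refine ⟨((k : ℂ) - (j : ℕ))⁻¹ • x, Submodule.mem_iSup_of_mem j (Submodule.smul_mem _ _ hx), ?_⟩
        rw [Module.End.mem_eigenspace_iff] at hx
        rw [map_smul, hx]
        have : x = (((k : ℂ) - (j : ℕ))⁻¹ * ((k : ℂ) - (j : ℕ))) • x := by
          rw [inv_mul_cancel₀ hne, one_smul]
        conv_rhs => rw [this]
        module
      · exact ⟨0, zero_mem _, by simp⟩
      · rintro x y ⟨a, ha, rfl⟩ ⟨b, hb, rfl⟩
        exact ⟨a + b, add_mem ha hb, by simp only [map_add]; module⟩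
    obtain ⟨w', hw', he⟩ := key _ hu
    have hle : (⨆ j : Fin k, End.eigenspace h (-(j : ℂ))) ≤ ⨆ j : Fin (k+1), End.eigenspace h (-(j : ℂ)) := by
      refine iSup_le fun j => ?_
      exact le_iSup (fun j : Fin (k+1) => End.eigenspace h (-(j : ℂ))) (Fin.castSucc j)
    have h3 : w - w' ∈ End.eigenspace h (-((Fin.last k : Fin (k+1)) : ℂ)) := by
      rw [Module.End.mem_eigenspace_iff]
      have : h w - h w' = (k : ℂ) • w' - (k : ℂ) • w := by
        have e1 : h w = h w' + (k : ℂ) • w' - (k : ℂ) • w := by rw [he]; abel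
        rw [e1]; abel
      simp only [map_sub, this, Fin.val_last]
      module
    have := add_mem (Submodule.mem_iSup_of_mem (p := fun j : Fin (k+1) => End.eigenspace h (-(j : ℂ))) _ h3) (hle hw')
    simpa using this

lemma S2.e_pp (s : S2 e h f) {u : V} {n : ℕ} (hu : h u = -(n : ℂ) • u) (k : ℕ) :
    ∀ (z : V) (a : ℂ), a ≠ 0 → e z = a • u → ∃ c : ℂ, c ≠ 0 ∧ e (pp (-h) k z) = c • u := by
  induction k with
  | zero => intro z a ha hz; exact ⟨a, ha, by simpa [pp] using hz⟩
  | succ k ih =>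
    intro z a ha hz
    rw [pp_succ_apply]
    refine ih _ (((n : ℂ) + 2 + k) * a) (mul_ne_zero ?_ ha) ?_
    · exact_mod_cast (by omega : n + 2 + k ≠ 0)
    · have h1 := s.he z
      have h2 : e (h z) = h (e z) - (2 : ℂ) • e z := by rw [h1]; abel
      simp only [LinearMap.neg_apply, map_add, map_neg, map_smul, h2, hz, hu]
      module

/-- `ker f ∩ im e = 0`. -/
lemma S2.disj [FiniteDimensional ℂ V] (s : S2 e h f) :
    Disjoint (LinearMap.range e) (LinearMap.ker f) := by
  obtain ⟨N, hN⟩ := s.nilp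
  obtain ⟨M, hM⟩ := s.swap.nilp
  rw [disjoint_iff]
  by_contra hne
  set U := LinearMap.range e ⊓ LinearMap.ker f with hU
  have hst : ∀ x ∈ U, h x ∈ U := by
    rintro x ⟨⟨y, rfl⟩, hx⟩
    refine ⟨⟨h y + (2 : ℂ) • y, by rw [s.he]; simp⟩, ?_⟩
    have := s.hf (e y)
    have hx' : f (e y) = 0 := hx
    rw [hx'] at this
    show f (h (e y)) = 0
    simpa using this.symm
  have : Nontrivial U := Submodule.nontrivial_iff_ne_bot.mpr hne
  obtain ⟨c, hc⟩ := Module.End.exists_eigenvalue (LinearMap.restrict h hst)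
  obtain ⟨⟨u, hu⟩, hu1, hu2⟩ := hc.exists_hasEigenvector
  rw [Module.End.mem_eigenspace_iff] at hu1
  have hu3 : h u = c • u := by simpa using congrArg Subtype.val hu1
  have hu0 : u ≠ 0 := by simpa using hu2
  obtain ⟨⟨y, hy⟩, hfu⟩ := hu
  replace hfu : f u = 0 := hfu
  have h1 : u ∈ ⨆ j : Fin N, End.eigenspace h (-(j : ℂ)) := pp_diag h N u (s.pp_zero N u hfu (hN u))
  obtain ⟨n, rfl⟩ : ∃ n : ℕ, c = -(n : ℂ) := by
    by_contra hcon
    push Not at hcon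
    have hd := (Module.End.eigenspaces_iSupIndep h) c
    have h2 : (⨆ j : Fin N, End.eigenspace h (-(j : ℂ))) ≤ ⨆ j, ⨆ (_ : j ≠ c), End.eigenspace h j := by
      refine iSup_le fun j => ?_
      exact le_iSup₂_of_le (-(j : ℂ)) (fun h => hcon _ h.symm) le_rfl
    exact hu0 (Submodule.disjoint_def.mp hd u (Module.End.mem_eigenspace_iff.mpr hu3) (h2 h1))
  obtain ⟨a, ha, hea⟩ := s.e_pp hu3 M y 1 one_ne_zero (by rw [hy, one_smul])
  set y' := pp (-h) M y
  have hy' : h y' = (-(n : ℂ) - 2) • y' := by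
    have hk : e (h y + ((n : ℂ) + 2) • y) = 0 := by
      have h2 : e (h y) = h (e y) - (2 : ℂ) • e y := by rw [s.he]; abel
      simp only [map_add, map_smul, h2, hy, hu3]
      module
    have h4 := s.swap.pp_zero M _ hk (hM _)
    have h5 := pp_comm (-h) M y
    simp only [LinearMap.neg_apply, map_neg, neg_inj] at h5
    rw [map_add, map_smul, ← h5] at h4
    rw [eq_neg_of_add_eq_zero_left h4]
    module
  have hdesc : ∀ k, (f ^ k) y' = 0 → y' = 0 := by
    intro k
    induction k with
    | zero => intro h0; simpa using h0
    | succ k ih =>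
      intro h0
      apply ih
      have h6 := s.swap.f_pow k y'
      rw [h0, hea, pow_succ, Module.End.mul_apply, map_smul, hfu] at h6
      simp only [map_zero, smul_zero, zero_sub, LinearMap.neg_apply, hy'] at h6
      have h7 : ((k : ℂ) + 1) • (f ^ k) (-((-(n : ℂ) - 2) • y') + (k : ℂ) • y') =
          (((k : ℂ) + 1) * ((n : ℂ) + 2 + k)) • (f ^ k) y' := by
        simp only [map_add, map_neg, map_smul]; module
      rw [h7] at h6
      refine (smul_eq_zero.mp (neg_eq_zero.mp h6.symm)).resolve_left ?_
      exact_mod_cast (by positivity : (k + 1) * (n + 2 + k) ≠ 0)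
  have hy0 := hdesc M (hM y')
  rw [hy0, map_zero] at hea
  exact hu0 ((smul_eq_zero.mp hea.symm).resolve_left ha)

lemma S2.sup_eq_top [FiniteDimensional ℂ V] (s : S2 e h f) :
    LinearMap.range e ⊔ LinearMap.ker f = ⊤ := by
  have h1 := Submodule.finrank_add_finrank_le_of_disjoint s.disj
  have h2 := Submodule.finrank_add_finrank_le_of_disjoint s.swap.disj
  have h3 := LinearMap.finrank_range_add_finrank_ker e
  have h4 := LinearMap.finrank_range_add_finrank_ker f
  apply Submodule.eq_top_of_finrank_eq
  have h5 := Submodule.finrank_sup_add_finrank_inf_eq (LinearMap.range e) (LinearMap.ker f)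
  rw [s.disj.eq_bot, finrank_bot] at h5
  omega

lemma S2.ker_le [FiniteDimensional ℂ V] (s : S2 e h f) :
    LinearMap.ker f ≤ ⨆ j : ℕ, End.eigenspace h (-(j : ℂ)) := by
  obtain ⟨N, hN⟩ := s.nilp
  intro w hw
  have h1 := pp_diag h N w (s.pp_zero N w hw (hN w))
  refine (iSup_le fun j : Fin N => ?_ : (⨆ j : Fin N, End.eigenspace h (-(j : ℂ))) ≤ _) h1
  exact le_iSup (fun j : ℕ => End.eigenspace h (-(j : ℂ))) (j : ℕ)

lemma S2.diag [FiniteDimensional ℂ V] (s : S2 e h f) :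
    ⨆ k : ℤ, End.eigenspace h (k : ℂ) = ⊤ := by
  set W := ⨆ k : ℤ, End.eigenspace h (k : ℂ) with hW
  have hst : ∀ x ∈ W, e x ∈ W := by
    intro x hx
    refine Submodule.iSup_induction _ (motive := fun x => e x ∈ W) hx ?_ ?_ ?_
    · intro k x hx
      refine Submodule.mem_iSup_of_mem (k + 2) ?_
      rw [Module.End.mem_eigenspace_iff] at hx ⊢
      rw [s.he, hx, map_smul]; push_cast; module
    · simp
    · intro x y hx hy; rw [map_add]; exact add_mem hx hy
  have hk : LinearMap.ker f ≤ W := s.ker_le.trans (iSup_le fun j =>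
    (le_iSup (fun k : ℤ => End.eigenspace h (k : ℂ)) (-(j : ℤ))).trans' (by simp))
  have key : ∀ N : ℕ, ∀ x, ∃ y, ∃ w ∈ W, x = (e ^ N) y + w := by
    intro N
    induction N with
    | zero => intro x; exact ⟨x, 0, zero_mem _, by simp⟩
    | succ N ih =>
      intro x
      have hx : x ∈ LinearMap.range e ⊔ LinearMap.ker f := by rw [s.sup_eq_top]; trivial
      obtain ⟨_, ⟨y, rfl⟩, z, hz, rfl⟩ := Submodule.mem_sup.mp hx
      obtain ⟨y', w, hw, rfl⟩ := ih y
      exact ⟨y', e w + z, add_mem (hst w hw) (hk hz), by rw [pow_succ']; simp [add_assoc]⟩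
  obtain ⟨N, hN⟩ := s.nilp
  rw [eq_top_iff]
  intro x _
  obtain ⟨y, w, hw, rfl⟩ := key N x
  rw [hN, zero_add]; exact hw

/-- `e` maps `E(k)` onto `E(k+2)` for `k ≥ -1`. -/
lemma S2.surj [FiniteDimensional ℂ V] (s : S2 e h f) {k : ℤ} (hk : -1 ≤ k) {x : V}
    (hx : h x = ((k : ℂ) + 2) • x) : ∃ y, h y = (k : ℂ) • y ∧ e y = x := by
  have h1 : x ∈ LinearMap.range e ⊔ LinearMap.ker f := by rw [s.sup_eq_top]; trivial
  obtain ⟨_, ⟨y, rfl⟩, z, hz, hxy⟩ := Submodule.mem_sup.mp h1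
  have hz' := s.ker_le hz
  have hy : y ∈ ⨆ k : ℤ, End.eigenspace h (k : ℂ) := by rw [s.diag]; trivial
  -- split off the component of y
  have hsplit : ∃ a, h a = (k : ℂ) • a ∧ y - a ∈ ⨆ j : {j : ℤ // j ≠ k}, End.eigenspace h ((j : ℤ) : ℂ) := by
    refine Submodule.iSup_induction _ (motive := fun y => ∃ a, h a = (k : ℂ) • a ∧ y - a ∈ ⨆ j : {j : ℤ // j ≠ k}, End.eigenspace h ((j : ℤ) : ℂ)) hy ?_ ?_ ?_
    · intro j y hy
      by_cases hjk : j = k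
      · subst hjk; exact ⟨y, Module.End.mem_eigenspace_iff.mp hy, by simp⟩
      · exact ⟨0, by simp, by
          rw [sub_zero]
          exact Submodule.mem_iSup_of_mem (p := fun j : {j : ℤ // j ≠ k} => End.eigenspace h ((j : ℤ) : ℂ)) ⟨j, hjk⟩ hy⟩
    · exact ⟨0, by simp, by simp⟩
    · rintro x y ⟨a, ha, ha'⟩ ⟨b, hb, hb'⟩
      exact ⟨a + b, by rw [map_add, ha, hb, smul_add], by
        have := add_mem ha' hb'; rwa [show x + y - (a + b) = x - a + (y - b) by abel]⟩
  obtain ⟨a, ha, hya⟩ := hsplit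
  refine ⟨a, ha, ?_⟩
  set T := ⨆ j, ⨆ (_ : j ≠ ((k : ℂ) + 2)), End.eigenspace h j with hT
  have hd := (Module.End.eigenspaces_iSupIndep h) ((k : ℂ) + 2)
  have hzT : z ∈ T := by
    refine (iSup_le fun j : ℕ => ?_ : (⨆ j : ℕ, End.eigenspace h (-(j : ℂ))) ≤ T) hz'
    refine le_iSup₂_of_le (-(j : ℂ)) ?_ le_rfl
    intro hj
    have : (-(j : ℤ)) = k + 2 := by exact_mod_cast hj
    omega
  have hyT : e (y - a) ∈ T := by
    refine Submodule.iSup_induction _ (motive := fun y => e y ∈ T) hya ?_ ?_ ?_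
    · rintro ⟨j, hj⟩ v hv
      have hv' := Module.End.mem_eigenspace_iff.mp hv
      have : e v ∈ End.eigenspace h ((j : ℂ) + 2) := by
        rw [Module.End.mem_eigenspace_iff, s.he, hv', map_smul]; module
      refine (le_iSup₂_of_le (f := fun j (_ : j ≠ ((k : ℂ) + 2)) => End.eigenspace h j) ((j : ℂ) + 2) ?_ le_rfl) this
      intro h0
      apply hj
      exact_mod_cast add_right_cancel h0
    · simp
    · intro x y hx hy; rw [map_add]; exact add_mem hx hy
  have hmem : x - e a ∈ End.eigenspace h ((k : ℂ) + 2) := by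
    rw [Module.End.mem_eigenspace_iff, map_sub, hx, s.he, ha, map_smul]; module
  have hmem2 : x - e a ∈ T := by
    rw [← hxy, show e y + z - e a = e (y - a) + z by rw [map_sub]; abel]
    exact add_mem hyT hzT
  have := Submodule.disjoint_def.mp hd _ hmem hmem2
  exact (sub_eq_zero.mp this).symm

/-- `e` is injective on `E(k)` for `k < 0`. -/
lemma S2.inj [FiniteDimensional ℂ V] (s : S2 e h f) {k : ℤ} (hk : k < 0) {x : V}
    (hx : h x = (k : ℂ) • x) (hex : e x = 0) : x = 0 := by
  have h1 : x ∈ LinearMap.ker e := hex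
  have h2 := s.swap.ker_le h1
  have hd := (Module.End.eigenspaces_iSupIndep h) (k : ℂ)
  refine Submodule.disjoint_def.mp hd x (Module.End.mem_eigenspace_iff.mpr hx) ?_
  refine (iSup_le fun j : ℕ => ?_ : (⨆ j : ℕ, End.eigenspace (-h) (-(j : ℂ))) ≤ _) h2
  refine le_iSup₂_of_le (j : ℂ) ?_ ?_
  · intro h0
    have : (j : ℤ) = k := by exact_mod_cast h0
    omega
  · intro v hv
    rw [Module.End.mem_eigenspace_iff] at hv ⊢
    simpa using hv

end PaperStmt.Sl2

namespace PaperStmt.Conj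
open Module Topology Filter

section analytic
variable {V : Type*} [NormedAddCommGroup V] [NormedSpace ℂ V] [CompleteSpace V]

lemma exp_mul_exp_neg (D : V →L[ℂ] V) : NormedSpace.exp D * NormedSpace.exp (-D) = 1 := by
  let _ : NormedAlgebra ℚ (V →L[ℂ] V) := NormedAlgebra.restrictScalars ℚ ℂ _
  rw [← NormedSpace.exp_add_of_commute (Commute.neg_right (Commute.refl D))]
  simp [NormedSpace.exp_zero]

lemma exp_deriv_aut (br : V →L[ℂ] V →L[ℂ] V) (D : V →L[ℂ] V)
    (hD : ∀ u v, D (br u v) = br (D u) v + br u (D v)) (u v : V) :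
    NormedSpace.exp D (br u v) = br (NormedSpace.exp D u) (NormedSpace.exp D v) := by
  have hc : ∀ t : ℂ, HasDerivAt (fun s : ℂ => NormedSpace.exp (s • D))
      (D * NormedSpace.exp (t • D)) t := fun t => hasDerivAt_exp_smul_const' D t
  have hc' : ∀ t : ℂ, HasDerivAt (fun s : ℂ => NormedSpace.exp (s • (-D)))
      (NormedSpace.exp (t • (-D)) * (-D)) t := fun t => hasDerivAt_exp_smul_const (-D) t
  let φ : ℂ → V := fun t => NormedSpace.exp (t • (-D))
    (br (NormedSpace.exp (t • D) u) (NormedSpace.exp (t • D) v))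
  have hφ : ∀ t, HasDerivAt φ 0 t := by
    intro t
    have hu := (hc t).clm_apply (hasDerivAt_const t u)
    have hv := (hc t).clm_apply (hasDerivAt_const t v)
    have hbu := (br.hasFDerivAt.comp_hasDerivAt t hu).clm_apply hv
    have := (hc' t).clm_apply hbu
    refine this.congr_deriv ?_
    simp only [mul_apply_eq_comp, neg_apply, map_zero, add_zero,
      Function.comp, hD]
    rw [← map_add, neg_add_cancel, map_zero]
  have h01 : φ 1 = φ 0 := by
    refine is_const_of_deriv_eq_zero (fun t => (hφ t).differentiableAt) (fun t => (hφ t).deriv) 1 0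
  simp only [φ, one_smul, zero_smul, NormedSpace.exp_zero, one_apply_eq_self] at h01
  rw [← h01, ← mul_apply_eq_comp]
  have := exp_mul_exp_neg D
  rw [this]; simp

lemma local_normed [FiniteDimensional ℂ V] (br : V →L[ℂ] V →L[ℂ] V) (x δ : V)
    (S W C : Submodule ℂ V)
    (hsurj : ∀ v, ∃ y ∈ S, ∃ w ∈ W, ∃ c ∈ C, v = br y x + w + c) :
    ∀ᶠ t in 𝓝 (0 : ℂ), ∃ y ∈ S, ∃ w ∈ W, ∃ c ∈ C,
      x + t • δ = NormedSpace.exp (br y) (x + w) + c := by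
  let F : S × W × C → V := fun p => NormedSpace.exp (br (p.1 : V)) (x + (p.2.1 : V)) + (p.2.2 : V)
  let p1 : S × W × C →L[ℂ] V := S.subtypeL.comp (ContinuousLinearMap.fst ℂ S (W × C))
  let p2 : S × W × C →L[ℂ] V := W.subtypeL.comp ((ContinuousLinearMap.fst ℂ W C).comp
    (ContinuousLinearMap.snd ℂ S (W × C)))
  let p3 : S × W × C →L[ℂ] V := C.subtypeL.comp ((ContinuousLinearMap.snd ℂ W C).comp
    (ContinuousLinearMap.snd ℂ S (W × C)))
  have hd1 : HasStrictFDerivAt (fun p : S × W × C => NormedSpace.exp (br (p1 p)))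
      (br.comp p1) 0 := by
    have h0 : HasStrictFDerivAt (NormedSpace.exp : (V →L[ℂ] V) → (V →L[ℂ] V))
      (1 : (V →L[ℂ] V) →L[ℂ] (V →L[ℂ] V)) ((br.comp p1) 0) := by
      rw [map_zero]; exact hasStrictFDerivAt_exp_zero
    have := h0.comp (0 : S × W × C) (br.comp p1).hasStrictFDerivAt
    exact this
  have hd2 : HasStrictFDerivAt (fun p : S × W × C => x + p2 p) p2 0 :=
    p2.hasStrictFDerivAt.const_add x
  have hF : HasStrictFDerivAt F _ 0 := (hd1.clm_apply hd2).add p3.hasStrictFDerivAt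
  have hmap := hF.map_nhds_eq_of_surj (by
    rw [LinearMap.range_eq_top]
    intro v
    obtain ⟨y, hy, w, hw, c, hc, rfl⟩ := hsurj v
    refine ⟨(⟨y, hy⟩, ⟨w, hw⟩, ⟨c, hc⟩), ?_⟩
    simp [p1, p2, p3, NormedSpace.exp_zero]
    abel)
  have hF0 : F 0 = x := by simp [F, NormedSpace.exp_zero]
  rw [hF0] at hmap
  have ht : Tendsto (fun t : ℂ => x + t • δ) (𝓝 0) (𝓝 x) := by
    have : Continuous (fun t : ℂ => x + t • δ) := by fun_prop
    simpa using this.tendsto 0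
  have hr : Set.range F ∈ 𝓝 x := by
    rw [← hmap]; exact range_mem_map
  filter_upwards [ht hr] with t ht
  obtain ⟨⟨y, w, c⟩, h⟩ := ht
  exact ⟨y, y.2, w, w.2, c, c.2, h.symm⟩

end analytic

section lie
variable {L : Type*} [LieRing L] [LieAlgebra ℂ L] [FiniteDimensional ℂ L]

lemma local_line (x δ : L) (S W C : Submodule ℂ L)
    (hsurj : ∀ v, ∃ y ∈ S, ∃ w ∈ W, ∃ c ∈ C, v = ⁅y, x⁆ + w + c) :
    ∀ᶠ t in 𝓝 (0 : ℂ), ∃ g : L ≃ₗ⁅ℂ⁆ L, (∀ z, (∀ y ∈ S, ⁅y, z⁆ = 0) → g z = z) ∧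
      ∃ w ∈ W, ∃ c ∈ C, x + t • δ = g (x + w) + c := by
  let b := (Module.finBasis ℂ L).equivFun
  let _ : NormedAddCommGroup L := NormedAddCommGroup.induced L _ b.toLinearMap b.injective
  let _ : NormedSpace ℂ L := NormedSpace.induced ℂ L _ b.toLinearMap
  have : CompleteSpace L := FiniteDimensional.complete ℂ L
  let br : L →L[ℂ] L →L[ℂ] L := LinearMap.toContinuousLinearMap
    ((LinearMap.toContinuousLinearMap : (L →ₗ[ℂ] L) ≃ₗ[ℂ] _).toLinearMap ∘ₗ
      (LieAlgebra.ad ℂ L : L →ₗ[ℂ] Module.End ℂ L))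
  have hbr : ∀ u v, br u v = ⁅u, v⁆ := fun u v => rfl
  have := local_normed br x δ S W C hsurj
  filter_upwards [this] with t ht
  obtain ⟨y, hy, w, hw, c, hc, h⟩ := ht
  have haut := exp_deriv_aut br (br y) (fun u v => by simp only [hbr]; exact leibniz_lie y u v)
  have h1 : NormedSpace.exp (br y) * NormedSpace.exp (-(br y)) = 1 := exp_mul_exp_neg _
  have h2 : NormedSpace.exp (-(br y)) * NormedSpace.exp (br y) = 1 := by
    simpa using exp_mul_exp_neg (-(br y))
  let g : L ≃ₗ⁅ℂ⁆ L :=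
    { toFun := fun v => (NormedSpace.exp (br y) : L →L[ℂ] L) v
      map_add' := map_add _
      map_smul' := map_smul _
      map_lie' := fun {u v} => haut u v
      invFun := fun v => (NormedSpace.exp (-(br y)) : L →L[ℂ] L) v
      left_inv := fun v => by
        have := congrArg (fun T : L →L[ℂ] L => T v) h2
        exact this
      right_inv := fun v => by
        have := congrArg (fun T : L →L[ℂ] L => T v) h1
        exact this }
  refine ⟨g, fun z hz => ?_, w, hw, c, hc, h⟩
  change NormedSpace.exp (br y) z = z
  have hz0 : br y z = 0 := hz y hy
  have hs := (NormedSpace.exp_series_hasSum_exp' (𝕂 := ℂ) (br y))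
  have hs2 := hs.mapL (ContinuousLinearMap.apply ℂ L z)
  have hs3 : HasSum (fun n : ℕ => ((n.factorial : ℂ)⁻¹ • (br y) ^ n) z) z := by
    have := hasSum_single (f := fun n : ℕ => ((n.factorial : ℂ)⁻¹ • (br y) ^ n) z) 0 (fun n hn => by
      obtain ⟨m, rfl⟩ := Nat.exists_eq_succ_of_ne_zero hn
      simp [pow_succ, hz0])
    simpa using this
  exact hs2.unique hs3
end lie


lemma line_conn (U O : Set ℂ) (hfin : Uᶜ.Finite) (h1 : ∀ t ∈ U, t ∈ O → ∀ᶠ s in 𝓝 t, s ∈ O)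
    (h2 : ∀ t ∈ U, t ∉ O → ∀ᶠ s in 𝓝 t, s ∉ O) (h3 : (0 : ℂ) ∈ U) (h4 : (0 : ℂ) ∈ O)
    (h5 : (1 : ℂ) ∈ U) : (1 : ℂ) ∈ O := by
  have hconn : IsPreconnected U := by
    have := (hfin.countable.isPathConnected_compl_of_one_lt_rank
      (by rw [Complex.rank_real_complex]; norm_num)).isConnected.isPreconnected
    rwa [compl_compl] at this
  by_contra hcon
  obtain ⟨t, ht, hto, hto'⟩ := hconn (interior O) (interior Oᶜ) isOpen_interior isOpen_interior
    (fun t ht => by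
      by_cases hO : t ∈ O
      · exact Or.inl (mem_interior_iff_mem_nhds.mpr (h1 t ht hO))
      · exact Or.inr (mem_interior_iff_mem_nhds.mpr (h2 t ht hO)))
    ⟨0, h3, mem_interior_iff_mem_nhds.mpr (h1 0 h3 h4)⟩
    ⟨1, h5, mem_interior_iff_mem_nhds.mpr (h2 1 h5 hcon)⟩
  exact interior_subset hto' (interior_subset hto)

end PaperStmt.Conj

namespace PaperStmt.Conj
open Module Topology Filter
section lie
attribute [local instance] LieRing.ofAssociativeRing
variable {L : Type*} [LieRing L] [LieAlgebra ℂ L] [FiniteDimensional ℂ L]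

lemma open_at (f : ℂ → Prop) (t : ℂ) (h : ∀ᶠ s in 𝓝 (0 : ℂ), f (t + s)) : ∀ᶠ s in 𝓝 t, f s := by
  have : Tendsto (fun s : ℂ => s - t) (𝓝 t) (𝓝 0) := by
    have hc : Continuous (fun s : ℂ => s - t) := by fun_prop
    simpa using hc.tendsto t
  filter_upwards [this.eventually h] with s hs
  simpa using hs

/-- Two elements of `g(2)` with `[g(0), e] = g(2)` are conjugate under automorphisms fixing `h`. -/
theorem conj_generic (h e e' : L) (he : ⁅h, e⁆ = (2 : ℂ) • e) (he' : ⁅h, e'⁆ = (2 : ℂ) • e')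
    (hs : ∀ v, ⁅h, v⁆ = (2 : ℂ) • v → ∃ y : L, ⁅h, y⁆ = 0 ∧ ⁅y, e⁆ = v)
    (hs' : ∀ v, ⁅h, v⁆ = (2 : ℂ) • v → ∃ y : L, ⁅h, y⁆ = 0 ∧ ⁅y, e'⁆ = v) :
    ∃ g : L ≃ₗ⁅ℂ⁆ L, g h = h ∧ g e = e' := by
  let G0 : Submodule ℂ L := LinearMap.ker (LieAlgebra.ad ℂ L h : L →ₗ[ℂ] L)
  let G2 : Submodule ℂ L := End.eigenspace (LieAlgebra.ad ℂ L h) 2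
  have m0 : ∀ y, y ∈ G0 ↔ ⁅h, y⁆ = 0 := fun y => by simp [G0]
  have m2 : ∀ y, y ∈ G2 ↔ ⁅h, y⁆ = (2 : ℂ) • y := fun y => by
    simp [G2]
  have m02 : ∀ y ∈ G0, ∀ x ∈ G2, ⁅y, x⁆ ∈ G2 := fun y hy x hx => by
    rw [m0] at hy; rw [m2] at hx ⊢
    rw [leibniz_lie, hy, zero_lie, zero_add, hx, lie_smul]
  let ℓ : ℂ → L := fun t => e + t • (e' - e)
  have hℓ2 : ∀ t, ℓ t ∈ G2 := fun t =>
    G2.add_mem ((m2 e).2 he) (G2.smul_mem _ (G2.sub_mem ((m2 _).2 he') ((m2 _).2 he)))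
  let U : Set ℂ := {t | ∀ v ∈ G2, ∃ y ∈ G0, ⁅y, ℓ t⁆ = v}
  let O : Set ℂ := {t | ∃ g : L ≃ₗ⁅ℂ⁆ L, g h = h ∧ g e = ℓ t}
  obtain ⟨C, hC⟩ := G2.exists_isCompl
  have key : ∀ t ∈ U, ∀ᶠ s in 𝓝 t, ∃ g : L ≃ₗ⁅ℂ⁆ L, g h = h ∧ ℓ s = g (ℓ t) := by
    intro t ht
    apply open_at
    have := local_line (ℓ t) (e' - e) G0 ⊥ C (fun v => by
      have hv : v ∈ G2 ⊔ C := by rw [hC.sup_eq_top]; trivial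
      obtain ⟨a, ha, c, hc, rfl⟩ := Submodule.mem_sup.1 hv
      obtain ⟨y, hy, rfl⟩ := ht a ha
      exact ⟨y, hy, 0, by simp, c, hc, by simp⟩)
    filter_upwards [this] with s hs
    obtain ⟨g, hg, w, hw, c, hc, h1⟩ := hs
    rw [Submodule.mem_bot] at hw
    subst hw
    have hgh : g h = h := hg h (fun y hy => by
      rw [m0] at hy; rw [← lie_skew, hy, neg_zero])
    refine ⟨g, hgh, ?_⟩
    have e1 : ℓ (t + s) = ℓ t + s • (e' - e) := by simp only [ℓ]; module
    rw [e1]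
    have hgl : g (ℓ t) ∈ G2 := by
      rw [m2]
      have := (m2 _).1 (hℓ2 t)
      have := congrArg g this
      rwa [LieEquiv.map_lie, hgh, map_smul] at this
    have hc2 : c ∈ G2 := by
      have : c = ℓ (t + s) - g (ℓ t) := by rw [e1, h1]; simp
      rw [this]; exact G2.sub_mem (hℓ2 _) hgl
    have : c = 0 := by
      have := hC.disjoint.le_bot (Submodule.mem_inf.2 ⟨hc2, hc⟩)
      simpa using this
    rw [h1, this]; simp
  have hfin : Uᶜ.Finite := by
    let T : G0 →ₗ[ℂ] G2 :=
      { toFun := fun y => ⟨⁅(y : L), e⁆, m02 y y.2 e ((m2 e).2 he)⟩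
        map_add' := fun a b => by ext; simp
        map_smul' := fun a b => by ext; simp }
    let T' : G0 →ₗ[ℂ] G2 :=
      { toFun := fun y => ⟨⁅(y : L), e' - e⁆, m02 y y.2 _ (G2.sub_mem ((m2 _).2 he') ((m2 _).2 he))⟩
        map_add' := fun a b => by ext; simp only [Submodule.coe_add, add_lie]
        map_smul' := fun a b => by ext; simp only [Submodule.coe_smul, smul_lie, RingHom.id_apply] }
    have hT : Function.Surjective T := fun v => by
      obtain ⟨y, hy, h⟩ := hs v ((m2 _).1 v.2)
      exact ⟨⟨y, (m0 y).2 hy⟩, Subtype.ext h⟩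
    obtain ⟨σ, hσ⟩ := T.exists_rightInverse_of_surjective (LinearMap.range_eq_top.2 hT)
    let B : End ℂ G2 := T' ∘ₗ σ
    have hev : {μ | B.HasEigenvalue μ}.Finite := Module.End.finite_hasEigenvalue B
    have hinj : Set.InjOn (fun t : ℂ => -t⁻¹) ((fun t : ℂ => -t⁻¹) ⁻¹' {μ | B.HasEigenvalue μ}) := by
      intro a _ b _ hab
      simpa using hab
    refine (hev.preimage hinj).subset ?_
    intro t ht
    by_contra hcon
    apply ht
    have hinj2 : Function.Injective (LinearMap.id + t • B : End ℂ G2) := by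
      rw [← LinearMap.ker_eq_bot, LinearMap.ker_eq_bot']
      intro v hv
      by_contra hv0
      have hv1 : v + t • B v = 0 := hv
      have ht0 : t ≠ 0 := by
        rintro rfl
        apply hv0; simpa using hv1
      apply hcon
      refine Module.End.hasEigenvalue_of_hasEigenvector (x := v) ⟨?_, hv0⟩
      rw [Module.End.mem_eigenspace_iff]
      have : B v = t⁻¹ • (t • B v) := by rw [smul_smul, inv_mul_cancel₀ ht0, one_smul]
      rw [this, eq_neg_of_add_eq_zero_right hv1]
      simp
    have hsurj2 := LinearMap.injective_iff_surjective.1 hinj2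
    intro v hv
    obtain ⟨u, hu⟩ := hsurj2 ⟨v, hv⟩
    refine ⟨σ u, (σ u).2, ?_⟩
    have h1 : ⁅((σ u : G0) : L), e⁆ = u := congrArg (fun w : G2 →ₗ[ℂ] G2 => (w u : L)) hσ
    have h2 : (u : L) + t • ⁅((σ u : G0) : L), e' - e⁆ = v := congrArg (fun w : G2 => (w : L)) hu
    simp only [ℓ, lie_add, lie_smul, h1, h2]
  have := line_conn U O hfin
    (fun t ht hO => by
      obtain ⟨g, hg, hge⟩ := hO
      filter_upwards [key t ht] with s hs
      obtain ⟨g', hg', h1⟩ := hs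
      exact ⟨g.trans g', by simp [LieEquiv.trans_apply, hg, hg'], by
        rw [LieEquiv.trans_apply, hge, h1]⟩)
    (fun t ht hO => by
      filter_upwards [key t ht] with s hs
      obtain ⟨g', hg', h1⟩ := hs
      rintro ⟨g, hg, hge⟩
      refine hO ⟨g.trans g'.symm, ?_, ?_⟩
      · rw [LieEquiv.trans_apply, hg, ← LieEquiv.apply_symm_apply g' h]
        conv_lhs => rw [LieEquiv.apply_symm_apply]
        conv_lhs => rw [← hg', LieEquiv.symm_apply_apply]
        rw [LieEquiv.apply_symm_apply]
      · rw [LieEquiv.trans_apply, hge, h1, LieEquiv.symm_apply_apply])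
    (fun v hv => by
      obtain ⟨y, hy, h⟩ := hs v ((m2 v).1 hv)
      exact ⟨y, (m0 y).2 hy, by simpa [ℓ] using h⟩)
    ⟨LieEquiv.refl, by simp, by simp [ℓ]⟩
    (fun v hv => by
      obtain ⟨y, hy, h⟩ := hs' v ((m2 v).1 hv)
      exact ⟨y, (m0 y).2 hy, by simpa [ℓ] using h⟩)
  obtain ⟨g, hg, hge⟩ := this
  exact ⟨g, hg, by rw [hge]; simp [ℓ]⟩

open LieSubalgebra in
lemma map_engel (g : L ≃ₗ⁅ℂ⁆ L) (x y : L) : g y ∈ engel ℂ (g x) ↔ y ∈ engel ℂ x := by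
  simp only [mem_engel_iff]
  have : ∀ n y, ((LieAlgebra.ad ℂ L (g x)) ^ n) (g y) = g (((LieAlgebra.ad ℂ L x) ^ n) y) := by
    intro n
    induction n with
    | zero => intro y; simp
    | succ n ih =>
      intro y
      rw [pow_succ, Module.End.mul_apply, pow_succ, Module.End.mul_apply, ← ih]
      simp [LieEquiv.map_lie]
  simp only [this]
  simp

open LieSubalgebra in
lemma finrank_engel_map (g : L ≃ₗ⁅ℂ⁆ L) (x : L) :
    finrank ℂ (engel ℂ (g x)) = finrank ℂ (engel ℂ x) := by
  have : (engel ℂ (g x)).toSubmodule = (engel ℂ x).toSubmodule.map g.toLinearEquiv.toLinearMap := by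
    ext y
    rw [Submodule.mem_map]
    constructor
    · intro hy
      refine ⟨g.symm y, ?_, g.apply_symm_apply y⟩
      have := (map_engel g x (g.symm y)).1
      rw [g.apply_symm_apply] at this
      exact this hy
    · rintro ⟨z, hz, rfl⟩
      exact (map_engel g x z).2 hz
  change finrank ℂ (engel ℂ (g x)).toSubmodule = finrank ℂ (engel ℂ x).toSubmodule
  rw [this]
  exact LinearEquiv.finrank_map_eq g.toLinearEquiv _

lemma regular_map (g : L ≃ₗ⁅ℂ⁆ L) (x : L) :
    LieAlgebra.IsRegular ℂ (g x) ↔ LieAlgebra.IsRegular ℂ x := by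
  rw [LieAlgebra.isRegular_iff_finrank_engel_eq_rank, LieAlgebra.isRegular_iff_finrank_engel_eq_rank,
    finrank_engel_map]

lemma poly_line {ι : Type*} (a d : ι → ℂ) (q : MvPolynomial ι ℂ) :
    ∃ p : Polynomial ℂ, ∀ t, p.eval t = MvPolynomial.eval (fun i => a i + t * d i) q := by
  induction q using MvPolynomial.induction_on with
  | C c => exact ⟨Polynomial.C c, by simp⟩
  | add p q hp hq =>
    obtain ⟨p', hp⟩ := hp; obtain ⟨q', hq⟩ := hq
    exact ⟨p' + q', by simp [hp, hq]⟩
  | mul_X p i hp =>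
    obtain ⟨p', hp⟩ := hp
    exact ⟨p' * (Polynomial.C (a i) + Polynomial.X * Polynomial.C (d i)), by
      intro t
      rw [Polynomial.eval_mul, hp, Polynomial.eval_add, Polynomial.eval_mul]
      simp⟩

lemma regular_line (x δ : L) (t0 : ℂ) (h0 : LieAlgebra.IsRegular ℂ (x + t0 • δ)) :
    {t : ℂ | LieAlgebra.IsRegular ℂ (x + t • δ)}ᶜ.Finite := by
  classical
  let b := Module.finBasis ℂ L
  obtain ⟨p, hp⟩ := poly_line (b.repr x) (b.repr δ)
    ((LinearMap.polyCharpoly (LieAlgebra.ad ℂ L).toLinearMap b).coeff (LieAlgebra.rank ℂ L))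
  have hreg : ∀ t, LieAlgebra.IsRegular ℂ (x + t • δ) ↔ p.eval t ≠ 0 := by
    intro t
    rw [LieAlgebra.isRegular_iff_coeff_polyCharpoly_rank_ne_zero ℂ b, hp]
    have : (⇑(b.repr (x + t • δ)) : _ → ℂ) = fun i => b.repr x i + t * b.repr δ i := by
      ext i; simp
    rw [this]
  have hp0 : p ≠ 0 := by
    rintro rfl
    exact (hreg t0).1 h0 (by simp)
  refine (Polynomial.finite_setOfPred_isRoot hp0).subset ?_
  intro t ht
  simp only [Set.mem_compl_iff, Set.mem_ofPred_eq, hreg, not_not] at ht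
  exact ht

lemma cofinite_near (A : Set ℂ) (hA : Aᶜ.Finite) (Q : ℂ → Prop) (hQ : ∀ᶠ t in 𝓝 (0 : ℂ), Q t) :
    ∃ t, t ∈ A ∧ Q t := by
  by_contra hcon
  push Not at hcon
  have : {t | Q t} ⊆ Aᶜ := fun t ht hA => hcon t hA ht
  exact (infinite_of_mem_nhds (0 : ℂ) hQ) (hA.subset this)

open LieSubalgebra in
lemma engel_eq_of_mem (x z : L) (hx : LieAlgebra.IsRegular ℂ x) (hz : LieAlgebra.IsRegular ℂ z)
    (hzx : z ∈ engel ℂ x) : engel ℂ z = engel ℂ x := by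
  rw [LieAlgebra.isRegular_iff_finrank_engel_eq_rank] at hx hz
  have hle : engel ℂ x ≤ engel ℂ z := by
    have hcard : (finrank ℂ L : Cardinal) ≤ Cardinal.mk ℂ :=
      (Cardinal.natCast_lt_aleph0.le).trans (Cardinal.aleph0_le_mk ℂ)
    have := LieAlgebra.engel_isBot_of_isMin hcard (engel ℂ x)
      ⟨engel ℂ x, x, self_mem_engel ℂ x, rfl⟩ le_rfl (by
        rintro ⟨_, y, hy, rfl⟩ hyx
        have hyx' : engel ℂ y ≤ engel ℂ x := hyx
        have h1 := LieAlgebra.rank_le_finrank_engel ℂ y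
        have : (engel ℂ y).toSubmodule = (engel ℂ x).toSubmodule :=
          Submodule.eq_of_le_of_finrank_le hyx' (by
            change finrank ℂ (engel ℂ x) ≤ finrank ℂ (engel ℂ y); lia)
        exact fun w hw => by
          change w ∈ (engel ℂ y).toSubmodule
          rw [this]; exact hw)
    exact this ⟨engel ℂ z, z, hzx, rfl⟩
  apply (LieSubalgebra.toSubmodule_inj _ _).1
  symm
  exact Submodule.eq_of_le_of_finrank_le hle (by
    change finrank ℂ (engel ℂ z) ≤ finrank ℂ (engel ℂ x); lia)

open LieSubalgebra in
lemma fitting (x v : L) : ∃ y ∈ (⊤ : Submodule ℂ L), ∃ w ∈ (engel ℂ x).toSubmodule,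
    ∃ c ∈ (⊥ : Submodule ℂ L), v = ⁅y, x⁆ + w + c := by
  have hc := LinearMap.isCompl_iSup_ker_pow_iInf_range_pow (LieAlgebra.ad ℂ L x : L →ₗ[ℂ] L)
  have hv : v ∈ (⊤ : Submodule ℂ L) := trivial
  rw [← hc.sup_eq_top] at hv
  obtain ⟨w, hw, u, hu, rfl⟩ := Submodule.mem_sup.1 hv
  have hu1 := (Submodule.mem_iInf _).1 hu 1
  obtain ⟨y, hy⟩ := hu1
  refine ⟨-y, trivial, w, ?_, 0, by simp, ?_⟩
  · have hmono : Monotone fun n => LinearMap.ker ((LieAlgebra.ad ℂ L x : L →ₗ[ℂ] L) ^ n) := by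
      intro m n hmn a ha
      exact Module.End.pow_map_zero_of_le hmn ha
    obtain ⟨n, hn⟩ := (Submodule.mem_iSup_of_directed _ hmono.directed_le).1 hw
    exact (mem_engel_iff _ _ _).2 ⟨n, hn⟩
  · rw [← hy]; simp [add_comm]

open LieSubalgebra in
/-- A semisimple-type element is conjugate into a given toral Cartan subalgebra. -/
theorem conj_into (H : Submodule ℂ L) (hab : ∀ a ∈ H, ∀ b ∈ H, ⁅a, b⁆ = 0) (z0 : L) (hz0 : z0 ∈ H)
    (hH : (engel ℂ z0).toSubmodule = H) (h : L)
    (hh : ∀ v, ∃ y c : L, ⁅h, c⁆ = 0 ∧ v = ⁅y, h⁆ + c) :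
    ∃ g : L ≃ₗ⁅ℂ⁆ L, g h ∈ H := by
  obtain ⟨y0, hy0⟩ := LieAlgebra.exists_isRegular ℂ L
  -- regular elements of `H` have Engel subalgebra `H`
  have hE : ∀ z ∈ H, LieAlgebra.IsRegular ℂ z → (engel ℂ z).toSubmodule = H := by
    intro z hz hr
    rw [LieAlgebra.isRegular_iff_finrank_engel_eq_rank] at hr
    symm
    refine Submodule.eq_of_le_of_finrank_le ?_ ?_
    · intro w hw
      exact (mem_engel_iff _ _ _).2 ⟨1, by simp [hab z hz w hw]⟩
    · have := LieAlgebra.rank_le_finrank_engel ℂ z0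
      change finrank ℂ (engel ℂ z) ≤ _
      rw [hr]
      refine this.trans (le_of_eq ?_)
      change finrank ℂ (engel ℂ z0).toSubmodule = _
      rw [hH]
  let O : Set L := {x | ∃ g : L ≃ₗ⁅ℂ⁆ L, g x ∈ H}
  have htr : ∀ x z, LieAlgebra.IsRegular ℂ x → LieAlgebra.IsRegular ℂ z → z ∈ engel ℂ x →
      x ∈ O → z ∈ O := by
    rintro x z hx hz hzx ⟨g, hg⟩
    refine ⟨g, ?_⟩
    rw [← hE (g x) hg ((regular_map g x).2 hx)]
    exact (map_engel g x z).2 hzx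
  have hOg : ∀ (g : L ≃ₗ⁅ℂ⁆ L) x, g x ∈ O ↔ x ∈ O := by
    intro g x
    constructor
    · rintro ⟨g', h⟩; exact ⟨g.trans g', h⟩
    · rintro ⟨g', h⟩; exact ⟨g.symm.trans g', by simpa [LieEquiv.trans_apply] using h⟩
  -- all regular elements lie in `O` as soon as one does
  have hall : ∀ x y, LieAlgebra.IsRegular ℂ x → LieAlgebra.IsRegular ℂ y → x ∈ O → y ∈ O := by
    intro x y hx hy hxO
    have key : ∀ t : ℂ, LieAlgebra.IsRegular ℂ (x + t • (y - x)) →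
        ∀ᶠ s in 𝓝 t, LieAlgebra.IsRegular ℂ (x + s • (y - x)) →
          (x + t • (y - x) ∈ O ↔ x + s • (y - x) ∈ O) := by
      intro t ht
      apply open_at
      filter_upwards [local_line (x + t • (y - x)) (y - x) ⊤ (engel ℂ (x + t • (y - x))).toSubmodule ⊥
        (fitting _)] with s hs hreg
      obtain ⟨g, -, w, hw, c, hc, h1⟩ := hs
      rw [Submodule.mem_bot] at hc
      subst hc
      have e1 : x + (t + s) • (y - x) = x + t • (y - x) + s • (y - x) := by module
      rw [e1, h1, add_zero] at hreg ⊢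
      rw [hOg]
      rw [regular_map] at hreg
      have hmem : x + t • (y - x) + w ∈ engel ℂ (x + t • (y - x)) :=
        add_mem (self_mem_engel ℂ _) hw
      refine ⟨htr _ _ ht hreg hmem, htr _ _ hreg ht ?_⟩
      rw [engel_eq_of_mem _ _ ht hreg hmem]
      exact self_mem_engel ℂ _
    have hev : ∀ t : ℂ, LieAlgebra.IsRegular ℂ (x + t • (y - x)) →
        ∀ᶠ s in 𝓝 t, LieAlgebra.IsRegular ℂ (x + s • (y - x)) := by
      intro t ht
      have hfin := regular_line x (y - x) t ht
      have := hfin.isClosed.isOpen_compl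
      rw [compl_compl] at this
      exact this.mem_nhds ht
    have := line_conn {t | LieAlgebra.IsRegular ℂ (x + t • (y - x))} {t | x + t • (y - x) ∈ O}
      (regular_line x (y - x) 0 (by simpa using hx))
      (fun t ht hO => by
        filter_upwards [key t ht, hev t ht] with s h1 h2
        exact (h1 h2).1 hO)
      (fun t ht hO => by
        filter_upwards [key t ht, hev t ht] with s h1 h2
        exact fun hh => hO ((h1 h2).2 hh))
      (by simpa using hx) (by simpa using hxO) (by simpa using hy)
    simpa using this
  -- there is a regular element in `O`
  have hone : ∃ x, LieAlgebra.IsRegular ℂ x ∧ x ∈ O := by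
    have := local_line z0 (y0 - z0) ⊤ (engel ℂ z0).toSubmodule ⊥ (fitting z0)
    obtain ⟨t, ht, g, -, w, hw, c, hc, h1⟩ := cofinite_near _
      (regular_line z0 (y0 - z0) 1 (by simpa using hy0)) _ this
    rw [Submodule.mem_bot] at hc
    subst hc
    refine ⟨_, ht, ?_⟩
    rw [h1, add_zero, hOg]
    rw [hH] at hw
    exact ⟨LieEquiv.refl, H.add_mem hz0 hw⟩
  obtain ⟨x1, hx1, hx1O⟩ := hone
  let Ch : Submodule ℂ L := LinearMap.ker (LieAlgebra.ad ℂ L h : L →ₗ[ℂ] L)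
  have := local_line h (y0 - h) ⊤ Ch ⊥ (fun v => by
    obtain ⟨y, c, hc, hv⟩ := hh v
    exact ⟨y, trivial, c, by simpa [Ch] using hc, 0, by simp, by simpa using hv⟩)
  obtain ⟨t, ht, g, -, w, hw, c, hc, h1⟩ := cofinite_near _
      (regular_line h (y0 - h) 1 (by simpa using hy0)) _ this
  rw [Submodule.mem_bot] at hc
  subst hc
  have hw' : ⁅h, w⁆ = 0 := by simpa [Ch] using hw
  have hreg : LieAlgebra.IsRegular ℂ (h + w) := by
    have ht' : LieAlgebra.IsRegular ℂ (h + t • (y0 - h)) := ht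
    rw [h1, add_zero, regular_map] at ht'
    exact ht'
  obtain ⟨g', hg'⟩ := hall x1 (h + w) hx1 hreg hx1O
  refine ⟨g', ?_⟩
  rw [← hE _ hg' ((regular_map _ _).2 hreg)]
  refine (map_engel g' _ _).2 ((mem_engel_iff _ _ _).2 ⟨1, ?_⟩)
  rw [pow_one, LieAlgebra.ad_apply, add_lie, lie_self, zero_add, ← lie_skew, hw', neg_zero]
end lie
end PaperStmt.Conj

namespace PaperStmt.Serre
open Module LieSubalgebra

variable {T : Type*} [LieRing T] [LieAlgebra ℂ T] {n : ℕ}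

/-- Chevalley generators. -/
structure Chev (A : Fin n → Fin n → ℤ) (E F H : Fin n → T) : Prop where
  diag : ∀ i, A i i = 2
  HH : ∀ i j, ⁅H i, H j⁆ = 0
  HE : ∀ i j, ⁅H i, E j⁆ = (A i j : ℂ) • E j
  HF : ∀ i j, ⁅H i, F j⁆ = -((A i j : ℂ) • F j)
  EF : ∀ i j, ⁅E i, F j⁆ = if i = j then H i else 0
  nE : ∀ i j, ∃ N, ((LieAlgebra.ad ℂ T (E i)) ^ N) (E j) = 0
  nF : ∀ i j, ∃ N, ((LieAlgebra.ad ℂ T (F i)) ^ N) (F j) = 0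
  gen : lieSpan ℂ T (Set.range E ∪ Set.range F) = ⊤

variable {A : Fin n → Fin n → ℤ} {E F H : Fin n → T}

lemma Chev.swap (C : Chev A E F H) : Chev A F E (fun i => - H i) where
  diag := C.diag
  HH i j := by simp [C.HH]
  HE i j := by rw [neg_lie, C.HF, neg_neg]
  HF i j := by rw [neg_lie, C.HE]
  EF i j := by
    rw [← lie_skew, C.EF]
    by_cases h : i = j
    · subst h; simp
    · rw [if_neg h, if_neg (Ne.symm h), neg_zero]
  nE := C.nF
  nF := C.nE
  gen := by rw [Set.union_comm]; exact C.gen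

lemma Chev.nilp (C : Chev A E F H) (i : Fin n) (v : T) :
    ∃ N, ((LieAlgebra.ad ℂ T (E i)) ^ N) v = 0 := by
  have : (⊤ : LieSubalgebra ℂ T) ≤ engel ℂ (E i) := by
    rw [← C.gen, lieSpan_le]
    rintro x (⟨j, rfl⟩ | ⟨j, rfl⟩)
    · exact (mem_engel_iff _ _ _).2 (C.nE i j)
    · refine (mem_engel_iff _ _ _).2 ⟨3, ?_⟩
      simp only [pow_succ, pow_zero, one_mul, Module.End.mul_apply, LieAlgebra.ad_apply, C.EF]
      by_cases h : i = j
      · rw [if_pos h, ← lie_skew (E i) (H i), C.HE]; simp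
      · simp [h]
  exact (mem_engel_iff _ _ _).1 (this (LieSubalgebra.mem_top v))

section sl2
variable {V : Type*} [AddCommGroup V] [Module ℂ V] {e h f : End ℂ V}

lemma f_epow (S : Sl2.S2 e h f) (v : V) (hv : f v = 0) (k : ℕ) :
    f ((e ^ (k + 1)) v) = -((k : ℂ) + 1) • (e ^ k) (h v + (k : ℂ) • v) := by
  have hh : ∀ (k : ℕ) (v : V), h ((e ^ k) v) = (e ^ k) (h v) + (2 * (k : ℂ)) • (e ^ k) v := by
    intro k
    induction k with
    | zero => intro v; simp
    | succ k ih =>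
      intro v
      rw [pow_succ, Module.End.mul_apply, ih, Module.End.mul_apply, S.he]
      simp only [map_add, map_smul]
      push_cast
      module
  induction k with
  | zero =>
    have := S.ef v
    rw [hv, map_zero] at this
    simp only [zero_add, pow_one, pow_zero, Module.End.one_apply]
    push_cast
    rw [zero_smul, add_zero]
    rw [zero_add, neg_one_smul]; exact eq_neg_of_add_eq_zero_left this.symm
  | succ k ih =>
    have h1 := S.ef ((e ^ (k + 1)) v)
    rw [ih, hh] at h1
    have h2 : (e ^ (k + 1 + 1)) v = e ((e ^ (k + 1)) v) := by
      rw [pow_succ' e (k + 1), Module.End.mul_apply]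
    rw [h2]
    have h3 : ∀ w, e ((e ^ k) w) = (e ^ (k + 1)) w := fun w => by
      rw [pow_succ' e k, Module.End.mul_apply]
    rw [map_smul, h3] at h1
    rw [eq_sub_of_add_eq h1.symm]
    simp only [map_add, map_smul]
    push_cast
    module

lemma exists_eig (S : Sl2.S2 e h f) (W : Submodule ℂ V) (hf : ∀ v ∈ W, f v = 0)
    (hh : ∀ v ∈ W, h v ∈ W) (N : ℕ) : ∀ v ∈ W, v ≠ 0 → (e ^ N) v = 0 →
    ∃ u ∈ W, u ≠ 0 ∧ ∃ k : ℕ, h u = -(k : ℂ) • u := by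
  induction N with
  | zero => intro v _ hv h0; simp at h0; contradiction
  | succ N ih =>
    intro v hv hv0 hN
    by_cases hu : h v + (N : ℂ) • v = 0
    · exact ⟨v, hv, hv0, N, by rw [neg_smul]; exact eq_neg_of_add_eq_zero_left hu⟩
    · refine ih _ (W.add_mem (hh v hv) (W.smul_mem _ hv)) hu ?_
      have := f_epow S v (hf v hv) N
      rw [hN, map_zero] at this
      have hne : -((N : ℂ) + 1) ≠ 0 := by
        rw [neg_ne_zero]; exact_mod_cast Nat.succ_ne_zero N
      exact (smul_eq_zero.1 this.symm).resolve_left hne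
end sl2

lemma Chev.s2 (C : Chev A E F H) (i : Fin n) :
    Sl2.S2 (LieAlgebra.ad ℂ T (E i)) (LieAlgebra.ad ℂ T (H i)) (LieAlgebra.ad ℂ T (F i)) where
  he v := by
    simp only [LieAlgebra.ad_apply]
    rw [leibniz_lie, C.HE, C.diag, smul_lie]; push_cast; abel
  hf v := by
    simp only [LieAlgebra.ad_apply]
    rw [leibniz_lie, C.HF, C.diag, neg_lie, smul_lie]; push_cast; abel
  ef v := by
    simp only [LieAlgebra.ad_apply]
    rw [leibniz_lie, C.EF, if_pos rfl]; abel

lemma Chev.simul (C : Chev A E F H) (W : Submodule ℂ T) (hf : ∀ i, ∀ v ∈ W, ⁅F i, v⁆ = 0)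
    (hh : ∀ i, ∀ v ∈ W, ⁅H i, v⁆ ∈ W) (v : T) (hv : v ∈ W) (hv0 : v ≠ 0) (s : Finset (Fin n)) :
    ∃ k : Fin n → ℕ, ∃ u ∈ W, u ≠ 0 ∧ ∀ i ∈ s, ⁅H i, u⁆ = -(k i : ℂ) • u := by
  induction s using Finset.induction_on with
  | empty => exact ⟨0, v, hv, hv0, by simp⟩
  | insert j s hj ih =>
    obtain ⟨k, u, hu, hu0, hk⟩ := ih
    let W' : Submodule ℂ T :=
      { carrier := {u | u ∈ W ∧ ∀ i ∈ s, ⁅H i, u⁆ = -(k i : ℂ) • u}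
        add_mem' := fun {a b} ha hb => ⟨W.add_mem ha.1 hb.1, fun i hi => by
          rw [lie_add, ha.2 i hi, hb.2 i hi, smul_add]⟩
        zero_mem' := ⟨W.zero_mem, by simp⟩
        smul_mem' := fun c a ha => ⟨W.smul_mem _ ha.1, fun i hi => by
          rw [lie_smul, ha.2 i hi, smul_comm]⟩ }
    obtain ⟨N, hN⟩ := C.nilp j u
    obtain ⟨u', hu', hu0', m, hm⟩ := exists_eig (C.s2 j) W' (fun v hv => hf j v hv.1)
      (fun v hv => ⟨hh j v hv.1, fun i hi => by
        rw [LieAlgebra.ad_apply, leibniz_lie, C.HH, zero_lie, zero_add, hv.2 i hi, lie_smul]⟩)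
      N u ⟨hu, hk⟩ hu0 hN
    classical
    refine ⟨Function.update k j m, u', hu'.1, hu0', fun i hi => ?_⟩
    by_cases hij : i = j
    · subst hij; simpa using hm
    · rw [Function.update_of_ne hij]
      exact hu'.2 i ((Finset.mem_insert.1 hi).resolve_left hij)

variable {M : Type*} [LieRing M] [LieAlgebra ℂ M]

lemma rho_E (C : Chev A E F H) (c : Fin n → ℕ) (hc : ∀ j, ∑ i, (c i : ℤ) * A i j = 2) (j : Fin n) :
    ⁅∑ i, (c i : ℂ) • H i, E j⁆ = (2 : ℂ) • E j := by
  rw [_root_.sum_lie] 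
  simp only [smul_lie, C.HE, smul_smul, ← Finset.sum_smul]
  congr 1
  exact_mod_cast hc j

lemma rho_F (C : Chev A E F H) (c : Fin n → ℕ) (hc : ∀ j, ∑ i, (c i : ℤ) * A i j = 2) (j : Fin n) :
    ⁅∑ i, (c i : ℂ) • H i, F j⁆ = -((2 : ℂ) • F j) := by
  have := rho_E C.swap c hc j
  simp only [smul_neg, Finset.sum_neg_distrib, neg_lie] at this
  rw [← this, neg_neg]

lemma pos_inj (C : Chev A E F H) (c : Fin n → ℕ) (hc : ∀ j, ∑ i, (c i : ℤ) * A i j = 2)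
    (φ : T →ₗ⁅ℂ⁆ M) (h0 : ∀ v, ⁅∑ i, (c i : ℂ) • H i, v⁆ = 0 → φ v = 0 → v = 0) (m : ℕ) :
    ∀ v, ⁅∑ i, (c i : ℂ) • H i, v⁆ = (2 * m : ℂ) • v → φ v = 0 → v = 0 := by
  induction m with
  | zero => intro v hv; exact h0 v (by simpa using hv)
  | succ m ih =>
    intro v hv hφ
    by_contra hv0
    set r : T := ∑ i, (c i : ℂ) • H i with hr
    have hrH : ∀ i, ⁅r, H i⁆ = 0 := fun i => by
      rw [hr, _root_.sum_lie]; simp [C.HH]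
    let W : Submodule ℂ T :=
      { carrier := {u | ⁅r, u⁆ = (2 * (m + 1 : ℕ) : ℂ) • u ∧ φ u = 0}
        add_mem' := fun {a b} ha hb => ⟨by rw [lie_add, ha.1, hb.1, smul_add], by
          rw [map_add, ha.2, hb.2, add_zero]⟩
        zero_mem' := ⟨by simp, by simp⟩
        smul_mem' := fun t a ha => ⟨by rw [lie_smul, ha.1, smul_comm], by
          rw [map_smul, ha.2, smul_zero]⟩ }
    obtain ⟨k, u, hu, hu0, hk⟩ := C.simul W
      (fun i w hw => ih _ (by
        rw [leibniz_lie, rho_F C c hc, hw.1, neg_lie, smul_lie, lie_smul]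
        push_cast; module) (by rw [LieHom.map_lie, hw.2, lie_zero]))
      (fun i w hw => ⟨by
        rw [leibniz_lie, hrH, zero_lie, zero_add, hw.1, lie_smul], by
          rw [LieHom.map_lie, hw.2, lie_zero]⟩)
      v ⟨hv, hφ⟩ hv0 Finset.univ
    have h1 : ⁅r, u⁆ = (2 * (m + 1 : ℕ) : ℂ) • u := hu.1
    have h2 : ⁅r, u⁆ = (-(∑ i, (c i * k i : ℕ) : ℕ) : ℂ) • u := by
      rw [hr, _root_.sum_lie]
      simp only [smul_lie, hk _ (Finset.mem_univ _), smul_smul, ← Finset.sum_smul]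
      congr 1
      push_cast
      simp
    rw [h1] at h2
    have h3 := smul_left_injective ℂ hu0 h2
    have h4 : ((2 * (m + 1) + ∑ i, c i * k i : ℕ) : ℂ) = 0 := by
      push_cast at h3 ⊢
      rw [h3]; ring
    have : 2 * (m + 1) + ∑ i, c i * k i = 0 := by exact_mod_cast h4
    lia

/-- The eigenspaces of `ad ρ`. -/
def Tm (r : T) (m : ℤ) : Submodule ℂ T := End.eigenspace (LieAlgebra.ad ℂ T r) (2 * m : ℂ)

lemma mem_Tm (r : T) (m : ℤ) (v : T) : v ∈ Tm r m ↔ ⁅r, v⁆ = (2 * m : ℂ) • v := by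
  simp [Tm]

lemma Tm_indep (r : T) : iSupIndep (Tm r) := by
  have := (Module.End.eigenspaces_iSupIndep (LieAlgebra.ad ℂ T r : End ℂ T)).comp
    (f := fun m : ℤ => (2 * m : ℂ)) (fun a b h => by simpa using h)
  exact this

lemma lie_Tm (r : T) {a b : ℤ} {u v : T} (hu : u ∈ Tm r a) (hv : v ∈ Tm r b) :
    ⁅u, v⁆ ∈ Tm r (a + b) := by
  rw [mem_Tm] at *
  rw [leibniz_lie, hu, hv, smul_lie, lie_smul]; push_cast; module

/-- Elements of positive degree. -/
def TPos (r : T) (ε : ℤ) : Submodule ℂ T := ⨆ m : ℕ, Tm r (ε * (m + 1))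

lemma lie_TPos (r : T) (ε : ℤ) {u v : T} (hu : u ∈ TPos r ε) (hv : v ∈ TPos r ε) :
    ⁅u, v⁆ ∈ TPos r ε := by
  induction hu using Submodule.iSup_induction' with
  | zero => simp
  | add x y _ _ hx hy => rw [add_lie]; exact Submodule.add_mem _ hx hy
  | mem i x hx =>
    induction hv using Submodule.iSup_induction' with
    | zero => simp
    | add y z _ _ hy hz => rw [lie_add]; exact Submodule.add_mem _ hy hz
    | mem j y hy =>
      refine Submodule.mem_iSup_of_mem (i + j + 1) ?_
      have := lie_Tm r hx hy
      convert this using 1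
      push_cast; ring

/-- Triangular decomposition. -/
lemma triang (C : Chev A E F H) (c : Fin n → ℕ) (hc : ∀ j, ∑ i, (c i : ℤ) * A i j = 2) (v : T) :
    ∃ a ∈ TPos (∑ i, (c i : ℂ) • H i) 1, ∃ h ∈ Submodule.span ℂ (Set.range H),
      ∃ b ∈ TPos (∑ i, (c i : ℂ) • H i) (-1), v = a + h + b := by
  set r : T := ∑ i, (c i : ℂ) • H i with hr
  let Hs := Submodule.span ℂ (Set.range H)
  have hHE : ∀ (E' : Fin n → T) (A' : Fin n → Fin n → ℂ) (_ : ∀ i j, ⁅H i, E' j⁆ = A' i j • E' j),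
      ∀ h ∈ Hs, ∀ u ∈ lieSpan ℂ T (Set.range E'), ⁅h, u⁆ ∈ lieSpan ℂ T (Set.range E') := by
    intro E' A' hA h hh u hu
    induction hh using Submodule.span_induction with
    | zero => simp
    | add x y _ _ hx hy => rw [add_lie]; exact add_mem hx hy
    | smul t x _ hx => rw [smul_lie]; exact LieSubalgebra.smul_mem _ _ hx
    | mem x hx =>
      obtain ⟨i, rfl⟩ := hx
      induction hu using lieSpan_induction with
      | zero => simp
      | add x y _ _ hx hy => rw [lie_add]; exact add_mem hx hy
      | smul t x _ hx => rw [lie_smul]; exact LieSubalgebra.smul_mem _ _ hx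
      | mem x hx =>
        obtain ⟨j, rfl⟩ := hx
        rw [hA]
        exact LieSubalgebra.smul_mem _ _ (subset_lieSpan ⟨j, rfl⟩)
      | lie x y hx hy ihx ihy =>
        rw [leibniz_lie]
        exact add_mem (LieSubalgebra.lie_mem _ ihx hy) (LieSubalgebra.lie_mem _ hx ihy)
  have hHE1 := hHE E _ C.HE
  have hHF1 := hHE F (fun i j => -(A i j : ℂ)) (fun i j => by rw [C.HF, neg_smul])
  let NE := (lieSpan ℂ T (Set.range E)).toSubmodule
  let NF := (lieSpan ℂ T (Set.range F)).toSubmodule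
  -- the opposite generators act
  have opp : ∀ (E' F' : Fin n → T)
      (_ : ∀ h ∈ Hs, ∀ u ∈ lieSpan ℂ T (Set.range E'), ⁅h, u⁆ ∈ lieSpan ℂ T (Set.range E'))
      (_ : ∀ i j, ⁅F' i, E' j⁆ ∈ Hs) i, ∀ u ∈ lieSpan ℂ T (Set.range E'),
        ⁅F' i, u⁆ ∈ (lieSpan ℂ T (Set.range E')).toSubmodule ⊔ Hs := by
    intro E' F' h1 h2 i u hu
    induction hu using lieSpan_induction with
    | zero => simp
    | add x y _ _ hx hy => rw [lie_add]; exact add_mem hx hy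
    | smul t x _ hx => rw [lie_smul]; exact Submodule.smul_mem _ _ hx
    | mem x hx =>
      obtain ⟨j, rfl⟩ := hx
      exact Submodule.mem_sup_right (h2 i j)
    | lie x y hx hy ihx ihy =>
      rw [leibniz_lie]
      refine Submodule.mem_sup_left (add_mem ?_ ?_)
      · obtain ⟨a, ha, b, hb, hab⟩ := Submodule.mem_sup.1 ihx
        rw [← hab, add_lie]
        exact add_mem (LieSubalgebra.lie_mem _ ha hy) (h1 b hb y hy)
      · obtain ⟨a, ha, b, hb, hab⟩ := Submodule.mem_sup.1 ihy
        rw [← hab, lie_add, ← lie_skew x b]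
        exact add_mem (LieSubalgebra.lie_mem _ hx ha) (neg_mem (h1 b hb x hx))
  have hEFs : ∀ i j, ⁅E i, F j⁆ ∈ Hs := fun i j => by
    rw [C.EF]; split_ifs
    · exact Submodule.subset_span ⟨i, rfl⟩
    · exact zero_mem _
  have oF := opp E F hHE1 (fun i j => by rw [← lie_skew]; exact neg_mem (hEFs j i))
  have oE := opp F E hHF1 hEFs
  let S := NE ⊔ Hs ⊔ NF
  have hNES : NE ≤ S := le_sup_left.trans le_sup_left
  have hHsS : Hs ≤ S := le_sup_right.trans le_sup_left
  have hNFS : NF ≤ S := le_sup_right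
  have stab : ∀ x ∈ Set.range E ∪ Set.range F, ∀ v ∈ S, ⁅x, v⁆ ∈ S := by
    intro x hx v hv
    obtain ⟨w, hw, b, hb, rfl⟩ := Submodule.mem_sup.1 hv
    obtain ⟨a, ha, h, hh, rfl⟩ := Submodule.mem_sup.1 hw
    rw [lie_add, lie_add]
    rcases hx with ⟨i, rfl⟩ | ⟨i, rfl⟩
    · have hEi : E i ∈ lieSpan ℂ T (Set.range E) := subset_lieSpan ⟨i, rfl⟩
      refine add_mem (add_mem (hNES (LieSubalgebra.lie_mem _ hEi ha)) ?_) ?_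
      · rw [← lie_skew]; exact hNES (neg_mem (hHE1 h hh _ hEi))
      · exact (sup_le hNFS hHsS) (oE i b hb)
    · have hFi : F i ∈ lieSpan ℂ T (Set.range F) := subset_lieSpan ⟨i, rfl⟩
      refine add_mem (add_mem ?_ ?_) (hNFS (LieSubalgebra.lie_mem _ hFi hb))
      · exact (sup_le hNES hHsS) (oF i a ha)
      · rw [← lie_skew]; exact hNFS (neg_mem (hHF1 h hh _ hFi))
  have stab2 : ∀ x ∈ lieSpan ℂ T (Set.range E ∪ Set.range F), ∀ v ∈ S, ⁅x, v⁆ ∈ S := by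
    intro x hx
    induction hx using lieSpan_induction with
    | zero => simp
    | add x y _ _ hx hy => intro v hv; rw [add_lie]; exact add_mem (hx v hv) (hy v hv)
    | smul t x _ hx => intro v hv; rw [smul_lie]; exact Submodule.smul_mem _ _ (hx v hv)
    | mem x hx => exact stab x hx
    | lie x y _ _ hx hy =>
      intro v hv; rw [lie_lie]
      exact sub_mem (hx _ (hy v hv)) (hy _ (hx v hv))
  have htop : ∀ v, v ∈ S := by
    intro v
    have hv : v ∈ lieSpan ℂ T (Set.range E ∪ Set.range F) := by rw [C.gen]; trivial
    induction hv using lieSpan_induction with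
    | zero => exact zero_mem _
    | add x y _ _ hx hy => exact add_mem hx hy
    | smul t x _ hx => exact Submodule.smul_mem _ _ hx
    | mem x hx =>
      rcases hx with ⟨i, rfl⟩ | ⟨i, rfl⟩
      · exact hNES (subset_lieSpan ⟨i, rfl⟩)
      · exact hNFS (subset_lieSpan ⟨i, rfl⟩)
    | lie x y hx hy ihx ihy => exact stab2 x hx y ihy
  have hE : ∀ u ∈ NE, u ∈ TPos r 1 := by
    intro u hu
    have hu' : u ∈ lieSpan ℂ T (Set.range E) := hu
    clear hu
    induction hu' using lieSpan_induction with
    | zero => exact zero_mem _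
    | add x y _ _ hx hy => exact add_mem hx hy
    | smul t x _ hx => exact Submodule.smul_mem _ _ hx
    | mem x hx =>
      obtain ⟨i, rfl⟩ := hx
      refine Submodule.mem_iSup_of_mem 0 ?_
      rw [mem_Tm, rho_E C c hc]; simp
    | lie x y hx hy ihx ihy => exact lie_TPos r 1 ihx ihy
  have hF : ∀ u ∈ NF, u ∈ TPos r (-1) := by
    intro u hu
    have hu' : u ∈ lieSpan ℂ T (Set.range F) := hu
    clear hu
    induction hu' using lieSpan_induction with
    | zero => exact zero_mem _
    | add x y _ _ hx hy => exact add_mem hx hy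
    | smul t x _ hx => exact Submodule.smul_mem _ _ hx
    | mem x hx =>
      obtain ⟨i, rfl⟩ := hx
      refine Submodule.mem_iSup_of_mem 0 ?_
      rw [mem_Tm, rho_F C c hc]; simp
    | lie x y hx hy ihx ihy => exact lie_TPos r (-1) ihx ihy
  obtain ⟨w, hw, b, hb, rfl⟩ := Submodule.mem_sup.1 (htop v)
  obtain ⟨a, ha, h, hh, rfl⟩ := Submodule.mem_sup.1 hw
  exact ⟨a, hE a ha, h, hh, b, hF b hb, rfl⟩

/-- A homomorphism from the Serre Lie algebra is injective if it is injective on the `H`'s. -/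
theorem inj (C : Chev A E F H) (c : Fin n → ℕ) (hc : ∀ j, ∑ i, (c i : ℤ) * A i j = 2)
    (φ : T →ₗ⁅ℂ⁆ M) (hli : LinearIndependent ℂ (fun i => φ (H i))) : Function.Injective φ := by
  set r : T := ∑ i, (c i : ℂ) • H i with hr
  have hrH : ∀ h ∈ Submodule.span ℂ (Set.range H), ⁅r, h⁆ = 0 := by
    intro h hh
    induction hh using Submodule.span_induction with
    | zero => simp
    | add x y _ _ hx hy => rw [lie_add, hx, hy, add_zero]
    | smul t x _ hx => rw [lie_smul, hx, smul_zero]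
    | mem x hx =>
      obtain ⟨i, rfl⟩ := hx
      rw [hr, _root_.sum_lie]; simp [C.HH]
  have hTP : ∀ ε : ℤ, ε ≠ 0 → TPos r ε ≤ ⨆ (j : ℤ) (_ : j ≠ 0), Tm r j := by
    intro ε hε
    refine iSup_le fun m => ?_
    refine le_iSup₂_of_le (ε * (m + 1)) ?_ le_rfl
    exact mul_ne_zero hε (by positivity)
  have h0 : ∀ v, ⁅r, v⁆ = 0 → φ v = 0 → v = 0 := by
    intro v hv hφ
    obtain ⟨a, ha, h, hh, b, hb, hvab⟩ := triang C c hc v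
    have hab : a + b = 0 := by
      have h1 : a + b ∈ Tm r 0 := by
        rw [mem_Tm]
        have : a + b = v - h := by rw [hvab]; abel
        rw [this, lie_sub, hv, hrH h hh]; simp
      have h2 : a + b ∈ ⨆ (j : ℤ) (_ : j ≠ 0), Tm r j :=
        add_mem (hTP 1 (by simp) ha) (hTP (-1) (by simp) hb)
      simpa using (Tm_indep r 0).le_bot (Submodule.mem_inf.2 ⟨h1, h2⟩)
    have hvh : v = h := by rw [hvab]; rw [add_right_comm, hab, zero_add]
    subst hvh
    obtain ⟨d, hd⟩ := (Submodule.mem_span_range_iff_exists_fun ℂ).1 hh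
    rw [← hd, map_sum] at hφ
    simp only [map_smul] at hφ
    have := Fintype.linearIndependent_iff.1 hli d hφ
    rw [← hd]; simp [this]
  have hm : ∀ m : ℤ, ∀ v ∈ Tm r m, φ v = 0 → v = 0 := by
    intro m v hv hφ
    rw [mem_Tm] at hv
    rcases Int.eq_nat_or_neg m with ⟨k, rfl | rfl⟩
    · exact pos_inj C c hc φ h0 k v (by simpa using hv) hφ
    · have hr' : ∑ i, (c i : ℂ) • (fun i => -H i) i = -r := by simp [hr]
      refine pos_inj C.swap c hc φ (fun v hv => h0 v ?_) k v ?_ hφ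
      · rw [hr', neg_lie] at hv; exact neg_eq_zero.1 hv
      · rw [hr', neg_lie, hv]; push_cast; module
  rw [injective_iff_map_eq_zero]
  intro v hv
  have htop : v ∈ ⨆ m, Tm r m := by
    obtain ⟨a, ha, h, hh, b, hb, rfl⟩ := triang C c hc v
    have hle : ∀ ε, TPos r ε ≤ ⨆ m, Tm r m := fun ε => iSup_le fun m => le_iSup _ _
    refine add_mem (add_mem (hle 1 ha) ?_) (hle (-1) hb)
    refine Submodule.mem_iSup_of_mem 0 ?_
    rw [mem_Tm, hrH h hh]; simp
  obtain ⟨u, hu, rfl⟩ := (Submodule.mem_iSup_iff_exists_finsupp _ _).1 htop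
  rw [Finsupp.sum, map_sum] at hv
  have hz := (iSupIndep_iff_finsetSum_eq_zero_imp_eq_zero _).1 (Tm_indep (φ r)) u.support
    (fun m => φ (u m)) (fun m _ => by
      rw [mem_Tm, ← LieHom.map_lie, (mem_Tm _ _ _).1 (hu m), map_smul]) hv
  refine Finset.sum_eq_zero fun m hm' => hm m (u m) (hu m) (hz m hm')

end PaperStmt.Serre

namespace PaperStmt.Gen
open Module

variable {L : Type*} [LieRing L] [LieAlgebra ℂ L]

/-- The equivalence to be proved for a given pair. -/
def Good (e h : L) : Prop :=
  IsReachable ℂ e ↔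
      (LieSubalgebra.lieSpan ℂ L (gradePieceCent ℂ e h 1 : Set L)).toSubmodule
        = gradeGeOneCent ℂ e h

lemma mem_gp {h v : L} {k : ℤ} : v ∈ gradePiece ℂ h k ↔ ⁅h, v⁆ = (k : ℂ) • v := by
  simp [gradePiece]

lemma mem_cent {e v : L} : v ∈ centralizerOf ℂ e ↔ ⁅v, e⁆ = 0 := Iff.rfl

lemma mem_gpc {e h v : L} {k : ℤ} :
    v ∈ gradePieceCent ℂ e h k ↔ ⁅h, v⁆ = (k : ℂ) • v ∧ ⁅v, e⁆ = 0 := by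
  rw [gradePieceCent, Submodule.mem_inf, mem_gp]; rfl

lemma gpc_le {e h : L} {k : ℤ} (hk : 1 ≤ k) : gradePieceCent ℂ e h k ≤ gradeGeOneCent ℂ e h :=
  le_iSup₂_of_le k hk le_rfl

lemma ge_lie {e h : L} {u v : L} (hu : u ∈ gradeGeOneCent ℂ e h) (hv : v ∈ gradeGeOneCent ℂ e h) :
    ⁅u, v⁆ ∈ gradeGeOneCent ℂ e h := by
  unfold gradeGeOneCent at hu
  have key : gradeGeOneCent ℂ e h ≤
      (gradeGeOneCent ℂ e h).comap (LieAlgebra.ad ℂ L v) := by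
    refine iSup₂_le fun i hi x hx => ?_
    rw [Submodule.mem_comap]
    have key2 : gradeGeOneCent ℂ e h ≤
      (gradeGeOneCent ℂ e h).comap (LieAlgebra.ad ℂ L x) := by
      refine iSup₂_le fun j hj y hy => ?_
      rw [Submodule.mem_comap]
      refine gpc_le (k := i + j) (by simp at hi hj; lia) ?_
      rw [mem_gpc] at *
      constructor
      · change ⁅h, ⁅x, y⁆⁆ = ((i + j : ℤ) : ℂ) • ⁅x, y⁆
        rw [leibniz_lie, hx.1, hy.1, smul_lie, lie_smul]; push_cast; module
      · change ⁅⁅x, y⁆, e⁆ = _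
        rw [lie_lie, hx.2, hy.2]; simp
    have := key2 hv
    rw [Submodule.mem_comap] at this
    change ⁅x, v⁆ ∈ _ at this
    change ⁅v, x⁆ ∈ _
    rw [← lie_skew]; exact neg_mem this
  have := key hu
  rw [Submodule.mem_comap] at this
  change ⁅v, u⁆ ∈ _ at this
  rw [← lie_skew]; exact neg_mem this

lemma span_le (e h : L) :
    (LieSubalgebra.lieSpan ℂ L (gradePieceCent ℂ e h 1 : Set L)).toSubmodule
        ≤ gradeGeOneCent ℂ e h := by
  let S : LieSubalgebra ℂ L := { gradeGeOneCent ℂ e h with lie_mem' := fun hu hv => ge_lie hu hv }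
  have : LieSubalgebra.lieSpan ℂ L (gradePieceCent ℂ e h 1 : Set L) ≤ S := by
    rw [LieSubalgebra.lieSpan_le]
    exact gpc_le le_rfl
  exact this

lemma der_lie {e x y : L} (hx : ⁅x, e⁆ = 0) (hy : ⁅y, e⁆ = 0) :
    ⁅x, y⁆ ∈ derivedOf ℂ (centralizerOf ℂ e) :=
  Submodule.subset_span ⟨x, hx, y, hy, rfl⟩

lemma der_ad {e h : L} (he : ⁅h, e⁆ = (2 : ℂ) • e) {d : L}
    (hd : d ∈ derivedOf ℂ (centralizerOf ℂ e)) : ⁅h, d⁆ ∈ derivedOf ℂ (centralizerOf ℂ e) := by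
  have st : ∀ x : L, ⁅x, e⁆ = 0 → ⁅⁅h, x⁆, e⁆ = 0 := by
    intro x hx; rw [lie_lie, hx, he, lie_smul, hx]; simp
  unfold derivedOf bracketSpan at hd
  induction hd using Submodule.span_induction with
  | zero => simp
  | add x y _ _ hx hy => rw [lie_add]; exact add_mem hx hy
  | smul t x _ hx => rw [lie_smul]; exact Submodule.smul_mem _ _ hx
  | mem x hx =>
    obtain ⟨a, ha, b, hb, rfl⟩ := hx
    rw [leibniz_lie]
    exact add_mem (der_lie (st a ha) hb) (der_lie ha (st b hb))

lemma good_of_span {e h : L} (he : ⁅h, e⁆ = (2 : ℂ) • e)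
    (H : gradeGeOneCent ℂ e h ≤
      (LieSubalgebra.lieSpan ℂ L (gradePieceCent ℂ e h 1 : Set L)).toSubmodule) : Good e h := by
  refine ⟨fun _ => le_antisymm (span_le e h) H, fun _ => ?_⟩
  set D := derivedOf ℂ (centralizerOf ℂ e) with hD
  have h1 : ∀ u ∈ LieSubalgebra.lieSpan ℂ L (gradePieceCent ℂ e h 1 : Set L),
      ⁅u, e⁆ = 0 ∧ ∃ a ∈ gradePieceCent ℂ e h 1, ∃ d ∈ D, u = a + d := by
    intro u hu
    induction hu using LieSubalgebra.lieSpan_induction with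
    | zero => exact ⟨by simp, 0, zero_mem _, 0, zero_mem _, by simp⟩
    | add x y _ _ hx hy =>
      obtain ⟨hx, a, ha, d, hd, rfl⟩ := hx
      obtain ⟨hy, a', ha', d', hd', rfl⟩ := hy
      exact ⟨by rw [add_lie, hx, hy, add_zero], a + a', add_mem ha ha', d + d', add_mem hd hd',
        by abel⟩
    | smul t x _ hx =>
      obtain ⟨hx, a, ha, d, hd, rfl⟩ := hx
      exact ⟨by rw [smul_lie, hx, smul_zero], t • a, Submodule.smul_mem _ _ ha, t • d,
        Submodule.smul_mem _ _ hd, by rw [smul_add]⟩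
    | mem x hx => exact ⟨(mem_gpc.1 hx).2, x, hx, 0, zero_mem _, by simp⟩
    | lie x y hx hy ihx ihy =>
      exact ⟨by rw [lie_lie, ihx.1, ihy.1]; simp, 0, zero_mem _, ⁅x, y⁆,
        der_lie ihx.1 ihy.1, by simp⟩
  have h2 : e ∈ gradeGeOneCent ℂ e h :=
    gpc_le (k := 2) (by norm_num) (mem_gpc.2 ⟨by simpa using he, lie_self e⟩)
  obtain ⟨-, a, ha, d, hd, hed⟩ := h1 e (H h2)
  have h3 : a = ⁅h, d⁆ - (2 : ℂ) • d := by
    have h4 := he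
    rw [hed, lie_add, (mem_gpc.1 ha).1, smul_add] at h4
    have h5 : ⁅h, d⁆ = (2 : ℂ) • a + (2 : ℂ) • d - ((1 : ℤ) : ℂ) • a := by
      rw [← h4]; abel
    rw [h5]; push_cast; module
  rw [IsReachable, ← hD, hed]
  refine add_mem ?_ hd
  rw [h3]
  exact sub_mem (der_ad he hd) (Submodule.smul_mem _ _ hd)

lemma good_of_not {e h : L} (he : ⁅h, e⁆ = (2 : ℂ) • e) (H : ¬ IsReachable ℂ e) : Good e h :=
  ⟨fun h' => absurd h' H, fun h' => (good_of_span he h'.symm.le).2 h'⟩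

lemma reach_map (g : L ≃ₗ⁅ℂ⁆ L) {e : L} (H : IsReachable ℂ e) : IsReachable ℂ (g e) := by
  unfold IsReachable at *
  have : derivedOf ℂ (centralizerOf ℂ e) ≤
      (derivedOf ℂ (centralizerOf ℂ (g e))).comap (g : L →ₗ[ℂ] L) := by
    refine Submodule.span_le.2 ?_
    rintro _ ⟨a, ha, b, hb, rfl⟩
    change g ⁅a, b⁆ ∈ derivedOf ℂ (centralizerOf ℂ (g e))
    rw [LieEquiv.map_lie]
    have ha : ⁅a, e⁆ = 0 := ha
    have hb : ⁅b, e⁆ = 0 := hb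
    exact der_lie (by rw [← LieEquiv.map_lie, ha, map_zero]) (by rw [← LieEquiv.map_lie, hb, map_zero])
  exact this H

lemma span_map (g : L ≃ₗ⁅ℂ⁆ L) {e h : L} (H : gradeGeOneCent ℂ e h ≤
      (LieSubalgebra.lieSpan ℂ L (gradePieceCent ℂ e h 1 : Set L)).toSubmodule) :
      gradeGeOneCent ℂ (g e) (g h) ≤
      (LieSubalgebra.lieSpan ℂ L (gradePieceCent ℂ (g e) (g h) 1 : Set L)).toSubmodule := by
  have h1 : ∀ (g : L ≃ₗ⁅ℂ⁆ L) (e h : L) k v, v ∈ gradePieceCent ℂ e h k →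
      g v ∈ gradePieceCent ℂ (g e) (g h) k := by
    intro g e h k v hv
    rw [mem_gpc] at *
    rw [← LieEquiv.map_lie, ← LieEquiv.map_lie, hv.1, hv.2]
    exact ⟨map_smul g _ _, map_zero g⟩
  have h2 : ∀ u ∈ LieSubalgebra.lieSpan ℂ L (gradePieceCent ℂ e h 1 : Set L),
      g u ∈ LieSubalgebra.lieSpan ℂ L (gradePieceCent ℂ (g e) (g h) 1 : Set L) := by
    intro u hu
    induction hu using LieSubalgebra.lieSpan_induction with
    | zero => rw [map_zero]; exact zero_mem _
    | add x y _ _ hx hy => rw [map_add]; exact add_mem hx hy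
    | smul t x _ hx => rw [map_smul]; exact LieSubalgebra.smul_mem _ _ hx
    | mem x hx => exact LieSubalgebra.subset_lieSpan (h1 g e h 1 x hx)
    | lie x y hx hy ihx ihy => rw [LieEquiv.map_lie]; exact LieSubalgebra.lie_mem _ ihx ihy
  refine iSup₂_le fun k hk v hv => ?_
  have h3 : g.symm v ∈ gradePieceCent ℂ e h k := by
    have := h1 g.symm _ _ k v hv
    simpa using this
  have := h2 _ (H (gpc_le hk h3))
  simpa using this

lemma good_map (g : L ≃ₗ⁅ℂ⁆ L) {e h : L} (he : ⁅h, e⁆ = (2 : ℂ) • e) (G : Good (g e) (g h)) :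
    Good e h := by
  by_cases hr : IsReachable ℂ e
  · refine good_of_span he ?_
    have := span_map g.symm (G.1 (reach_map g hr)).symm.le
    simpa using this
  · exact good_of_not he hr

/-- The adjoint `sl₂`-triple. -/
lemma s2_ad {e h f : L} (he : ⁅h, e⁆ = (2 : ℂ) • e) (hf : ⁅h, f⁆ = -((2 : ℂ) • f))
    (ef : ⁅e, f⁆ = h) :
    Sl2.S2 (LieAlgebra.ad ℂ L e) (LieAlgebra.ad ℂ L h) (LieAlgebra.ad ℂ L f) where
  he v := by
    simp only [LieAlgebra.ad_apply]
    rw [leibniz_lie, he, smul_lie]; abel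
  hf v := by
    simp only [LieAlgebra.ad_apply]
    rw [leibniz_lie, hf, neg_lie, smul_lie]; abel
  ef v := by
    simp only [LieAlgebra.ad_apply]
    rw [leibniz_lie, ef]; abel

end PaperStmt.Gen

namespace PaperStmt.Gen
open Module
set_option linter.unusedSectionVars false

variable {L : Type*} [LieRing L] [LieAlgebra ℂ L] [FiniteDimensional ℂ L]
variable {e h f : L}

/-- An `sl₂`-triple over `ℂ`. -/
structure Tr (e h f : L) : Prop where
  he : ⁅h, e⁆ = (2 : ℂ) • e
  hf : ⁅h, f⁆ = -((2 : ℂ) • f)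
  ef : ⁅e, f⁆ = h

lemma Tr.s2 (t : Tr e h f) :
    Sl2.S2 (LieAlgebra.ad ℂ L e) (LieAlgebra.ad ℂ L h) (LieAlgebra.ad ℂ L f) :=
  s2_ad t.he t.hf t.ef

lemma gp_indep (h : L) : iSupIndep (gradePiece ℂ h) :=
  (Module.End.eigenspaces_iSupIndep (LieAlgebra.ad ℂ L h : End ℂ L)).comp
    (f := fun m : ℤ => (m : ℂ)) Int.cast_injective

lemma lie_gp {h u v : L} {i j : ℤ} (hu : u ∈ gradePiece ℂ h i) (hv : v ∈ gradePiece ℂ h j) :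
    ⁅u, v⁆ ∈ gradePiece ℂ h (i + j) := by
  rw [mem_gp] at *
  rw [leibniz_lie, hu, hv, smul_lie, lie_smul]; push_cast; module

lemma cent_neg (t : Tr e h f) {v : L} {k : ℤ} (hk : k < 0) (hv : v ∈ gradePieceCent ℂ e h k) :
    v = 0 := by
  rw [mem_gpc] at hv
  refine t.s2.inj hk hv.1 ?_
  rw [LieAlgebra.ad_apply, ← lie_skew, hv.2, neg_zero]

lemma cent_le (t : Tr e h f) {v : L} (hv : ⁅v, e⁆ = 0) :
    v ∈ ⨆ k : ℕ, gradePieceCent ℂ e h k := by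
  have hd : v ∈ ⨆ k : ℤ, gradePiece ℂ h k := by
    have := t.s2.diag
    change v ∈ ⨆ k : ℤ, End.eigenspace (LieAlgebra.ad ℂ L h) (k : ℂ)
    rw [this]; trivial
  obtain ⟨u, hu, rfl⟩ := (Submodule.mem_iSup_iff_exists_finsupp _ _).1 hd
  rw [Finsupp.sum, sum_lie] at hv
  have hI : iSupIndep (fun m : ℤ => gradePiece ℂ h (m + 2)) :=
    (gp_indep h).comp (f := fun m : ℤ => m + 2) (add_left_injective 2)
  have he : e ∈ gradePiece ℂ h 2 := mem_gp.2 (by simpa using t.he)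
  have hz := (iSupIndep_iff_finsetSum_eq_zero_imp_eq_zero _).1 hI u.support
    (fun m => ⁅u m, e⁆) (fun m _ => lie_gp (hu m) he) hv
  refine Submodule.sum_mem _ fun m hm => ?_
  have hm2 : u m ∈ gradePieceCent ℂ e h m := ⟨hu m, hz m hm⟩
  rcases lt_or_ge m 0 with h0 | h0
  · rw [cent_neg t h0 hm2]; exact zero_mem _
  · obtain ⟨k, rfl⟩ := Int.eq_ofNat_of_zero_le h0
    exact Submodule.mem_iSup_of_mem k hm2

lemma not_reach (t : Tr e h f) (lam : L →ₗ[ℂ] ℂ)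
    (h0 : ∀ k : ℤ, k ≠ 2 → ∀ v : L, ⁅h, v⁆ = (k : ℂ) • v → lam v = 0)
    (h1 : ∀ a b : L, ⁅h, a⁆ = a → ⁅a, e⁆ = 0 → ⁅h, b⁆ = b → ⁅b, e⁆ = 0 → lam ⁅a, b⁆ = 0)
    (h2 : ∀ a b : L, ⁅h, a⁆ = 0 → ⁅a, e⁆ = 0 → ⁅h, b⁆ = (2 : ℂ) • b → ⁅b, e⁆ = 0 →
      lam ⁅a, b⁆ = 0)
    (hl : lam e ≠ 0) : ¬ IsReachable ℂ e := by
  intro hr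
  have key : ∀ a b : L, ⁅a, e⁆ = 0 → ⁅b, e⁆ = 0 → lam ⁅a, b⁆ = 0 := by
    intro a b ha hb
    replace ha := cent_le t ha
    replace hb := cent_le t hb
    induction ha using Submodule.iSup_induction' with
    | zero => simp
    | add x y _ _ hx hy => rw [add_lie, map_add, hx, hy, add_zero]
    | mem i x hx =>
      induction hb using Submodule.iSup_induction' with
      | zero => simp
      | add y z _ _ hy hz => rw [lie_add, map_add, hy, hz, add_zero]
      | mem j y hy =>
        by_cases hij : ((i : ℤ) + j) = 2
        · rw [mem_gpc] at hx hy
          have : (i = 0 ∧ j = 2) ∨ (i = 1 ∧ j = 1) ∨ (i = 2 ∧ j = 0) := by lia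
          rcases this with ⟨rfl, rfl⟩ | ⟨rfl, rfl⟩ | ⟨rfl, rfl⟩
          · exact h2 x y (by simpa using hx.1) hx.2 (by simpa using hy.1) hy.2
          · exact h1 x y (by simpa using hx.1) hx.2 (by simpa using hy.1) hy.2
          · rw [← lie_skew, map_neg,
              h2 y x (by simpa using hy.1) hy.2 (by simpa using hx.1) hx.2, neg_zero]
        · exact h0 _ hij _ (mem_gp.1 (lie_gp hx.1 hy.1))
  apply hl
  have : derivedOf ℂ (centralizerOf ℂ e) ≤ LinearMap.ker lam := by
    refine Submodule.span_le.2 ?_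
    rintro _ ⟨a, ha, b, hb, rfl⟩
    exact key a b ha hb
  exact this hr

lemma finrank_gpc (t : Tr e h f) {k : ℤ} (hk : -1 ≤ k) :
    finrank ℂ (gradePieceCent ℂ e h k) + finrank ℂ (gradePiece ℂ h (k + 2))
      = finrank ℂ (gradePiece ℂ h k) := by
  let φ : gradePiece ℂ h k →ₗ[ℂ] L := (LieAlgebra.ad ℂ L e : End ℂ L).domRestrict (gradePiece ℂ h k)
  have hR : LinearMap.range φ = gradePiece ℂ h (k + 2) := by
    ext v
    constructor
    · rintro ⟨⟨y, hy⟩, rfl⟩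
      have := lie_gp (mem_gp.2 (by simpa using t.he) : e ∈ gradePiece ℂ h 2) hy
      rw [add_comm]; exact this
    · intro hv
      obtain ⟨y, hy, hy2⟩ := t.s2.surj hk (x := v) (by
        have := mem_gp.1 hv
        rw [LieAlgebra.ad_apply, this]; push_cast; rfl)
      exact ⟨⟨y, mem_gp.2 hy⟩, hy2⟩
  have hK : (LinearMap.ker φ).map (gradePiece ℂ h k).subtype = gradePieceCent ℂ e h k := by
    ext v
    constructor
    · rintro ⟨⟨y, hy⟩, hy2, rfl⟩
      refine ⟨hy, ?_⟩
      have : ⁅e, y⁆ = 0 := hy2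
      change ⁅y, e⁆ = 0
      rw [← lie_skew, this, neg_zero]
    · rintro ⟨hv, hv2⟩
      refine ⟨⟨v, hv⟩, ?_, rfl⟩
      have : ⁅v, e⁆ = 0 := hv2
      change ⁅e, v⁆ = 0
      rw [← lie_skew, this, neg_zero]
  have h1 := LinearMap.finrank_range_add_finrank_ker φ
  rw [hR] at h1
  rw [← hK, Submodule.finrank_map_subtype_eq]
  lia

/-- Killing form, as a trace. -/
noncomputable def kap (u v : L) : ℂ :=
  LinearMap.trace ℂ L (LieAlgebra.ad ℂ L u ∘ₗ LieAlgebra.ad ℂ L v)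

lemma kap_eq (u v : L) : kap u v = killingForm ℂ L u v := rfl

lemma kap_lie (u v w : L) : kap ⁅u, v⁆ w = kap u ⁅v, w⁆ := by
  rw [kap_eq, kap_eq]; exact LieModule.traceForm_apply_lie_apply ℂ L L u v w

lemma kap_grade {h u v : L} {i j : ℤ} (hu : ⁅h, u⁆ = (i : ℂ) • u) (hv : ⁅h, v⁆ = (j : ℂ) • v)
    (hij : i + j ≠ 0) : kap u v = 0 := by
  have h1 : kap ⁅u, h⁆ v = kap u ⁅h, v⁆ := kap_lie u h v
  rw [← lie_skew, hu, hv] at h1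
  simp only [kap_eq, map_neg, map_smul, LinearMap.neg_apply, LinearMap.smul_apply, smul_eq_mul] at h1 ⊢
  have h2 : ((i + j : ℤ) : ℂ) * killingForm ℂ L u v = 0 := by push_cast; linear_combination -h1
  exact (mul_eq_zero.1 h2).resolve_left (by exact_mod_cast hij)

/-- A torus element commuting with `e` is Killing-orthogonal to `h`. -/
lemma kap_tor (t : Tr e h f) {τ : L} (hτ : ⁅τ, e⁆ = 0) : kap τ h = 0 := by
  rw [← t.ef, ← kap_lie, hτ, kap_eq, map_zero]; rfl

/-- Elements with some label at least two. -/
lemma not_reach_two (t : Tr e h f) {τ : L} (h0 : ∀ v : L, ⁅h, v⁆ = 0 → ⁅τ, v⁆ = 0)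
    (h1 : ∀ v : L, ⁅h, v⁆ = v → ⁅τ, v⁆ = 0) (hτ : ⁅h, τ⁆ = 0) (hk : kap h τ ≠ 0) :
    ¬ IsReachable ℂ e := by
  let lam : L →ₗ[ℂ] ℂ := (killingForm ℂ L f) ∘ₗ (LieAlgebra.ad ℂ L τ : End ℂ L)
  have hlam : ∀ v, lam v = kap f ⁅τ, v⁆ := fun v => rfl
  have hf : ⁅h, f⁆ = ((-2 : ℤ) : ℂ) • f := by rw [t.hf]; push_cast; module
  have hz : ∀ u : L, kap u 0 = 0 := fun u => by rw [kap_eq, map_zero]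
  refine not_reach t lam ?_ ?_ ?_ ?_
  · intro k hk v hv
    rw [hlam]
    refine kap_grade (h := h) (i := -2) (j := k) hf ?_ (by lia)
    rw [leibniz_lie, hτ, hv, zero_lie, lie_smul, zero_add]
  · intro a b ha _ hb _
    rw [hlam, leibniz_lie, h1 a ha, h1 b hb]; simp [hz]
  · intro a b ha hae hb _
    rw [hlam, leibniz_lie, h0 a ha, zero_lie, zero_add, ← kap_lie]
    have : ⁅f, a⁆ = 0 := by
      refine t.s2.inj (k := -2) (by norm_num) ?_ ?_
      · rw [LieAlgebra.ad_apply, leibniz_lie, ha, hf, smul_lie, lie_zero, add_zero]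
      · rw [LieAlgebra.ad_apply, leibniz_lie, t.ef, ha, ← lie_skew e a, hae]; simp
    rw [this, kap_eq, map_zero]; rfl
  · rw [hlam, ← lie_skew]
    have : kap f (-⁅e, τ⁆) = kap h τ := by
      have h2 := kap_lie f e τ
      rw [← lie_skew f e, t.ef] at h2
      rw [kap_eq, map_neg, ← kap_eq, ← h2, kap_eq, map_neg, kap_eq]
      simp
    rw [this]; exact hk

end PaperStmt.Gen

namespace PaperStmt.Chk
open Module Gen

/-- Sparse integer vectors. -/
abbrev Vec := List (ℕ × ℤ)

/-- Root data. Keys below `8` denote Cartan elements, the other ones encode roots in base `64`.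
`A` is the Cartan matrix, `G` the Gram matrix of the coordinates of the roots. -/
structure RD where
  n : ℕ
  A : List (List ℤ)
  G : List (List ℤ)
  rk : List ℕ
  Nf : ℕ → ℕ → ℤ

def RD.keys (D : RD) : List ℕ := List.range D.n ++ D.rk

/-- Test for zero. -/
def zb : ℤ → Bool
  | .ofNat n => Nat.beq n 0
  | .negSucc _ => false

/-- Pairing of an integral weight with the digits of a key. -/
def dgo : List ℤ → ℕ → ℤ
  | [], _ => 0
  | c :: cs, k => Int.add (Int.mul c (Int.subNatNat (Nat.mod k 64) 32)) (dgo cs (Nat.div k 64))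

def dg (d : List ℤ) (k : ℕ) : ℤ := bif Nat.blt k 8 then 0 else dgo d k

/-- Pairing of a natural weight with the digits of a key, without offset. -/
def dgn : List ℕ → ℕ → ℕ
  | [], _ => 0
  | c :: cs, k => Nat.add (Nat.mul c (Nat.mod k 64)) (dgn cs (Nat.div k 64))

def OFF : ℕ := 142971416741920

/-- Brackets of basis vectors. -/
def RD.brk (D : RD) (a b : ℕ) : Vec :=
  bif Nat.blt a 8 then [(b, dg (D.A.getD a []) b)]
  else bif Nat.blt b 8 then [(a, Int.neg (dg (D.A.getD b []) a))]
  else bif zb (D.Nf a b) then [] else [(Nat.sub (Nat.add a b) OFF, D.Nf a b)]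

def RD.bil (D : RD) (u v : Vec) : Vec :=
  u.flatMap fun p => v.flatMap fun q =>
    (D.brk p.1 q.1).map fun r => (r.1, Int.mul (Int.mul p.2 q.2) r.2)

def coef : Vec → ℕ → ℤ
  | [], _ => 0
  | p :: r, k => bif Nat.beq p.1 k then Int.add p.2 (coef r k) else coef r k

def isZero (v : Vec) : Bool := v.all fun p => zb (coef v p.1)

def memb (k : ℕ) (l : List ℕ) : Bool := l.any fun a => Nat.beq a k

def inK (l : List ℕ) (v : Vec) : Bool := v.all fun p => memb p.1 l

/-- The keys of degree `j` with respect to the labels `d`. -/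
def RD.lev (D : RD) (d : List ℕ) (j : ℕ) : List ℕ :=
  D.keys.filter fun k =>
    bif Nat.blt k 8 then Nat.beq j 0 else Nat.beq (dgn d k) (Nat.add j (Nat.mul 32 d.sum))

/-- Evaluate the argument first. -/
def strict {α : Type} (a : ℕ) (f : ℕ → α) : α := Nat.rec (f 0) (fun m _ => f (Nat.succ m)) a

/-- Keys outside `K` at which `w` is nonzero. -/
def newk (K : List ℕ) (w : Vec) : Vec → List ℕ
  | [] => []
  | p :: r => strict p.1 fun k => bif memb k K || zb (coef w k) then newk K w r else k :: newk K w r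

def RD.ordc (D : RD) (l0 : List ℕ) (e0 : Vec) : List ℕ → List Vec → List ℕ
  | K, [] => K
  | K, y :: ys =>
    match newk K (D.bil y e0) (D.bil y e0) with
    | [] => []
    | p :: r => bif inK l0 y && r.all (fun q => Nat.beq q p) then D.ordc l0 e0 (p :: K) ys else []

def indc : List Vec → Bool
  | [] => true
  | v :: r => v.any (fun p => !(zb (coef v p.1)) && r.all (fun w => zb (coef w p.1))) && indc r

/-- Translation of indices into keys. -/
def RD.tr (D : RD) (v : Vec) : Vec := v.map fun p => (D.keys.getD p.1 0, p.2)

/-- Certificates. -/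
inductive Cert where
  | A (S : List ℕ) (ord : List Vec) (t : List ℤ)
  | B (S : List ℕ) (ord : List Vec) (K1 C0 : List Vec) (lam : Vec)
  | C (S : List ℕ) (ord : List Vec) (K1 : List Vec) (cmb : List (List (List (ℕ × ℕ × ℤ))))

def RD.mkE (D : RD) (S : List ℕ) : Vec := S.map fun i => (D.keys.getD i 0, 1)

def RD.chkE (D : RD) (d : List ℕ) (e0 : Vec) (ord : List Vec) : Bool :=
  inK (D.lev d 2) e0 &&
  (D.lev d 2).all (fun k => memb k (D.ordc (D.lev d 0) e0 [] (ord.map D.tr)))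

/-- Vectors of degree `j` killed by `e0`. -/
def RD.chkZ (D : RD) (l : List ℕ) (e0 : Vec) (B : List Vec) : Bool :=
  B.all fun v => inK l v && isZero (D.bil e0 v)

def lamv (l : Vec) : Vec → ℤ
  | [] => 0
  | p :: r => Int.add (Int.mul p.2 (coef l p.1)) (lamv l r)

def scal (c : ℤ) (v : Vec) : Vec := v.map fun p => (p.1, Int.mul c p.2)

def RD.comb (D : RD) (K B : List Vec) (l : List (ℕ × ℕ × ℤ)) : Vec :=
  l.flatMap fun q => scal q.2.2 (D.bil (K.getD q.1 []) (B.getD q.2.1 []))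

/-- Check that the degree `≥ j` parts are generated. -/
def RD.chkC (D : RD) (d : List ℕ) (K : List Vec) : ℕ → List Vec → List (List (List (ℕ × ℕ × ℤ))) → Bool
  | j, _, [] => D.keys.all fun k => Nat.blt k 8 || Nat.blt (dgn d k) (Nat.add j (Nat.mul 32 d.sum))
  | j, B, c :: cs =>
    let B' := c.map (D.comb K B)
    B'.all (inK (D.lev d j)) && indc B' &&
    Nat.beq (B'.length + (D.lev d (j + 2)).length) (D.lev d j).length &&
    D.chkC d K (j + 1) B' cs

/-- Bilinear form of a matrix, with an integral and a natural argument. -/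
def dot : List ℤ → List ℕ → ℤ
  | a :: l, b :: m => Int.add (Int.mul a (Int.ofNat b)) (dot l m)
  | _, _ => 0

def gramv : List ℤ → List (List ℤ) → List ℕ → ℤ
  | a :: l, r :: m, d => Int.add (Int.mul a (dot r d)) (gramv l m d)
  | _, _, _ => 0

def RD.chk (D : RD) (d : List ℕ) : Cert → Bool
  | .A S ord t =>
    D.chkE d (D.mkE S) ord && Nat.beq t.length D.n && (D.mkE S).all (fun p => zb (dg t p.1)) &&
      !(zb (gramv t D.G d))
  | .B S ord K1 C0 lam =>
    let e0 := D.mkE S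
    let K := K1.map D.tr
    let C := C0.map D.tr
    let l := D.tr lam
    D.chkE d e0 ord && D.chkZ (D.lev d 1) e0 K && D.chkZ (D.lev d 0) e0 C &&
    indc K && indc C && inK (D.lev d 2) l &&
    Nat.beq (K.length + (D.lev d 3).length) (D.lev d 1).length &&
    Nat.beq (C.length + (D.lev d 2).length) (D.lev d 0).length &&
    K.all (fun u => K.all fun v => inK (D.lev d 2) (D.bil u v) && zb (lamv l (D.bil u v))) &&
    C.all (fun u => (D.lev d 2).all fun k =>
      inK (D.lev d 2) (D.bil u [(k, 1)]) && zb (lamv l (D.bil u [(k, 1)]))) &&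
    !(zb (lamv l e0))
  | .C S ord K1 cmb =>
    let e0 := D.mkE S
    let K := K1.map D.tr
    D.chkE d e0 ord && D.chkZ (D.lev d 1) e0 K && D.chkC d K 2 K cmb

end PaperStmt.Chk

namespace PaperStmt.Chk
open Module Gen

section Ev
variable {T : Type*} [LieRing T] [LieAlgebra ℂ T]

/-- Evaluation of a sparse vector. -/
noncomputable def ev (x : ℕ → T) (v : Vec) : T := (v.map fun p => (p.2 : ℂ) • x p.1).sum

lemma zb_iff {a : ℤ} : zb a = true ↔ a = 0 := by
  cases a with
  | ofNat n => simp [zb]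
  | negSucc n => simp [zb]

lemma zb_false {a : ℤ} : zb a = false ↔ a ≠ 0 := by
  rw [← Bool.not_eq_true, zb_iff]

lemma ev_nil (x : ℕ → T) : ev x [] = 0 := rfl

lemma ev_cons (x : ℕ → T) (p : ℕ × ℤ) (v : Vec) : ev x (p :: v) = (p.2 : ℂ) • x p.1 + ev x v := rfl

lemma ev_append (x : ℕ → T) (u v : Vec) : ev x (u ++ v) = ev x u + ev x v := by
  simp [ev]

lemma coef_cons (p : ℕ × ℤ) (v : Vec) (k : ℕ) :
    coef (p :: v) k = (if p.1 = k then p.2 else 0) + coef v k := by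
  rw [coef]
  by_cases h : p.1 = k
  · have : Nat.beq p.1 k = true := by simpa using h
    rw [this, if_pos h]; rfl
  · have : Nat.beq p.1 k = false := by
      rw [← Bool.not_eq_true]; simpa using h
    rw [this, if_neg h, zero_add]; rfl

lemma coef_nmem (v : Vec) (k : ℕ) (h : ∀ p ∈ v, p.1 ≠ k) : coef v k = 0 := by
  induction v with
  | nil => rfl
  | cons p v ih =>
    rw [coef_cons, if_neg (h p List.mem_cons_self), zero_add]
    exact ih fun q hq => h q (List.mem_cons_of_mem _ hq)

lemma ev_eq (x : ℕ → T) (v : Vec) (s : Finset ℕ) (hs : ∀ p ∈ v, p.1 ∈ s) :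
    ev x v = ∑ k ∈ s, (coef v k : ℂ) • x k := by
  induction v with
  | nil => simp [ev_nil, coef]
  | cons p v ih =>
    rw [ev_cons, ih fun q hq => hs q (List.mem_cons_of_mem _ hq)]
    simp only [coef_cons, Int.cast_add, add_smul, Finset.sum_add_distrib]
    congr 1
    rw [Finset.sum_eq_single p.1]
    · simp
    · intro b _ hb; simp [Ne.symm hb]
    · intro h; exact absurd (hs p List.mem_cons_self) h

lemma ev_zero (x : ℕ → T) (v : Vec) (h : isZero v = true) : ev x v = 0 := by
  rw [ev_eq x v (v.map Prod.fst).toFinset (fun p hp => by simp only [List.mem_toFinset, List.mem_map]; exact ⟨p, hp, rfl⟩)]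
  refine Finset.sum_eq_zero fun k hk => ?_
  simp only [List.mem_toFinset, List.mem_map] at hk
  obtain ⟨p, hp, rfl⟩ := hk
  have := (List.all_eq_true.1 h) p hp
  rw [zb_iff] at this
  rw [this]; simp

lemma ev_scal (x : ℕ → T) (c : ℤ) (v : Vec) : ev x (scal c v) = (c : ℂ) • ev x v := by
  induction v with
  | nil => simp [scal, ev_nil]
  | cons p v ih =>
    rw [ev_cons, smul_add, ← ih]
    change ev x ((p.1, Int.mul c p.2) :: scal c v) = _
    rw [ev_cons]
    change ((c * p.2 : ℤ) : ℂ) • _ + _ = _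
    push_cast; rw [mul_smul]

lemma ev_map (x : ℕ → T) (c : ℤ) (v : Vec) :
    ev x (v.map fun r => (r.1, Int.mul c r.2)) = (c : ℂ) • ev x v := ev_scal x c v

lemma ev_flatMap {α : Type*} (x : ℕ → T) (l : List α) (g : α → Vec) :
    ev x (l.flatMap g) = (l.map fun a => ev x (g a)).sum := by
  induction l with
  | nil => rfl
  | cons a l ih => rw [List.flatMap_cons, ev_append, ih]; rfl

lemma ev_bil (D : RD) (x : ℕ → T) (u v : Vec)
    (h : ∀ p ∈ u, ∀ q ∈ v, ⁅x p.1, x q.1⁆ = ev x (D.brk p.1 q.1)) :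
    ⁅ev x u, ev x v⁆ = ev x (D.bil u v) := by
  induction u with
  | nil => simp [RD.bil, ev_nil]
  | cons p u ih =>
    rw [ev_cons, add_lie, ih fun p' hp' => h p' (List.mem_cons_of_mem _ hp')]
    rw [show D.bil (p :: u) v = (v.flatMap fun q =>
      (D.brk p.1 q.1).map fun r => (r.1, Int.mul (Int.mul p.2 q.2) r.2)) ++ D.bil u v from rfl,
      ev_append]
    congr 1
    rw [ev_flatMap]
    have h' := h p List.mem_cons_self
    clear h ih
    induction v with
    | nil => simp [ev_nil]
    | cons q v ih =>
      rw [ev_cons, lie_add, ih fun q' hq' => h' q' (List.mem_cons_of_mem _ hq'), List.map_cons,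
        List.sum_cons, ev_map, smul_lie, lie_smul, h' q List.mem_cons_self, smul_smul]
      change _ = ((p.2 * q.2 : ℤ) : ℂ) • _ + _
      push_cast; rfl

lemma memb_iff {k : ℕ} {l : List ℕ} : memb k l = true ↔ k ∈ l := by
  simp only [memb, List.any_eq_true]
  constructor
  · rintro ⟨a, ha, h⟩; exact (Nat.eq_of_beq_eq_true h) ▸ ha
  · intro h; exact ⟨k, h, by simp⟩

lemma inK_iff {l : List ℕ} {v : Vec} : inK l v = true ↔ ∀ p ∈ v, p.1 ∈ l := by
  simp only [inK, List.all_eq_true, memb_iff]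

lemma strict_eq {α : Type} (a : ℕ) (g : ℕ → α) : strict a g = g a := by
  cases a <;> rfl

lemma mem_newk {K : List ℕ} {w v : Vec} {k : ℕ} :
    k ∈ newk K w v ↔ (∃ p ∈ v, p.1 = k) ∧ k ∉ K ∧ coef w k ≠ 0 := by
  induction v with
  | nil => simp [newk]
  | cons p v ih =>
    rw [newk, strict_eq]
    cases h : (memb p.1 K || zb (coef w p.1)) with
    | true =>
      rw [cond_true, ih]
      rw [Bool.or_eq_true, memb_iff, zb_iff] at h
      constructor
      · rintro ⟨⟨q, hq, rfl⟩, h2⟩; exact ⟨⟨q, List.mem_cons_of_mem _ hq, rfl⟩, h2⟩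
      · rintro ⟨⟨q, hq, rfl⟩, h2, h3⟩
        rcases List.mem_cons.1 hq with rfl | hq
        · exact (h.elim h2 h3).elim
        · exact ⟨⟨q, hq, rfl⟩, h2, h3⟩
    | false =>
      rw [cond_false, List.mem_cons, ih]
      rw [Bool.or_eq_false_iff, zb_false, ← Bool.not_eq_true, memb_iff] at h
      constructor
      · rintro (rfl | ⟨⟨q, hq, rfl⟩, h2⟩)
        · exact ⟨⟨p, List.mem_cons_self, rfl⟩, h⟩
        · exact ⟨⟨q, List.mem_cons_of_mem _ hq, rfl⟩, h2⟩
      · rintro ⟨⟨q, hq, rfl⟩, h2⟩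
        rcases List.mem_cons.1 hq with rfl | hq
        · exact Or.inl rfl
        · exact Or.inr ⟨⟨q, hq, rfl⟩, h2⟩

lemma ev_mem (x : ℕ → T) (v : Vec) (M : Submodule ℂ T) (h : ∀ p ∈ v, x p.1 ∈ M) : ev x v ∈ M := by
  induction v with
  | nil => exact M.zero_mem
  | cons p v ih =>
    exact M.add_mem (M.smul_mem _ (h p List.mem_cons_self))
      (ih fun q hq => h q (List.mem_cons_of_mem _ hq))

/-- Keys obtained by `ordc` belong to any submodule containing the brackets. -/
lemma ordc_mem (D : RD) (x : ℕ → T) (l0 : List ℕ) (e0 : Vec) (M : Submodule ℂ T)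
    (hM : ∀ y : Vec, inK l0 y = true → ev x (D.bil y e0) ∈ M) (ys : List Vec) (K : List ℕ)
    (hK : ∀ k ∈ K, x k ∈ M) : ∀ k ∈ D.ordc l0 e0 K ys, x k ∈ M := by
  induction ys generalizing K with
  | nil => exact hK
  | cons y ys ih =>
    rw [RD.ordc]
    cases hn : newk K (D.bil y e0) (D.bil y e0) with
    | nil => simp
    | cons p r =>
      simp only
      cases hb : (inK l0 y && r.all (fun q => Nat.beq q p)) with
      | false => simp
      | true =>
        rw [cond_true]
        refine ih _ fun k hk => ?_
        rcases List.mem_cons.1 hk with rfl | hk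
        swap
        · exact hK k hk
        rw [Bool.and_eq_true] at hb
        have h1 := hM y hb.1
        set w := D.bil y e0 with hw
        have hp : k ∈ newk K w w := by rw [hn]; exact List.mem_cons_self
        rw [mem_newk] at hp
        obtain ⟨⟨q, hq, hqk⟩, hkK, hc⟩ := hp
        rw [ev_eq x w (w.map Prod.fst).toFinset (fun p hp => by simp only [List.mem_toFinset, List.mem_map]; exact ⟨p, hp, rfl⟩)] at h1
        rw [← Finset.add_sum_erase _ _ (a := k) (by simp only [List.mem_toFinset, List.mem_map]; exact ⟨q, hq, hqk⟩)] at h1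
        have h2 : ∑ j ∈ ((w.map Prod.fst).toFinset).erase k, (coef w j : ℂ) • x j ∈ M := by
          refine M.sum_mem fun j hj => ?_
          rw [Finset.mem_erase, List.mem_toFinset, List.mem_map] at hj
          obtain ⟨hjk, p', hp', rfl⟩ := hj
          by_cases hjK : p'.1 ∈ K
          · exact M.smul_mem _ (hK _ hjK)
          by_cases hz : coef w p'.1 = 0
          · rw [hz]; simp
          exfalso
          have : p'.1 ∈ newk K w w := mem_newk.2 ⟨⟨p', hp', rfl⟩, hjK, hz⟩
          rw [hn] at this
          rcases List.mem_cons.1 this with h3 | h3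
          · exact hjk h3
          · have := List.all_eq_true.1 hb.2 _ h3
            exact hjk (by simpa using this)
        have h3 := (M.add_mem_iff_left h2).1 h1
        have h4 : (coef w k : ℂ) ≠ 0 := by exact_mod_cast hc
        exact (M.smul_mem_iff h4).1 h3

end Ev
end PaperStmt.Chk

namespace PaperStmt.Chk
open Module Gen
set_option linter.unusedSectionVars false

/-- Degree of a key with respect to labels `d`. -/
def dz (d : List ℕ) (k : ℕ) : ℤ := dg (d.map Int.ofNat) k

lemma dgo_cons (c : ℤ) (cs : List ℤ) (k : ℕ) :
    dgo (c :: cs) k = c * (((k % 64 : ℕ) : ℤ) - 32) + dgo cs (k / 64) := by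
  have h : Int.subNatNat (Nat.mod k 64) 32 = ((k % 64 : ℕ) : ℤ) - 32 := Int.subNatNat_eq_coe
  rw [dgo, h]; rfl

lemma dgo_dgn (d : List ℕ) (k : ℕ) : dgo (d.map Int.ofNat) k = (dgn d k : ℤ) - 32 * (d.sum : ℤ) := by
  induction d generalizing k with
  | nil => simp [dgo, dgn]
  | cons c d ih =>
    rw [List.map_cons, dgo_cons, ih, dgn]
    change _ = ((c * (k % 64) + dgn d (k / 64) : ℕ) : ℤ) - _
    rw [List.sum_cons]
    push_cast
    simp only [Int.ofNat_eq_natCast]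
    ring

lemma dz_lt (d : List ℕ) {k : ℕ} (h : k < 8) : dz d k = 0 := by
  rw [dz, dg]
  have : Nat.blt k 8 = true := by simpa using h
  rw [this]; rfl

lemma dz_ge (d : List ℕ) {k : ℕ} (h : ¬ k < 8) : dz d k = (dgn d k : ℤ) - 32 * (d.sum : ℤ) := by
  rw [dz, dg]
  have : Nat.blt k 8 = false := by rw [← Bool.not_eq_true]; simpa using h
  rw [this, cond_false, dgo_dgn]

lemma mem_lev {D : RD} {d : List ℕ} {j k : ℕ} : k ∈ D.lev d j ↔ k ∈ D.keys ∧ dz d k = j := by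
  rw [RD.lev, List.mem_filter]
  refine and_congr_right fun _ => ?_
  by_cases h : k < 8
  · have : Nat.blt k 8 = true := by simpa using h
    rw [this, dz_lt d h, cond_true]
    change (Nat.beq j 0 = true) ↔ _
    simp only [Nat.beq_eq]; omega
  · have : Nat.blt k 8 = false := by rw [← Bool.not_eq_true]; simpa using h
    rw [this, dz_ge d h, cond_false, Nat.beq_eq]
    change _ = j + 32 * d.sum ↔ _
    omega

section S
variable {T : Type*} [LieRing T] [LieAlgebra ℂ T]

/-- A Lie algebra with a basis indexed by the keys of a root datum. -/
structure Fr (D : RD) (x : ℕ → T) : Prop where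
  nodup : D.keys.Nodup
  li : LinearIndependent ℂ (fun k : {k // k ∈ D.keys} => x k)
  sp : ⊤ ≤ Submodule.span ℂ (Set.range (fun k : {k // k ∈ D.keys} => x k))
  brk : ∀ a ∈ D.keys, ∀ b ∈ D.keys, ∀ d : List ℕ, d.length = D.n →
    dz d a + dz d b ≠ 0 → ⁅x a, x b⁆ = ev x (D.brk a b)
  tor : ∀ t : List ℤ, t.length = D.n → ∃ τ : T, ∀ k ∈ D.keys, ⁅τ, x k⁆ = (dg t k : ℂ) • x k
  gram : ∀ (t : List ℤ) (d : List ℕ), t.length = D.n → d.length = D.n →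
    gramv t D.G d = (D.keys.map fun k => dg t k * dz d k).sum

variable {D : RD} {x : ℕ → T}

/-- The basis. -/
noncomputable def Fr.b (F : Fr D x) : Basis {k // k ∈ D.keys} ℂ T := Basis.mk F.li F.sp

lemma Fr.b_apply (F : Fr D x) (k : {k // k ∈ D.keys}) : F.b k = x k := by
  rw [Fr.b, Basis.mk_apply]

lemma Fr.fd (F : Fr D x) : FiniteDimensional ℂ T := Module.Finite.of_basis F.b

/-- Coordinates. -/
noncomputable def Fr.co (F : Fr D x) (k : ℕ) : T →ₗ[ℂ] ℂ :=
  if h : k ∈ D.keys then F.b.coord ⟨k, h⟩ else 0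

lemma Fr.co_x (F : Fr D x) {k j : ℕ} (hk : k ∈ D.keys) (hj : j ∈ D.keys) :
    F.co k (x j) = if j = k then 1 else 0 := by
  rw [Fr.co, dif_pos hk, ← F.b_apply ⟨j, hj⟩, Basis.coord_apply, Basis.repr_self,
    Finsupp.single_apply]
  simp

lemma Fr.co_ev (F : Fr D x) {k : ℕ} (hk : k ∈ D.keys) {v : Vec} (hv : ∀ p ∈ v, p.1 ∈ D.keys) :
    F.co k (ev x v) = coef v k := by
  induction v with
  | nil => simp [ev_nil, coef]
  | cons p v ih =>
    rw [ev_cons, map_add, ih fun q hq => hv q (List.mem_cons_of_mem _ hq), map_smul,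
      F.co_x hk (hv p List.mem_cons_self), coef_cons]
    push_cast
    simp

lemma Fr.expand (F : Fr D x) (v : T) : v = ∑ k ∈ D.keys.toFinset, F.co k v • x k := by
  have h := (F.b.sum_repr v).symm
  conv_lhs => rw [h]
  rw [← Finset.sum_coe_sort D.keys.toFinset]
  refine Fintype.sum_equiv (Equiv.subtypeEquivRight fun k => by simp) _ _ fun k => ?_
  rw [F.b_apply]
  simp [Fr.co, k.2]

variable {d : List ℕ} {h : T}

lemma Fr.co_h (F : Fr D x)
    (hh : d.length = D.n ∧ ∀ k ∈ D.keys, ⁅h, x k⁆ = (dz d k : ℂ) • x k) (k : ℕ) (v : T) : F.co k ⁅h, v⁆ = (dz d k : ℂ) * F.co k v := by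
  by_cases hk : k ∈ D.keys
  swap
  · simp [Fr.co, hk]
  conv_lhs => rw [F.expand v]
  rw [lie_sum, map_sum, Finset.sum_eq_single k]
  · rw [lie_smul, hh.2 k hk, map_smul, map_smul, F.co_x hk hk]; simp [mul_comm]
  · intro j hj hjk
    rw [List.mem_toFinset] at hj
    rw [lie_smul, hh.2 j hj, map_smul, map_smul, F.co_x hk hj, if_neg hjk]; simp
  · intro hk'; simp [hk] at hk'

lemma Fr.co_zero (F : Fr D x)
    (hh : d.length = D.n ∧ ∀ k ∈ D.keys, ⁅h, x k⁆ = (dz d k : ℂ) • x k) {k : ℕ} {v : T} {j : ℤ} (hv : ⁅h, v⁆ = (j : ℂ) • v) (hk : dz d k ≠ j) :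
    F.co k v = 0 := by
  have h1 := F.co_h hh k v
  rw [hv, map_smul, smul_eq_mul] at h1
  have h2 : ((dz d k - j : ℤ) : ℂ) * F.co k v = 0 := by push_cast; linear_combination -h1
  exact (mul_eq_zero.1 h2).resolve_left (by exact_mod_cast sub_ne_zero.2 hk)

lemma Fr.gp (F : Fr D x)
    (hh : d.length = D.n ∧ ∀ k ∈ D.keys, ⁅h, x k⁆ = (dz d k : ℂ) • x k) (j : ℕ) : gradePiece ℂ h j = Submodule.span ℂ (x '' {k | k ∈ D.lev d j}) := by
  apply le_antisymm
  · intro v hv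
    rw [mem_gp] at hv
    rw [F.expand v]
    refine Submodule.sum_mem _ fun k hk => ?_
    by_cases hd : dz d k = j
    · exact Submodule.smul_mem _ _ (Submodule.subset_span ⟨k, mem_lev.2 ⟨List.mem_toFinset.1 hk, hd⟩, rfl⟩)
    · rw [F.co_zero hh hv hd, zero_smul]; exact Submodule.zero_mem _
  · rw [Submodule.span_le]
    rintro _ ⟨k, hk, rfl⟩
    have hk' := mem_lev.1 hk
    change x k ∈ gradePiece ℂ h j
    rw [mem_gp, hh.2 k hk'.1, hk'.2]

lemma Fr.rank_gp (F : Fr D x)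
    (hh : d.length = D.n ∧ ∀ k ∈ D.keys, ⁅h, x k⁆ = (dz d k : ℂ) • x k) (j : ℕ) : finrank ℂ (gradePiece ℂ h j) = (D.lev d j).length := by
  rw [F.gp hh]
  have hl : LinearIndependent ℂ (fun k : {k // k ∈ D.lev d j} => x k) :=
    F.li.comp (fun k : {k // k ∈ D.lev d j} => (⟨k.1, (mem_lev.1 k.2).1⟩ : {k // k ∈ D.keys}))
      (fun a b hab => Subtype.ext (by simpa using hab))
  have h1 := finrank_span_eq_card hl
  have h2 : Set.range (fun k : {k // k ∈ D.lev d j} => x k) = x '' {k | k ∈ D.lev d j} := by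
    ext v; simp
  rw [h2] at h1
  rw [h1, Fintype.card_of_subtype (D.lev d j).toFinset (by simp)]
  exact List.toFinset_card_of_nodup (F.nodup.filter _)

lemma Fr.bil (F : Fr D x)
    (hh : d.length = D.n ∧ ∀ k ∈ D.keys, ⁅h, x k⁆ = (dz d k : ℂ) • x k) {u v : Vec} {i j : ℕ} (hu : ∀ p ∈ u, p.1 ∈ D.lev d i) (hv : ∀ p ∈ v, p.1 ∈ D.lev d j)
    (hij : i + j ≠ 0) : ⁅ev x u, ev x v⁆ = ev x (D.bil u v) := by
  refine ev_bil D x u v fun p hp q hq => ?_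
  have h1 := mem_lev.1 (hu p hp)
  have h2 := mem_lev.1 (hv q hq)
  refine F.brk _ h1.1 _ h2.1 d hh.1 ?_
  rw [h1.2, h2.2]; exact_mod_cast hij

lemma Fr.ev_gp (F : Fr D x)
    (hh : d.length = D.n ∧ ∀ k ∈ D.keys, ⁅h, x k⁆ = (dz d k : ℂ) • x k) {u : Vec} {i : ℕ} (hu : ∀ p ∈ u, p.1 ∈ D.lev d i) : ⁅h, ev x u⁆ = (i : ℂ) • ev x u := by
  have : ev x u ∈ gradePiece ℂ h i := by
    rw [F.gp hh]
    exact ev_mem _ _ _ fun p hp => Submodule.subset_span ⟨p.1, hu p hp, rfl⟩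
  rw [mem_gp] at this
  simpa using this

lemma Fr.generic (F : Fr D x)
    (hh : d.length = D.n ∧ ∀ k ∈ D.keys, ⁅h, x k⁆ = (dz d k : ℂ) • x k) {e0 : Vec} {ord : List Vec} (hc : D.chkE d e0 ord = true) :
    ⁅h, ev x e0⁆ = (2 : ℂ) • ev x e0 ∧
    ∀ v, ⁅h, v⁆ = (2 : ℂ) • v → ∃ y : T, ⁅h, y⁆ = 0 ∧ ⁅y, ev x e0⁆ = v := by
  rw [RD.chkE, Bool.and_eq_true, inK_iff, List.all_eq_true] at hc
  refine ⟨by simpa using F.ev_gp hh hc.1, ?_⟩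
  let M : Submodule ℂ T :=
    { carrier := {v | ∃ y : T, ⁅h, y⁆ = 0 ∧ ⁅y, ev x e0⁆ = v}
      add_mem' := by
        rintro _ _ ⟨y, hy, rfl⟩ ⟨z, hz, rfl⟩
        exact ⟨y + z, by rw [lie_add, hy, hz, add_zero], by rw [add_lie]⟩
      zero_mem' := ⟨0, by simp, by simp⟩
      smul_mem' := by
        rintro c _ ⟨y, hy, rfl⟩
        exact ⟨c • y, by rw [lie_smul, hy, smul_zero], by rw [smul_lie]⟩ }
  have hM := ordc_mem D x (D.lev d 0) e0 M (fun y hy => by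
    rw [inK_iff] at hy
    refine ⟨ev x y, by simpa using F.ev_gp hh hy, F.bil hh hy hc.1 (by norm_num)⟩) (ord.map D.tr) []
    (by simp)
  intro v hv
  have hv' : v ∈ gradePiece ℂ h ((2 : ℕ) : ℤ) := by rw [mem_gp]; simpa using hv
  rw [F.gp hh] at hv'
  have : Submodule.span ℂ (x '' {k | k ∈ D.lev d 2}) ≤ M := by
    rw [Submodule.span_le]
    rintro _ ⟨k, hk, rfl⟩
    exact hM k (memb_iff.1 (hc.2 k hk))
  exact this hv'
lemma Fr.indc_le (F : Fr D x) (l : List Vec) (hl : ∀ v ∈ l, ∀ p ∈ v, p.1 ∈ D.keys) (hi : indc l = true) :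
    l.length ≤ finrank ℂ (Submodule.span ℂ {w | ∃ v ∈ l, w = ev x v}) := by
  have := F.fd
  induction l with
  | nil => simp
  | cons v r ih =>
    rw [indc, Bool.and_eq_true, List.any_eq_true] at hi
    obtain ⟨⟨p, hp, hpc⟩, hi⟩ := hi
    rw [Bool.and_eq_true, Bool.not_eq_true', zb_false, List.all_eq_true] at hpc
    have h1 := ih (fun v hv => hl v (List.mem_cons_of_mem _ hv)) hi
    have hpk := hl v List.mem_cons_self p hp
    have h2 : Submodule.span ℂ {w | ∃ v ∈ r, w = ev x v} ≤ LinearMap.ker (F.co p.1) := by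
      rw [Submodule.span_le]
      rintro _ ⟨w, hw, rfl⟩
      change F.co p.1 (ev x w) = 0
      rw [F.co_ev hpk (hl w (List.mem_cons_of_mem _ hw)), zb_iff.1 (hpc.2 w hw)]; simp
    have h3 : Submodule.span ℂ {w | ∃ v ∈ r, w = ev x v} <
        Submodule.span ℂ {w | ∃ v' ∈ v :: r, w = ev x v'} := by
      refine lt_of_le_of_ne (Submodule.span_mono ?_) fun heq => ?_
      · rintro _ ⟨w, hw, rfl⟩; exact ⟨w, List.mem_cons_of_mem _ hw, rfl⟩
      · have : ev x v ∈ LinearMap.ker (F.co p.1) := by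
          apply h2; rw [heq]; exact Submodule.subset_span ⟨v, List.mem_cons_self, rfl⟩
        rw [LinearMap.mem_ker, F.co_ev hpk (hl v List.mem_cons_self)] at this
        exact hpc.1 (by exact_mod_cast this)
    have := Submodule.finrank_lt_finrank_of_lt h3
    rw [List.length_cons]; omega

end S
end PaperStmt.Chk

namespace PaperStmt.Chk
open Module Gen
set_option linter.unusedSectionVars false
section S
variable {T : Type*} [LieRing T] [LieAlgebra ℂ T]
variable {D : RD} {x : ℕ → T} {d : List ℕ} {h e f : T}

lemma Fr.kap_sum (F : Fr D x) {u v : T} (a b : ℕ → ℤ) (hu : ∀ k ∈ D.keys, ⁅u, x k⁆ = (a k : ℂ) • x k)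
    (hv : ∀ k ∈ D.keys, ⁅v, x k⁆ = (b k : ℂ) • x k) :
    kap u v = ((D.keys.map fun k => a k * b k).sum : ℤ) := by
  have := F.fd
  rw [kap, LinearMap.trace_eq_matrix_trace ℂ F.b, Matrix.trace]
  have h1 : ∀ k : {k // k ∈ D.keys}, Matrix.diag (LinearMap.toMatrix F.b F.b
      (LieAlgebra.ad ℂ T u ∘ₗ LieAlgebra.ad ℂ T v)) k = ((a k * b k : ℤ) : ℂ) := by
    intro k
    rw [Matrix.diag_apply, LinearMap.toMatrix_apply, LinearMap.comp_apply, LieAlgebra.ad_apply,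
      LieAlgebra.ad_apply, F.b_apply, hv k k.2, lie_smul, hu k k.2, ← F.b_apply]
    simp [mul_comm]
  rw [Finset.sum_congr rfl fun k _ => h1 k]
  rw [← List.sum_toFinset _ F.nodup, Int.cast_sum, ← Finset.sum_coe_sort D.keys.toFinset]
  refine Fintype.sum_equiv (Equiv.subtypeEquivRight fun k => by simp) _ _ fun k => ?_
  simp

lemma Fr.lie_e0 (F : Fr D x) (hh : d.length = D.n ∧ ∀ k ∈ D.keys, ⁅h, x k⁆ = (dz d k : ℂ) • x k) {e0 v : Vec} {j : ℕ}
    (he : ∀ p ∈ e0, p.1 ∈ D.lev d 2) (hv : ∀ p ∈ v, p.1 ∈ D.lev d j)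
    (hz : isZero (D.bil e0 v) = true) : ev x v ∈ gradePieceCent ℂ (ev x e0) h j := by
  rw [mem_gpc]
  refine ⟨by simpa using F.ev_gp hh hv, ?_⟩
  rw [← lie_skew, F.bil hh he hv (by omega), ev_zero x _ hz, neg_zero]

/-- Spanning sets of the graded pieces of the centralizer. -/
lemma Fr.span_gpc (F : Fr D x) (hh : d.length = D.n ∧ ∀ k ∈ D.keys, ⁅h, x k⁆ = (dz d k : ℂ) • x k)
    (t : Tr e h f) {j : ℕ} {l : List Vec}
    (hl : ∀ v ∈ l, ∀ p ∈ v, p.1 ∈ D.lev d j)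
    (hc : ∀ v ∈ l, ev x v ∈ gradePieceCent ℂ e h j)
    (hi : indc l = true) (hn : l.length + (D.lev d (j + 2)).length = (D.lev d j).length) :
    gradePieceCent ℂ e h j = Submodule.span ℂ {w | ∃ v ∈ l, w = ev x v} := by
  have := F.fd
  symm
  apply Submodule.eq_of_le_of_finrank_le
  · rw [Submodule.span_le]
    rintro _ ⟨v, hv, rfl⟩; exact hc v hv
  · have h1 := F.indc_le l (fun v hv p hp => (mem_lev.1 (hl v hv p hp)).1) hi
    have h2 := finrank_gpc t (k := j) (by omega)
    have h3 := F.rank_gp hh j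
    have h4 := F.rank_gp hh (j + 2)
    rw [show ((j + 2 : ℕ) : ℤ) = (j : ℤ) + 2 by push_cast; rfl] at h4
    omega

lemma lamv_eq (F : Fr D x) (l w : Vec) (hl : ∀ p ∈ l, p.1 ∈ D.keys) (hw : ∀ p ∈ w, p.1 ∈ D.keys) :
    ((l.map fun p => (p.2 : ℂ) • F.co p.1).sum : T →ₗ[ℂ] ℂ) (ev x w) = lamv l w := by
  have h1 : ∀ k ∈ D.keys, ((l.map fun p => (p.2 : ℂ) • F.co p.1).sum : T →ₗ[ℂ] ℂ) (x k) = coef l k := by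
    intro k hk
    induction l with
    | nil => simp [coef]
    | cons p l ih =>
      rw [List.map_cons, List.sum_cons, LinearMap.add_apply,
        ih fun q hq => hl q (List.mem_cons_of_mem _ hq), LinearMap.smul_apply,
        F.co_x (hl p List.mem_cons_self) hk, coef_cons]
      push_cast
      simp [eq_comm]
  induction w with
  | nil => simp [ev_nil, lamv]
  | cons q w ih =>
    rw [ev_cons, map_add, ih fun p hp => hw p (List.mem_cons_of_mem _ hp), map_smul,
      h1 _ (hw q List.mem_cons_self), lamv]
    change _ = ((q.2 * coef l q.1 + lamv l w : ℤ) : ℂ)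
    push_cast; simp

lemma lam_zero (F : Fr D x) (hh : d.length = D.n ∧ ∀ k ∈ D.keys, ⁅h, x k⁆ = (dz d k : ℂ) • x k)
    (l : Vec) (hl : ∀ p ∈ l, p.1 ∈ D.lev d 2) (j : ℤ) (hj : j ≠ 2) (v : T) (hv : ⁅h, v⁆ = (j : ℂ) • v) :
    ((l.map fun p => (p.2 : ℂ) • F.co p.1).sum : T →ₗ[ℂ] ℂ) v = 0 := by
  induction l with
  | nil => simp
  | cons p l ih =>
    have h2 := (mem_lev.1 (hl p List.mem_cons_self)).2
    rw [List.map_cons, List.sum_cons, LinearMap.add_apply,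
      ih fun q hq => hl q (List.mem_cons_of_mem _ hq), LinearMap.smul_apply,
      F.co_zero hh hv (by rw [h2]; push_cast; exact hj.symm), smul_zero, add_zero]

lemma lam_span (lam : T →ₗ[ℂ] ℂ) {A B : Set T} (hAB : ∀ u ∈ A, ∀ v ∈ B, lam ⁅u, v⁆ = 0)
    {a b : T} (ha : a ∈ Submodule.span ℂ A) (hb : b ∈ Submodule.span ℂ B) : lam ⁅a, b⁆ = 0 := by
  have h1 : ∀ v ∈ B, lam ⁅a, v⁆ = 0 := by
    intro v hv
    induction ha using Submodule.span_induction with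
    | mem u hu => exact hAB u hu v hv
    | zero => simp
    | add u w _ _ i1 i2 => rw [add_lie, map_add, i1, i2, add_zero]
    | smul c u _ i1 => rw [smul_lie, map_smul, i1, smul_zero]
  induction hb using Submodule.span_induction with
  | mem u hu => exact h1 u hu
  | zero => simp
  | add u w _ _ i1 i2 => rw [lie_add, map_add, i1, i2, add_zero]
  | smul c u _ i1 => rw [lie_smul, map_smul, i1, smul_zero]

lemma Fr.comb (F : Fr D x) (hh : d.length = D.n ∧ ∀ k ∈ D.keys, ⁅h, x k⁆ = (dz d k : ℂ) • x k) {K B : List Vec} {j : ℕ}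
    (hK : ∀ v ∈ K, ∀ p ∈ v, p.1 ∈ D.lev d 1) (hB : ∀ v ∈ B, ∀ p ∈ v, p.1 ∈ D.lev d j)
    (M : Submodule ℂ T) (hM : ∀ u ∈ K, ∀ v ∈ B, ⁅ev x u, ev x v⁆ ∈ M) (q : List (ℕ × ℕ × ℤ)) :
    ev x (D.comb K B q) ∈ M := by
  rw [RD.comb, ev_flatMap]
  refine list_sum_mem fun w hw => ?_
  rw [List.mem_map] at hw
  obtain ⟨r, _, rfl⟩ := hw
  rw [ev_scal]
  refine M.smul_mem _ ?_
  by_cases h1 : r.1 < K.length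
  swap
  · rw [List.getD_eq_default _ _ (not_lt.1 h1)]; exact M.zero_mem
  by_cases h2 : r.2.1 < B.length
  swap
  · rw [List.getD_eq_default _ _ (not_lt.1 h2)]
    have : ∀ u : Vec, D.bil u [] = [] := by
      intro u; induction u with
      | nil => rfl
      | cons p u ih => exact ih
    rw [this]; exact M.zero_mem
  rw [List.getD_eq_getElem _ _ h1, List.getD_eq_getElem _ _ h2]
  rw [← F.bil hh (hK _ (List.getElem_mem h1)) (hB _ (List.getElem_mem h2)) (by omega)]
  exact hM _ (List.getElem_mem h1) _ (List.getElem_mem h2)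

lemma Fr.chkC_sound (F : Fr D x) (hh : d.length = D.n ∧ ∀ k ∈ D.keys, ⁅h, x k⁆ = (dz d k : ℂ) • x k)
    (t : Tr e h f) {K : List Vec}
    (hK : ∀ v ∈ K, ∀ p ∈ v, p.1 ∈ D.lev d 1) (hKc : ∀ v ∈ K, ev x v ∈ gradePieceCent ℂ e h 1)
    (cmb : List (List (List (ℕ × ℕ × ℤ)))) (j : ℕ) (B : List Vec)
    (hB : ∀ v ∈ B, ∀ p ∈ v, p.1 ∈ D.lev d j) (hBc : ∀ v ∈ B, ev x v ∈ gradePieceCent ℂ e h j)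
    (hBs : ∀ v ∈ B, ev x v ∈ LieSubalgebra.lieSpan ℂ T (gradePieceCent ℂ e h 1 : Set T))
    (hc : D.chkC d K (j + 1) B cmb = true) (i : ℕ) (hi : j + 1 ≤ i) :
    gradePieceCent ℂ e h i ≤
      (LieSubalgebra.lieSpan ℂ T (gradePieceCent ℂ e h 1 : Set T)).toSubmodule := by
  have := F.fd
  have hKs : ∀ v ∈ K, ev x v ∈ LieSubalgebra.lieSpan ℂ T (gradePieceCent ℂ e h 1 : Set T) :=
    fun v hv => LieSubalgebra.subset_lieSpan (hKc v hv)
  induction cmb generalizing j B with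
  | nil =>
    rw [RD.chkC, List.all_eq_true] at hc
    have h0 : D.lev d i = [] := by
      rw [List.eq_nil_iff_forall_not_mem]
      intro k hk
      obtain ⟨hk, hd⟩ := mem_lev.1 hk
      have := hc k hk
      rw [Bool.or_eq_true] at this
      by_cases h8 : k < 8
      · rw [dz_lt d h8] at hd; omega
      rcases this with h1 | h1
      · rw [Nat.blt_eq] at h1; exact h8 h1
      · rw [Nat.blt_eq] at h1
        rw [dz_ge d h8] at hd
        change _ < j + 1 + 32 * d.sum at h1
        omega
    intro v hv
    rw [mem_gpc] at hv
    have h1 := F.gp hh i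
    rw [h0] at h1
    have h2 : v ∈ gradePiece ℂ h i := by rw [mem_gp]; exact hv.1
    rw [h1] at h2
    simp at h2
    rw [h2]; exact Submodule.zero_mem _
  | cons c cs ih =>
    rw [RD.chkC] at hc
    simp only [Bool.and_eq_true, List.all_eq_true, inK_iff, Nat.beq_eq] at hc
    obtain ⟨⟨⟨h1, h2⟩, h3⟩, h4⟩ := hc
    have hm : ∀ v ∈ c.map (D.comb K B), ev x v ∈ gradePieceCent ℂ e h (j + 1 : ℕ) := by
      intro v hv
      obtain ⟨q, _, rfl⟩ := List.mem_map.1 hv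
      refine F.comb hh hK hB _ (fun u hu v hv => ?_) q
      have ha := hKc u hu
      have hb := hBc v hv
      refine ⟨?_, LieSubalgebra.lie_mem _ ha.2 hb.2⟩
      have := lie_gp ha.1 hb.1
      push_cast
      rw [add_comm]; exact this
    have hs : ∀ v ∈ c.map (D.comb K B),
        ev x v ∈ LieSubalgebra.lieSpan ℂ T (gradePieceCent ℂ e h 1 : Set T) := by
      intro v hv
      obtain ⟨q, _, rfl⟩ := List.mem_map.1 hv
      exact F.comb hh hK hB (LieSubalgebra.lieSpan ℂ T (gradePieceCent ℂ e h 1 : Set T)).toSubmodule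
        (fun u hu v hv => LieSubalgebra.lie_mem _ (hKs u hu) (hBs v hv)) q
    rcases Nat.eq_or_lt_of_le hi with rfl | hi
    · rw [F.span_gpc hh t h1 hm h2 h3, Submodule.span_le]
      rintro _ ⟨v, hv, rfl⟩
      exact hs v hv
    · exact ih (j + 1) _ h1 hm hs h4 hi

/-- Soundness of the checker. -/
theorem sound (F : Fr D x) (c : Cert) (hc : D.chk d c = true) (hdn : d.length = D.n)
    (t : Tr e h f) (hh0 : ∀ k ∈ D.keys, ⁅h, x k⁆ = (dz d k : ℂ) • x k) : Good e h := by
  have := F.fd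
  have hh : d.length = D.n ∧ ∀ k ∈ D.keys, ⁅h, x k⁆ = (dz d k : ℂ) • x k := ⟨hdn, hh0⟩
  have key : ∀ (e0 : Vec) (ord : List Vec), D.chkE d e0 ord = true →
      (∀ f', Tr (ev x e0) h f' → Good (ev x e0) h) → Good e h := by
    intro e0 ord h1 h2
    obtain ⟨h3, h4⟩ := F.generic hh h1
    obtain ⟨g, hg, hge⟩ := Conj.conj_generic h e (ev x e0) t.he h3 (fun v hv => by
      obtain ⟨y, hy, hy'⟩ := t.s2.surj (k := 0) (x := v) (by norm_num) (by simpa using hv)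
      refine ⟨-y, ?_, ?_⟩
      · have : ⁅h, y⁆ = ((0 : ℤ) : ℂ) • y := hy
        rw [lie_neg, this]; simp
      · rw [neg_lie, lie_skew]; exact hy') h4
    refine good_map g t.he ?_
    rw [hg, hge]
    refine h2 (g f) ⟨h3, ?_, ?_⟩
    · conv_lhs => rw [← hg, ← LieEquiv.map_lie, t.hf]
      simp
    · rw [← hge, ← LieEquiv.map_lie, t.ef, hg]
  cases c with
  | A S ord tt =>
    simp only [RD.chk, Bool.and_eq_true, Nat.beq_eq, List.all_eq_true, zb_iff, Bool.not_eq_true',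
      zb_false] at hc
    obtain ⟨⟨⟨h1, h2⟩, h3⟩, h4⟩ := hc
    refine key _ _ h1 fun f' t' => ?_
    exfalso
    obtain ⟨τ, hτ⟩ := F.tor tt h2
    have h5 : ⁅τ, ev x (D.mkE S)⁆ = 0 := by
      rw [RD.chkE, Bool.and_eq_true, inK_iff] at h1
      have h1 := h1.1
      revert h1 h3
      generalize D.mkE S = v
      intro h3 h1
      induction v with
      | nil => simp [ev_nil]
      | cons p v ih =>
        rw [ev_cons, lie_add, ih (fun q hq => h3 q (List.mem_cons_of_mem _ hq))
          (fun q hq => h1 q (List.mem_cons_of_mem _ hq)), lie_smul,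
          hτ _ (mem_lev.1 (h1 p List.mem_cons_self)).1, h3 p List.mem_cons_self]
        simp
    have h6 := kap_tor t' h5
    rw [F.kap_sum (dg tt) (dz d) hτ hh0, ← F.gram tt d h2 hdn] at h6
    exact h4 (by exact_mod_cast h6)
  | B S ord K1 C0 lam =>
    simp only [RD.chk, Bool.and_eq_true, Nat.beq_eq, List.all_eq_true, zb_iff, Bool.not_eq_true',
      zb_false, RD.chkZ, inK_iff] at hc
    obtain ⟨⟨⟨⟨⟨⟨⟨⟨⟨⟨h1, h2⟩, h3⟩, h4⟩, h5⟩, h6⟩, h7⟩, h8⟩, h9⟩, h10⟩, h11⟩ := hc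
    refine key _ _ h1 fun f' t' => ?_
    rw [RD.chkE, Bool.and_eq_true, inK_iff] at h1
    have h1 := h1.1
    have hk : ∀ {j : ℕ} {v : Vec}, (∀ p ∈ v, p.1 ∈ D.lev d j) → ∀ p ∈ v, p.1 ∈ D.keys :=
      fun hv p hp => (mem_lev.1 (hv p hp)).1
    have s1 := F.span_gpc hh t' (j := 1) (fun v hv => (h2 v hv).1)
      (fun v hv => F.lie_e0 hh h1 (h2 v hv).1 (h2 v hv).2) h4 h7
    have s0 := F.span_gpc hh t' (j := 0) (fun v hv => (h3 v hv).1)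
      (fun v hv => F.lie_e0 hh h1 (h3 v hv).1 (h3 v hv).2) h5 h8
    refine good_of_not t'.he (not_reach t' ((((D.tr lam).map fun p => (p.2 : ℂ) • F.co p.1).sum :
      T →ₗ[ℂ] ℂ)) (fun k hk v hv => lam_zero F hh _ h6 k hk v hv) ?_ ?_ ?_)
    · intro a b ha ha' hb hb'
      have ma : a ∈ gradePieceCent ℂ (ev x (D.mkE S)) h ((1 : ℕ) : ℤ) := by
        rw [mem_gpc]; exact ⟨by simpa using ha, ha'⟩
      have mb : b ∈ gradePieceCent ℂ (ev x (D.mkE S)) h ((1 : ℕ) : ℤ) := by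
        rw [mem_gpc]; exact ⟨by simpa using hb, hb'⟩
      rw [s1] at ma mb
      refine lam_span _ ?_ ma mb
      rintro _ ⟨u, hu, rfl⟩ _ ⟨v, hv, rfl⟩
      have h12 := h9 u hu v hv
      rw [F.bil hh (h2 u hu).1 (h2 v hv).1 (by norm_num), lamv_eq F _ _ (hk h6) (hk h12.1), h12.2]
      simp
    · intro a b ha ha' hb hb'
      have ma : a ∈ gradePieceCent ℂ (ev x (D.mkE S)) h ((0 : ℕ) : ℤ) := by
        rw [mem_gpc]; exact ⟨by simpa using ha, ha'⟩
      have mb : b ∈ gradePiece ℂ h ((2 : ℕ) : ℤ) := by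
        rw [mem_gp]; simpa using hb
      rw [s0] at ma
      rw [F.gp hh] at mb
      refine lam_span _ ?_ ma mb
      rintro _ ⟨u, hu, rfl⟩ _ ⟨k, hkk, rfl⟩
      have h12 := h10 u hu k hkk
      have h13 : x k = ev x [(k, 1)] := by simp [ev]
      rw [h13, F.bil hh (i := 0) (j := 2) (h3 u hu).1 (by simpa using hkk) (by norm_num),
        lamv_eq F _ _ (hk h6) (hk h12.1), h12.2]
      simp
    · rw [lamv_eq F _ _ (hk h6) (hk h1)]
      exact_mod_cast h11
  | C S ord K1 cmb =>
    simp only [RD.chk, Bool.and_eq_true, Nat.beq_eq, List.all_eq_true, RD.chkZ, inK_iff] at hc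
    obtain ⟨⟨h1, h2⟩, h3⟩ := hc
    refine key _ _ h1 fun f' t' => ?_
    rw [RD.chkE, Bool.and_eq_true, inK_iff] at h1
    have h1 := h1.1
    have hKc : ∀ v ∈ K1.map D.tr, ev x v ∈ gradePieceCent ℂ (ev x (D.mkE S)) h 1 := fun v hv => by
      have := F.lie_e0 hh h1 (h2 v hv).1 (h2 v hv).2
      exact_mod_cast this
    have h4 := F.chkC_sound hh t' (fun v hv => (h2 v hv).1) hKc cmb 1 _ (fun v hv => (h2 v hv).1)
      (by exact_mod_cast hKc) (fun v hv => LieSubalgebra.subset_lieSpan (hKc v hv)) h3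
    refine good_of_span t'.he ?_
    rw [gradeGeOneCent]
    refine iSup₂_le fun k hk => ?_
    have hk : 1 ≤ k := hk
    rcases eq_or_lt_of_le hk with rfl | hk
    · exact fun v hv => LieSubalgebra.subset_lieSpan hv
    · have := h4 k.toNat (by omega)
      rwa [Int.toNat_of_nonneg (by omega)] at this

end S
end PaperStmt.Chk

namespace PaperStmt.Chk
open Module Gen
set_option linter.unusedSectionVars false
section X
variable {T : Type*} [LieRing T] [LieAlgebra ℂ T]

/-- Exponentials of nilpotent elements. -/
lemma exp_ad (u : T) (hn : IsNilpotent (LieAlgebra.ad ℂ T u : End ℂ T)) :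
    ∃ g : T ≃ₗ⁅ℂ⁆ T, ∀ v, ⁅u, ⁅u, ⁅u, v⁆⁆⁆ = 0 → g v = v + ⁅u, v⁆ + (1 / 2 : ℂ) • ⁅u, ⁅u, v⁆⁆ := by
  letI m : Module ℚ T := Module.compHom T (algebraMap ℚ ℂ)
  letI : LieAlgebra ℚ T := { m with lie_smul := fun t x y => lie_smul (algebraMap ℚ ℂ t) x y }
  have hsm : ∀ (q : ℚ) (v : T), q • v = (q : ℂ) • v := fun q v => rfl
  let D : LieDerivation ℂ T T := LieDerivation.ad ℂ T u
  have hD : D.toLinearMap = (LieAlgebra.ad ℂ T u : End ℂ T) := by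
    ext v; simp [D]
  have hn' : IsNilpotent D.toLinearMap := by rw [hD]; exact hn
  refine ⟨LieDerivation.exp D hn', fun v hv => ?_⟩
  rw [LieDerivation.exp_map_apply, hD]
  obtain ⟨k, hk⟩ := hn
  have hk3 : (LieAlgebra.ad ℂ T u : End ℂ T) ^ (3 + k) = 0 := by rw [pow_add, hk, mul_zero]
  rw [IsNilpotent.exp_eq_sum hk3, LinearMap.sum_apply, Finset.sum_range_add]
  have h0 : ∀ i, (LieAlgebra.ad ℂ T u : End ℂ T) ^ (3 + i) = (LieAlgebra.ad ℂ T u : End ℂ T) ^ i *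
      (LieAlgebra.ad ℂ T u : End ℂ T) ^ 3 := by
    intro i; rw [← pow_add, add_comm]
  have h3 : ((LieAlgebra.ad ℂ T u : End ℂ T) ^ 3) v = 0 := by
    simp only [pow_succ, pow_zero, one_mul, Module.End.mul_apply, LieAlgebra.ad_apply]
    exact hv
  rw [Finset.sum_eq_zero (s := Finset.range k), add_zero]
  · simp only [Finset.sum_range_succ, Finset.sum_range_zero, LinearMap.smul_apply, hsm, pow_succ,
      pow_zero, one_mul, Module.End.mul_apply, LieAlgebra.ad_apply, zero_add, Module.End.one_apply]
    norm_num [Nat.factorial]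
  · intro i _
    rw [LinearMap.smul_apply, h0, Module.End.mul_apply, h3, map_zero, smul_zero]

lemma reflect {E F H : T} (nE : IsNilpotent (LieAlgebra.ad ℂ T E : End ℂ T))
    (nF : IsNilpotent (LieAlgebra.ad ℂ T F : End ℂ T)) (hE : ⁅H, E⁆ = (2 : ℂ) • E)
    (hF : ⁅H, F⁆ = -((2 : ℂ) • F)) (hEF : ⁅E, F⁆ = H) :
    ∃ g : T ≃ₗ⁅ℂ⁆ T, ∀ (z : T) (a : ℂ), ⁅z, E⁆ = a • E → ⁅z, F⁆ = -(a • F) → g z = z - a • H := by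
  have nF' : IsNilpotent (LieAlgebra.ad ℂ T (-F) : End ℂ T) := by
    rw [map_neg]; exact nF.neg
  obtain ⟨g1, h1⟩ := exp_ad E nE
  obtain ⟨g2, h2⟩ := exp_ad (-F) nF'
  refine ⟨(g1.trans g2).trans g1, fun z a hz hz' => ?_⟩
  have ez : ⁅E, z⁆ = -(a • E) := by rw [← lie_skew, hz]
  have fz : ⁅F, z⁆ = a • F := by rw [← lie_skew, hz', neg_neg]
  have eH : ⁅E, H⁆ = -((2 : ℂ) • E) := by rw [← lie_skew, hE]
  have fH : ⁅F, H⁆ = (2 : ℂ) • F := by rw [← lie_skew, hF, neg_neg]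
  have fE : ⁅F, E⁆ = -H := by rw [← lie_skew, hEF]
  have a1 : g1 z = z - a • E := by
    rw [h1 z (by simp [ez])]
    simp [ez, sub_eq_add_neg]
  have a2 : g1 E = E := by rw [h1 E (by simp)]; simp
  have a3 : g1 H = H - (2 : ℂ) • E := by
    rw [h1 H (by simp [eH])]
    simp [eH, sub_eq_add_neg]
  have b1 : g2 z = z - a • F := by
    rw [h2 z (by simp [fz])]
    simp [fz, sub_eq_add_neg]
  have b2 : g2 E = E + H - F := by
    rw [h2 E (by simp [fE, fH])]
    simp only [neg_lie, fE, fH, lie_neg, neg_neg]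
    module
  change g1 (g2 (g1 z)) = _
  rw [a1, map_sub, map_smul, b1, b2]
  have : z - a • F - a • (E + H - F) = z - a • E - a • H := by module
  rw [this, map_sub, map_sub, map_smul, map_smul, a1, a2, a3]
  module
end X
end PaperStmt.Chk

namespace PaperStmt.Chk
open Module Gen Serre
set_option linter.unusedSectionVars false

/-- Coordinates of the root encoded by a key. -/
def vec (k i : ℕ) : ℤ := if k < 8 then 0 else ((k / 64 ^ i % 64 : ℕ) : ℤ) - 32

lemma dgo_sum {n : ℕ} (t : Fin n → ℤ) (k : ℕ) :
    dgo (List.ofFn t) k = ∑ i, t i * (((k / 64 ^ (i : ℕ) % 64 : ℕ) : ℤ) - 32) := by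
  induction n generalizing k with
  | zero => simp [dgo]
  | succ n ih =>
    rw [List.ofFn_succ, dgo_cons, ih, Fin.sum_univ_succ]
    congr 1
    · simp
    · refine Finset.sum_congr rfl fun i _ => ?_
      rw [Nat.div_div_eq_div_mul, Fin.val_succ, pow_succ']

lemma dg_sum {n : ℕ} (t : Fin n → ℤ) (k : ℕ) : dg (List.ofFn t) k = ∑ i : Fin n, t i * vec k i := by
  rw [dg]
  by_cases h : k < 8
  · have : Nat.blt k 8 = true := by simpa using h
    rw [this]; simp [vec, h]
  · have : Nat.blt k 8 = false := by rw [← Bool.not_eq_true]; simpa using h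
    rw [this, cond_false, dgo_sum]; simp [vec, h]

lemma dz_sum {n : ℕ} (t : Fin n → ℕ) (k : ℕ) :
    dz (List.ofFn t) k = ∑ i : Fin n, (t i : ℤ) * vec k i := by
  rw [dz, List.map_ofFn, ← dg_sum]; rfl

variable {T : Type*} [LieRing T] [LieAlgebra ℂ T] {n : ℕ}

/-- A root model of the Lie algebra `T`. -/
structure Rm (A : Fin n → Fin n → ℤ) (D : RD) (x : ℕ → T) (E F : Fin n → T) : Prop where
  fr : Fr D x
  hn : D.n = n
  n8 : n ≤ 8
  rk8 : ∀ k ∈ D.rk, 8 ≤ k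
  sgn : ∀ k ∈ D.rk, ((∀ i : Fin n, 0 ≤ vec k i) ∨ (∀ i : Fin n, vec k i ≤ 0)) ∧
    ∃ i : Fin n, vec k i ≠ 0
  car : ∀ i : Fin n, ∀ k ∈ D.keys, ⁅x i, x k⁆ = ((∑ j : Fin n, A i j * vec k j : ℤ) : ℂ) • x k
  chev : Chev A E F (fun i => x i)
  hE : ∀ i : Fin n, ∃ k ∈ D.rk, E i = x k ∧ ∀ j : Fin n, vec k j = if j = i then 1 else 0

variable {A : Fin n → Fin n → ℤ} {D : RD} {x : ℕ → T} {E F : Fin n → T}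

lemma Rm.lt (M : Rm A D x E F) (i : Fin n) : (i : ℕ) ∈ D.keys := by
  rw [RD.keys, List.mem_append, List.mem_range, M.hn]; exact Or.inl i.2

lemma Rm.vec0 (M : Rm A D x E F) (i : Fin n) (j : ℕ) : vec i j = 0 := by
  have := M.n8
  have := i.2
  rw [vec, if_pos (by lia)]

def Rm.wt (_M : Rm A D x E F) (z : T) (a : Fin n → ℤ) :
    Prop := ∀ k ∈ D.keys, ⁅z, x k⁆ = ((∑ j : Fin n, a j * vec k j : ℤ) : ℂ) • x k

lemma Rm.conj (M : Rm A D x E F) (h : T) (hd : ⨆ k : ℤ, End.eigenspace (LieAlgebra.ad ℂ T h : End ℂ T) (k : ℂ) = ⊤) :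
    ∃ g : T ≃ₗ⁅ℂ⁆ T, g h ∈ Submodule.span ℂ (Set.range fun i : Fin n => x i) := by
  have := M.fr.fd
  obtain ⟨z0, hz⟩ := M.fr.tor (List.ofFn fun _ : Fin n => 1) (by simp [M.hn])
  have hz' : ∀ k ∈ D.keys, ⁅z0, x k⁆ = (dz (List.ofFn fun _ : Fin n => 1) k : ℂ) • x k := by
    intro k hk; rw [hz k hk, dz_sum, dg_sum]; simp
  have hht : ∀ k ∈ D.rk, dz (List.ofFn fun _ : Fin n => 1) k ≠ 0 := by
    intro k hk h0
    rw [dz_sum] at h0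
    simp only [Nat.cast_one, one_mul] at h0
    obtain ⟨h1 | h1, i, hi⟩ := M.sgn k hk
    · exact hi ((Finset.sum_eq_zero_iff_of_nonneg fun i _ => h1 i).1 h0 i (Finset.mem_univ _))
    · exact hi ((Finset.sum_eq_zero_iff_of_nonpos fun i _ => h1 i).1 h0 i (Finset.mem_univ _))
  have hsp : ∀ v, (∀ k ∈ D.rk, M.fr.co k v = 0) →
      v ∈ Submodule.span ℂ (Set.range fun i : Fin n => x i) := by
    intro v hv
    rw [M.fr.expand v]
    refine Submodule.sum_mem _ fun k hk => ?_
    rw [List.mem_toFinset, RD.keys, List.mem_append, List.mem_range, M.hn] at hk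
    rcases hk with hk | hk
    · exact Submodule.smul_mem _ _ (Submodule.subset_span ⟨⟨k, hk⟩, rfl⟩)
    · rw [hv k hk, zero_smul]; exact Submodule.zero_mem _
  refine Conj.conj_into _ ?_ z0 ?_ ?_ h ?_
  · intro a ha b hb
    induction ha using Submodule.span_induction with
    | mem a ha =>
      obtain ⟨i, rfl⟩ := ha
      induction hb using Submodule.span_induction with
      | mem b hb =>
        obtain ⟨j, rfl⟩ := hb
        exact M.chev.HH i j
      | zero => exact lie_zero _
      | add a b _ _ h1 h2 => rw [lie_add, h1, h2, add_zero]
      | smul a b _ h1 => rw [lie_smul, h1, smul_zero]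
    | zero => exact zero_lie _
    | add a b _ _ h1 h2 => rw [add_lie, h1, h2, add_zero]
    | smul a b _ h1 => rw [smul_lie, h1, smul_zero]
  · refine hsp _ fun k hk => M.fr.co_zero ⟨by simp [M.hn], hz'⟩ (j := 0) (by simp) (hht k hk)
  · ext v
    change v ∈ LieSubalgebra.engel ℂ z0 ↔ _
    constructor
    · intro hv
      obtain ⟨N, hN⟩ := (LieSubalgebra.mem_engel_iff _ _ _).1 hv
      refine hsp _ fun k hk => ?_
      have h1 : ∀ N, M.fr.co k ((LieAlgebra.ad ℂ T z0 ^ N) v) =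
          (dz (List.ofFn fun _ : Fin n => 1) k : ℂ) ^ N * M.fr.co k v := by
        intro N
        induction N with
        | zero => simp
        | succ N ih =>
          rw [pow_succ', Module.End.mul_apply, LieAlgebra.ad_apply, M.fr.co_h ⟨by simp [M.hn], hz'⟩, ih, pow_succ']
          ring
      have h2 := h1 N
      rw [hN, map_zero] at h2
      exact (mul_eq_zero.1 h2.symm).resolve_left (pow_ne_zero _ (by exact_mod_cast hht k hk))
    · intro hv
      have : Submodule.span ℂ (Set.range fun i : Fin n => x i) ≤ (LieSubalgebra.engel ℂ z0).toSubmodule := by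
        rw [Submodule.span_le]
        rintro _ ⟨i, rfl⟩
        refine (LieSubalgebra.mem_engel_iff _ _ _).2 ⟨1, ?_⟩
        rw [pow_one, LieAlgebra.ad_apply, hz' _ (M.lt i), dz_sum]
        simp [M.vec0]
      exact this hv
  · intro v
    have hv : v ∈ ⨆ k : ℤ, End.eigenspace (LieAlgebra.ad ℂ T h : End ℂ T) (k : ℂ) := by rw [hd]; trivial
    induction hv using Submodule.iSup_induction' with
    | mem k v hv =>
      rw [End.mem_eigenspace_iff, LieAlgebra.ad_apply] at hv
      by_cases hk : k = 0
      · exact ⟨0, v, by simpa [hk] using hv, by simp⟩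
      · refine ⟨-((k : ℂ)⁻¹ • v), 0, by simp, ?_⟩
        rw [add_zero, neg_lie, lie_skew, lie_smul, hv, smul_smul, inv_mul_cancel₀ (by exact_mod_cast hk),
          one_smul]
    | zero => exact ⟨0, 0, by simp, by simp⟩
    | add v w _ _ h1 h2 =>
      obtain ⟨y, c, h3, rfl⟩ := h1
      obtain ⟨y', c', h3', rfl⟩ := h2
      exact ⟨y + y', c + c', by rw [lie_add, h3, h3', add_zero], by rw [add_lie]; abel⟩
end PaperStmt.Chk

namespace PaperStmt.Chk
open Module Gen Serre
set_option linter.unusedSectionVars false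
variable {T : Type*} [LieRing T] [LieAlgebra ℂ T] {n : ℕ}
variable {A : Fin n → Fin n → ℤ} {D : RD} {x : ℕ → T} {E F : Fin n → T}

lemma Rm.vecrk (M : Rm A D x E F) {k : ℕ} (hk : k ∈ D.keys) :
    (∀ i : Fin n, 0 ≤ vec k i) ∨ (∀ i : Fin n, vec k i ≤ 0) := by
  rw [RD.keys, List.mem_append, List.mem_range, M.hn] at hk
  rcases hk with hk | hk
  · exact Or.inl fun i => (M.vec0 ⟨k, hk⟩ i).ge
  · exact (M.sgn k hk).1

lemma Rm.dual (M : Rm A D x E F) {a : Fin n → ℕ} {e h f : T} (t : Tr e h f)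
    (hs : h ∈ Submodule.span ℂ (Set.range fun i : Fin n => x i))
    (hw : ∀ k ∈ D.keys, ⁅h, x k⁆ = (dz (List.ofFn a) k : ℂ) • x k) (i : Fin n) (hi : 2 ≤ a i) :
    Good e h := by
  have := M.fr.fd
  obtain ⟨τ, hτ⟩ := M.fr.tor (List.ofFn fun j : Fin n => if j = i then 1 else 0) (by simp [M.hn])
  have hτ' : ∀ k ∈ D.keys, ⁅τ, x k⁆ = (vec k i : ℂ) • x k := by
    intro k hk
    rw [hτ k hk, dg_sum]
    simp
  have small : ∀ (j : ℤ), 0 ≤ j → j ≤ 1 → ∀ v : T, ⁅h, v⁆ = (j : ℂ) • v → ⁅τ, v⁆ = 0 := by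
    intro j h0 h1 v hv
    rw [M.fr.expand v, lie_sum]
    refine Finset.sum_eq_zero fun k hk => ?_
    have hk' := List.mem_toFinset.1 hk
    rw [lie_smul, hτ' k hk']
    by_cases hj : dz (List.ofFn a) k = j
    · have : vec k i = 0 := by
        rw [dz_sum] at hj
        rcases M.vecrk hk' with h2 | h2
        · by_contra h3
          have h4 : (a i : ℤ) * vec k i ≤ ∑ i : Fin n, (a i : ℤ) * vec k i :=
            Finset.single_le_sum (f := fun i : Fin n => (a i : ℤ) * vec k i)
              (fun i _ => mul_nonneg (by positivity) (h2 i)) (Finset.mem_univ i)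
          have := h2 i
          have : 1 ≤ vec k i := by lia
          have : (2 : ℤ) ≤ a i := by exact_mod_cast hi
          nlinarith
        · by_contra h3
          have h4 : ∑ i : Fin n, (a i : ℤ) * vec k i ≤ (a i : ℤ) * vec k i := by
            have := Finset.single_le_sum (f := fun i : Fin n => -((a i : ℤ) * vec k i))
              (fun i _ => by
                have : (a i : ℤ) * vec k i ≤ 0 :=
                  mul_nonpos_of_nonneg_of_nonpos (by positivity) (h2 i)
                lia) (Finset.mem_univ i)
            rw [Finset.sum_neg_distrib] at this
            lia
          have := h2 i
          have : vec k i ≤ -1 := by lia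
          have : (2 : ℤ) ≤ a i := by exact_mod_cast hi
          nlinarith
      rw [this]; simp
    · rw [M.fr.co_zero ⟨by simp [M.hn], hw⟩ hv hj, zero_smul]
  refine good_of_not t.he (not_reach_two t (τ := τ) ?_ ?_ ?_ ?_)
  · intro v hv; exact small 0 le_rfl (by norm_num) v (by simpa using hv)
  · intro v hv; exact small 1 (by norm_num) le_rfl v (by simpa using hv)
  · clear hw small t
    induction hs using Submodule.span_induction with
    | mem a ha =>
      obtain ⟨j, rfl⟩ := ha
      rw [← lie_skew, hτ' _ (M.lt j), M.vec0]; simp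
    | zero => exact zero_lie _
    | add a b _ _ h1 h2 => rw [add_lie, h1, h2, add_zero]
    | smul a b _ h1 => rw [smul_lie, h1, smul_zero]
  · rw [M.fr.kap_sum _ _ hw hτ']
    have hnn : ∀ k ∈ D.keys, 0 ≤ dz (List.ofFn a) k * vec k i := by
      intro k hk
      rw [dz_sum]
      rcases M.vecrk hk with h2 | h2
      · exact mul_nonneg (Finset.sum_nonneg fun j _ => mul_nonneg (by positivity) (h2 j)) (h2 i)
      · exact mul_nonneg_of_nonpos_of_nonpos (Finset.sum_nonpos fun j _ =>
          mul_nonpos_of_nonneg_of_nonpos (by positivity) (h2 j)) (h2 i)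
    obtain ⟨k, hk, -, hv⟩ := M.hE i
    have hk' : k ∈ D.keys := List.mem_append_right _ hk
    have h1 : dz (List.ofFn a) k * vec k i = a i := by
      rw [dz_sum, hv i, if_pos rfl, mul_one]
      simp [hv]
    have h2 := List.single_le_sum (l := D.keys.map fun k => dz (List.ofFn a) k * vec k i)
      (by simpa using hnn) _ (List.mem_map_of_mem hk')
    rw [h1] at h2
    have : (2 : ℤ) ≤ a i := by exact_mod_cast hi
    have h3 : ((D.keys.map fun k => dz (List.ofFn a) k * vec k i).sum) ≠ 0 := by lia
    exact_mod_cast h3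

theorem Rm.main (M : Rm A D x E F) (c : Fin n → ℤ) (hc : ∀ i, 0 < ∑ j, A i j * c j)
    (hdat : ∀ a : Fin n → ℕ, (∀ i, a i ≤ 1) → (∃ i, a i ≠ 0) → ∃ ct, D.chk (List.ofFn a) ct = true) :
    PanyushevProperty ℂ T := by
  intro e h f ht
  have := M.fr.fd
  have t : Tr e h f := ⟨ht.lie_h_e_smul ℂ, ht.lie_lie_smul_f ℂ, ht.lie_e_f⟩
  have hd : ⨆ k : ℤ, End.eigenspace (LieAlgebra.ad ℂ T h : End ℂ T) (k : ℂ) = ⊤ := t.s2.diag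
  have hInt : ∀ (μ : ℂ) (v : T), ⁅h, v⁆ = μ • v → v ≠ 0 → ∃ m : ℤ, (m : ℂ) = μ := by
    intro μ v hv hv0
    by_contra hm
    push Not at hm
    have h1 := Module.End.eigenspaces_iSupIndep (LieAlgebra.ad ℂ T h : End ℂ T) μ
    have h2 : (⊤ : Submodule ℂ T) ≤ ⨆ (j) (_ : j ≠ μ), End.eigenspace (LieAlgebra.ad ℂ T h : End ℂ T) j := by
      rw [← hd]
      exact iSup_le fun k => le_iSup₂_of_le (k : ℂ) (hm k) le_rfl
    have h3 : v ∈ End.eigenspace (LieAlgebra.ad ℂ T h : End ℂ T) μ := by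
      rw [End.mem_eigenspace_iff]; exact hv
    exact hv0 (Submodule.disjoint_def.1 h1 v h3 (h2 trivial))
  have hE0 : ∀ j, E j ≠ 0 := by
    intro j h0
    obtain ⟨k, hk, h1, -⟩ := M.hE j
    rw [h1] at h0
    exact M.fr.li.ne_zero ⟨k, List.mem_append_right _ hk⟩ h0
  -- the labels
  let S : Set (Fin n → ℤ) := {a | ∃ g : T ≃ₗ⁅ℂ⁆ T,
    g h ∈ Submodule.span ℂ (Set.range fun i : Fin n => x i) ∧ M.wt (g h) a}
  have wtE : ∀ {z : T} {a : Fin n → ℤ}, M.wt z a → ∀ j, ⁅z, E j⁆ = (a j : ℂ) • E j := by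
    intro z a hz j
    obtain ⟨k, hk, h1, h2⟩ := M.hE j
    rw [h1, hz k (List.mem_append_right _ hk)]
    simp [h2]
  have hfin : S.Finite := by
    have h1 : {μ : ℤ | End.HasEigenvalue (LieAlgebra.ad ℂ T h : End ℂ T) (μ : ℂ)}.Finite := by
      refine Set.Finite.preimage (f := fun μ : ℤ => (μ : ℂ)) (Int.cast_injective.injOn)
        (s := {μ : ℂ | End.HasEigenvalue (LieAlgebra.ad ℂ T h : End ℂ T) μ}) ?_
      exact Module.End.finite_hasEigenvalue _
    refine (Set.Finite.pi' fun _ : Fin n => h1).subset ?_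
    rintro a ⟨g, -, hg⟩ j
    have h2 := wtE hg j
    refine End.hasEigenvalue_of_hasEigenvector (x := g.symm (E j)) ⟨?_, ?_⟩
    · rw [End.mem_eigenspace_iff, LieAlgebra.ad_apply]
      apply g.injective
      change g ⁅h, g.symm (E j)⁆ = g _
      rw [LieEquiv.map_lie, map_smul, LieEquiv.apply_symm_apply, h2]
    · intro h0
      apply hE0 j
      rw [← g.apply_symm_apply (E j), h0, map_zero]
  have hne : S.Nonempty := by
    obtain ⟨g, hg⟩ := M.conj h hd
    obtain ⟨s, hs⟩ := (Submodule.mem_span_range_iff_exists_fun ℂ).1 hg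
    have hw : ∀ k ∈ D.keys, ⁅g h, x k⁆ = (∑ j : Fin n, (∑ i, s i * (A i j : ℂ)) * (vec k j : ℂ)) • x k := by
      intro k hk
      rw [← hs, sum_lie]
      simp_rw [smul_lie, M.car _ k hk, smul_smul]
      rw [← Finset.sum_smul]
      congr 1
      simp_rw [Finset.sum_mul]
      rw [Finset.sum_comm]
      refine Finset.sum_congr rfl fun i _ => ?_
      push_cast
      rw [Finset.mul_sum]
      exact Finset.sum_congr rfl fun j _ => by ring
    have h1 : ∀ j, ∃ m : ℤ, (m : ℂ) = ∑ i, s i * (A i j : ℂ) := by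
      intro j
      obtain ⟨k, hk, h1, h2⟩ := M.hE j
      have h3 := hw k (List.mem_append_right _ hk)
      simp only [h2] at h3
      simp at h3
      refine hInt _ (g.symm (E j)) ?_ ?_
      · apply g.injective
        change g ⁅h, g.symm (E j)⁆ = g _
        rw [LieEquiv.map_lie, map_smul, LieEquiv.apply_symm_apply, h1, h3]
      · intro h0
        apply hE0 j
        rw [← g.apply_symm_apply (E j), h0, map_zero]
    choose a ha using h1
    refine ⟨a, g, hg, fun k hk => ?_⟩
    rw [hw k hk]
    push_cast
    simp_rw [ha]
  obtain ⟨a, ⟨g, hg, hw⟩, hmax⟩ := Set.exists_max_image S (fun a => ∑ j, c j * a j) hfin hne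
  have hpos : ∀ i, 0 ≤ a i := by
    intro i
    by_contra hi
    have nil : ∀ {u v w : T}, Sl2.S2 (LieAlgebra.ad ℂ T u) (LieAlgebra.ad ℂ T v)
        (LieAlgebra.ad ℂ T w) → IsNilpotent (LieAlgebra.ad ℂ T u : End ℂ T) := by
      intro u v w s
      obtain ⟨N, hN⟩ := s.nilp
      exact ⟨N, LinearMap.ext hN⟩
    have h2 := M.chev.HE i i
    have h2' := M.chev.HF i i
    rw [M.chev.diag] at h2 h2'
    obtain ⟨r, hr⟩ := reflect (nil (M.chev.s2 i)) (nil (M.chev.swap.s2 i)) (by exact_mod_cast h2)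
      (by exact_mod_cast h2') (by rw [M.chev.EF, if_pos rfl])
    have hF : ⁅g h, F i⁆ = -((a i : ℂ) • F i) := by
      have key : ∀ z ∈ Submodule.span ℂ (Set.range fun i : Fin n => x i), ∃ μ : ℂ,
          ⁅z, E i⁆ = μ • E i ∧ ⁅z, F i⁆ = -(μ • F i) := by
        intro z hz
        induction hz using Submodule.span_induction with
        | mem z hz =>
          obtain ⟨j, rfl⟩ := hz
          exact ⟨_, M.chev.HE j i, M.chev.HF j i⟩
        | zero => exact ⟨0, by simp, by simp⟩
        | add u v _ _ h1 h2 =>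
          obtain ⟨μ, h1, h1'⟩ := h1
          obtain ⟨ν, h2, h2'⟩ := h2
          exact ⟨μ + ν, by rw [add_lie, h1, h2, add_smul], by rw [add_lie, h1', h2', add_smul]; abel⟩
        | smul b v _ h1 =>
          obtain ⟨μ, h1, h1'⟩ := h1
          exact ⟨b * μ, by rw [smul_lie, h1, smul_smul], by rw [smul_lie, h1', smul_neg, smul_smul]⟩
      obtain ⟨μ, h3, h4⟩ := key _ hg
      rw [wtE hw i] at h3
      have h5 : (a i : ℂ) = μ := smul_left_injective ℂ (hE0 i) h3
      rw [h4, h5]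
    have hr' := hr (g h) (a i) (wtE hw i) hF
    have hS : (fun j => a j - a i * A i j) ∈ S := by
      refine ⟨g.trans r, ?_, ?_⟩
      · change r (g h) ∈ _
        rw [hr']
        exact Submodule.sub_mem _ hg (Submodule.smul_mem _ _ (Submodule.subset_span ⟨i, rfl⟩))
      · intro k hk
        change ⁅r (g h), x k⁆ = _
        rw [hr', sub_lie, smul_lie, hw k hk, M.car i k hk, smul_smul, ← sub_smul]
        congr 1
        norm_cast
        rw [Finset.mul_sum, ← Finset.sum_sub_distrib]
        exact Finset.sum_congr rfl fun j _ => by ring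
    have h3 := hmax _ hS
    have h4 : ∑ j, c j * (a j - a i * A i j) = ∑ j, c j * a j - a i * ∑ j, A i j * c j := by
      rw [Finset.mul_sum, ← Finset.sum_sub_distrib]
      exact Finset.sum_congr rfl fun j _ => by ring
    simp only [h4] at h3
    have := hc i
    push Not at hi
    nlinarith
  have ha' : ∀ i, ((a i).toNat : ℤ) = a i := fun i => Int.toNat_of_nonneg (hpos i)
  have hw' : ∀ k ∈ D.keys, ⁅g h, x k⁆ = (dz (List.ofFn fun i => (a i).toNat) k : ℂ) • x k := by
    intro k hk
    rw [hw k hk, dz_sum]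
    simp_rw [ha']
  have t' : Tr (g e) (g h) (g f) :=
    ⟨by rw [← LieEquiv.map_lie, t.he, map_smul],
      by rw [← LieEquiv.map_lie, t.hf, map_neg, map_smul], by rw [← LieEquiv.map_lie, t.ef]⟩
  refine good_map g t.he ?_
  by_cases hb : ∀ i, (a i).toNat ≤ 1
  · by_cases h0 : ∃ i, (a i).toNat ≠ 0
    · obtain ⟨ct, hct⟩ := hdat _ hb h0
      exact sound M.fr ct hct (by simp [M.hn]) t' hw'
    · exfalso
      push Not at h0
      have h1 : ∀ v : T, ⁅g h, v⁆ = 0 := by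
        intro v
        rw [M.fr.expand v, lie_sum]
        refine Finset.sum_eq_zero fun k hk => ?_
        rw [lie_smul, hw' k (List.mem_toFinset.1 hk), dz_sum]
        simp [h0]
      have h2 : g e = 0 := by
        have := t'.he
        rw [h1] at this
        simpa using this.symm
      have h3 : g h = 0 := by rw [← t'.ef, h2, zero_lie]
      exact ht.h_ne_zero (by simpa using h3)
  · push Not at hb
    obtain ⟨i, hi⟩ := hb
    exact M.dual t' hg hw' i hi
end PaperStmt.Chk

namespace PaperStmt.E8m
open Module

/-- The bilinear form whose symmetrization is the form of the root lattice of type `E₈`. -/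
def eta {R : Type*} [CommRing R] (a b : Fin 8 → R) : R :=
  a 0 * (b 0 - b 2) + a 1 * (b 1 - b 3) + a 2 * (b 2 - b 3) + a 3 * (b 3 - b 4) +
    a 4 * (b 4 - b 5) + a 5 * (b 5 - b 6) + a 6 * (b 6 - b 7) + a 7 * b 7

def bf {R : Type*} [CommRing R] (a b : Fin 8 → R) : R := eta a b + eta b a

section
variable {R : Type*} [CommRing R] (a b c : Fin 8 → R)
lemma eta_add_left : eta (a + b) c = eta a c + eta b c := by simp only [eta, Pi.add_apply]; ring
lemma eta_add_right : eta a (b + c) = eta a b + eta a c := by simp only [eta, Pi.add_apply]; ring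
lemma eta_neg_left : eta (-a) c = -eta a c := by simp only [eta, Pi.neg_apply]; ring
lemma eta_neg_right : eta a (-c) = -eta a c := by simp only [eta, Pi.neg_apply]; ring
lemma eta_smul_right (r : R) : eta a (r • c) = r * eta a c := by
  simp only [eta, Pi.smul_apply, smul_eq_mul]; ring
lemma eta_smul_left (r : R) : eta (r • a) c = r * eta a c := by
  simp only [eta, Pi.smul_apply, smul_eq_mul]; ring
lemma bf_add_left : bf (a + b) c = bf a c + bf b c := by
  simp only [bf, eta_add_left, eta_add_right]; ring
lemma bf_add_right : bf a (b + c) = bf a b + bf a c := by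
  simp only [bf, eta_add_left, eta_add_right]; ring
lemma bf_neg_left : bf (-a) c = -bf a c := by simp only [bf, eta_neg_left, eta_neg_right]; ring
lemma bf_neg_right : bf a (-c) = -bf a c := by simp only [bf, eta_neg_left, eta_neg_right]; ring
lemma bf_smul_right (r : R) : bf a (r • c) = r * bf a c := by
  simp only [bf, eta_smul_left, eta_smul_right]; ring
lemma bf_comm : bf a b = bf b a := by simp only [bf]; ring
end

lemma eta_pos (a : Fin 8 → ℤ) : 0 ≤ eta a a := by
  have h : 120 * eta a a = 30 * (2 * a 0 - a 2) ^ 2 + 30 * (2 * a 1 - a 3) ^ 2 +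
      10 * (3 * a 2 - 2 * a 3) ^ 2 + 2 * (5 * a 3 - 6 * a 4) ^ 2 + 3 * (4 * a 4 - 5 * a 5) ^ 2 +
      5 * (3 * a 5 - 4 * a 6) ^ 2 + 10 * (2 * a 6 - 3 * a 7) ^ 2 + 30 * a 7 ^ 2 := by
    simp only [eta]; ring
  have : 0 ≤ 120 * eta a a := by rw [h]; positivity
  lia

lemma eta_def {a : Fin 8 → ℤ} (h0 : eta a a = 0) : a = 0 := by
  have h : 120 * eta a a = 30 * (2 * a 0 - a 2) ^ 2 + 30 * (2 * a 1 - a 3) ^ 2 +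
      10 * (3 * a 2 - 2 * a 3) ^ 2 + 2 * (5 * a 3 - 6 * a 4) ^ 2 + 3 * (4 * a 4 - 5 * a 5) ^ 2 +
      5 * (3 * a 5 - 4 * a 6) ^ 2 + 10 * (2 * a 6 - 3 * a 7) ^ 2 + 30 * a 7 ^ 2 := by
    simp only [eta]; ring
  rw [h0] at h
  have z : ∀ y : ℤ, y ^ 2 ≤ 0 → y = 0 := fun y hy => by nlinarith [sq_nonneg y, pow_eq_zero_iff (M₀ := ℤ) (a := y) two_ne_zero]
  have p0 := sq_nonneg (2 * a 0 - a 2)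
  have p1 := sq_nonneg (2 * a 1 - a 3)
  have p2 := sq_nonneg (3 * a 2 - 2 * a 3)
  have p3 := sq_nonneg (5 * a 3 - 6 * a 4)
  have p4 := sq_nonneg (4 * a 4 - 5 * a 5)
  have p5 := sq_nonneg (3 * a 5 - 4 * a 6)
  have p6 := sq_nonneg (2 * a 6 - 3 * a 7)
  have p7 := sq_nonneg (a 7)
  have q0 := z (2 * a 0 - a 2) (by linarith)
  have q1 := z (2 * a 1 - a 3) (by linarith)
  have q2 := z (3 * a 2 - 2 * a 3) (by linarith)
  have q3 := z (5 * a 3 - 6 * a 4) (by linarith)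
  have q4 := z (4 * a 4 - 5 * a 5) (by linarith)
  have q5 := z (3 * a 5 - 4 * a 6) (by linarith)
  have q6 := z (2 * a 6 - 3 * a 7) (by linarith)
  have q7 := z (a 7) (by linarith)
  ext i
  fin_cases i <;> simp <;> lia

/-- Roots. -/
def rt (a : Fin 8 → ℤ) : Prop := eta a a = 1

lemma rt.b2 {a : Fin 8 → ℤ} (h : rt a) : bf a a = 2 := by rw [bf]; rw [rt] at h; lia
lemma rt.neg {a : Fin 8 → ℤ} (h : rt a) : rt (-a) := by
  rw [rt, eta_neg_left, eta_neg_right]; rw [rt] at h; lia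
lemma eta_add (a b : Fin 8 → ℤ) : eta (a + b) (a + b) = eta a a + eta b b + bf a b := by
  rw [eta_add_left, eta_add_right, eta_add_right, bf]; ring
lemma rt.ge {a b : Fin 8 → ℤ} (h : rt a) (h' : rt b) : -2 ≤ bf a b := by
  have := eta_pos (a + b)
  rw [eta_add] at this; rw [rt] at h h'; lia
lemma rt.le {a b : Fin 8 → ℤ} (h : rt a) (h' : rt b) : bf a b ≤ 2 := by
  have := h.ge h'.neg
  rw [bf_neg_right] at this; lia
lemma rt.eq_neg {a b : Fin 8 → ℤ} (h : rt a) (h' : rt b) (e : bf a b = -2) : b = -a := by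
  have : eta (a + b) (a + b) = 0 := by rw [eta_add]; rw [rt] at h h'; lia
  exact (neg_eq_of_add_eq_zero_right (eta_def this)).symm
lemma rt.eq {a b : Fin 8 → ℤ} (h : rt a) (h' : rt b) (e : bf a b = 2) : b = a := by
  have := h.eq_neg h'.neg (by rw [bf_neg_right]; lia)
  exact neg_injective this
lemma rt_add_iff {a b : Fin 8 → ℤ} (h : rt a) (h' : rt b) : rt (a + b) ↔ bf a b = -1 := by
  rw [rt, eta_add]; rw [rt] at h h'; lia

/-- The sign function. -/
def eps (a b : Fin 8 → ℤ) : ℤ := ((eta a b).negOnePow : ℤˣ)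

lemma eps_add_left (a b c : Fin 8 → ℤ) : eps (a + b) c = eps a c * eps b c := by
  simp [eps, eta_add_left, Int.negOnePow_add]
lemma eps_add_right (a b c : Fin 8 → ℤ) : eps a (b + c) = eps a b * eps a c := by
  simp [eps, eta_add_right, Int.negOnePow_add]
lemma eps_neg_left (a c : Fin 8 → ℤ) : eps (-a) c = eps a c := by
  simp [eps, eta_neg_left]
lemma eps_neg_right (a c : Fin 8 → ℤ) : eps a (-c) = eps a c := by
  simp [eps, eta_neg_right]
lemma eps_self {a : Fin 8 → ℤ} (h : rt a) : eps a a = -1 := by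
  rw [eps, h]; simp
lemma eps_sq (a b : Fin 8 → ℤ) : eps a b * eps a b = 1 := by
  simp [eps, ← Units.val_mul]
lemma eps_comm (a b : Fin 8 → ℤ) : eps a b * eps b a = ((bf a b).negOnePow : ℤˣ) := by
  simp [eps, bf, Int.negOnePow_add]
lemma eps_comm0 {a b : Fin 8 → ℤ} (h : bf a b = 0) : eps b a = eps a b := by
  have h1 := eps_comm a b
  have h2 := eps_sq a b
  rw [h] at h1
  simp at h1
  calc eps b a = (eps a b * eps a b) * eps b a := by rw [h2, one_mul]
    _ = eps a b * (eps a b * eps b a) := by ring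
    _ = _ := by rw [h1, mul_one]
lemma eps_comm1 {a b : Fin 8 → ℤ} (h : bf a b = -1 ∨ bf a b = 1) : eps b a = -eps a b := by
  have h1 := eps_comm a b
  have h2 := eps_sq a b
  have h3 : eps a b * eps b a = -1 := by rcases h with h | h <;> rw [h1, h] <;> simp
  calc eps b a = (eps a b * eps a b) * eps b a := by rw [h2, one_mul]
    _ = eps a b * (eps a b * eps b a) := by ring
    _ = _ := by rw [h3]; ring
end PaperStmt.E8m

namespace PaperStmt.E8m
open Module
open scoped Classical in
section

abbrev Q := Fin 8 → ℤ
/-- The underlying space of the model. -/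
def V := (Fin 8 → ℂ) × (Q →₀ ℂ)
noncomputable instance : AddCommGroup V := inferInstanceAs (AddCommGroup ((Fin 8 → ℂ) × (Q →₀ ℂ)))
noncomputable instance : Module ℂ V := inferInstanceAs (Module ℂ ((Fin 8 → ℂ) × (Q →₀ ℂ)))

noncomputable def inl : (Fin 8 → ℂ) →ₗ[ℂ] V := LinearMap.inl ℂ (Fin 8 → ℂ) (Q →₀ ℂ)
noncomputable def inr : (Q →₀ ℂ) →ₗ[ℂ] V := LinearMap.inr ℂ (Fin 8 → ℂ) (Q →₀ ℂ)
noncomputable def fst : V →ₗ[ℂ] (Fin 8 → ℂ) := LinearMap.fst ℂ (Fin 8 → ℂ) (Q →₀ ℂ)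
noncomputable def snd : V →ₗ[ℂ] (Q →₀ ℂ) := LinearMap.snd ℂ (Fin 8 → ℂ) (Q →₀ ℂ)
lemma fst_inl (v : Fin 8 → ℂ) : fst (inl v) = v := rfl
lemma snd_inl (v : Fin 8 → ℂ) : snd (inl v) = 0 := rfl
lemma fst_inr (v : Q →₀ ℂ) : fst (inr v) = 0 := rfl
lemma snd_inr (v : Q →₀ ℂ) : snd (inr v) = v := rfl
lemma prod_V (v : V) : v = inl (fst v) + inr (snd v) := by
  change v = ((fst v + 0, 0 + snd v) : (Fin 8 → ℂ) × (Q →₀ ℂ))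
  rw [add_zero, zero_add]; rfl

/-- Complexification of lattice vectors. -/
def cc (a : Q) : Fin 8 → ℂ := fun i => (a i : ℂ)

lemma cc_add (a b : Q) : cc (a + b) = cc a + cc b := by ext i; simp [cc]
lemma cc_neg (a : Q) : cc (-a) = -cc a := by ext i; simp [cc]
lemma bf_cc (a b : Q) : bf (cc a) (cc b) = ((bf a b : ℤ) : ℂ) := by simp [bf, eta, cc]

noncomputable def ee (c : Q) : V := inr (Finsupp.single c 1)
noncomputable def tt (v : Fin 8 → ℂ) : V := inl v

open scoped Classical in
noncomputable def ww (a c : Q) : V :=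
  if rt c then (if bf a c = -2 then tt (-cc a) else if bf a c = -1 then (eps a c : ℂ) • ee (a + c) else 0)
  else 0

noncomputable def mk (f : (Fin 8 → ℂ) →ₗ[ℂ] V) (w : Q → V) : End ℂ V :=
  f.comp fst + (Finsupp.lsum ℂ fun c => LinearMap.toSpanSingleton ℂ V (w c)).comp snd

lemma mk_ee (f : (Fin 8 → ℂ) →ₗ[ℂ] V) (w : Q → V) (c : Q) : mk f w (ee c) = w c := by
  simp [mk, ee, fst_inr, snd_inr]
lemma mk_tt (f : (Fin 8 → ℂ) →ₗ[ℂ] V) (w : Q → V) (v : Fin 8 → ℂ) : mk f w (tt v) = f v := by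
  simp [mk, tt, fst_inl, snd_inl]

lemma ext_V {f g : End ℂ V} (h1 : ∀ v, f (tt v) = g (tt v)) (h2 : ∀ c, f (ee c) = g (ee c)) :
    f = g := by
  have h3 : f.comp inr = g.comp inr := by
    refine Finsupp.lhom_ext fun c b => ?_
    have hb : inr (Finsupp.single c b) = b • ee c := by
      rw [ee, ← map_smul, Finsupp.smul_single, smul_eq_mul, mul_one]
    rw [LinearMap.comp_apply, LinearMap.comp_apply, hb, map_smul, map_smul, h2]
  refine LinearMap.ext fun v => ?_
  have h4 : f (inr (snd v)) = g (inr (snd v)) := LinearMap.congr_fun h3 (snd v)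
  have h5 : f (inl (fst v)) = g (inl (fst v)) := h1 _
  rw [prod_V v, map_add, map_add, h4, h5]

noncomputable def bl (a : Fin 8 → ℂ) : (Fin 8 → ℂ) →ₗ[ℂ] ℂ where
  toFun v := bf a v
  map_add' := bf_add_right a
  map_smul' r v := bf_smul_right a v r

/-- Root operators. -/
noncomputable def XX (a : Q) : End ℂ V :=
  mk (-(LinearMap.toSpanSingleton ℂ V (ee a)).comp (bl (cc a))) (ww a)

open scoped Classical in
noncomputable def HH (v : Fin 8 → ℂ) : End ℂ V :=
  mk 0 (fun c => if rt c then bf v (cc c) • ee c else 0)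

lemma XX_tt (a : Q) (v : Fin 8 → ℂ) : XX a (tt v) = -(bf (cc a) v • ee a) := by
  rw [XX, mk_tt]; rfl
lemma XX_not (a : Q) {c : Q} (hc : ¬ rt c) : XX a (ee c) = 0 := by
  rw [XX, mk_ee, ww, if_neg hc]
lemma XX_two (a : Q) {c : Q} (hc : rt c) (h : bf a c = -2) : XX a (ee c) = -tt (cc a) := by
  rw [XX, mk_ee, ww, if_pos hc, if_pos h]; simp [tt]
lemma XX_one (a : Q) {c : Q} (hc : rt c) (h : bf a c = -1) :
    XX a (ee c) = (eps a c : ℂ) • ee (a + c) := by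
  rw [XX, mk_ee, ww, if_pos hc, if_neg (by lia), if_pos h]
lemma XX_zero (a : Q) {c : Q} (h : bf a c ≠ -2) (h' : bf a c ≠ -1) : XX a (ee c) = 0 := by
  rw [XX, mk_ee, ww, if_neg h, if_neg h', ite_self]
lemma HH_tt (u v : Fin 8 → ℂ) : HH u (tt v) = 0 := by rw [HH, mk_tt]; rfl
lemma HH_ee (u : Fin 8 → ℂ) {c : Q} (hc : rt c) : HH u (ee c) = bf u (cc c) • ee c := by
  rw [HH, mk_ee, if_pos hc]
lemma HH_not (u : Fin 8 → ℂ) {c : Q} (hc : ¬ rt c) : HH u (ee c) = 0 := by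
  rw [HH, mk_ee, if_neg hc]
lemma tt_smul (r : ℂ) (v : Fin 8 → ℂ) : tt (r • v) = r • tt v := by simp [tt]
lemma tt_add (u v : Fin 8 → ℂ) : tt (u + v) = tt u + tt v := by simp [tt]
lemma tt_neg (u : Fin 8 → ℂ) : tt (-u) = -tt u := by simp [tt]

attribute [local instance] LieRing.ofAssociativeRing

lemma lie_ap (f g : End ℂ V) (v : V) : ⁅f, g⁆ v = f (g v) - g (f v) := by
  rfl

lemma HH_HH (u v : Fin 8 → ℂ) : ⁅HH u, HH v⁆ = 0 := by
  refine ext_V (fun w => ?_) fun c => ?_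
  · rw [lie_ap, HH_tt, HH_tt]; simp
  · by_cases hc : rt c
    · rw [lie_ap, HH_ee _ hc, HH_ee _ hc, map_smul, map_smul, HH_ee _ hc, HH_ee _ hc, smul_comm]
      simp
    · rw [lie_ap, HH_not _ hc, HH_not _ hc]; simp

lemma HH_add (u v : Fin 8 → ℂ) : HH (u + v) = HH u + HH v := by
  refine ext_V (fun w => ?_) fun c => ?_
  · simp [HH_tt]
  · by_cases hc : rt c
    · rw [LinearMap.add_apply, HH_ee _ hc, HH_ee _ hc, HH_ee _ hc, bf_add_left, add_smul]
    · simp [HH_not _ hc]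

lemma HH_XX (u : Fin 8 → ℂ) (a : Q) (ha : rt a) : ⁅HH u, XX a⁆ = bf u (cc a) • XX a := by
  refine ext_V (fun w => ?_) fun c => ?_
  · rw [lie_ap, HH_tt, XX_tt, map_neg, map_smul, HH_ee _ ha, map_zero, LinearMap.smul_apply, XX_tt]
    rw [smul_comm]; simp
  · by_cases hc : rt c
    swap
    · simp [XX_not a hc, HH_not u hc]
    rw [lie_ap, HH_ee _ hc, map_smul, LinearMap.smul_apply]
    by_cases h2 : bf a c = -2
    · rw [XX_two a hc h2, map_neg, HH_tt, ha.eq_neg hc h2, cc_neg, bf_neg_right]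
      simp
    by_cases h1 : bf a c = -1
    · rw [XX_one a hc h1, map_smul, HH_ee _ ((rt_add_iff ha hc).2 h1), cc_add, bf_add_right]
      module
    · simp [XX_zero a h2 h1]

lemma XX_opp {a : Q} (ha : rt a) : ⁅XX a, XX (-a)⁆ = -HH (cc a) := by
  refine ext_V (fun w => ?_) fun c => ?_
  · rw [lie_ap, LinearMap.neg_apply, HH_tt, XX_tt, XX_tt, map_neg, map_neg, map_smul, map_smul,
      XX_two a ha.neg (by rw [bf_neg_right, ha.b2]), XX_two (-a) ha (by rw [bf_neg_left, ha.b2]),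
      cc_neg, bf_neg_left, tt_neg]
    module
  · by_cases hc : rt c
    swap
    · simp [XX_not a hc, XX_not (-a) hc, HH_not _ hc]
    rw [lie_ap, LinearMap.neg_apply, HH_ee _ hc, bf_cc]
    have h1 := ha.ge hc
    have h2 := ha.le hc
    have hn : bf (-a) c = -bf a c := bf_neg_left a c
    obtain h | h | h | h | h : bf a c = -2 ∨ bf a c = -1 ∨ bf a c = 0 ∨ bf a c = 1 ∨ bf a c = 2 := by
      lia
    · rw [XX_two a hc h, XX_zero (-a) (by lia) (by lia), h, ha.eq_neg hc h, map_neg, XX_tt, bf_cc,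
        bf_neg_left, ha.b2]
      rw [map_zero]
      push_cast
      module
    · have hd : rt (a + c) := (rt_add_iff ha hc).2 h
      have he := eps_sq a c
      rw [XX_one a hc h, XX_zero (-a) (by lia) (by lia), h, map_smul,
        XX_one (-a) hd (by rw [bf_neg_left, bf_add_right, ha.b2, h]; norm_num), neg_add_cancel_left,
        eps_neg_left, eps_add_right, eps_self ha, smul_smul]
      have : ((eps a c : ℂ) * ((-1 * eps a c : ℤ) : ℂ)) = -1 := by
        push_cast; rw [mul_left_comm]; norm_cast; rw [he]; simp
      rw [this]; push_cast; simp
    · rw [XX_zero a (by lia) (by lia), XX_zero (-a) (by lia) (by lia), h]; simp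
    · have hn' : bf (-a) c = -1 := by lia
      have hd : rt (-a + c) := (rt_add_iff ha.neg hc).2 hn'
      have he := eps_sq a c
      rw [XX_one (-a) hc hn', XX_zero a (by lia) (by lia), h, map_smul,
        XX_one a hd (by rw [bf_add_right, bf_neg_right, ha.b2, h]; norm_num), add_neg_cancel_left,
        eps_neg_left, eps_add_right, eps_neg_right, eps_self ha, smul_smul]
      have : ((eps a c : ℂ) * ((-1 * eps a c : ℤ) : ℂ)) = -1 := by
        push_cast; rw [mul_left_comm]; norm_cast; rw [he]; simp
      rw [this]; push_cast; simp
    · rw [XX_two (-a) hc (by lia), XX_zero a (by lia) (by lia), h, ha.eq hc h, map_neg, XX_tt, cc_neg, bf_neg_right, bf_cc,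
        ha.b2]
      rw [map_zero]
      push_cast
      module
end
end PaperStmt.E8m

namespace PaperStmt.E8m
open Module
attribute [local instance] LieRing.ofAssociativeRing

lemma es (a b : Q) : (eps a b : ℂ) * eps a b = 1 := by exact_mod_cast eps_sq a b

/-- Two roots with non-negative product commute. -/
lemma XX_comm {a b : Q} (ha : rt a) (hb : rt b) (h : 0 ≤ bf a b) : ⁅XX a, XX b⁆ = 0 := by
  have hle := ha.le hb
  have hba : bf b a = bf a b := bf_comm b a
  by_cases hp2 : bf a b = 2
  · rw [ha.eq hb hp2]; exact lie_self _
  have key : ∀ {a b c : Q}, rt a → rt b → rt c → 0 ≤ bf a b → bf a b ≤ 1 → bf b c ≤ -1 →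
      XX a (XX b (ee c)) = XX b (XX a (ee c)) := by
    intro a b c ha hb hc h0 h1 hy
    have hy' := hb.ge hc
    have hba : bf b a = bf a b := bf_comm b a
    obtain hy | hy : bf b c = -1 ∨ bf b c = -2 := by lia
    · have hbc : rt (b + c) := (rt_add_iff hb hc).2 hy
      have hx := ha.ge hc
      have hx2 := ha.le hc
      have e1 : bf a (b + c) = bf a b + bf a c := bf_add_right a b c
      have e2 := ha.ge hbc
      rw [XX_one b hc hy, map_smul]
      obtain hp | hp : bf a b = 0 ∨ bf a b = 1 := by lia
      · have hx3 : bf a c ≠ -2 := by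
          intro hx3
          rw [ha.eq_neg hc hx3, bf_neg_right] at hy
          lia
        by_cases hx1 : bf a c = -1
        · have hac : rt (a + c) := (rt_add_iff ha hc).2 hx1
          have e3 : bf b (a + c) = bf b a + bf b c := bf_add_right b a c
          rw [XX_one a hbc (by lia), XX_one a hc hx1, map_smul, XX_one b hac (by lia), smul_smul,
            smul_smul, eps_add_right, eps_add_right, eps_comm0 hp, add_left_comm]
          congr 1
          push_cast; ring
        · rw [XX_zero a (c := c) hx3 hx1, XX_zero a (by lia) (by lia)]; simp
      · by_cases hx3 : bf a c = -2
        · obtain rfl := ha.eq_neg hc hx3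
          have e4 := es a b
          rw [XX_one a hbc (by lia), XX_two a hc hx3, map_neg, XX_tt, bf_cc, hba, hp, smul_smul,
            eps_neg_right, eps_add_right, eps_neg_right, eps_self ha, eps_comm1 (Or.inr hp),
            add_comm b, add_neg_cancel_left]
          have : ((-eps a b : ℤ) : ℂ) * ((eps a b * -1 : ℤ) : ℂ) = 1 := by
            push_cast; linear_combination e4
          rw [this]; simp
        · by_cases hx1 : bf a c = -1
          · have hac : rt (a + c) := (rt_add_iff ha hc).2 hx1
            have e3 : bf b (a + c) = bf b a + bf b c := bf_add_right b a c
            rw [XX_zero a (by lia) (by lia), XX_one a hc hx1, map_smul, XX_zero b (by lia) (by lia)]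
            simp
          · rw [XX_zero a (c := c) hx3 hx1, XX_zero a (by lia) (by lia)]; simp
    · obtain rfl := hb.eq_neg hc hy
      have hx : bf a (-b) = -bf a b := bf_neg_right a b
      rw [XX_two b hc hy, map_neg, XX_tt, bf_cc]
      obtain hp | hp : bf a b = 0 ∨ bf a b = 1 := by lia
      · rw [XX_zero a (c := -b) (by lia) (by lia), hp]; simp
      · have e4 := es a b
        have hab : rt (a + -b) := (rt_add_iff ha hc).2 (by lia)
        have e3 : bf b (a + -b) = bf b a + bf b (-b) := bf_add_right b a (-b)
        rw [XX_one a hc (by lia), map_smul, XX_one b hab (by lia), hp, smul_smul, eps_neg_right,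
          eps_add_right, eps_neg_right, eps_self hb, eps_comm1 (Or.inr hp), add_comm a, add_neg_cancel_left]
        have : ((eps a b : ℤ) : ℂ) * ((-eps a b * -1 : ℤ) : ℂ) = 1 := by
          push_cast; linear_combination e4
        rw [this]; simp
  refine ext_V (fun v => ?_) fun c => ?_
  · rw [lie_ap, XX_tt, XX_tt, map_neg, map_neg, map_smul, map_smul, XX_zero a (by lia) (by lia),
      XX_zero b (by lia) (by lia)]
    simp
  · rw [lie_ap, LinearMap.zero_apply, sub_eq_zero]
    by_cases hc : rt c
    swap
    · rw [XX_not a hc, XX_not b hc]; simp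
    by_cases hy : bf b c ≤ -1
    · exact key ha hb hc h (by lia) hy
    by_cases hx : bf a c ≤ -1
    · exact (key hb ha hc (by lia) (by lia) hx).symm
    · rw [XX_zero a (c := c) (by lia) (by lia), XX_zero b (c := c) (by lia) (by lia)]; simp

lemma XX_XX {a b : Q} (ha : rt a) (hb : rt b) (h : bf a b = -1) :
    ⁅XX a, XX b⁆ = (eps a b : ℂ) • XX (a + b) := by
  have hba : bf b a = bf a b := bf_comm b a
  have hab : rt (a + b) := (rt_add_iff ha hb).2 h
  have e5 := eps_comm1 (Or.inl h)
  have e6 := es a b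
  refine ext_V (fun v => ?_) fun c => ?_
  · rw [lie_ap, LinearMap.smul_apply, XX_tt, XX_tt, XX_tt, map_neg, map_neg, map_smul, map_smul,
      XX_one a hb h, XX_one b ha (by lia), cc_add, bf_add_left, add_comm b, e5]
    push_cast
    module
  · rw [lie_ap, LinearMap.smul_apply]
    by_cases hc : rt c
    swap
    · simp [XX_not _ hc]
    have hx := ha.ge hc
    have hx2 := ha.le hc
    have hy := hb.ge hc
    have hy2 := hb.le hc
    have e0 : bf (a + b) c = bf a c + bf b c := bf_add_left a b c
    have e1 : bf a (b + c) = bf a b + bf a c := bf_add_right a b c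
    have e2 : bf b (a + c) = bf b a + bf b c := bf_add_right b a c
    by_cases hy2 : bf b c = -2
    · obtain rfl := hb.eq_neg hc hy2
      have hx : bf a (-b) = -bf a b := bf_neg_right a b
      rw [XX_two b hc hy2, XX_zero a (by lia) (by lia), XX_one (a + b) hc (by lia), map_neg, XX_tt,
        bf_cc, h, smul_smul, eps_neg_right, eps_add_left, eps_self hb, add_neg_cancel_right]
      have : ((eps a b : ℤ) : ℂ) * ((eps a b * -1 : ℤ) : ℂ) = -1 := by
        push_cast; linear_combination -e6
      rw [this, map_zero]; push_cast; module
    by_cases hx2 : bf a c = -2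
    · obtain rfl := ha.eq_neg hc hx2
      have hx : bf b (-a) = -bf b a := bf_neg_right b a
      rw [XX_two a hc hx2, XX_zero b (by lia) (by lia), XX_one (a + b) hc (by lia), map_neg, XX_tt,
        bf_cc, hba, h, smul_smul, eps_neg_right, eps_add_left, eps_self ha, e5, add_comm a,
        add_neg_cancel_right]
      have : ((eps a b : ℤ) : ℂ) * ((-1 * -eps a b : ℤ) : ℂ) = 1 := by
        push_cast; linear_combination e6
      rw [this, map_zero]; push_cast; module
    by_cases hy1 : bf b c = -1
    · have hbc : rt (b + c) := (rt_add_iff hb hc).2 hy1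
      by_cases hx1 : bf a c = -1
      · have hac : rt (a + c) := (rt_add_iff ha hc).2 hx1
        have hc' : c = -(a + b) := hab.eq_neg hc (by lia)
        have q1 : eps b c = eps a b := by
          rw [hc', eps_neg_right, eps_add_right, eps_self hb, e5]; ring
        have q2 : eps a c = -eps a b := by
          rw [hc', eps_neg_right, eps_add_right, eps_self ha]; ring
        rw [XX_one b hc hy1, XX_one a hc hx1, map_smul, map_smul, XX_two a hbc (by lia),
          XX_two b hac (by lia), XX_two (a + b) hc (by lia), q1, q2, cc_add, tt_add]
        push_cast
        module
      · rw [XX_one b hc hy1, XX_zero a (c := c) hx2 hx1, map_smul]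
        by_cases hx0 : bf a c = 0
        · rw [XX_one a hbc (by lia), XX_one (a + b) hc (by lia), eps_add_left, eps_add_right,
            add_assoc]
          rw [map_zero]
          push_cast
          module
        · rw [XX_zero a (by lia) (by lia), XX_zero (a + b) (by lia) (by lia)]; simp
    · rw [XX_zero b (c := c) hy2 hy1]
      by_cases hx1 : bf a c = -1
      · have hac : rt (a + c) := (rt_add_iff ha hc).2 hx1
        rw [XX_one a hc hx1, map_smul]
        by_cases hy0 : bf b c = 0
        · rw [XX_one b hac (by lia), XX_one (a + b) hc (by lia), eps_add_left, eps_add_right,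
            add_assoc, add_left_comm a, e5]
          rw [map_zero]
          push_cast
          module
        · rw [XX_zero b (by lia) (by lia), XX_zero (a + b) (by lia) (by lia)]; simp
      · rw [XX_zero a (c := c) hx2 hx1]
        by_cases hz : bf (a + b) c = -1 ∨ bf (a + b) c = -2
        · lia
        · rw [XX_zero (a + b) (by lia) (by lia)]; simp
end PaperStmt.E8m

namespace PaperStmt.E8m
open Module Chk

lemma ndiv (a b : ℕ) : Nat.div a b = a / b := rfl
lemma nmod (a b : ℕ) : Nat.mod a b = a % b := rfl

/-- Test for roots of type `E₈` in terms of digits. -/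
def q8 (c : ℕ) : Bool :=
  let u0 := Nat.mod (Nat.div c 1) 64
  let u1 := Nat.mod (Nat.div c 64) 64
  let u2 := Nat.mod (Nat.div c 4096) 64
  let u3 := Nat.mod (Nat.div c 262144) 64
  let u4 := Nat.mod (Nat.div c 16777216) 64
  let u5 := Nat.mod (Nat.div c 1073741824) 64
  let u6 := Nat.mod (Nat.div c 68719476736) 64
  let u7 := Nat.mod (Nat.div c 4398046511104) 64
  Nat.beq (Nat.add (1024) (Nat.add (Nat.mul u0 u0) (Nat.add (Nat.mul u1 u1) (Nat.add (Nat.mul u2 u2) (Nat.add (Nat.mul u3 u3) (Nat.add (Nat.mul u4 u4) (Nat.add (Nat.mul u5 u5) (Nat.add (Nat.mul u6 u6) (Nat.add (Nat.mul u7 u7) (Nat.mul 32 u3))))))))))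
    (Nat.add (1) (Nat.add (Nat.mul u0 u2) (Nat.add (Nat.mul u1 u3) (Nat.add (Nat.mul u2 u3) (Nat.add (Nat.mul u3 u4) (Nat.add (Nat.mul u4 u5) (Nat.add (Nat.mul u5 u6) (Nat.add (Nat.mul u6 u7) (Nat.mul 32 (Nat.add u0 (Nat.add u1 u7)))))))))))

def par (a b : ℕ) : ℕ :=
  Nat.mod
    (Nat.add (Nat.mul (Nat.mod (Nat.div a 1) 64) (Nat.add (Nat.mod (Nat.div b 1) 64) (Nat.mod (Nat.div b 4096) 64)))
    (Nat.add (Nat.mul (Nat.mod (Nat.div a 64) 64) (Nat.add (Nat.mod (Nat.div b 64) 64) (Nat.mod (Nat.div b 262144) 64)))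
    (Nat.add (Nat.mul (Nat.mod (Nat.div a 4096) 64) (Nat.add (Nat.mod (Nat.div b 4096) 64) (Nat.mod (Nat.div b 262144) 64)))
    (Nat.add (Nat.mul (Nat.mod (Nat.div a 262144) 64) (Nat.add (Nat.mod (Nat.div b 262144) 64) (Nat.mod (Nat.div b 16777216) 64)))
    (Nat.add (Nat.mul (Nat.mod (Nat.div a 16777216) 64) (Nat.add (Nat.mod (Nat.div b 16777216) 64) (Nat.mod (Nat.div b 1073741824) 64)))
    (Nat.add (Nat.mul (Nat.mod (Nat.div a 1073741824) 64) (Nat.add (Nat.mod (Nat.div b 1073741824) 64) (Nat.mod (Nat.div b 68719476736) 64)))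
    (Nat.add (Nat.mul (Nat.mod (Nat.div a 68719476736) 64) (Nat.add (Nat.mod (Nat.div b 68719476736) 64) (Nat.mod (Nat.div b 4398046511104) 64))) (Nat.mul (Nat.mod (Nat.div a 4398046511104) 64) (Nat.mod (Nat.div b 4398046511104) 64))))))))) 2

/-- Structure constants of type `E₈`. -/
def NE (a b : ℕ) : ℤ :=
  bif q8 (Nat.sub (Nat.add a b) OFF) then
    (bif Nat.beq (par a b) 0 then Int.ofNat 1 else Int.negSucc 0) else Int.ofNat 0

/-- Test for keys. -/
def r8 (k : ℕ) : Bool :=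
  Nat.blt k 281474976710656 && q8 k &&
    [1,64,4096,262144,16777216,1073741824,68719476736,4398046511104].all fun p =>
      Nat.blt 16 (Nat.mod (Nat.div k p) 64) && Nat.blt (Nat.mod (Nat.div k p) 64) 48

def D8 : RD := ⟨8, [[2, 0, -1, 0, 0, 0, 0, 0], [0, 2, 0, -1, 0, 0, 0, 0], [-1, 0, 2, -1, 0, 0, 0, 0], [0, -1, -1, 2, -1, 0, 0, 0], [0, 0, 0, -1, 2, -1, 0, 0], [0, 0, 0, 0, -1, 2, -1, 0], [0, 0, 0, 0, 0, -1, 2, -1], [0, 0, 0, 0, 0, 0, -1, 2]], [], [], NE⟩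

def qv (k : ℕ) : Q := fun i => vec k i

lemma qv_ap {k : ℕ} (hk : 8 ≤ k) (i : Fin 8) : qv k i = ((k / 64 ^ (i : ℕ) % 64 : ℕ) : ℤ) - 32 := by
  rw [qv, vec, if_neg (by lia)]

lemma q8_iff {c : ℕ} (hc : 8 ≤ c) : q8 c = true ↔ rt (qv c) := by
  simp only [q8, rt, eta, qv_ap hc, Nat.beq_eq, Nat.add_eq, Nat.mul_eq, ndiv, nmod]
  zify
  norm_num
  constructor <;> intro h <;> linear_combination h

lemma par_aux (u w : Fin 8 → ℤ) : ∃ t, (u 0 * (w 0 + w 2) + u 1 * (w 1 + w 3) + u 2 * (w 2 + w 3) + u 3 * (w 3 + w 4) + u 4 * (w 4 + w 5) + u 5 * (w 5 + w 6) + u 6 * (w 6 + w 7) + u 7 * w 7 : ℤ) =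
    eta (fun i => u i - 32) (fun i => w i - 32) + 2 * t := by
  refine ⟨(u 0 * w 2 + 16 * (w 0 - w 2)) + (u 1 * w 3 + 16 * (w 1 - w 3)) + (u 2 * w 3 + 16 * (w 2 - w 3)) + (u 3 * w 4 + 16 * (w 3 - w 4)) + (u 4 * w 5 + 16 * (w 4 - w 5)) + (u 5 * w 6 + 16 * (w 5 - w 6)) + (u 6 * w 7 + 16 * (w 6 - w 7)) + (16 * u 7 + 16 * w 7 - 512), ?_⟩
  simp only [eta]; ring

lemma par_eq {a b : ℕ} (ha : 8 ≤ a) (hb : 8 ≤ b) :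
    (bif Nat.beq (par a b) 0 then Int.ofNat 1 else Int.negSucc 0) = eps (qv a) (qv b) := by
  have hq : ∀ {k : ℕ}, 8 ≤ k → qv k = fun i : Fin 8 => ((k / 64 ^ (i : ℕ) % 64 : ℕ) : ℤ) - 32 :=
    fun hk => funext fun i => qv_ap hk i
  obtain ⟨t, ht⟩ := par_aux (fun i : Fin 8 => ((a / 64 ^ (i : ℕ) % 64 : ℕ) : ℤ))
    (fun i : Fin 8 => ((b / 64 ^ (i : ℕ) % 64 : ℕ) : ℤ))
  rw [← hq ha, ← hq hb] at ht
  have hp : ((par a b : ℕ) : ℤ) = (eta (qv a) (qv b) + 2 * t) % 2 := by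
    rw [← ht]
    simp only [par, Nat.add_eq, Nat.mul_eq, ndiv, nmod]
    push_cast
    norm_num
    congr 1
    ring
  rw [Int.add_mul_emod_self_left] at hp
  rw [eps]
  rcases Int.even_or_odd (eta (qv a) (qv b)) with h | h
  · rw [Int.negOnePow_even _ h]
    have : par a b = 0 := by
      rw [Int.even_iff.1 h] at hp; exact_mod_cast hp
    rw [this]; rfl
  · rw [Int.negOnePow_odd _ h]
    have : par a b = 1 := by
      rw [Int.odd_iff.1 h] at hp; exact_mod_cast hp
    rw [this]; rfl

lemma r8_dig {k : ℕ} (h : r8 k = true) : k < 281474976710656 ∧ q8 k = true ∧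
    ∀ i : Fin 8, 16 < k / 64 ^ (i : ℕ) % 64 ∧ k / 64 ^ (i : ℕ) % 64 < 48 := by
  simp only [r8, Bool.and_eq_true, List.all_cons, List.all_nil, Nat.blt_eq, ndiv, nmod] at h
  refine ⟨h.1.1, h.1.2, fun i => ?_⟩
  obtain ⟨_, h0, h1, h2, h3, h4, h5, h6, h7, _⟩ := h
  fin_cases i
  · simpa using h0
  · simpa using h1
  · simpa using h2
  · simpa using h3
  · simpa using h4
  · simpa using h5
  · simpa using h6
  · simpa using h7

lemma expand {k : ℕ} (h : k < 281474976710656) :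
    k = ∑ i : Fin 8, (k / 64 ^ (i : ℕ) % 64) * 64 ^ (i : ℕ) := by
  simp only [Fin.sum_univ_eight]
  norm_num
  omega

lemma digit (w : Fin 8 → ℕ) (hw : ∀ i, w i < 64) (i : Fin 8) :
    (∑ i : Fin 8, w i * 64 ^ (i : ℕ)) / 64 ^ (i : ℕ) % 64 = w i := by
  have h0 := hw 0
  have h1 := hw 1
  have h2 := hw 2
  have h3 := hw 3
  have h4 := hw 4
  have h5 := hw 5
  have h6 := hw 6
  have h7 := hw 7
  simp only [Fin.sum_univ_eight]
  fin_cases i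
  · change _ = w 0
    norm_num; omega
  · change _ = w 1
    norm_num; omega
  · change _ = w 2
    norm_num; omega
  · change _ = w 3
    norm_num; omega
  · change _ = w 4
    norm_num; omega
  · change _ = w 5
    norm_num; omega
  · change _ = w 6
    norm_num; omega
  · change _ = w 7
    norm_num; omega

lemma r8_ge {k : ℕ} (h : r8 k = true) : 8 ≤ k := by
  have := (r8_dig h).2.2 1
  by_contra h'
  norm_num at this
  omega

lemma r8_rt {k : ℕ} (h : r8 k = true) : rt (qv k) := (q8_iff (r8_ge h)).1 (r8_dig h).2.1

lemma add_key {a b : ℕ} (ha : r8 a = true) (hb : r8 b = true) :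
    8 ≤ a + b - OFF ∧ qv (a + b - OFF) = qv a + qv b := by
  have a1 := r8_dig ha
  have b1 := r8_dig hb
  have h1 : a + b - OFF = ∑ i : Fin 8, (a / 64 ^ (i : ℕ) % 64 + b / 64 ^ (i : ℕ) % 64 - 32) * 64 ^ (i : ℕ) := by
    have h2 : OFF = ∑ i : Fin 8, 32 * 64 ^ (i : ℕ) := by decide
    have h3 : a + b = (∑ i : Fin 8, (a / 64 ^ (i : ℕ) % 64 + b / 64 ^ (i : ℕ) % 64 - 32) * 64 ^ (i : ℕ)) + OFF := by
      conv_lhs => rw [expand a1.1, expand b1.1]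
      rw [h2, ← Finset.sum_add_distrib, ← Finset.sum_add_distrib]
      refine Finset.sum_congr rfl fun i _ => ?_
      rw [← add_mul, ← add_mul]
      congr 1
      have := a1.2.2 i
      have := b1.2.2 i
      omega
    omega
  have h4 := digit (fun i => a / 64 ^ (i : ℕ) % 64 + b / 64 ^ (i : ℕ) % 64 - 32) (fun i => by
    have := a1.2.2 i
    have := b1.2.2 i
    omega)
  rw [← h1] at h4
  have h5 : 8 ≤ a + b - OFF := by
    have h6 := h4 1
    have q1 := a1.2.2 1
    have q2 := b1.2.2 1
    norm_num at h6 q1 q2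
    by_contra h'
    have : (a + b - OFF) / 64 = 0 := by omega
    omega
  refine ⟨h5, funext fun i => ?_⟩
  rw [Pi.add_apply, qv_ap h5, h4 i, qv_ap (r8_ge ha), qv_ap (r8_ge hb)]
  have := a1.2.2 i
  have := b1.2.2 i
  omega

lemma opp_key {a b : ℕ} (ha : r8 a = true) (hb : r8 b = true) (h : qv a = - qv b) :
    a + b = 2 * OFF := by
  have a1 := r8_dig ha
  have b1 := r8_dig hb
  have h2 : 2 * OFF = ∑ i : Fin 8, 64 * 64 ^ (i : ℕ) := by decide
  rw [h2]
  conv_lhs => rw [expand a1.1, expand b1.1]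
  rw [← Finset.sum_add_distrib]
  refine Finset.sum_congr rfl fun i _ => ?_
  rw [← add_mul]
  congr 1
  have h3 := congrFun h i
  rw [Pi.neg_apply, qv_ap (r8_ge ha), qv_ap (r8_ge hb)] at h3
  omega

/-- Basis elements of the model. -/
noncomputable def X8 (k : ℕ) : End ℂ V :=
  if h : k < 8 then HH (cc (Pi.single ⟨k, h⟩ 1)) else XX (qv k)

attribute [local instance] LieRing.ofAssociativeRing

lemma X8_ge {k : ℕ} (h : 8 ≤ k) : X8 k = XX (qv k) := by rw [X8, dif_neg (by lia)]

lemma D8_brk {a b : ℕ} (ha : 8 ≤ a) (hb : 8 ≤ b) :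
    D8.brk a b = bif zb (NE a b) then [] else [(a + b - OFF, NE a b)] := by
  have ca : Nat.blt a 8 = false := by rw [← Bool.not_eq_true]; simpa using ha
  have cb : Nat.blt b 8 = false := by rw [← Bool.not_eq_true]; simpa using hb
  rw [RD.brk, ca, cb, cond_false, cond_false, Nat.sub_eq, Nat.add_eq, D8]

lemma NE_eq {a b : ℕ} (ha : 8 ≤ a) (hb : 8 ≤ b) :
    NE a b = bif q8 (a + b - OFF) then eps (qv a) (qv b) else 0 := by
  rw [← par_eq ha hb, NE, Nat.sub_eq, Nat.add_eq]
  rfl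

lemma ev_one (x : ℕ → End ℂ V) (N : ℤ) (c : ℕ) :
    ev x (bif zb N then [] else [(c, N)]) = (N : ℂ) • x c := by
  cases h : zb N
  · rw [cond_false, ev_cons, ev_nil, add_zero]
  · rw [cond_true, ev_nil, zb_iff.1 h, Int.cast_zero, zero_smul]

lemma X8_rr {a b : ℕ} (ha : r8 a = true) (hb : r8 b = true) (h : a + b ≠ 2 * OFF) :
    ⁅X8 a, X8 b⁆ = ev X8 (D8.brk a b) := by
  have ha8 := r8_ge ha
  have hb8 := r8_ge hb
  have ra := r8_rt ha
  have rb := r8_rt hb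
  obtain ⟨c8, hc⟩ := add_key ha hb
  have hNE := NE_eq ha8 hb8
  have hD := D8_brk ha8 hb8
  generalize a + b - OFF = c at c8 hc hNE hD
  rw [hD, ev_one, X8_ge ha8, X8_ge hb8]
  have hm := ra.ge rb
  have hq := q8_iff c8
  rw [hc, rt_add_iff ra rb] at hq
  have h2 : bf (qv a) (qv b) ≠ -2 := fun h' => h (opp_key ha hb (by
    rw [ra.eq_neg rb h', neg_neg]))
  by_cases h1 : bf (qv a) (qv b) = -1
  · rw [hq.2 h1, cond_true] at hNE
    rw [XX_XX ra rb h1, hNE, X8_ge c8, hc]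
  · have hq' : q8 c = false := by rw [← Bool.not_eq_true]; exact fun h' => h1 (hq.1 h')
    rw [hq', cond_false] at hNE
    rw [XX_comm ra rb (by clear h c8 ha8 hb8; omega), hNE, Int.cast_zero, zero_smul]

lemma D8_row (a : Fin 8) : D8.A.getD a [] =
    List.ofFn fun j : Fin 8 => bf (Pi.single a 1 : Q) (Pi.single j 1) := by
  revert a; decide

lemma bf_row (a : Fin 8) (q : Q) :
    ∑ j : Fin 8, bf (Pi.single a 1 : Q) (Pi.single j 1) * q j = bf (Pi.single a 1) q := by
  fin_cases a <;> simp [bf, eta, Fin.sum_univ_eight, Pi.single_apply] <;> ring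

lemma X8_cr {a b : ℕ} (ha : a < 8) (hb : r8 b = true) : ⁅X8 a, X8 b⁆ = ev X8 (D8.brk a b) := by
  have hb8 := r8_ge hb
  have ca : Nat.blt a 8 = true := by simpa using ha
  have h1 := D8_row ⟨a, ha⟩
  have h2 : bf (Pi.single (⟨a, ha⟩ : Fin 8) 1 : Q) (qv b) = dg (D8.A.getD a []) b := by
    rw [← bf_row]
    simp only at h1
    rw [h1, dg_sum]; rfl
  rw [RD.brk, ca, cond_true, ev_cons, ev_nil, add_zero, X8_ge hb8, X8, dif_pos ha,
    HH_XX _ _ (r8_rt hb), bf_cc, h2]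

end PaperStmt.E8m

namespace PaperStmt.Pres
open Module Serre CartanMatrix

variable {n : ℕ} (CM : Matrix (Fin n) (Fin n) ℤ)

/-- The projection of the free Lie algebra. -/
noncomputable def pr : FreeLieAlgebra ℂ (Generators (Fin n)) →ₗ⁅ℂ⁆ Matrix.ToLieAlgebra ℂ CM :=
  { (LieSubmodule.Quotient.mk' (Relations.toIdeal ℂ CM)).toLinearMap with
    map_lie' := fun {x y} => rfl }

lemma pr_surj : Function.Surjective (pr CM) :=
  LieSubmodule.Quotient.surjective_mk' (Relations.toIdeal ℂ CM)

lemma pr_zero {a : FreeLieAlgebra ℂ (Generators (Fin n))} : pr CM a = 0 ↔ a ∈ Relations.toIdeal ℂ CM :=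
  LieSubmodule.Quotient.mk_eq_zero (Relations.toIdeal ℂ CM)

lemma pr_rel {a : FreeLieAlgebra ℂ (Generators (Fin n))} (h : a ∈ Relations.toSet ℂ CM) : pr CM a = 0 :=
  (pr_zero CM).2 (LieSubmodule.subset_lieSpan h)

noncomputable def gE (i : Fin n) : Matrix.ToLieAlgebra ℂ CM := pr CM (FreeLieAlgebra.of ℂ (Generators.E i))
noncomputable def gF (i : Fin n) : Matrix.ToLieAlgebra ℂ CM := pr CM (FreeLieAlgebra.of ℂ (Generators.F i))
noncomputable def gH (i : Fin n) : Matrix.ToLieAlgebra ℂ CM := pr CM (FreeLieAlgebra.of ℂ (Generators.H i))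

lemma map_ad {L M : Type*} [LieRing L] [LieAlgebra ℂ L] [LieRing M] [LieAlgebra ℂ M]
    (f : L →ₗ⁅ℂ⁆ M) (a b : L) (N : ℕ) :
    f (((LieAlgebra.ad ℂ L a) ^ N) b) = ((LieAlgebra.ad ℂ M (f a)) ^ N) (f b) := by
  induction N with
  | zero => simp
  | succ N ih => rw [pow_succ', pow_succ', Module.End.mul_apply, Module.End.mul_apply,
      LieAlgebra.ad_apply, LieAlgebra.ad_apply, LieHom.map_lie, ih]

lemma rHH (i j : Fin n) : ⁅gH CM i, gH CM j⁆ = 0 := by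
  rw [gH, gH, ← LieHom.map_lie]
  exact pr_rel CM (Or.inl (Or.inl (Or.inl (Or.inl (Or.inl ⟨(i, j), rfl⟩)))))

lemma rEF (i j : Fin n) : ⁅gE CM i, gF CM j⁆ = if i = j then gH CM i else 0 := by
  have h := pr_rel CM (Or.inl (Or.inl (Or.inl (Or.inl (Or.inr ⟨(i, j), rfl⟩)))))
  change pr CM (if i = j then ⁅FreeLieAlgebra.of ℂ (Generators.E i), FreeLieAlgebra.of ℂ (Generators.F i)⁆ - FreeLieAlgebra.of ℂ (Generators.H i)
    else ⁅FreeLieAlgebra.of ℂ (Generators.E i), FreeLieAlgebra.of ℂ (Generators.F j)⁆) = 0 at h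
  split_ifs at h ⊢ with hij
  · subst hij
    rw [map_sub, LieHom.map_lie] at h
    exact sub_eq_zero.1 h
  · rw [LieHom.map_lie] at h
    exact h

lemma rHE (i j : Fin n) : ⁅gH CM i, gE CM j⁆ = (CM i j : ℂ) • gE CM j := by
  have h := pr_rel CM (Or.inl (Or.inl (Or.inl (Or.inr ⟨(i, j), rfl⟩))))
  change pr CM (⁅FreeLieAlgebra.of ℂ (Generators.H i), FreeLieAlgebra.of ℂ (Generators.E j)⁆ - CM i j • FreeLieAlgebra.of ℂ (Generators.E j)) = 0 at h
  rw [map_sub, LieHom.map_lie, map_zsmul] at h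
  rw [Int.cast_smul_eq_zsmul]
  exact sub_eq_zero.1 h

lemma rHF (i j : Fin n) : ⁅gH CM i, gF CM j⁆ = -((CM i j : ℂ) • gF CM j) := by
  have h := pr_rel CM (Or.inl (Or.inl (Or.inr ⟨(i, j), rfl⟩)))
  change pr CM (⁅FreeLieAlgebra.of ℂ (Generators.H i), FreeLieAlgebra.of ℂ (Generators.F j)⁆ + CM i j • FreeLieAlgebra.of ℂ (Generators.F j)) = 0 at h
  rw [map_add, LieHom.map_lie, map_zsmul] at h
  rw [Int.cast_smul_eq_zsmul]
  exact eq_neg_of_add_eq_zero_left h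

lemma rE (i j : Fin n) :
    ((LieAlgebra.ad ℂ (Matrix.ToLieAlgebra ℂ CM) (gE CM i)) ^ ((-CM i j).toNat + 1)) (gE CM j) = 0 := by
  have h := pr_rel CM (Or.inl (Or.inr ⟨(i, j), rfl⟩))
  change pr CM (((LieAlgebra.ad ℂ _ (FreeLieAlgebra.of ℂ (Generators.E i))) ^ (-CM i j).toNat)
    ⁅FreeLieAlgebra.of ℂ (Generators.E i), FreeLieAlgebra.of ℂ (Generators.E j)⁆) = 0 at h
  rw [map_ad, LieHom.map_lie] at h
  rw [pow_succ, Module.End.mul_apply, LieAlgebra.ad_apply]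
  exact h

lemma rF (i j : Fin n) :
    ((LieAlgebra.ad ℂ (Matrix.ToLieAlgebra ℂ CM) (gF CM i)) ^ ((-CM i j).toNat + 1)) (gF CM j) = 0 := by
  have h := pr_rel CM (Or.inr ⟨(i, j), rfl⟩)
  change pr CM (((LieAlgebra.ad ℂ _ (FreeLieAlgebra.of ℂ (Generators.F i))) ^ (-CM i j).toNat)
    ⁅FreeLieAlgebra.of ℂ (Generators.F i), FreeLieAlgebra.of ℂ (Generators.F j)⁆) = 0 at h
  rw [map_ad, LieHom.map_lie] at h
  rw [pow_succ, Module.End.mul_apply, LieAlgebra.ad_apply]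
  exact h

lemma gen_top : LieSubalgebra.lieSpan ℂ (Matrix.ToLieAlgebra ℂ CM)
    (Set.range (gE CM) ∪ Set.range (gF CM)) = ⊤ := by
  set S := LieSubalgebra.lieSpan ℂ (Matrix.ToLieAlgebra ℂ CM)
    (Set.range (gE CM) ∪ Set.range (gF CM)) with hS
  have hE : ∀ i, gE CM i ∈ S := fun i => LieSubalgebra.subset_lieSpan (Or.inl ⟨i, rfl⟩)
  have hF : ∀ i, gF CM i ∈ S := fun i => LieSubalgebra.subset_lieSpan (Or.inr ⟨i, rfl⟩)
  have hH : ∀ i, gH CM i ∈ S := fun i => by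
    have := S.lie_mem (hE i) (hF i)
    rwa [rEF, if_pos rfl] at this
  have hg : ∀ g, pr CM (FreeLieAlgebra.of ℂ g) ∈ S := by
    rintro (i | i | i)
    exacts [hH i, hE i, hF i]
  let ρ : FreeLieAlgebra ℂ (Generators (Fin n)) →ₗ⁅ℂ⁆ S :=
    FreeLieAlgebra.lift ℂ fun g => ⟨pr CM (FreeLieAlgebra.of ℂ g), hg g⟩
  have hρ : S.incl.comp ρ = pr CM := by
    refine FreeLieAlgebra.hom_ext fun g => ?_
    rw [LieHom.comp_apply, FreeLieAlgebra.lift_of_apply]; rfl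
  rw [eq_top_iff]
  intro t _
  obtain ⟨a, rfl⟩ := pr_surj CM t
  rw [← hρ]
  exact (ρ a).2

lemma chev (h2 : ∀ i, CM i i = 2) : Chev (fun i j => CM i j) (gE CM) (gF CM) (gH CM) where
  diag := h2
  HH := rHH CM
  HE := rHE CM
  HF := rHF CM
  EF := rEF CM
  nE i j := ⟨_, rE CM i j⟩
  nF i j := ⟨_, rF CM i j⟩
  gen := gen_top CM

variable {L : Type*} [LieRing L] [LieAlgebra ℂ L]

lemma hom (e f h : Fin n → L) (hHH : ∀ i j, ⁅h i, h j⁆ = 0)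
    (hEF : ∀ i j, ⁅e i, f j⁆ = if i = j then h i else 0)
    (hHE : ∀ i j, ⁅h i, e j⁆ = (CM i j : ℂ) • e j)
    (hHF : ∀ i j, ⁅h i, f j⁆ = -((CM i j : ℂ) • f j))
    (hE : ∀ i j, ((LieAlgebra.ad ℂ L (e i)) ^ ((-CM i j).toNat + 1)) (e j) = 0)
    (hF : ∀ i j, ((LieAlgebra.ad ℂ L (f i)) ^ ((-CM i j).toNat + 1)) (f j) = 0) :
    ∃ φ : Matrix.ToLieAlgebra ℂ CM →ₗ⁅ℂ⁆ L, (∀ i, φ (gE CM i) = e i) ∧ (∀ i, φ (gF CM i) = f i) ∧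
      ∀ i, φ (gH CM i) = h i := by
  let ψ : FreeLieAlgebra ℂ (Generators (Fin n)) →ₗ⁅ℂ⁆ L := FreeLieAlgebra.lift ℂ fun g =>
    match g with
    | .H i => h i
    | .E i => e i
    | .F i => f i
  have pE : ∀ i, ψ (FreeLieAlgebra.of ℂ (Generators.E i)) = e i := fun i => FreeLieAlgebra.lift_of_apply ..
  have pF : ∀ i, ψ (FreeLieAlgebra.of ℂ (Generators.F i)) = f i := fun i => FreeLieAlgebra.lift_of_apply ..
  have pH : ∀ i, ψ (FreeLieAlgebra.of ℂ (Generators.H i)) = h i := fun i => FreeLieAlgebra.lift_of_apply ..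
  have hI : Relations.toIdeal ℂ CM ≤ ψ.ker := by
    refine LieSubmodule.lieSpan_le.2 ?_
    rintro a (((((⟨⟨i, j⟩, rfl⟩ | ⟨⟨i, j⟩, rfl⟩) | ⟨⟨i, j⟩, rfl⟩) | ⟨⟨i, j⟩, rfl⟩) | ⟨⟨i, j⟩, rfl⟩) | ⟨⟨i, j⟩, rfl⟩)
    · change ψ ⁅FreeLieAlgebra.of ℂ (Generators.H i), FreeLieAlgebra.of ℂ (Generators.H j)⁆ = 0
      rw [LieHom.map_lie, pH, pH, hHH]
    · change ψ (if i = j then ⁅FreeLieAlgebra.of ℂ (Generators.E i), FreeLieAlgebra.of ℂ (Generators.F i)⁆ - FreeLieAlgebra.of ℂ (Generators.H i) else ⁅FreeLieAlgebra.of ℂ (Generators.E i), FreeLieAlgebra.of ℂ (Generators.F j)⁆) = 0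
      split_ifs with hij
      · rw [map_sub, LieHom.map_lie, pH, pE, pF, hEF, if_pos rfl, sub_self]
      · rw [LieHom.map_lie, pE, pF, hEF, if_neg hij]
    · change ψ (⁅FreeLieAlgebra.of ℂ (Generators.H i), FreeLieAlgebra.of ℂ (Generators.E j)⁆ - CM i j • FreeLieAlgebra.of ℂ (Generators.E j)) = 0
      rw [map_sub, LieHom.map_lie, map_zsmul, pH, pE, hHE, Int.cast_smul_eq_zsmul, sub_self]
    · change ψ (⁅FreeLieAlgebra.of ℂ (Generators.H i), FreeLieAlgebra.of ℂ (Generators.F j)⁆ + CM i j • FreeLieAlgebra.of ℂ (Generators.F j)) = 0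
      rw [map_add, LieHom.map_lie, map_zsmul, pH, pF, hHF, Int.cast_smul_eq_zsmul, neg_add_cancel]
    · change ψ (((LieAlgebra.ad ℂ _ (FreeLieAlgebra.of ℂ (Generators.E i))) ^ (-CM i j).toNat) ⁅FreeLieAlgebra.of ℂ (Generators.E i), FreeLieAlgebra.of ℂ (Generators.E j)⁆) = 0
      rw [map_ad, LieHom.map_lie, pE, pE, ← hE i j, pow_succ, Module.End.mul_apply, LieAlgebra.ad_apply]
    · change ψ (((LieAlgebra.ad ℂ _ (FreeLieAlgebra.of ℂ (Generators.F i))) ^ (-CM i j).toNat) ⁅FreeLieAlgebra.of ℂ (Generators.F i), FreeLieAlgebra.of ℂ (Generators.F j)⁆) = 0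
      rw [map_ad, LieHom.map_lie, pF, pF, ← hF i j, pow_succ, Module.End.mul_apply, LieAlgebra.ad_apply]
  let φ0 : Matrix.ToLieAlgebra ℂ CM →ₗ[ℂ] L :=
    Submodule.liftQ (Relations.toIdeal ℂ CM).toSubmodule ψ.toLinearMap (fun a ha => hI ha)
  have hφ0 : ∀ a, φ0 (pr CM a) = ψ a := fun a => rfl
  let φ : Matrix.ToLieAlgebra ℂ CM →ₗ⁅ℂ⁆ L :=
    { φ0 with
      map_lie' := fun {x y} => by
        obtain ⟨a, rfl⟩ := pr_surj CM x
        obtain ⟨b, rfl⟩ := pr_surj CM y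
        change φ0 ⁅pr CM a, pr CM b⁆ = ⁅φ0 (pr CM a), φ0 (pr CM b)⁆
        rw [← LieHom.map_lie, hφ0, hφ0, hφ0, LieHom.map_lie] }
  exact ⟨φ, pE, pF, pH⟩

end PaperStmt.Pres

namespace PaperStmt.Pres
open Module Serre Chk

/-- Keys of simple roots and their opposites. -/
def ap (i : ℕ) : ℕ := OFF + 64 ^ i
def an (i : ℕ) : ℕ := OFF - 64 ^ i

/-- Check of the Serre relations. -/
def ser (D : RD) (a : ℕ) : ℕ → Vec → Bool
  | 0, v => isZero v
  | m + 1, v => (v.all fun p => memb p.1 D.rk && !(Nat.beq (Nat.add a p.1) (Nat.mul 2 OFF))) &&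
      ser D a m (D.bil [(a, 1)] v)

/-- Combinatorial properties of root data. -/
structure Ck {n : ℕ} (CM : Matrix (Fin n) (Fin n) ℤ) (D : RD) : Prop where
  hn : D.n = n
  n8 : n ≤ 8
  diag : ∀ i, CM i i = 2
  rk8 : ∀ k ∈ D.rk, 8 ≤ k ∧ k ≠ OFF
  nodup : D.rk.Nodup
  row : ∀ i : Fin n, D.A.getD i [] = List.ofFn fun j : Fin n => CM i j
  sgn : ∀ k ∈ D.rk, ((∀ i : Fin n, 0 ≤ vec k i) ∨ (∀ i : Fin n, vec k i ≤ 0)) ∧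
    ∃ i : Fin n, vec k i ≠ 0
  inv : ∃ (W : Fin n → Fin n → ℤ) (d : ℤ), d ≠ 0 ∧
    ∀ l j, ∑ i, W l i * CM i j = if l = j then d else 0
  pos : ∃ c : Fin n → ℕ, ∀ j, ∑ i, (c i : ℤ) * CM i j = 2
  dgk : ∀ k ∈ D.rk, dg (List.ofFn fun i : Fin n => 64 ^ (i : ℕ)) k = k - OFF
  gram : D.G = List.ofFn fun i : Fin n => List.ofFn fun j : Fin n =>
    (D.rk.map fun k => vec k i * vec k j).sum
  smp : ∀ i : Fin n, ap i ∈ D.rk ∧ an i ∈ D.rk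
  vecp : ∀ i j : Fin n, vec (ap i) j = if j = i then 1 else 0
  vecn : ∀ i j : Fin n, vec (an i) j = if j = i then -1 else 0
  off : ∀ i j : Fin n, i ≠ j → D.Nf (ap i) (an j) = 0 ∧ ap i + an j ≠ 2 * OFF
  op : ∀ a ∈ D.rk, ∀ i : Fin n, vec (2 * OFF - a) i = -vec a i
  gen : ∀ k ∈ D.rk, (∃ i : Fin n, k = ap i) ∨ (∃ i : Fin n, k = an i) ∨
    (∃ i : Fin n, ap i < k ∧ k - 64 ^ (i : ℕ) ∈ D.rk ∧ D.Nf (ap i) (k - 64 ^ (i : ℕ)) ≠ 0 ∧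
      D.Nf (an i) k ≠ 0) ∨
    (∃ i : Fin n, k < an i ∧ k + 64 ^ (i : ℕ) ∈ D.rk ∧ D.Nf (an i) (k + 64 ^ (i : ℕ)) ≠ 0 ∧
      D.Nf (ap i) k ≠ 0)
  stab : ∀ i : Fin n, ∀ b ∈ D.rk,
    (D.Nf (ap i) b = 0 ∨ ap i + b = 2 * OFF ∨ ap i + b - OFF ∈ D.rk) ∧
    (D.Nf (an i) b = 0 ∨ an i + b = 2 * OFF ∨ an i + b - OFF ∈ D.rk)
  sre : ∀ i j : Fin n, ser D (ap i) ((-CM i j).toNat + 1) [(ap j, 1)] = true ∧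
    ser D (an i) ((-CM i j).toNat + 1) [(an j, 1)] = true

variable {n : ℕ} {CM : Matrix (Fin n) (Fin n) ℤ} {D : RD}
variable {L : Type*} [LieRing L] [LieAlgebra ℂ L] {X : ℕ → L}

/-- A model. -/
structure Md (n : ℕ) (D : RD) (X : ℕ → L) : Prop where
  brk : ∀ a ∈ D.rk, ∀ b ∈ D.rk, a + b ≠ 2 * OFF → ⁅X a, X b⁆ = ev X (D.brk a b)
  HH : ∀ i j : Fin n, ⁅X i, X j⁆ = 0
  car : ∀ i : Fin n, ∀ k ∈ D.rk, ⁅X i, X k⁆ = (dg (D.A.getD i []) k : ℂ) • X k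
  opp : ∀ i : Fin n, ⁅X (ap i), X (an i)⁆ = -X i
  nz : ∀ i : Fin n, X (ap i) ≠ 0

lemma ev_brk (X : ℕ → L) {a b : ℕ} (ha : 8 ≤ a) (hb : 8 ≤ b) :
    ev X (D.brk a b) = (D.Nf a b : ℂ) • X (a + b - OFF) := by
  have ca : Nat.blt a 8 = false := by rw [← Bool.not_eq_true]; simpa using ha
  have cb : Nat.blt b 8 = false := by rw [← Bool.not_eq_true]; simpa using hb
  rw [RD.brk, ca, cb, cond_false, cond_false, Nat.sub_eq, Nat.add_eq]
  cases h : zb (D.Nf a b)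
  · rw [cond_false, ev_cons, ev_nil, add_zero]
  · rw [cond_true, ev_nil, zb_iff.1 h, Int.cast_zero, zero_smul]


lemma Md.b (M : Md n D X) (C : Ck CM D) {a b : ℕ} (ha : a ∈ D.rk) (hb : b ∈ D.rk)
    (h : a + b ≠ 2 * OFF) : ⁅X a, X b⁆ = (D.Nf a b : ℂ) • X (a + b - OFF) := by
  rw [M.brk a ha b hb h, ev_brk X (C.rk8 a ha).1 (C.rk8 b hb).1]

lemma Md.c (M : Md n D X) (C : Ck CM D) (i : Fin n) {k : ℕ} (hk : k ∈ D.rk) :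
    ⁅X i, X k⁆ = ((∑ j : Fin n, CM i j * vec k j : ℤ) : ℂ) • X k := by
  rw [M.car i k hk, C.row, dg_sum]

lemma Md.ser (M : Md n D X) {a : ℕ} (ha : a ∈ D.rk) (m : ℕ) (v : Vec)
    (h : ser D a m v = true) : ((LieAlgebra.ad ℂ L (X a)) ^ m) (ev X v) = 0 := by
  induction m generalizing v with
  | zero => rw [pow_zero]; exact ev_zero X v h
  | succ m ih =>
    rw [Pres.ser, Bool.and_eq_true, List.all_eq_true] at h
    have h1 : ⁅ev X [(a, 1)], ev X v⁆ = ev X (D.bil [(a, 1)] v) := by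
      refine ev_bil D X _ _ fun p hp q hq => ?_
      rw [List.mem_singleton] at hp
      subst hp
      have h2 := h.1 q hq
      rw [Bool.and_eq_true, memb_iff, Bool.not_eq_true', ← Bool.not_eq_true, Nat.beq_eq, Nat.add_eq, Nat.mul_eq] at h2
      exact M.brk a ha q.1 h2.1 h2.2
    have h3 : ev X [(a, 1)] = X a := by simp [ev_cons, ev_nil]
    rw [pow_succ, Module.End.mul_apply, LieAlgebra.ad_apply, ← ih _ h.2, ← h1, h3]

lemma pow_off {i : ℕ} (h : i < 8) : 64 ^ i ≤ OFF ∧ 0 < 64 ^ i := by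
  refine ⟨(Nat.pow_le_pow_right (by norm_num) (Nat.le_of_lt_succ h)).trans ?_, by positivity⟩
  rw [OFF]; norm_num

lemma Md.li0 (M : Md n D X) (C : Ck CM D) : LinearIndependent ℂ fun i : Fin n => X i := by
  obtain ⟨W, d, hd, hW⟩ := C.inv
  rw [Fintype.linearIndependent_iff]
  intro g hg
  have h1 : ∀ j : Fin n, ∑ i, g i * (CM i j : ℂ) = 0 := by
    intro j
    have h2 : ⁅∑ i, g i • X i, X (ap j)⁆ = (∑ i, g i * (CM i j : ℂ)) • X (ap j) := by
      rw [sum_lie, Finset.sum_smul]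
      refine Finset.sum_congr rfl fun i _ => ?_
      rw [smul_lie, M.c C i (C.smp j).1, smul_smul]
      simp [C.vecp]
    rw [hg, zero_lie] at h2
    exact (smul_eq_zero.1 h2.symm).resolve_right (M.nz j)
  have h3 : Matrix.vecMul g (CM.map (Int.cast : ℤ → ℂ)) = 0 := by
    funext j
    exact h1 j
  have hd' : (d : ℂ) ≠ 0 := by exact_mod_cast hd
  have h4 : ((d : ℂ)⁻¹ • (Matrix.of fun l i => (W l i : ℂ))) * CM.map (Int.cast : ℤ → ℂ) = 1 := by
    ext l j
    have h5 : (∑ i, (W l i : ℂ) * (CM i j : ℂ)) = if l = j then (d : ℂ) else 0 := by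
      have := congrArg (Int.cast : ℤ → ℂ) (hW l j)
      push_cast at this
      exact this
    rw [Matrix.smul_mul, Matrix.smul_apply, Matrix.mul_apply, Matrix.one_apply]
    simp only [Matrix.of_apply, Matrix.map_apply]
    rw [h5]
    split_ifs <;> simp [hd']
  have h5 := mul_eq_one_comm.1 h4
  have h6 : g = 0 := by
    rw [← Matrix.vecMul_one g, ← h5, ← Matrix.vecMul_vecMul, h3, Matrix.zero_vecMul]
  intro i
  rw [h6]; rfl

lemma Md.nzk (M : Md n D X) (C : Ck CM D) (k : ℕ) (hk : k ∈ D.rk) : X k ≠ 0 := by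
  have hi (i : Fin n) := pow_off (lt_of_lt_of_le i.2 C.n8)
  suffices H : ∀ m : ℕ, ∀ k ∈ D.rk, (k - OFF) + (OFF - k) ≤ m → X k ≠ 0 from H _ k hk le_rfl
  intro m
  induction m with
  | zero =>
    intro k hk h
    have := (C.rk8 k hk).2
    lia
  | succ m ih =>
    intro k hk h h0
    rcases C.gen k hk with ⟨i, rfl⟩ | ⟨i, rfl⟩ | ⟨i, h1, h2, -, h3⟩ | ⟨i, h1, h2, -, h3⟩
    · exact M.nz i h0
    · have h1 := M.opp i
      rw [h0, lie_zero, eq_comm, neg_eq_zero] at h1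
      exact (M.li0 C).ne_zero i h1
    · have h4 := M.b C (C.smp i).2 hk (by have := hi i; unfold an; unfold ap at h1; lia)
      rw [h0, lie_zero, eq_comm, smul_eq_zero, Int.cast_eq_zero] at h4
      have h5 : an i + k - OFF = k - 64 ^ (i : ℕ) := by have := hi i; unfold an; unfold ap at h1; lia
      rw [h5] at h4
      refine ih _ h2 ?_ (h4.resolve_left h3)
      have := hi i; unfold ap at h1; lia
    · have h4 := M.b C (C.smp i).1 hk (by have := hi i; unfold ap; unfold an at h1; lia)
      rw [h0, lie_zero, eq_comm, smul_eq_zero, Int.cast_eq_zero] at h4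
      have h5 : ap i + k - OFF = k + 64 ^ (i : ℕ) := by have := hi i; unfold ap; unfold an at h1; lia
      rw [h5] at h4
      refine ih _ h2 ?_ (h4.resolve_left h3)
      have := hi i; unfold an at h1; lia

lemma Md.hom (M : Md n D X) (C : Ck CM D) :
    ∃ φ : Matrix.ToLieAlgebra ℂ CM →ₗ⁅ℂ⁆ L, Function.Injective φ ∧
      (∀ i : Fin n, φ (gE CM i) = X (ap i)) ∧ (∀ i : Fin n, φ (gF CM i) = -X (an i)) ∧
      ∀ i : Fin n, φ (gH CM i) = X i := by
  obtain ⟨φ, hE, hF, hH⟩ := Pres.hom CM (fun i => X (ap i)) (fun i => -X (an i)) (fun i => X i)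
    M.HH (fun i j => by
      split_ifs with h
      · subst h; rw [lie_neg, M.opp, neg_neg]
      · rw [lie_neg, M.b C (C.smp i).1 (C.smp j).2 (C.off i j h).2, (C.off i j h).1]; simp)
    (fun i j => by
      rw [M.c C i (C.smp j).1]; simp [C.vecp])
    (fun i j => by
      rw [lie_neg, M.c C i (C.smp j).2]; simp [C.vecn])
    (fun i j => by
      have := M.ser (C.smp i).1 _ _ (C.sre i j).1
      simpa [ev_cons, ev_nil] using this)
    (fun i j => by
      have := M.ser (C.smp i).2 _ _ (C.sre i j).2
      have h3 : ev X [(an j, 1)] = X (an j) := by simp [ev_cons, ev_nil]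
      rw [h3] at this
      rw [map_neg, map_neg, neg_pow, Module.End.mul_apply, this, map_zero, neg_zero])
  obtain ⟨c, hc⟩ := C.pos
  refine ⟨φ, Serre.inj (chev CM C.diag) c hc φ ?_, hE, hF, hH⟩
  simp only [hH]
  exact M.li0 C

lemma Md.range (M : Md n D X) (C : Ck CM D) (R : LieSubalgebra ℂ L)
    (hp : ∀ i : Fin n, X (ap i) ∈ R) (hm : ∀ i : Fin n, X (an i) ∈ R) (k : ℕ) (hk : k ∈ D.rk) :
    X k ∈ R := by
  have hi (i : Fin n) := pow_off (lt_of_lt_of_le i.2 C.n8)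
  suffices H : ∀ m : ℕ, ∀ k ∈ D.rk, (k - OFF) + (OFF - k) ≤ m → X k ∈ R from H _ k hk le_rfl
  have hdv : ∀ {c : ℤ} {y : L}, c ≠ 0 → (c : ℂ) • y ∈ R → y ∈ R := by
    intro c y hc hy
    have h1 := R.smul_mem (c : ℂ)⁻¹ hy
    rwa [smul_smul, inv_mul_cancel₀ (by exact_mod_cast hc), one_smul] at h1
  intro m
  induction m with
  | zero =>
    intro k hk h
    have := (C.rk8 k hk).2
    lia
  | succ m ih =>
    intro k hk h
    rcases C.gen k hk with ⟨i, rfl⟩ | ⟨i, rfl⟩ | ⟨i, h1, h2, h3, -⟩ | ⟨i, h1, h2, h3, -⟩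
    · exact hp i
    · exact hm i
    · have h4 := M.b C (C.smp i).1 h2 (by have := hi i; unfold ap at h1 ⊢; lia)
      have h5 : ap i + (k - 64 ^ (i : ℕ)) - OFF = k := by have := hi i; unfold ap at h1 ⊢; lia
      rw [h5] at h4
      refine hdv h3 ?_
      rw [← h4]
      exact R.lie_mem (hp i) (ih _ h2 (by have := hi i; unfold ap at h1; lia))
    · have h4 := M.b C (C.smp i).2 h2 (by have := hi i; unfold an at h1 ⊢; lia)
      have h5 : an i + (k + 64 ^ (i : ℕ)) - OFF = k := by have := hi i; unfold an at h1 ⊢; lia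
      rw [h5] at h4
      refine hdv h3 ?_
      rw [← h4]
      exact R.lie_mem (hm i) (ih _ h2 (by have := hi i; unfold an at h1; lia))
end PaperStmt.Pres

namespace PaperStmt.Pres
open Module Serre Chk

variable {n : ℕ} {CM : Matrix (Fin n) (Fin n) ℤ} {D : RD}
variable {L : Type*} [LieRing L] [LieAlgebra ℂ L] {X : ℕ → L}

/-- Transport of a model to the abstract algebra. -/
lemma Md.pull (M : Md n D X) (C : Ck CM D) : ∃ x : ℕ → Matrix.ToLieAlgebra ℂ CM, Md n D x ∧
    (∀ i : Fin n, gE CM i = x (ap i)) ∧ (∀ i : Fin n, gF CM i = -x (an i)) ∧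
    ∀ i : Fin n, gH CM i = x i := by
  classical
  obtain ⟨φ, hφ, hE, hF, hH⟩ := M.hom C
  let x : ℕ → Matrix.ToLieAlgebra ℂ CM := fun k => if h : ∃ y, φ y = X k then h.choose else 0
  have hx : ∀ k, (∃ y, φ y = X k) → φ (x k) = X k := by
    intro k h
    have : x k = h.choose := dif_pos h
    rw [this]; exact h.choose_spec
  have rp : ∀ i : Fin n, φ (x (ap i)) = X (ap i) := fun i => hx _ ⟨_, hE i⟩
  have rn : ∀ i : Fin n, φ (x (an i)) = X (an i) :=
    fun i => hx _ ⟨-gF CM i, by rw [map_neg, hF, neg_neg]⟩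
  have rc : ∀ i : Fin n, φ (x i) = X i := fun i => hx _ ⟨_, hH i⟩
  have rk : ∀ k ∈ D.rk, φ (x k) = X k := by
    intro k hk
    have h1 := M.range C φ.range (fun i => ⟨_, hE i⟩)
      (fun i => ⟨-gF CM i, by rw [LieHom.coe_toLinearMap, map_neg, hF, neg_neg]⟩) k hk
    obtain ⟨y, hy⟩ := (LieHom.mem_range φ (X k)).1 h1
    exact hx k ⟨y, hy⟩
  refine ⟨x, ⟨?_, ?_, ?_, ?_, ?_⟩, ?_, ?_, ?_⟩
  · intro a ha b hb hab
    apply hφ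
    rw [LieHom.map_lie, rk a ha, rk b hb, ev_brk x (C.rk8 a ha).1 (C.rk8 b hb).1, map_smul,
      M.b C ha hb hab]
    by_cases h0 : D.Nf a b = 0
    · rw [h0]; simp
    · rw [hx]
      have h0' : (D.Nf a b : ℂ) ≠ 0 := by exact_mod_cast h0
      refine ⟨(D.Nf a b : ℂ)⁻¹ • ⁅x a, x b⁆, ?_⟩
      rw [map_smul, LieHom.map_lie, rk a ha, rk b hb, M.b C ha hb hab, smul_smul,
        inv_mul_cancel₀ h0', one_smul]
  · intro i j
    apply hφ
    rw [LieHom.map_lie, rc, rc, M.HH, map_zero]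
  · intro i k hk
    apply hφ
    rw [LieHom.map_lie, rc, rk k hk, map_smul, rk k hk, M.car i k hk]
  · intro i
    apply hφ
    rw [LieHom.map_lie, rp, rn, map_neg, rc, M.opp]
  · intro i h0
    apply M.nz i
    rw [← rp, h0, map_zero]
  · intro i; apply hφ; rw [hE, rp]
  · intro i; apply hφ; rw [hF, map_neg, rn]
  · intro i; apply hφ; rw [hH, rc]

lemma Ck.mem (C : Ck CM D) {k : ℕ} : k ∈ D.keys ↔ (∃ i : Fin n, k = i) ∨ k ∈ D.rk := by
  rw [RD.keys, List.mem_append, List.mem_range, C.hn]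
  refine or_congr ⟨fun h => ⟨⟨k, h⟩, rfl⟩, ?_⟩ Iff.rfl
  rintro ⟨i, rfl⟩; exact i.2

lemma Ck.lt8 (C : Ck CM D) (i : Fin n) : (i : ℕ) < 8 := lt_of_lt_of_le i.2 C.n8

lemma Ck.vec0 (C : Ck CM D) (i : Fin n) (j : ℕ) : vec i j = 0 := by
  rw [vec, if_pos (C.lt8 i)]

lemma dg0 (d : List ℤ) {k : ℕ} (h : k < 8) : dg d k = 0 := by
  have : Nat.blt k 8 = true := by simpa using h
  rw [dg, this, cond_true]

lemma Ck.kn (C : Ck CM D) : D.keys.Nodup := by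
  rw [RD.keys]
  refine List.nodup_append.2 ⟨List.nodup_range, C.nodup, ?_⟩
  intro a ha b hb hab
  have h1 := (C.rk8 b hb).1
  have h2 := C.n8
  rw [List.mem_range, C.hn] at ha
  lia

lemma Md.fbrk (M : Md n D X) (C : Ck CM D) : ∀ a ∈ D.keys, ∀ b ∈ D.keys, ∀ d : List ℕ,
    d.length = D.n → dz d a + dz d b ≠ 0 → ⁅X a, X b⁆ = ev X (D.brk a b) := by
  intro a ha b hb d hd h
  rcases C.mem.1 ha with ⟨i, rfl⟩ | ha
  · have ca : Nat.blt (i : ℕ) 8 = true := by simpa using C.lt8 i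
    rw [RD.brk, ca, cond_true, ev_cons, ev_nil, add_zero]
    rcases C.mem.1 hb with ⟨j, rfl⟩ | hb
    · rw [M.HH, dg0 _ (C.lt8 j)]; simp
    · exact M.car i b hb
  · have ca : Nat.blt a 8 = false := by rw [← Bool.not_eq_true]; simpa using (C.rk8 a ha).1
    rcases C.mem.1 hb with ⟨j, rfl⟩ | hb
    · have cb : Nat.blt (j : ℕ) 8 = true := by simpa using C.lt8 j
      rw [RD.brk, ca, cb, cond_false, cond_true, ev_cons, ev_nil, add_zero, ← lie_skew, M.car j a ha]
      change _ = ((-(dg (D.A.getD j []) a) : ℤ) : ℂ) • X a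
      rw [Int.cast_neg, neg_smul]
    · refine M.brk a ha b hb fun hab => h ?_
      have hb' : b = 2 * OFF - a := by lia
      obtain ⟨d', rfl⟩ : ∃ d' : Fin n → ℕ, d = List.ofFn d' := by
        have := C.hn
        exact ⟨fun i => d.get ⟨i, by lia⟩, List.ext_get (by simp; lia) (by simp)⟩
      rw [dz_sum, dz_sum, hb', ← Finset.sum_add_distrib]
      refine Finset.sum_eq_zero fun i _ => ?_
      rw [C.op a ha]; ring

lemma Md.ftor (M : Md n D X) (C : Ck CM D) (t : Fin n → ℤ) :
    ∃ τ : L, ∀ k ∈ D.keys, ⁅τ, X k⁆ = (dg (List.ofFn t) k : ℂ) • X k := by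
  obtain ⟨W, d, hd, hW⟩ := C.inv
  have hd' : (d : ℂ) ≠ 0 := by exact_mod_cast hd
  refine ⟨(d : ℂ)⁻¹ • ∑ i, ((∑ l, t l * W l i : ℤ) : ℂ) • X i, fun k hk => ?_⟩
  rw [smul_lie, sum_lie]
  rcases C.mem.1 hk with ⟨j, rfl⟩ | hk
  · rw [dg0 _ (C.lt8 j)]
    simp [smul_lie, M.HH]
  · have h1 : ∀ i : Fin n, ⁅((∑ l, t l * W l i : ℤ) : ℂ) • X i, X k⁆ =
        (((∑ l, t l * W l i) * ∑ j : Fin n, CM i j * vec k j : ℤ) : ℂ) • X k := by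
      intro i
      rw [smul_lie, M.c C i hk, smul_smul, Int.cast_mul]
    simp only [h1]
    rw [← Finset.sum_smul, smul_smul, ← Int.cast_sum]
    have h2 : ∑ i, (∑ l, t l * W l i) * ∑ j : Fin n, CM i j * vec k j =
        d * dg (List.ofFn t) k := by
      have e1 : ∀ i, (∑ l, t l * W l i) * ∑ j : Fin n, CM i j * vec k j =
          ∑ l, ∑ j : Fin n, t l * (W l i * CM i j) * vec k j := by
        intro i
        rw [Finset.sum_mul_sum]
        exact Finset.sum_congr rfl fun l _ => Finset.sum_congr rfl fun j _ => by ring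
      simp only [e1]
      rw [Finset.sum_comm, dg_sum, Finset.mul_sum]
      refine Finset.sum_congr rfl fun l _ => ?_
      rw [Finset.sum_comm]
      have e2 : ∀ j : Fin n, ∑ i, t l * (W l i * CM i j) * vec k j =
          if l = j then d * (t l * vec k l) else 0 := by
        intro j
        rw [← Finset.sum_mul, ← Finset.mul_sum, hW l j]
        split_ifs with h
        · subst h; ring
        · ring
      simp [e2]
    rw [h2, Int.cast_mul, ← mul_assoc, inv_mul_cancel₀ hd', one_mul]

lemma Md.fli (M : Md n D X) (C : Ck CM D) :
    LinearIndependent ℂ (fun k : {k // k ∈ D.keys} => X k) := by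
  obtain ⟨τ, hτ⟩ := M.ftor C fun i => 64 ^ (i : ℕ)
  set f : End ℂ L := LieAlgebra.ad ℂ L τ with hf
  have l0 : ∀ i : Fin n, X i ∈ f.eigenspace 0 := by
    intro i
    rw [End.mem_eigenspace_iff, hf, LieAlgebra.ad_apply, hτ i (C.mem.2 (Or.inl ⟨i, rfl⟩)),
      dg0 _ (C.lt8 i), Int.cast_zero]
  have l1 : ∀ k : {k // k ∈ D.rk}, f.HasEigenvector (((k : ℕ) : ℂ) - (OFF : ℂ)) (X k) := by
    intro k
    refine ⟨?_, M.nzk C k k.2⟩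
    rw [End.mem_eigenspace_iff, hf, LieAlgebra.ad_apply, hτ k (C.mem.2 (Or.inr k.2)), C.dgk k k.2]
    push_cast; rfl
  have l2 : ∀ k : {k // k ∈ D.rk}, ((k : ℕ) : ℂ) - (OFF : ℂ) ≠ 0 := by
    intro k h
    rw [sub_eq_zero, Nat.cast_inj] at h
    exact (C.rk8 k k.2).2 h
  have li1 := End.eigenvectors_linearIndependent' f
    (fun k : {k // k ∈ D.rk} => ((k : ℕ) : ℂ) - (OFF : ℂ))
    (fun a b h => Subtype.ext (Nat.cast_injective (sub_left_injective h)))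
    (fun k : {k // k ∈ D.rk} => X k) l1
  have hdis : Disjoint (Submodule.span ℂ (Set.range fun i : Fin n => X i))
      (Submodule.span ℂ (Set.range fun k : {k // k ∈ D.rk} => X k)) := by
    refine (f.eigenspaces_iSupIndep 0).mono ?_ ?_
    · rw [Submodule.span_le]; rintro _ ⟨i, rfl⟩; exact l0 i
    · rw [Submodule.span_le]; rintro _ ⟨k, rfl⟩
      exact Submodule.mem_iSup_of_mem _ (Submodule.mem_iSup_of_mem (l2 k) (l1 k).1)
  have li2 := (M.li0 C).sum_type li1 hdis
  have hk : ∀ k : {k // k ∈ D.keys}, ∃ s : Fin n ⊕ {k // k ∈ D.rk},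
      Sum.elim (fun i : Fin n => (i : ℕ)) (fun k : {k // k ∈ D.rk} => (k : ℕ)) s = k := by
    rintro ⟨k, hk⟩
    rcases C.mem.1 hk with ⟨i, rfl⟩ | hk
    · exact ⟨Sum.inl i, rfl⟩
    · exact ⟨Sum.inr ⟨k, hk⟩, rfl⟩
  choose σ hσ using hk
  have hinj : Function.Injective σ := fun a b h => Subtype.ext (by rw [← hσ a, ← hσ b, h])
  have e : (fun k : {k // k ∈ D.keys} => X k) =
      (Sum.elim (fun i : Fin n => X i) fun k : {k // k ∈ D.rk} => X k) ∘ σ := by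
    funext k
    rw [← hσ k, Function.comp_apply]
    rcases σ k with i | k <;> rfl
  rw [e]
  exact li2.comp σ hinj

lemma Md.fsp (M : Md n D X) (C : Ck CM D)
    (hg : ∀ R : LieSubalgebra ℂ L, (∀ i : Fin n, X (ap i) ∈ R) → (∀ i : Fin n, X (an i) ∈ R) → R = ⊤) :
    ⊤ ≤ Submodule.span ℂ (Set.range (fun k : {k // k ∈ D.keys} => X k)) := by
  set S := Submodule.span ℂ (Set.range (fun k : {k // k ∈ D.keys} => X k)) with hS
  have hk : ∀ k ∈ D.keys, X k ∈ S := fun k hk => Submodule.subset_span ⟨⟨k, hk⟩, rfl⟩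
  have hc : ∀ i : Fin n, X i ∈ S := fun i => hk _ (C.mem.2 (Or.inl ⟨i, rfl⟩))
  have hr : ∀ k ∈ D.rk, X k ∈ S := fun k h => hk _ (C.mem.2 (Or.inr h))
  let N : LieSubalgebra ℂ L :=
    { carrier := {y | ∀ s ∈ S, ⁅y, s⁆ ∈ S}
      add_mem' := fun {a b} ha hb s hs => by rw [add_lie]; exact S.add_mem (ha s hs) (hb s hs)
      zero_mem' := fun s _ => by rw [zero_lie]; exact S.zero_mem
      smul_mem' := fun c a ha s hs => by rw [smul_lie]; exact S.smul_mem c (ha s hs)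
      lie_mem' := fun {a b} ha hb s hs => by
        rw [lie_lie]
        exact S.sub_mem (ha _ (hb s hs)) (hb _ (ha s hs)) }
  have hN : ∀ y, (∀ k ∈ D.keys, ⁅y, X k⁆ ∈ S) → y ∈ N := by
    intro y h s hs
    induction hs using Submodule.span_induction with
    | mem _ hm => obtain ⟨k, rfl⟩ := hm; exact h k k.2
    | zero => rw [lie_zero]; exact S.zero_mem
    | add _ _ _ _ h1 h2 => rw [lie_add]; exact S.add_mem h1 h2
    | smul c _ _ h1 => rw [lie_smul]; exact S.smul_mem c h1
  have hi (i : Fin n) := pow_off (C.lt8 i)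
  have h1 : N = ⊤ := by
    refine hg N (fun i => hN _ fun k h => ?_) (fun i => hN _ fun k h => ?_)
    · rcases C.mem.1 h with ⟨j, rfl⟩ | h
      · rw [← lie_skew, M.c C j (C.smp i).1]
        exact S.neg_mem (S.smul_mem _ (hr _ (C.smp i).1))
      · by_cases h2 : ap i + k = 2 * OFF
        · have h3 : k = an i := by have := hi i; unfold ap at h2; unfold an; lia
          rw [h3, M.opp]; exact S.neg_mem (hc i)
        · rw [M.b C (C.smp i).1 h h2]
          rcases (C.stab i k h).1 with h3 | h3 | h3
          · rw [h3, Int.cast_zero, zero_smul]; exact S.zero_mem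
          · exact absurd h3 h2
          · exact S.smul_mem _ (hr _ h3)
    · rcases C.mem.1 h with ⟨j, rfl⟩ | h
      · rw [← lie_skew, M.c C j (C.smp i).2]
        exact S.neg_mem (S.smul_mem _ (hr _ (C.smp i).2))
      · by_cases h2 : an i + k = 2 * OFF
        · have h3 : k = ap i := by have := hi i; unfold an at h2; unfold ap; lia
          rw [h3, ← lie_skew, M.opp, neg_neg]; exact hc i
        · rw [M.b C (C.smp i).2 h h2]
          rcases (C.stab i k h).2 with h3 | h3 | h3
          · rw [h3, Int.cast_zero, zero_smul]; exact S.zero_mem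
          · exact absurd h3 h2
          · exact S.smul_mem _ (hr _ h3)
  let R : LieSubalgebra ℂ L :=
    { S with
      lie_mem' := fun {a b} _ hb => by
        have h2 : a ∈ N := by rw [h1]; trivial
        exact h2 b hb }
  have h2 : R = ⊤ := hg R (fun i => hr _ (C.smp i).1) (fun i => hr _ (C.smp i).2)
  intro y _
  have h3 : y ∈ R := by rw [h2]; trivial
  exact h3

lemma dot_sum (a : Fin n → ℤ) (b : Fin n → ℕ) : dot (List.ofFn a) (List.ofFn b) = ∑ i, a i * b i := by
  induction n with
  | zero => simp [dot]
  | succ n ih =>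
    rw [List.ofFn_succ, List.ofFn_succ, Fin.sum_univ_succ, ← ih]; rfl

lemma gramv_sum {m : ℕ} (t : Fin m → ℤ) (r : Fin m → List ℤ) (d : List ℕ) :
    gramv (List.ofFn t) (List.ofFn r) d = ∑ i, t i * dot (r i) d := by
  induction m with
  | zero => simp [gramv]
  | succ n ih =>
    rw [List.ofFn_succ, List.ofFn_succ, Fin.sum_univ_succ, ← ih]; rfl

lemma Ck.fgram (C : Ck CM D) (t : Fin n → ℤ) (d : Fin n → ℕ) :
    gramv (List.ofFn t) D.G (List.ofFn d) =
      (D.keys.map fun k => dg (List.ofFn t) k * dz (List.ofFn d) k).sum := by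
  rw [RD.keys, List.map_append, List.sum_append, C.gram, gramv_sum]
  have h0 : ((List.range D.n).map fun k => dg (List.ofFn t) k * dz (List.ofFn d) k).sum = 0 := by
    refine List.sum_eq_zero fun z hz => ?_
    rw [List.mem_map] at hz
    obtain ⟨k, hk, rfl⟩ := hz
    rw [List.mem_range, C.hn] at hk
    rw [dg0 _ (lt_of_lt_of_le hk C.n8), zero_mul]
  rw [h0, zero_add]
  simp only [dot_sum, dg_sum, dz_sum]
  generalize D.rk = l
  induction l with
  | nil => simp
  | cons k l ih =>
    simp only [List.map_cons, List.sum_cons]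
    rw [← ih]
    simp only [add_mul, Finset.sum_add_distrib, mul_add]
    congr 1
    rw [Finset.sum_mul_sum]
    refine Finset.sum_congr rfl fun i _ => ?_
    rw [Finset.mul_sum]
    refine Finset.sum_congr rfl fun j _ => ?_
    ring

lemma ofFn_of {α : Type*} (t : List α) (h : t.length = n) : ∃ t' : Fin n → α, t = List.ofFn t' :=
  ⟨fun i => t.get ⟨i, by lia⟩, List.ext_get (by simp; lia) (by simp)⟩

lemma Md.rm (M : Md n D X) (C : Ck CM D) :
    ∃ x : ℕ → Matrix.ToLieAlgebra ℂ CM, Rm (fun i j => CM i j) D x (gE CM) (gF CM) := by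
  obtain ⟨x, M', hE, hF, hH⟩ := M.pull C
  have hc := chev CM C.diag
  have hH' : gH CM = fun i : Fin n => x i := funext hH
  refine ⟨x, ⟨C.kn, M'.fli C, M'.fsp C ?_, M'.fbrk C, ?_, ?_⟩, C.hn, C.n8, fun k hk => (C.rk8 k hk).1,
    C.sgn, ?_, hH' ▸ hc, fun i => ⟨ap i, (C.smp i).1, hE i, C.vecp i⟩⟩
  · intro R h1 h2
    rw [eq_top_iff, ← hc.gen, LieSubalgebra.lieSpan_le]
    rintro _ (⟨i, rfl⟩ | ⟨i, rfl⟩)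
    · rw [hE]; exact h1 i
    · rw [hF]; exact R.neg_mem (h2 i)
  · intro t ht
    obtain ⟨t, rfl⟩ := ofFn_of t (ht.trans C.hn)
    exact M'.ftor C t
  · intro t d ht hd
    obtain ⟨t, rfl⟩ := ofFn_of t (ht.trans C.hn)
    obtain ⟨d, rfl⟩ := ofFn_of d (hd.trans C.hn)
    exact C.fgram t d
  · intro i k hk
    rcases C.mem.1 hk with ⟨j, rfl⟩ | hk
    · rw [M'.HH]; simp [C.vec0]
    · exact M'.c C i hk
end PaperStmt.Pres

namespace PaperStmt.E8m
open Module Chk Pres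

attribute [local instance] LieRing.ofAssociativeRing

lemma sm_ap (a : Fin 8) : qv (ap a) = Pi.single a 1 := by revert a; decide +kernel
lemma sm_an (a : Fin 8) : qv (an a) = -Pi.single a 1 := by revert a; decide +kernel
lemma sm_r (a : Fin 8) : r8 (ap a) = true ∧ r8 (an a) = true := by revert a; decide +kernel
lemma sm_ne (a b : Fin 8) (h : a ≠ b) : ap a + an b ≠ 2 * OFF ∧ D8.brk (ap a) (an b) = [] := by
  revert a b; decide +kernel
lemma sm_rt (a : Fin 8) : rt (Pi.single a 1) := by
  rw [← sm_ap]; exact r8_rt (sm_r a).1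

lemma X8_lt (a : Fin 8) : X8 a = HH (cc (Pi.single a 1)) := by
  rw [X8, dif_pos a.2]

lemma X8_op (a b : Fin 8) : ⁅X8 (ap a), X8 (an b)⁆ = if a = b then -X8 a else 0 := by
  split_ifs with h
  · subst h
    rw [X8_ge (r8_ge (sm_r a).1), X8_ge (r8_ge (sm_r a).2), sm_ap, sm_an, XX_opp (sm_rt a), X8_lt]
  · rw [X8_rr (sm_r a).1 (sm_r b).2 (sm_ne a b h).1, (sm_ne a b h).2, ev_nil]

lemma X8_nz (a : Fin 8) : X8 a ≠ 0 := by
  intro h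
  have h1 : X8 a (ee (Pi.single a 1)) = 0 := by rw [h]; rfl
  rw [X8_lt, HH_ee _ (sm_rt a), bf_cc, (sm_rt a).b2, smul_eq_zero] at h1
  rcases h1 with h1 | h1
  · norm_num at h1
  · have h2 := congrArg snd h1
    rw [ee, snd_inr, map_zero, Finsupp.single_eq_zero] at h2
    exact one_ne_zero h2

/-- Models inside the algebra of type `E₈`. -/
lemma md8 {n : ℕ} {D : RD} {X : ℕ → End ℂ V} (o : Fin n → List (Fin 8))
    (ho : ∀ i, (o i).Nodup ∧ o i ≠ [])
    (h0 : ∀ i : Fin n, X i = ((o i).map fun a : Fin 8 => X8 a).sum)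
    (hp : ∀ i : Fin n, X (ap i) = ((o i).map fun a : Fin 8 => X8 (ap a)).sum)
    (hm : ∀ i : Fin n, X (an i) = ((o i).map fun a : Fin 8 => X8 (an a)).sum)
    (hb : ∀ a ∈ D.rk, ∀ b ∈ D.rk, a + b ≠ 2 * OFF → ⁅X a, X b⁆ = ev X (D.brk a b))
    (hc : ∀ i : Fin n, ∀ k ∈ D.rk, ⁅X i, X k⁆ = (dg (D.A.getD i []) k : ℂ) • X k) :
    Md n D X := by
  have h0' : ∀ i : Fin n, X i = ∑ a ∈ (o i).toFinset, X8 a := fun i => by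
    rw [h0, List.sum_toFinset _ (ho i).1]
  have hp' : ∀ i : Fin n, X (ap i) = ∑ a ∈ (o i).toFinset, X8 (ap a) := fun i => by
    rw [hp, List.sum_toFinset _ (ho i).1]
  have hm' : ∀ i : Fin n, X (an i) = ∑ a ∈ (o i).toFinset, X8 (an a) := fun i => by
    rw [hm, List.sum_toFinset _ (ho i).1]
  refine ⟨hb, fun i j => ?_, hc, fun i => ?_, fun i h => ?_⟩
  · rw [h0', h0', sum_lie]
    refine Finset.sum_eq_zero fun a _ => ?_
    rw [lie_sum]
    refine Finset.sum_eq_zero fun b _ => ?_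
    rw [X8_lt, X8_lt, HH_HH]
  · rw [hp', hm', h0', sum_lie, ← Finset.sum_neg_distrib]
    refine Finset.sum_congr rfl fun a ha => ?_
    rw [lie_sum]
    simp only [X8_op]
    rw [Finset.sum_ite_eq, if_pos ha]
  · obtain ⟨a, ha⟩ := List.exists_mem_of_ne_nil _ (ho i).2
    have h1 : ⁅X (ap i), X8 (an a)⁆ = -X8 a := by
      rw [hp', sum_lie]
      simp only [X8_op]
      rw [Finset.sum_ite_eq', if_pos (List.mem_toFinset.2 ha)]
    rw [h, zero_lie, eq_comm, neg_eq_zero] at h1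
    exact X8_nz a h1

/-- Models of type `E`. -/
lemma mdE {n : ℕ} (hn : n ≤ 8) (A G : List (List ℤ)) (rk : List ℕ)
    (hr : ∀ k ∈ rk, r8 k = true)
    (hA : ∀ i : Fin n, ∀ k ∈ rk, dg (A.getD i []) k = dg (D8.A.getD i []) k) :
    Md n ⟨n, A, G, rk, NE⟩ X8 := by
  refine md8 (fun i => [Fin.castLE hn i]) (fun i => by simp) (fun i => by simp) (fun i => by simp)
    (fun i => by simp) (fun a ha b hb hab => ?_) (fun i k hk => ?_)
  · have ra := hr a ha
    have rb := hr b hb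
    rw [X8_rr ra rb hab, D8_brk (r8_ge ra) (r8_ge rb), ev_one, ev_brk X8 (r8_ge ra) (r8_ge rb)]
  · have ca : Nat.blt (i : ℕ) 8 = true := by simpa using lt_of_lt_of_le i.2 hn
    rw [X8_cr (lt_of_lt_of_le i.2 hn) (hr k hk), RD.brk, ca, cond_true, ev_cons, ev_nil, add_zero]
    rw [← hA i k hk]

/-- Table lookup. -/
def look (k : ℕ) : List (ℕ × Vec) → Vec
  | [] => []
  | p :: r => bif Nat.beq p.1 k then p.2 else look k r

/-- Structure constants of folded root systems. -/
def nfo (tb : List (ℕ × Vec)) (a b : ℕ) : ℤ :=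
  match look (Nat.sub (Nat.add a b) OFF) tb with
  | [] => 0
  | p :: _ => coef (D8.bil (look a tb) (look b tb)) p.1

/-- Check of brackets. -/
def pc (D : RD) (tb : List (ℕ × Vec)) (a b : ℕ) : Bool :=
  ((look a tb).all fun p => (look b tb).all fun q =>
    (Nat.blt p.1 8 || r8 p.1) && r8 q.1 && !(Nat.beq (Nat.add p.1 q.1) (Nat.mul 2 OFF))) &&
  isZero (D8.bil (look a tb) (look b tb) ++
    scal (-1) ((D.brk a b).flatMap fun r => scal r.2 (look r.1 tb)))

lemma pc_brk {D : RD} {tb : List (ℕ × Vec)} {a b : ℕ} (h : pc D tb a b = true) :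
    ⁅ev X8 (look a tb), ev X8 (look b tb)⁆ = ev (fun k => ev X8 (look k tb)) (D.brk a b) := by
  rw [pc, Bool.and_eq_true, List.all_eq_true] at h
  have h1 := ev_zero X8 _ h.2
  rw [ev_append, ev_scal] at h1
  rw [ev_bil D8 X8 (look a tb) (look b tb)]
  · have h2 : ev X8 ((D.brk a b).flatMap fun r => scal r.2 (look r.1 tb)) =
        ev (fun k => ev X8 (look k tb)) (D.brk a b) := by
      generalize D.brk a b = l
      induction l with
      | nil => rfl
      | cons p l ih => rw [List.flatMap_cons, ev_append, ev_cons, ih, ev_scal]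
    rw [← h2]
    push_cast at h1
    rw [neg_one_smul, ← sub_eq_add_neg] at h1
    exact sub_eq_zero.1 h1
  · intro p hp q hq
    have h3 := List.all_eq_true.1 (h.1 p hp) q hq
    rw [Bool.and_eq_true, Bool.and_eq_true, Bool.or_eq_true, Nat.blt_eq, Bool.not_eq_true',
      ← Bool.not_eq_true, Nat.beq_eq, Nat.add_eq, Nat.mul_eq] at h3
    obtain ⟨⟨h4 | h4, h5⟩, h6⟩ := h3
    · exact X8_cr h4 h5
    · exact X8_rr h4 h5 h6

lemma ev_ones (l : List (Fin 8)) (f : Fin 8 → ℕ) :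
    ev X8 (l.map fun a : Fin 8 => (f a, 1)) = (l.map fun a : Fin 8 => X8 (f a)).sum := by
  induction l with
  | nil => rfl
  | cons a l ih => rw [List.map_cons, List.map_cons, List.sum_cons, ev_cons, ih]; simp

/-- Models of folded types. -/
lemma mdF {n : ℕ} (hn : n ≤ 8) (A G : List (List ℤ)) (rk : List ℕ) (tb : List (ℕ × Vec))
    (o : Fin n → List (Fin 8)) (ho : ∀ i, (o i).Nodup ∧ o i ≠ [])
    (h0 : ∀ i : Fin n, look i tb = (o i).map fun a : Fin 8 => ((a : ℕ), 1))
    (hp : ∀ i : Fin n, look (ap i) tb = (o i).map fun a : Fin 8 => (ap a, 1))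
    (hm : ∀ i : Fin n, look (an i) tb = (o i).map fun a : Fin 8 => (an a, 1))
    (hb : ∀ a ∈ rk, ∀ b ∈ rk, a + b = 2 * OFF ∨ pc ⟨n, A, G, rk, nfo tb⟩ tb a b = true)
    (hc : ∀ i : Fin n, ∀ k ∈ rk, pc ⟨n, A, G, rk, nfo tb⟩ tb i k = true) :
    Md n ⟨n, A, G, rk, nfo tb⟩ (fun k => ev X8 (look k tb)) := by
  refine md8 o ho (fun i => ?_) (fun i => ?_) (fun i => ?_) (fun a ha b hb' hab => ?_) (fun i k hk => ?_)
  · rw [h0, ev_ones]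
  · rw [hp, ev_ones]
  · rw [hm, ev_ones]
  · exact pc_brk ((hb a ha b hb').resolve_left hab)
  · have ca : Nat.blt (i : ℕ) 8 = true := by simpa using lt_of_lt_of_le i.2 hn
    rw [pc_brk (hc i k hk), RD.brk, ca, cond_true, ev_cons, ev_nil, add_zero]

end PaperStmt.E8m

namespace PaperStmt.Pres
open Module Serre Chk

/-- All lists of zeros and ones. -/
def bins : ℕ → List (List ℕ)
  | 0 => [[]]
  | m + 1 => (bins m).map (List.cons 0) ++ (bins m).map (List.cons 1)

lemma mem_bins {m : ℕ} (a : Fin m → ℕ) (h : ∀ i, a i ≤ 1) : List.ofFn a ∈ bins m := by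
  induction m with
  | zero => simp [bins]
  | succ m ih =>
    have h1 := ih (fun i => a i.succ) fun i => h i.succ
    rw [List.ofFn_succ, bins, List.mem_append]
    rcases Nat.le_one_iff_eq_zero_or_eq_one.1 (h 0) with h0 | h0
    · rw [h0]; exact Or.inl (List.mem_map_of_mem h1)
    · rw [h0]; exact Or.inr (List.mem_map_of_mem h1)

lemma fin {n : ℕ} {CM : Matrix (Fin n) (Fin n) ℤ} {D : RD}
    {L : Type*} [LieRing L] [LieAlgebra ℂ L] {X : ℕ → L} (M : Md n D X) (C : Ck CM D)
    (c : Fin n → ℤ) (hc : ∀ i, 0 < ∑ j, CM i j * c j) (dat : List (List ℕ × Cert))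
    (h1 : (dat.all fun p => D.chk p.1 p.2) = true)
    (h2 : List.replicate n 0 :: dat.map Prod.fst = bins n) :
    PanyushevProperty ℂ (Matrix.ToLieAlgebra ℂ CM) := by
  obtain ⟨x, R⟩ := M.rm C
  refine R.main c hc fun a ha ⟨i, hi⟩ => ?_
  have h3 := mem_bins a ha
  rw [← h2, List.mem_cons] at h3
  rcases h3 with h3 | h3
  · have h4 : a i ∈ List.replicate n 0 := by rw [← h3, List.mem_ofFn]; exact ⟨i, rfl⟩
    exact absurd (List.eq_of_mem_replicate h4) hi
  · obtain ⟨p, hp, h4⟩ := List.mem_map.1 h3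
    exact ⟨p.2, by rw [← h4]; exact List.all_eq_true.1 h1 p hp⟩
/-- Compact shorthand for certificate data: basis vectors. -/
def u (l : List ℕ) : List Vec := l.map fun k => [(k, 1)]

/-- Compact shorthand for certificate data: vectors given by coordinates on the Cartan part. -/
def q (l : List (List ℤ)) : List Vec :=
  l.map fun w => ((List.range w.length).zip w).filter fun p => p.2 != 0

/-- The root keys from the offsets of the positive roots. -/
def rp (l : List ℕ) : List ℕ :=
  l.map (fun k => 142971416741920 + k) ++ l.map fun k => 142971416741920 - k

end PaperStmt.Pres

namespace PaperStmt.G2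
open Chk Pres E8m
attribute [local instance] LieRing.ofAssociativeRing

def rk : List ℕ := rp [64,1,65,66,67,131]
def tb : List (ℕ × Vec) := [
(0, [(1, 1),(2, 1),(4, 1)]),
(1, [(3, 1)]),
(142971416741984, [(142971417004064, 1)]),
(142971416741921, [(142971416741984, 1),(142971416746016, 1),(142971433519136, 1)]),
(142971416741985, [(142971433781280, 1),(142971417008160, -1),(142971417004128, -1)]),
(142971416741986, [(142971433785376, 1),(142971433781344, 1),(142971417008224, -1)]),
(142971416741987, [(142971433785440, 1)]),
(142971416742051, [(142971434047584, 1)]),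
(142971416741856, [(142971416479776, 1)]),
(142971416741919, [(142971416741856, 1),(142971416737824, 1),(142971399964704, 1)]),
(142971416741855, [(142971416479712, 1),(142971416475680, 1),(142971399702560, -1)]),
(142971416741854, [(142971416475616, 1),(142971399702496, -1),(142971399698464, -1)]),
(142971416741853, [(142971399698400, 1)]),
(142971416741789, [(142971399436256, 1)])]
def A : List (List ℤ) := [[2,-3],[-1,2]]
def G : List (List ℤ) := [[48,24],[24,16]]
def D : RD := ⟨2, A, G, rk, nfo tb⟩
def o : Fin 2 → List (Fin 8) := ![[1,2,4], [3]]
lemma md : Md 2 D (fun k => ev X8 (look k tb)) := mdF (by norm_num) A G rk tb o (by decide +kernel)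
  (by decide +kernel) (by decide +kernel) (by decide +kernel) (by decide +kernel) (by decide +kernel)
lemma ck : Ck CartanMatrix.G₂ D where
  hn := rfl
  n8 := by norm_num
  diag := by decide +kernel
  rk8 := by decide +kernel
  nodup := by decide +kernel
  row := by decide +kernel
  sgn := by decide +kernel
  inv := ⟨![![2, 3], ![1, 2]],
    1, by decide +kernel⟩
  pos := ⟨![6, 10], by decide +kernel⟩
  dgk := by decide +kernel
  gram := by decide +kernel
  smp := by decide +kernel
  vecp := by decide +kernel
  vecn := by decide +kernel
  off := by decide +kernel
  op := by decide +kernel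
  gen := by decide +kernel
  stab := by decide +kernel
  sre := by decide +kernel
set_option maxHeartbeats 2000000 in
def dat0 : List (List ℕ × Cert) := ((bins 2).drop 1).zip [
.C [7] (q [[0,1]]) (q [[0,0,1],[0,0,0,0,1],[0,0,0,0,0,1],[0,0,0,0,0,0,1]]) [[[(0,3,1)]]],
.B [5] (q [[1]]) [] (q [[0,0,1]]++u [8]++q [[0,1]]) [(5,1)],
.A [4] (q [[-1]]) [-1,1]
]
lemma tt0 : (dat0.all fun p => D.chk p.1 p.2) = true := by decide +kernel
def dat : List (List ℕ × Cert) := dat0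
lemma tt : (dat.all fun p => D.chk p.1 p.2) = true := by
  exact tt0
theorem main : PanyushevProperty ℂ (Matrix.ToLieAlgebra ℂ CartanMatrix.G₂) :=
  fin md ck ![10, 6] (by decide +kernel) dat tt (by decide +kernel)
end PaperStmt.G2

namespace PaperStmt.F4
open Chk Pres E8m
attribute [local instance] LieRing.ofAssociativeRing

def rk : List ℕ := rp [262144,4096,64,1,266240,4160,65,266304,4224,4161,266368,266305,4225,270464,266369,4226,270465,266370,270529,270466,270530,270594,274690,536834]
def tb : List (ℕ × Vec) := [
(0, [(0, 1),(5, 1)]),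
(1, [(2, 1),(4, 1)]),
(2, [(3, 1)]),
(3, [(1, 1)]),
(142971417004064, [(142971416741984, 1)]),
(142971416746016, [(142971417004064, 1)]),
(142971416741984, [(142971416746016, 1),(142971433519136, 1)]),
(142971416741921, [(142971416741921, 1),(142972490483744, 1)]),
(142971417008160, [(142971417004128, 1)]),
(142971416746080, [(142971433781280, 1),(142971417008160, -1)]),
(142971416741985, [(142972507260960, 1),(142971416746017, -1)]),
(142971417008224, [(142971433781344, 1),(142971417008224, -1)]),
(142971416746144, [(142971433785376, 1)]),
(142971416746081, [(142972507523104, 1),(142971417008161, 1)]),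
(142971417008288, [(142971433785440, 1)]),
(142971417008225, [(142972507523168, 1),(142971417008225, 1)]),
(142971416746145, [(142972507527200, 1),(142971433785377, -1)]),
(142971417012384, [(142971434047584, 1)]),
(142971417008289, [(142972507527264, 1),(142971433785441, -1)]),
(142971416746146, [(142972507527201, 1)]),
(142971417012385, [(142972507789408, 1),(142971434047585, -1)]),
(142971417008290, [(142972507527265, 1)]),
(142971417012449, [(142972524566624, 1),(142971434051681, 1)]),
(142971417012386, [(142972507789409, 1)]),
(142971417012450, [(142972524566625, 1),(142972507793505, -1)]),
(142971417012514, [(142972524570721, 1)]),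
(142971417016610, [(142972524832865, 1)]),
(142971417278754, [(142972524832929, 1)]),
(142971416479776, [(142971416741856, 1)]),
(142971416737824, [(142971416479776, 1)]),
(142971416741856, [(142971416737824, 1),(142971399964704, 1)]),
(142971416741919, [(142971416741919, 1),(142970343000096, 1)]),
(142971416475680, [(142971416479712, 1)]),
(142971416737760, [(142971416475680, 1),(142971399702560, -1)]),
(142971416741855, [(142971416737823, 1),(142970326222880, -1)]),
(142971416475616, [(142971416475616, 1),(142971399702496, -1)]),
(142971416737696, [(142971399698464, 1)]),
(142971416737759, [(142971416475679, 1),(142970325960736, 1)]),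
(142971416475552, [(142971399698400, 1)]),
(142971416475615, [(142971416475615, 1),(142970325960672, 1)]),
(142971416737695, [(142971399698463, 1),(142970325956640, -1)]),
(142971416471456, [(142971399436256, 1)]),
(142971416475551, [(142971399698399, 1),(142970325956576, -1)]),
(142971416737694, [(142970325956639, 1)]),
(142971416471455, [(142971399436255, 1),(142970325694432, -1)]),
(142971416475550, [(142970325956575, 1)]),
(142971416471391, [(142971399432159, 1),(142970308917216, 1)]),
(142971416471454, [(142970325694431, 1)]),
(142971416471390, [(142970325690335, 1),(142970308917215, -1)]),
(142971416471326, [(142970308913119, 1)]),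
(142971416467230, [(142970308650975, 1)]),
(142971416205086, [(142970308650911, 1)])]
def A : List (List ℤ) := [[2,-1,0,0],[-1,2,-2,0],[0,-1,2,-1],[0,0,-1,2]]
def G : List (List ℤ) := [[72,108,72,36],[108,216,144,72],[72,144,108,54],[36,72,54,36]]
def D : RD := ⟨4, A, G, rk, nfo tb⟩
def o : Fin 4 → List (Fin 8) := ![[0,5], [2,4], [3], [1]]
lemma md : Md 4 D (fun k => ev X8 (look k tb)) := mdF (by norm_num) A G rk tb o (by decide +kernel)
  (by decide +kernel) (by decide +kernel) (by decide +kernel) (by decide +kernel) (by decide +kernel)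
lemma ck : Ck CartanMatrix.F₄ D where
  hn := rfl
  n8 := by norm_num
  diag := by decide +kernel
  rk8 := by decide +kernel
  nodup := by decide +kernel
  row := by decide +kernel
  sgn := by decide +kernel
  inv := ⟨![![2, 3, 4, 2], ![3, 6, 8, 4], ![2, 4, 6, 3], ![1, 2, 3, 2]],
    1, by decide +kernel⟩
  pos := ⟨![16, 30, 42, 22], by decide +kernel⟩
  dgk := by decide +kernel
  gram := by decide +kernel
  smp := by decide +kernel
  vecp := by decide +kernel
  vecn := by decide +kernel
  off := by decide +kernel
  op := by decide +kernel
  gen := by decide +kernel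
  stab := by decide +kernel
  sre := by decide +kernel
set_option maxHeartbeats 2000000 in
def dat0 : List (List ℕ × Cert) := ((bins 4).drop 1).zip [
.C [27] (q [[0,0,0,1]]) (q [[0,0,0,0,1]]++u [8,11,14,15,17,18,20,21,22,23,24,25,26]) [[[(0,13,1)]]],
.C [24,17] (q [[1,0,2],[0,0,1],[0,0,0,0,0,0,1],[0,0,0,0,0,0,0,1]]++u [10,30]) (q [[0,0,0,0,0,1]]++u [8,12,13,14,15,16,18]++[[(19,-2),(9,1)],[(21,-2),(11,1)]]) [[[(0,4,1)],[(0,7,1)],[(0,9,-1)],[(2,5,-1)],[(2,9,-1)],[(3,7,1)]],[[(0,4,1)],[(1,4,-1)]]],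
.A [18,8] (q [[0,-1,-2],[0,-1,-1],[0,0,0,0,0,0,1],[0,0,0,0,0,0,0,1]]++u [10,31]) [0,0,-1,1],
.C [20,21,12] (q [[1,1,2],[1,1,1],[1,2,2],[0,0,0,0,1],[0,0,0,0,0,1],[0,0,0,0,0,0,0,1]]++u [8,28,29]) ([[(10,-1),(9,1)]]++u [11,13]++[[(15,-1),(6,1)]]) [[[(0,1,1)],[(0,2,-1)],[(0,3,1)],[(1,2,-1)],[(1,3,1)],[(2,3,1)]],[[(0,0,1)],[(0,2,1)]],[[(0,0,1)],[(0,1,1)],[(1,1,-1)]]],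
.B [11,12,19] (q [[1,2,0,2],[0,1],[2,3,0,2]]++u [31]++q [[0,0,0,0,0,0,0,1]]) [] (q [[0,0,0,0,0,1]]++u [29]++q [[0,0,1]]) [(11,1)],
.A [13,11] (q [[0,-1],[-1,-1],[0,0,0,0,1]]++u [28]) [0,-1,1,0],
.A [8,13] (q [[-1,-1],[1]]++u [31]) [-1,1,0,0],
.C [25,23] (q [[1,1],[1],[0,0,0,0,0,1],[0,0,0,0,0,0,1]]++u [8,29,32]) (q [[0,0,0,0,0,0,0,1]]++u [10,13,15,16,18,20,22]) [[[(0,4,-1)],[(0,5,-1)],[(0,6,-1)],[(0,7,-1)],[(1,7,-1)],[(2,7,1)],[(3,7,-1)]]],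
.A [19,22] (q [[1,1],[0,1]]++u [30,33,36]) [1,-3,4,0],
.B [16,15,17] (q [[1,1,2],[1,0,2],[0,0,1],[0,0,0,0,1]]++u [28]) (q [[0,0,0,0,0,1]]++[[(9,1),(8,1)],[(12,-1),(11,1)]]++u [14]) [[(6,-1),(4,1)],[(30,1),(28,-1)],[(3,1),(1,1)]] [(16,1),(15,1)],
.A [8,13,14] (q [[-1,-1],[0,1,2],[-1,1,2]]++u [30]++q [[0,0,0,0,0,0,1]]) [1,0,-1,1],
.A [15,12] (q [[-1,0,0,2],[-1,0,0,1],[0,0,0,0,1]]++u [8,28,32]) [-1,-1,2,0],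
.A [12,10,11] (q [[0,1,1],[0,0,-1],[-1,-1,-2],[0,0,0,0,0,1]]) [-1,1,-2,1],
.A [9,10] (q [[-1,1],[0,1],[0,0,0,0,1]]) [1,-1,1,0],
.A [8,10,9] (q [[1,0,1],[2,1,2],[1,1,2]]) [-1,1,-1,1]
]
lemma tt0 : (dat0.all fun p => D.chk p.1 p.2) = true := by decide +kernel
def dat : List (List ℕ × Cert) := dat0
lemma tt : (dat.all fun p => D.chk p.1 p.2) = true := by
  exact tt0
theorem main : PanyushevProperty ℂ (Matrix.ToLieAlgebra ℂ CartanMatrix.F₄) :=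
  fin md ck ![22, 42, 30, 16] (by decide +kernel) dat tt (by decide +kernel)
end PaperStmt.F4

namespace PaperStmt.E6
open Chk Pres E8m
attribute [local instance] LieRing.ofAssociativeRing

def rk : List ℕ := rp [1073741824,16777216,262144,4096,64,1,1090519040,17039360,266240,262208,4097,1090781184,17043456,17039424,266304,266241,1090785280,1090781248,17043520,17043457,266305,1090785344,17305664,1090785281,17043521,1091047488,1090785345,17305665,1107824704,1091047489,17309761,1107824705,1091051585,1107828801,1108090945,1108091009]
def A : List (List ℤ) := [[2,0,-1,0,0,0],[0,2,0,-1,0,0],[-1,0,2,-1,0,0],[0,-1,-1,2,-1,0],[0,0,0,-1,2,-1],[0,0,0,0,-1,2]]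
def G : List (List ℤ) := [[32,24,40,48,32,16],[24,48,48,72,48,24],[40,48,80,96,64,32],[48,72,96,144,96,48],[32,48,64,96,80,40],[16,24,32,48,40,32]]
def D : RD := ⟨6, A, G, rk, NE⟩
lemma md : Md 6 D X8 := mdE (by norm_num) A G rk (by decide +kernel) (by decide +kernel)
lemma ck : Ck CartanMatrix.E₆ D where
  hn := rfl
  n8 := by norm_num
  diag := by decide +kernel
  rk8 := by decide +kernel
  nodup := by decide +kernel
  row := by decide +kernel
  sgn := by decide +kernel
  inv := ⟨![![4, 3, 5, 6, 4, 2], ![3, 6, 6, 9, 6, 3], ![5, 6, 10, 12, 8, 4], ![6, 9, 12, 18, 12, 6], ![4, 6, 8, 12, 10, 5], ![2, 3, 4, 6, 5, 4]],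
    3, by decide +kernel⟩
  pos := ⟨![16, 22, 30, 42, 30, 16], by decide +kernel⟩
  dgk := by decide +kernel
  gram := by decide +kernel
  smp := by decide +kernel
  vecp := by decide +kernel
  vecn := by decide +kernel
  off := by decide +kernel
  op := by decide +kernel
  gen := by decide +kernel
  stab := by decide +kernel
  sre := by decide +kernel
set_option maxHeartbeats 2000000 in
def dat0 : List (List ℕ × Cert) := ((bins 6).drop 1).zip [
.A [] [] [1,0,0,0,0,0],
.A [40] (q [[0,-1]]++u [10,44,50,57]) [-1,1,0,0,0,0],
.A [32,17] (q [[1],[1,-1]]++u [8,9,10,14,16,20,44,47]) [-1,1,0,0,0,0],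
.C [38,34,33] (q [[0,0,1,1],[-1,0,0,1],[0,0,0,1],[0,0,0,0,0,0,1],[0,0,0,0,0,0,0,1]]++u [9,11,43,47]) (u [8,14,15,17,18,20]++[[(21,1),(13,1)],[(22,1),(21,1)]]++u [23,24,25]++[[(26,1),(19,1)],[(27,1),(26,1)]]++u [29,30,32]) [[[(0,9,1)],[(0,12,1)],[(0,14,1)],[(0,15,1)],[(1,14,1)],[(1,15,1)],[(3,9,-1)],[(3,14,-1)],[(4,15,1)]],[[(0,8,1)],[(2,8,-1)]]],
.A [33,29,27] (q [[1,1],[1,0,1],[1,1,1]]++u [9,10,45,46,47,52]) [-1,-1,0,1,0,0],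
.A [29,13,19,27,24] (q [[0,-1,-1,-2],[-1,-1,-1,-1],[0,0,-1,-1],[-2,-2,-3,-4,-1],[1,1,2,2,1]]++u [9,10,11,16,45,46,52]) [0,0,0,-1,1,0],
.A [24,13,12] (q [[-1],[-1,-1],[0,-1,0,-1]]++u [9,10,11,16]) [1,0,0,0,0,0],
.A [40] (q [[0,-1]]++u [10,44,49,53]) [-1,1,0,0,0,0],
.A [36,34,32] (q [[0,0,1],[-1,1],[0,1]]++u [8,11,43,46,47,55]) [1,-1,-1,1,0,0],
.C [18,32,31,33] (q [[1,0,2,1],[1,1,2,1],[0,1,1,1],[1,0,1,1]]++u [8,10,11,15,42,44,46,51]) ([[(13,1),(12,1)],[(16,-1),(14,1)]]++u [17,19,20,21]++[[(23,-1),(7,1)],[(26,1),(9,1)]]) [[[(0,1,1)],[(0,4,1)],[(0,5,1)],[(0,7,1)],[(1,3,-1)],[(1,6,1),(0,7,1)],[(2,4,-1),(1,6,-1),(0,7,-1)],[(2,7,1),(0,1,-1)],[(3,7,1)]],[[(0,1,1)],[(0,3,1)],[(1,1,1)],[(1,3,1)]],[[(0,2,-1)],[(0,3,-1)],[(3,3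,1)]]],
.A [30,17,18] (q [[2,-1,1],[1,-1],[1,-1,1]]++u [8,11,15,44,47,10]) [-1,1,0,0,0,0],
.A [30,20,22,21] (q [[1,0,1,-1],[0,1,1,1],[0,-1,1,-1],[1,0,1,1],[0,0,0,0,0,0,1]]++u [42,43,48,10,11,46,47]) [0,0,-1,1,0,0],
.A [23,17,20,25] (q [[1,1,0,1],[0,0,0,1],[1,1,1,2],[2,1,1,2],[0,0,0,0,0,0,0,1]]++u [10,11,43,46,47]) [-1,0,1,-1,1,0],
.A [20,21,17,19] (q [[-1,1,1,2],[2,1,1,2],[-2,-1,-1,1],[1,2,-1,1],[0,0,0,0,0,0,1]]++u [10,42,46]) [0,0,1,-1,1,0],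
.A [20,13,12,21] (q [[-1,-1,1],[-1,-1],[-1,-2,1,-1],[0,-1,1]]++u [11,46,10]) [-1,-1,1,0,0,0],
.C [41] (q [[0,1]]) (u [10,15,19,20,23,24,26,27,28,30,31,32,33,34,35,36,37,38,39,40]) [[[(0,19,1)]]],
.A [38,34] (q [[0,0,1],[-1],[0,0,0,0,0,0,0,1]]++u [11,13,43,45,49,50,54]) [-1,-1,1,0,0,0],
.A [23,36] (q [[0,1],[0,1,1],[0,0,0,0,0,0,1]]++u [9,14,16,21,42,45,50,52,57]) [-1,-1,0,1,0,0],
.A [30,17,28] (q [[0,1,-1],[0,0,-1],[-1,1,-1]]++u [8,9,14,16,47,50,44]) [0,-1,1,0,0,0],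
.A [30,23,20] (q [[2,1,1],[-1,1,-2],[-1,1,1],[0,0,0,0,0,0,1],[0,0,0,0,0,0,0,1]]++u [9,11,42,45]) [0,-1,0,1,0,0],
.A [29,24,15] (q [[2,1,1],[1,1,1],[1,1],[0,0,0,0,0,0,0,1]]++u [9,11,16,47,52]) [-1,-1,0,1,0,0],
.A [26,22,13] (q [[2,-1,1],[1,-1,1],[1,-1],[0,0,0,0,0,0,1]]++u [9,11,16,47,52]) [-1,1,0,0,0,0],
.A [20,13,12] (q [[-1],[-1,-1],[-1,-1,0,-1]]++u [9,11,16,45]) [1,0,0,0,0,0],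
.A [24,35] (q [[0,1],[1,1],[0,0,0,0,0,0,1],[0,0,0,0,0,0,0,1]]++u [8,11,17,42,43,44,47,53]) [0,-1,1,0,0,0],
.A [30,28,22,23] (q [[0,1,1],[0,1,1,1],[-1,0,0,-1],[-1,0,-1,-1]]++u [8,11,43,44,49]) [1,-1,-1,1,0,0],
.B [23,25,20,22] (q [[-1,1,0,0,2],[0,1,1,0,2],[0,1,1,0,1],[-1,0,0,0,1],[0,0,0,0,0,0,1]]++u [11,47,42]) [[(12,1),(9,1)],[(17,1),(14,-1)]] (u [8,44]++q [[0,0,0,1]]++[[(5,1),(4,-1),(0,2),(2,1)]]) [(20,1)],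
.A [12,20,25,19] (q [[0,0,0,-1],[1,1,1],[2,1,1],[1,1]]++u [8,11,47]) [-1,-1,0,1,0,0],
.A [25,22,15] (q [[0,-1,-1],[-1,-1,-1],[-1,-1,-2],[0,0,0,0,0,0,1],[0,0,0,0,0,0,0,1]]++u [12,42,43,48]) [0,-1,-1,1,0,0],
.A [19,17,14,25] (q [[2,2,1,3],[-1,-1,-1,-1],[1,1,1,2],[2,1,1,2],[0,0,0,0,0,0,0,1]]++u [11,43]) [-1,0,1,-1,1,0],
.A [15,21,17] (q [[1,1,-1],[1],[-1,-1,-1]]++u [42,47]) [-1,0,1,0,0,0],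
.A [13,12,21,15] (q [[-1,-1,-1],[1,0,-1,-1],[1],[1,1,-1]]++u [47]) [-1,0,1,0,0,0],
.A [] [] [1,0,0,0,0,0]
]
set_option maxHeartbeats 2000000 in
def dat1 : List (List ℕ × Cert) := ((bins 6).drop 33).zip [
.C [38,37] (q [[1,0,1],[1],[0,0,0,0,0,0,0,1]]++u [13,19,43,49,55]) (q [[0,0,0,0,0,0,1]]++u [11,12,16,17,21,22,23,25,26,27,30,31,33,34,36]) [[[(0,8,1)],[(0,11,1)],[(0,13,1)],[(0,15,1)],[(1,14,-1)],[(2,15,-1)],[(4,15,1)],[(7,15,-1)]]],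
.A [36,34,29] (q [[0,0,1],[-1,-1],[0,-1],[0,0,0,0,0,0,1]]++u [10,15,42,45,50]) [-1,-1,1,0,0,0],
.A [31,33,12] (q [[-1,0,-1],[0,0,-1],[-1,0,-2,-1]]++u [8,9,14,15,20,44,51]) [0,-1,1,0,0,0],
.A [32,25,28] (q [[1,1,0,1],[1,0,0,1],[1,1,0,2]]++u [10,12,43,46,48]++q [[0,0,0,0,0,0,1]]) [0,0,-1,0,1,0],
.C [28,26,23,25,22] (q [[0,0,0,1],[2,1,2,3,0,1],[1,-1,-2,3,0,2],[2,-2,-1,3,0,1],[1,-1,1,3,0,2],[0,0,0,0,0,0,0,1]]++u [9,43,45]) (u [8]++[[(14,2),(6,1),(11,1),(15,-1)],[(15,-1),(13,1),(14,1)],[(19,-1),(12,1),(16,1),(20,1)],[(20,-1),(18,1),(19,-1)]]++u [24]) [[[(0,3,-1)],[(0,5,1)],[(1,3,-1),(0,5,2)],[(1,4,-2),(0,5,8),(1,3,-1)],[(1,5,1)]],[[(0,4,1)],[(1,2,-1),(0,4,2)],[(1,4,-1)],[(2,4,1)]],[[(0,2,1)],[(1,2,1)],[(1,3,-6),(1,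2,-1)],[(3,2,-1)]],[[(0,3,1)],[(1,3,1)]]],
.A [19,27,22,21] (q [[-1,1,0,2],[0,1,1,1],[-1,0,0,1],[0,1,1,2],[0,0,0,0,0,0,1]]++u [9,10,42,45,46]) [1,0,0,-1,1,0],
.A [21,18,12,19] (q [[0,-1,-1],[-1,-1,-1],[0,-1,-1,-1],[-1,-1,-2]]++u [9,10,45]) [0,-1,-1,1,0,0],
.A [33,29] (q [[1,1],[0,-1],[0,0,0,0,0,0,1]]++u [10,12,42,44,48,49,53]) [-1,0,1,0,0,0],
.A [31,33,16] (q [[0,0,1,1],[1,0,0,1],[1,0,2,1],[0,0,0,0,0,0,0,1]]++u [8,13,15,19,44,51]) [0,-1,0,0,1,0],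
.A [28,26,22] (q [[-1,1],[0,1,1],[0,0,1],[0,0,0,0,0,0,1]]++u [10,42,44,46,51]) [1,-1,-1,1,0,0],
.A [26,12,28,16] (q [[0,1],[-1,1,0,-1],[-1,1,1],[0,0,1]]++u [15,44,46,51,8]) [1,-1,-1,1,0,0],
.A [22,16,24] (q [[-1,-2,1],[1,0,1],[-1,2,1],[0,0,0,0,0,0,1]]++u [42,43,48]) [1,0,-1,1,0,0],
.A [20,17,16,18] (q [[1,1,2,3],[1,0,1,2],[1,0,1,1],[-1,-1,0,-1],[0,0,0,0,0,0,0,1]]++u [10,43]) [0,1,0,-1,1,0],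
.A [19,16,14,17] (q [[2,2,1,3],[2,1,1,2],[1,1,1,2],[1,0,0,1],[0,0,0,0,0,0,1]]++u [10,42]) [-1,0,1,-1,1,0],
.A [19,14,12,16] (q [[-1,2,1],[-1,1,1],[-1,0,0,-1],[0,1,1]]++u [10,46]) [1,-1,-1,1,0,0],
.A [38,30] (q [[0,0,1],[1],[0,0,0,0,0,0,1],[0,0,0,0,0,0,0,1]]++u [8,13,14,17,43,45]) [-1,1,0,0,0,0],
.C [34,26,29] (q [[1,1,0,0,2],[1,1,0,0,1],[1,0,0,0,1],[0,0,0,0,0,0,0,1]]++u [13,18,43,49,54]) (q [[0,0,0,0,0,0,1]]++[[(12,1),(10,1)],[(17,1),(15,-1)],[(19,1),(11,-1)],[(22,1),(20,-1)],[(24,1),(16,1)]]++u [25]++[[(28,1),(21,1)]]) [[[(0,3,1)],[(0,5,1)],[(0,6,1)],[(0,7,1)],[(1,6,-1)],[(1,7,-1),(0,6,1)],[(2,6,1)],[(4,6,1)]],[[(0,4,1)],[(0,6,1)],[(0,7,1)],[(1,6,-1)],[(1,7,-1)],[(2,7,1)]],[[(1,5,1)]]],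
.A [29,27,26,19] (q [[1,-1,-1,-3],[0,0,0,-1],[1,1,1,1],[0,0,-1,-1],[0,0,0,0,0,0,1]]++u [8,9,14,42]) [1,1,0,-2,1,0],
.A [24,17,25,26] (q [[0,1,-1,0,1],[0,1,-2,0,1],[1,0,0,0,1],[1,2,-2,0,1]]++u [8,9,44,45]) [0,0,1,-1,0,1],
.A [27,19,21] (q [[1,1,1],[1,1],[2,1,1],[0,0,0,0,0,0,1],[0,0,0,0,0,0,0,1]]++u [9,12,43,48]) [-1,-1,0,1,0,0],
.A [24,15,22,25] (q [[1,1,2,1],[1,1,2,2],[0,0,1,1],[2,1,3,2],[0,0,0,0,0,0,0,1]]++u [9,43,45]) [1,1,0,-1,0,1],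
.A [20,17,21,18] (q [[-1,2,1,3],[-1,0,-1,1],[1,0,1,1],[-1,-2,1,-1],[0,0,0,0,0,0,1]]++u [42,45]) [1,1,0,-1,1,0],
.A [20,13,12,21] (q [[-1,-1,1],[-1,-1],[-1,-2,1,-1],[0,-1,1]]++u [9,45]) [-1,-1,1,0,0,0],
.A [29,31,24] (q [[0,-1,1],[-1,-1],[0,0,1],[0,0,0,0,0,0,1],[0,0,0,0,0,0,0,1]]++u [8,42,43,48,53]) [-1,-1,1,0,0,0],
.A [28,16,22,23] (q [[0,1,1,1],[0,1,1],[-1,0,0,-1],[-1,1,0,-1]]++u [8,13,44,49]) [1,-1,-1,1,0,0],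
.A [21,22,20,19] (q [[0,0,0,1],[-2,-1,-1,1],[0,1,1,1],[-1,0,-1,1],[0,0,0,0,0,0,1]]++u [42,44]) [1,1,1,-2,1,0],
.B [19,17,16,20,18] (q [[1,1,1,2,1],[2,1,2,4,1],[2,1,2,3,1],[2,2,3,5,1],[0,0,1,1,1]]++u [8,44]) [[(10,1),(6,1),(7,2),(9,1)],[(15,1),(11,1),(14,-2),(13,1)]] [[(5,-2),(4,-1),(3,3),(0,2),(2,1)]] [(18,1),(16,5)],
.A [19,16,14] (q [[-1,2,1],[0,1,1],[-1,1,1],[0,0,0,0,0,0,1],[0,0,0,0,0,0,0,1]]++u [12,43]) [1,-1,-1,1,0,0],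
.A [18,16,15,17] (q [[0,0,1,1],[1,0,1,1],[1,1,2,3],[1,-1,0,1],[0,0,0,0,0,0,0,1]]++u [43]) [0,1,0,-1,1,0],
.A [15,14,17,16] (q [[2,2,1,3],[0,0,1,1],[2,-2,-1,1],[2,0,1,1]]++u [42]) [-1,1,1,-1,1,0],
.A [14,13,12,16,15] (q [[1,-1,1,2,0,2],[2,-2,-1,1,0,1],[2,-2,-1,1,0,4],[4,-1,1,2,0,2],[1,0,0,1,0,1]]) [1,-1,-1,1,-1,1]
]
lemma tt0 : (dat0.all fun p => D.chk p.1 p.2) = true := by decide +kernel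
lemma tt1 : (dat1.all fun p => D.chk p.1 p.2) = true := by decide +kernel
def dat : List (List ℕ × Cert) := dat0 ++ (dat1)
lemma tt : (dat.all fun p => D.chk p.1 p.2) = true := by
  simp only [dat, List.all_append, tt0, tt1, Bool.and_self]
theorem main : PanyushevProperty ℂ (Matrix.ToLieAlgebra ℂ CartanMatrix.E₆) :=
  fin md ck ![16, 22, 30, 42, 30, 16] (by decide +kernel) dat tt (by decide +kernel)
end PaperStmt.E6

namespace PaperStmt.E7
open Chk Pres E8m
attribute [local instance] LieRing.ofAssociativeRing

def rk : List ℕ := rp [68719476736,1073741824,16777216,262144,4096,64,1,69793218560,1090519040,17039360,266240,262208,4097,69809995776,1090781184,17043456,17039424,266304,266241,69810257920,1090785280,1090781248,17043520,17043457,266305,69810262016,69810257984,1090785344,17305664,1090785281,17043521,69810262080,1091047488,69810262017,1090785345,17305665,69810524224,1107824704,69810262081,1091047489,17309761,69827301440,69810524225,1107824705,1091051585,70901043264,69827301441,69810528321,1107828801,70901043265,69827305537,1108090945,70901047361,69827567681,1108091009,70901309505,69827567745,70918086721,70901309569,70918086785,70918348929,70918353025,70918353026]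
def A : List (List ℤ) := [[2,0,-1,0,0,0,0],[0,2,0,-1,0,0,0],[-1,0,2,-1,0,0,0],[0,-1,-1,2,-1,0,0],[0,0,0,-1,2,-1,0],[0,0,0,0,-1,2,-1],[0,0,0,0,0,-1,2]]
def G : List (List ℤ) := [[72,72,108,144,108,72,36],[72,126,144,216,162,108,54],[108,144,216,288,216,144,72],[144,216,288,432,324,216,108],[108,162,216,324,270,180,90],[72,108,144,216,180,144,72],[36,54,72,108,90,72,54]]
def D : RD := ⟨7, A, G, rk, NE⟩
lemma md : Md 7 D X8 := mdE (by norm_num) A G rk (by decide +kernel) (by decide +kernel)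
lemma ck : Ck CartanMatrix.E₇ D where
  hn := rfl
  n8 := by norm_num
  diag := by decide +kernel
  rk8 := by decide +kernel
  nodup := by decide +kernel
  row := by decide +kernel
  sgn := by decide +kernel
  inv := ⟨![![4, 4, 6, 8, 6, 4, 2], ![4, 7, 8, 12, 9, 6, 3], ![6, 8, 12, 16, 12, 8, 4], ![8, 12, 16, 24, 18, 12, 6], ![6, 9, 12, 18, 15, 10, 5], ![4, 6, 8, 12, 10, 8, 4], ![2, 3, 4, 6, 5, 4, 3]],
    2, by decide +kernel⟩
  pos := ⟨![34, 49, 66, 96, 75, 52, 27], by decide +kernel⟩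
  dgk := by decide +kernel
  gram := by decide +kernel
  smp := by decide +kernel
  vecp := by decide +kernel
  vecn := by decide +kernel
  off := by decide +kernel
  op := by decide +kernel
  gen := by decide +kernel
  stab := by decide +kernel
  sre := by decide +kernel
set_option maxHeartbeats 2000000 in
def dat0 : List (List ℕ × Cert) := ((bins 7).drop 1).zip [
.A [] [] [1,0,0,0,0,0,0],
.C [67,59] (q [[0,0,-1,0,0,1],[0,0,0,0,0,1]]++u [10,11,16,18,19,23,74,82]) (u [8,14,15,20,21,26,27,28,32,33,34,36,38,39,40,41,43,44,45,46,48,49,50,51,53,54,55,57,58,60,61,63]) [[[(0,20,1)],[(0,24,1)],[(0,27,1)],[(0,29,1)],[(0,31,1)],[(2,29,-1)],[(2,31,-1)],[(4,31,1)],[(6,31,-1)],[(11,31,1)]]],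
.A [49,38] (q [[1,1],[0,1]]++u [9,10,11,13,16,22,29,30,74,75,81,87,92,94]) [0,-1,1,0,0,0,0],
.A [60,50,52] (q [[0,-1],[0,0,-1],[-1,0,-1],[0,0,0,0,0,0,0,1]]++u [8,11,12,13,17,19,24,31,71,73,76]) [0,-1,-1,1,0,0,0],
.A [50,54,33] (q [[1],[1,1,1],[0,1]]++u [19,24,25,75,76,81,82,87,88,94,11,17]) [-1,-1,0,1,0,0,0],
.A [38,51,15,49] (q [[0,1],[1,0,1],[1,0,0,-1],[1,1]]++u [11,13,17,18,24,25,31,70,74,75,76,81,82,87,94,10]) [-1,-1,0,1,0,0,0],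
.A [46,27,14] (q [[1,-1],[0,-1],[-1,1,0,0,-1]]++u [11,12,13,18,73,74,80,88]) [-1,1,0,0,0,0,0],
.C [52,57,42,51] (q [[-1,0,1,2,1],[0,0,1,1,1],[0,0,1,2,1],[0,0,1,1],[0,0,0,0,0,0,0,1]]++u [9,11,13,14,15,19,20,71,74,76,77,78,82]) (u [17,22,24]++[[(26,1),(25,-1)],[(27,-1),(16,1)]]++u [29]++[[(30,1),(21,1)],[(32,1),(10,1)],[(33,1),(31,-1)],[(34,-1),(23,1)]]++u [36]++[[(37,1),(28,1)],[(38,1),(18,1)]]++u [40,41,45]) [[[(0,8,-1)],[(0,9,-1)],[(0,11,-1)],[(0,14,1)],[(0,15,1)],[(1,8,-1)],[(1,11,-1)],[(1,14,1)],[(1,15,1)],[(3,8,1)],[(3,9,1),(0,14,1)],[(3,11,1)],[(3,14,-1)],[(4,14,1)],[(4,15,1)]],[[(0,11,1)],[(0,12,-1)],[(0,13,-1)],[(1,12,-1)],[(2,11,-1)],[(2,12,1)],[(2,13,1)],[(5,12,1)]],[[(0,7,-1)],[(3,6,-1)],[(3,7,-1)]]],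
.A [32,46,47,33,44] (q [[-1,0,0,0,-1],[0,0,0,1],[0,1,1,1],[-1,1,0,0,-1],[0,0,0,1,1]]++u [8,9,11,13,15,19,71,72,74,78]) [1,0,0,-1,1,0,0],
.B [34,32,36,45,35,33] (q [[0,1,1,1,0,1],[0,0,1,1,0,1,1],[2,2,3,5,0,3,1],[2,2,3,3,0,1,1],[2,3,4,6,0,2,1],[0,1,0,2,0,2,1]]++u [11,12,19,76,82]++q [[0,0,0,0,0,0,0,1]]++u [13,70,74]) [[(25,-1),(24,1),(10,-1),(8,1)],[(30,1),(29,-1),(16,1),(15,1)],[(31,-1),(17,1),(14,1)],[(37,1),(22,-1),(20,1)]] (u [9,72]++[[(76,2),(70,1),(12,-1),(11,4),(74,1),(75,-1),(7,1)]]++q [[0,0,0,0,1]]) [(45,1),(21,-2),(32,1),(33,2),(34,1),(36,3)],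
.A [42,21,34,14] (q [[0,1,-1],[-1,0,-1],[-1,1,-1],[0,0,0,0,-1]]++u [9,12,13,19,75,76,11]) [0,-1,1,0,0,0,0],
.A [32,16,41,22,33] (q [[-1,-2,-2,-3,-1],[0,-1,-1,-1],[0,-1,-1,-2],[0,1,1,1,1],[-1,0,-1,-1],[0,0,0,0,0,0,0,1]]++u [11,14,19,71,75,76,77,82,12,13,70,8]) [0,0,0,-1,1,0,0],
.A [27,28,16,37,20] (q [[-1,1,1,1,1],[-2,2,0,1,1],[0,0,0,1,1],[0,1,1,1,1],[0,-2,-2,-3,-1]]++u [13,74,75,76,82,8,12,71]) [2,-1,-1,1,-1,1,0],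
.A [23,20,22] (q [[-1,1],[0,0,0,-1],[-1]]++u [11,13,19,70,74]) [1,0,0,0,0,0,0],
.A [23,15,14,22] (q [[-1,1],[0,0,0,-1],[-2,1,0,-1,-1],[-1]]++u [11,13,19,74]) [1,0,0,0,0,0,0],
.C [51,63,64] (q [[0,0,1],[0,1,1,0,1],[0,0,1,0,1],[0,0,0,0,0,0,0,1]]++u [8,9,12,16,18,20,23,26,71,75,81]) (u [11,17,19,22,25]++[[(27,1),(48,1)]]++u [29,30,32,34,35]++[[(36,1),(53,1)]]++u [37,38,39,40,41,42,43,44,45,46]++[[(48,1),(24,1)]]++u [49,50,52]++[[(53,1),(31,1)]]++u [56]) [[[(0,11,-1)],[(0,17,-1)],[(0,21,-1)],[(0,23,-1)],[(0,24,-1)],[(0,27,-1)],[(1,11,-1)],[(1,24,-1)],[(1,27,-1)],[(3,27,-1)],[(5,16,-1)],[(5,21,-1)],[(5,26,1),(0,21,-1),(3,27,1)],[(6,21,-1)],[(9,23,-1)]],[[(0,11,1)],[(2,11,-1)]]],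
.A [52,55,49] (q [[0,0,0,0,0,1],[1,0,1,0,0,1],[1,0,0,0,0,1]]++u [9,10,13,18,71,72,73,76,78,81,84,91]) [1,-1,-1,0,1,0,0],
.C [27,49,47,41,48] (q [[-1,2,1,2,0,1],[-1,3,1,3,0,1],[0,1,1,1],[-1,3,1,2,0,1],[-2,4,1,3,0,1]]++u [9,10,12,13,16,18,23,72,73,79,81,86]) ([[(14,1),(11,1)],[(20,1),(19,1)]]++u [24]++[[(26,1),(15,1),(25,-1),(37,1)]]++u [30]++[[(31,-1),(29,1),(17,1)],[(33,-1),(8,1),(29,2),(31,-1)],[(35,1),(28,1)],[(37,-1),(25,-1),(22,1)],[(42,-1),(21,1)]]) [[[(0,3,-1)],[(0,4,1)],[(0,5,1)],[(0,7,-1)],[(0,9,-1)],[(1,7,-1)],[(1,9,-1)],[(2,4,-1)],[(2,9,1)],[(3,7,-1)],[(3,9,1)]],[[(0,4,-1)],[(0,6,1)],[(0,9,-1)],[(0,10,-1)],[(2,6,-1)],[(2,10,1)],[(3,4,2),(0,10,1)],[(3,9,-1)]],[[(0,3,-1)],[(0,5,-1)],[(0,7,-1)],[(1,5,1)],[(1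,7,1)],[(3,5,-1)]],[[(0,5,1)],[(1,5,-1)]]],
.A [46,34,47,26] (q [[0,1,0,1],[-1,1,0,1],[0,0,1,1],[-1,0,0,1]]++u [9,10,12,13,16,73,75,79,81]) [1,0,0,-1,1,0,0],
.A [40,38,22,46,29] (q [[1,0,1],[0,0,1,0,-1],[0,0,1,1],[1,1,2,2],[1,1,1,1,1],[0,0,0,0,0,0,0,1]]++u [12,14,18,71,73,76,77,81,10,13,70,8]) [0,0,-1,0,1,0,0],
.A [22,20,41,42,39] (q [[0,1,1,1,1],[-1,1,-1,0,1],[0,2,1,1,1],[0,1,0,1,1],[-1,2,0,1,1]]++u [12,75]++[[(8,1),(81,1),(13,1)],[(10,-2),(81,-1),(8,1),(13,-1)],[(13,-1),(81,1),(8,-1)],[(76,1),(73,1),(71,-1)],[(71,-1),(76,-1),(73,-1)],[(73,-1),(71,1),(76,1)],[(76,-1),(18,-2),(73,-1),(71,1)],[(81,-1),(8,1),(13,-1)]]) [1,-2,0,1,-1,1,0],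
.A [20,35,37,21] (q [[-1,0,-1,-1],[-1,1,-1],[0,1,-1],[0,0,-1],[0,0,0,0,0,0,0,1]]++u [10,12,18,70,73,75,81]) [0,-1,1,0,0,0,0],
.A [35,37,15,14] (q [[-1,1],[0,1],[-1,0,0,-1],[-1,1,0,-1,-1]]++u [13,18,73,75,81,10]) [0,-1,1,0,0,0,0],
.A [36,29,31,32] (q [[1,-1,0,-2],[0,0,0,-1],[1,1,2,2],[0,0,1,1],[0,0,0,0,0,0,0,1]]++u [8,9,14,15,20,70,71,72,77,78,83]) [0,0,-1,1,0,0,0],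
.A [25,34,37,33,22] (q [[1,3,3,5,1],[0,1,1,1],[1,1,1,1,1],[0,2,1,3,1],[0,1,1,2,1]]++u [9,13,15,71,76,78,8,12,75]) [1,-1,0,-1,1,1,0],
.A [21,31,33,22] (q [[0,0,0,1],[0,1,1,2],[-1,1,0,1],[-1,1,1,2],[0,0,0,0,0,0,0,1]]++u [9,13,70,72,75,76,12]) [1,0,0,-1,1,0,0],
.A [30,14,21,29,25,28] (q [[1,0,1,0,1,1],[1,0,2,0,1,2],[0,0,1,1,1,1],[1,1,3,2,2,2],[1,1,2,2,1,1],[1,1,1,1,1,1]]++u [9,13,72,75,76,12]) [0,0,-1,1,0,-1,1],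
.A [28,31,17,16] (q [[-2,2,-1,1],[2,1,1,2],[-1,1,1,2],[1,-1,-1,1],[0,0,0,0,0,0,0,1]]++u [8,13,14,71,76]) [0,0,1,-1,1,0,0],
.A [28,24,20,16,25] (q [[1,2,-1,1,0,0,1],[0,1,0,1,0,0,1],[1,2,-1,1,0,0,3],[-1,0,-1,1,0,0,1],[1,1,0,1,0,0,1]]++u [8,13,71,75]) [-1,-1,0,1,-1,1,0],
.A [23,24,15,25] (q [[1,1],[1,1,1],[2,1,1,-1],[2,1,1],[0,0,0,0,0,0,0,1]]++u [12,76,75]) [-1,-1,0,1,0,0,0],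
.A [23,15,24,14,25] (q [[1,1],[2,1,1,-1],[1,1,1],[0,0,-1,-1,-1],[2,1,1]]++u [12,76,75]) [-1,-1,0,1,0,0,0],
.A [67] (q [[0,0,-1]]++u [11,19,73,79,84,89]) [-2,1,0,0,0,0,0]
]
set_option maxHeartbeats 2000000 in
def dat1 : List (List ℕ × Cert) := ((bins 7).drop 33).zip [
.C [57,62,61,33] (q [[0,1,2,1,0,0,1],[0,1,2,3,0,0,1],[0,1,1,1],[0,1,0,1,0,0,1]]++u [8,9,10,11,17,19,22,25,27,30,36,72]) ([[(14,1),(51,1)],[(7,1),(47,-1)]]++u [24]++[[(26,1),(58,1)],[(20,1),(55,-1)]]++u [31]++[[(32,1),(39,-1)]]++u [34,35]++[[(39,-1),(29,1)],[(40,1),(46,-1)]]++u [41,42,44]++[[(46,-1),(37,1)],[(47,1),(18,1)]]++u [50]++[[(51,-1),(12,1)],[(55,-1),(28,1)],[(58,1),(23,1)]]) [[[(0,1,-1)],[(0,3,-1)],[(0,4,1)],[(0,8,1)],[(0,9,1)],[(0,12,1)],[(0,13,-1)],[(0,14,1)],[(0,16,-1)],[(0,19,2),(0,3,-1)],[(1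,3,1)],[(1,4,-1)],[(1,13,1)],[(1,16,1)],[(2,16,1)],[(3,4,-1)]],[[(0,9,1)],[(0,12,-1)],[(0,13,1)],[(1,9,-1)],[(3,9,1)],[(4,9,-1)]]],
.A [34,53,43,58] (q [[-1,0,0,0,1],[-1,0,-1,0,1],[-1,0,-1],[-1,-1,0,0,1]]++u [9,10,11,16,17,19,25,30,70,72,73,74,79,80,85,13]) [-1,-1,0,0,1,0,0],
.A [20,46,34] (q [[1,0,0,-1],[1,1],[0,1]]++u [9,11,13,16,17,22,25,30,72,74,76,10]) [0,-1,1,0,0,0,0],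
.A [43,41,23,51,29,49] (q [[-1,0,-1,-1,-1],[-1,0,-2,-3,-2],[1,2,2,5,4,2],[1,1,2,3,2,1],[0,0,0,-1,-1,-1],[1,0,0,-1,-2,-2]]++u [11,13,17,71,74,76,77,80]++q [[0,0,0,0,0,0,0,1]]++u [8,14,70]) [0,-1,0,0,1,0,0],
.A [26,47,34,42] (q [[-1,0,0,1],[0,0,1,1],[-1,1,0,1],[0,1,0,1]]++u [10,11,13,19,25,71,74,76,80,88,8,73]) [1,0,0,-1,1,0,0],
.A [23,27,40,47] (q [[0,0,0,0,1],[-1,-1,0,0,1],[1,-1,0,0,1],[1,1,2,0,1],[0,0,0,0,0,0,0,1]]++u [11,13,17,19,25,74,80,82,88]) [0,2,1,-2,0,1,0],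
.A [42,15,29,14] (q [[1,1],[1,0,0,-1],[0,1],[1,1,0,-1,-1]]++u [11,13,17,25,74,76,10]) [0,-1,1,0,0,0,0],
.A [23,41,24] (q [[-1,1,-2],[2,1,1],[-1,1,1],[0,0,0,0,0,0,0,1]]++u [8,9,13,14,15,19,20,72]) [0,-1,0,1,0,0,0],
.A [37,18,26,34] (q [[0,0,-1,-1],[0,1,0,1],[-2,-1,-4,-3],[-1,0,-1,-1]]++u [8,9,15,71,72,78,11,19]) [0,1,-1,-1,1,0,0],
.A [21,32,37,24] (q [[-3,1,-2,0,2],[-1,0,0,0,1],[-2,1,-1,0,2],[-2,1,-1,0,1],[0,0,0,0,0,0,0,1]]++u [9,11,19,72,74,82,13]) [-1,1,0,-1,1,0,0],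
.A [36,18,20,29] (q [[2,1,1],[1,1],[0,0,-1,-1],[1,1,1]]++u [9,11,13,19,72,76,82]) [-1,-1,0,1,0,0,0],
.A [31,26,36,22] (q [[1,1,2,3],[0,0,0,1],[1,-1,0,-1],[0,0,1,1],[0,0,0,0,0,0,0,1]]++u [8,11,13,70,74,76,82]) [0,1,0,-1,1,0,0],
.A [27,31,20,16] (q [[1,-1,1],[2,-1,1],[1,-1,0,-1],[1,-1]]++u [8,11,13,19,76,82]) [-1,1,0,0,0,0,0],
.A [30,15,24] (q [[1,0,1],[0,0,0,-1],[0,0,1],[0,0,0,0,0,0,0,1]]++u [13,74,76,82]) [-1,-1,1,0,0,0,0],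
.A [30,14,24,15] (q [[1,0,1],[1,0,0,-1,-1],[0,0,1],[0,0,0,-1]]++u [13,74,76,82]) [-1,-1,1,0,0,0,0],
.A [43,53,44,31] (q [[0,0,0,1],[0,0,-1],[-1,1,-1,-1],[0,1],[0,0,0,0,0,0,0,1]]++u [8,9,14,15,16,20,21,26,72,73,76,77,79,84,13]) [0,-1,1,0,0,0,0],
.B [35,42,41,32,33] (q [[0,1,1,1],[2,1,2,2,0,0,1],[2,3,4,2,0,0,1],[1,1,2,1,0,0,1],[0,1,0,0,0,0,1]]++u [10,13,16,71,73,76,78,79,8,15]) [[(19,1),(11,1),(7,1),(12,-1)],[(25,1),(18,1),(14,1)],[(30,-1),(23,-1),(20,1)],[(36,-1),(27,-1),(26,1),(28,1)]] (u [9,21,72,84]++q [[0,0,0,0,1]]++[[(5,1),(3,1)]]) [(34,1),(32,-1)],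
.A [36,32,28,35,31] (q [[0,-1,-1,0,-1],[-1,-1,-1,-1,-2],[-1,-1,-2,-1,-2],[0,0,0,1],[0,0,0,0,-1]]++u [9,16,70,73,76,13]++q [[0,0,0,0,0,0,0,1]]) [0,-1,-1,2,-2,1,0],
.A [36,28,37,24,26] (q [[1,0,0,0,-1],[0,0,-1,-1,-1],[1,1,1,2,1],[1,1,1,2],[1,1,1,3,1]]++u [9,10,13,16,73,76,79]) [-1,0,1,-1,1,0,0],
.A [33,24,30,27] (q [[-1,1,0,0,2],[0,1,1,0,1],[0,1,1,0,2],[-1,0,0,0,1],[0,0,0,0,0,0,0,1]]++u [8,13,14,70,71,77]) [1,1,1,-2,0,1,0],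
.A [30,31,27,26,23] (q [[1,0,1,1,1],[1,2,3,5,1],[0,1,2,3,1],[0,0,0,1],[0,1,1,2,1]]++u [13,71,73,76,8]) [1,1,0,-2,1,1,0],
.A [30,24,20,23,21] (q [[0,0,1,1,1],[-1,0,1,1,1],[-2,-1,0,-1,1],[0,1,0,1,1],[-2,-1,0,1,1],[0,0,0,0,0,0,0,1]]++u [13,70,76]) [2,1,-1,0,-1,1,0],
.A [30,14,24,15,23] (q [[2,1,1],[2,1,0,-1,-1],[1,1,1],[0,0,0,-1],[1,1]]++u [10,13,76]) [-1,-1,0,1,0,0,0],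
.A [33,36,22] (q [[-1,-1,-2],[0,-1,-1],[-1,-1,-1],[0,0,0,0,0,0,0,1]]++u [8,13,14,70,72,77,78,83]) [0,-1,-1,1,0,0,0],
.A [28,30,26,17] (q [[2,2,1,3],[2,1,1,2],[-1,-1,-1,-1],[1,1,1,2]]++u [8,9,13,15,71,78]) [-1,0,1,-1,1,0,0],
.A [23,25,21,22] (q [[-1,2,1,3],[0,1,1,2],[0,-1,-1,-1],[-1,1,1,2],[0,0,0,0,0,0,0,1]]++u [9,76,72]) [1,0,0,-1,1,0,0],
.A [25,22,20,21,18] (q [[2,1,1,2,2],[1,1,1,2,2],[3,2,1,3,4],[-1,-1,-1,-1,-1],[2,2,1,3,3]]++u [13,76,9,72]) [-1,0,1,0,-1,1,0],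
.A [25,18,16] (q [[1],[1,1,-1],[-1,-1,-1]]++u [8,14,76]) [-1,0,1,0,0,0,0],
.A [21,18,17,20] (q [[0,-1,-1],[-2,1,-1],[-1],[-2,0,-1,-1]]++u [13,71]) [1,0,0,0,0,0,0],
.A [20,17,16,18] (q [[-2,0,-1,-1],[-1],[0,-1,-1],[-2,1,-1]]++u [13,70]) [1,0,0,0,0,0,0],
.A [18,16,15,14,25] (q [[1,1,-1],[-1,-1,-1],[1,0,-1,-1],[-1,-1,-1,-1,-1],[1]]++u [76]) [-1,0,1,0,0,0,0],
.C [69] (q [[1]]) (u [13,19,25,30,31,36,37,40,41,42,45,46,47,49,50,51,53,54,55,56,57,58,59,60,61,62,63,64,65,66,67,68]) [[[(0,31,1)]]]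
]
set_option maxHeartbeats 2000000 in
def dat2 : List (List ℕ × Cert) := ((bins 7).drop 65).zip [
.A [63,56] (q [[0,1],[1]]++u [8,11,15,17,21,22,27,71,75,78,81,84,86,91]) [0,-1,1,0,0,0,0],
.C [50,54,52] (q [[1,0,0,0,0,1],[1,0,1,0,0,1],[0,0,0,0,0,1],[0,0,0,0,0,0,0,1]]++u [9,11,16,17,23,24,70,72,74,79,80,86,87]) (u [8]++[[(14,1),(13,-1)],[(19,-1),(15,1)]]++u [20]++[[(25,1),(21,1)]]++u [26,27]++[[(31,1),(28,1)],[(32,1),(30,1)]]++u [33,34]++[[(38,1),(37,1)]]++u [39]++[[(43,1),(42,1)],[(47,1),(44,1)]]++u [48]) [[[(0,8,1)],[(0,11,1)],[(0,13,1)],[(0,14,1)],[(0,15,1)],[(1,8,1)],[(1,11,1)],[(1,13,1)],[(1,14,1),(0,15,1)],[(1,15,1)],[(2,14,-1)],[(2,15,-1)],[(4,14,1)],[(4,15,1)],[(7,14,-1)],[(7,15,-1)]],[[(0,9,1)],[(0,11,1)],[(0,13,1)],[(0,15,1)],[(2,13,-1)],[(2,15,-1)],[(4,15,1)],[(6,1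5,-1)]],[[(1,7,-1)]]],
.A [48,58,41,14] (q [[-1,0,0,0,1,1],[0,-1,0,0,1,1],[0,0,0,0,1,1],[-1,0,0,0,0,1]]++u [9,10,12,17,23,29,35,73,75,80,86,92]) [1,0,0,0,0,-1,1],
.A [36,48,49,37] (q [[0,-1,-1,-1],[-1,-1,-3,-2],[0,0,-1],[0,0,-1,-1],[0,0,0,0,0,0,0,1]]++u [10,11,12,14,17,18,24,70,71,8]) [1,0,-2,0,1,0,0],
.B [26,42,36,44,38] (q [[0,-1,0,0,1,0,1],[2,1,0,0,3,0,1],[2,-1,2,0,3,0,1],[0,0,0,0,1],[1,0,1,0,2,0,1]]++u [8,10,24,71,74,75,87,11,12,73]) (u [9,22]++[[(23,-1),(15,1)]]++u [28]++[[(29,1),(16,-2),(19,1),(7,1)],[(34,-1),(21,2),(31,-1),(14,1)],[(35,-1),(27,1)]]++u [39]) (u [17]++[[(18,1),(8,1)]]++u [80]++[[(81,1),(71,1)],[(3,1),(2,1)],[(5,1),(1,1),(3,1)]]) [(38,2),(26,1)],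
.A [32,37,21,38] (q [[0,-1,0,-1],[0,-1,-1,-2],[-1,-1,-2,-2],[-1,0,-1,-1],[0,0,0,0,0,0,0,1]]++u [11,12,17,18,24,70,73,74,75,80,10]) [0,0,0,-1,1,0,0],
.A [39,15,30,14] (q [[-1,-1],[-1,-1,0,-1],[0,-1],[0,-1,0,-1,-1]]++u [10,12,17,73,80,18,24]) [-1,-1,1,0,0,0,0],
.B [45,44,52,25,35] (q [[1,2,0,2,1,1],[1,1,0,2,2,1],[0,1,0,1,0,1],[1,1,0,2,1,1],[0,1,0,1],[0,0,0,0,0,0,0,1]]++u [8,9,12,14,15,20,70,77]) (u [18,24,26,32]++[[(33,-1),(10,1)],[(38,-1),(17,1)]]) (u [11]++[[(71,1),(7,1)],[(72,1),(8,1)]]++u [74]++[[(75,1),(20,-1),(7,-1)],[(83,1),(12,-1),(8,-1)]]++q [[0,0,1]]++[[(5,1),(14,1),(78,1)],[(6,-1),(1,1),(4,-1)]]) [(44,1)],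
.A [26,39,38,30,31] (q [[-1,1,-1,1,0,-2],[0,0,1,1],[-1,1,0,1,0,-2],[0,0,1,1,0,-1],[0,1,0,1,0,-1]]++u [8,11,15,71,72,74,12,9]) [0,-1,1,0,-1,1,0],
.C [25,35,34,37,26] (q [[1,2,0,2,0,1],[0,1,0,1],[1,4,-1,3,0,2],[1,3,-1,2,0,1],[1,4,-2,3,0,2],[0,0,0,0,0,0,0,1]]++u [9,11,70,72,74,75,12]) (u [18,22]++[[(23,2),(10,-1),(8,1),(13,1)],[(29,1),(17,-2),(20,1),(19,1)]]) [[[(0,1,-1)],[(0,3,-1)],[(1,2,-1)],[(2,3,1),(0,1,-5)]],[[(0,2,-1)],[(1,1,-1)],[(2,2,-1)],[(3,1,1)]],[[(0,2,-1)],[(1,3,-1)],[(2,1,1)],[(2,2,-1)],[(3,3,1)]],[[(0,1,-1)],[(1,0,1)],[(2,1,1)],[(2,2,-1)]],[[(0,2,-1)],[(1,3,-1)],[(2,2,-1)]],[[(0,1,1)],[(1,0,1)]],[[(2,1,1)]]],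
.A [30,28,35,31,14,27] (q [[2,-1,0,3,1,1],[1,1,0,3,2,2],[0,0,0,1],[2,2,3,3,1,1],[0,-1,-1,0,-1],[1,1,3,3,2,2]]++u [11,12,72,74,9]) [-1,2,2,-3,2,-1,1],
.A [23,32,34,31,21] (q [[0,1,1,2,1],[0,1,2,3,1],[-1,0,-1,-1,-1],[0,1,1,2],[-1,0,-1,0,-1]]++u [8,12,14,70,74,77,11,71,75]) [1,0,0,-1,1,0,0],
.A [29,31,20,21,25] (q [[1,1,1,2,2],[1,1,0,1,1],[1,0,0,0,1],[1,1,0,2,2],[1,0,1,1,1]]++u [8,11,12,71,74,75]) [-1,0,1,0,-1,1,0],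
.A [23,25,20,22] (q [[-1,-1,-2],[0,-1,-1],[0,-1,-1,-1],[-1,-1,-1]]++u [11,12,70,74]) [0,-1,-1,1,0,0,0],
.A [23,15,25,14,22] (q [[-1,-1,-2],[0,-1,-1,-1],[0,-1,-1],[-2,-2,-3,-1,-1],[-1,-1,-1]]++u [11,12,74]) [0,-1,-1,1,0,0,0],
.A [46,45,30] (q [[0,0,-1],[1,1,1],[1,-1,1],[0,0,0,0,0,0,0,1]]++u [8,9,12,14,16,18,20,70,72,79,83]) [-1,0,1,0,0,0,0],
.A [43,50,19] (q [[1,0,1,2],[1,0,0,1],[1,0,1,1]]++u [9,10,15,16,18,21,23,28,72,73,78,81]) [-1,-2,1,0,1,0,0],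
.A [25,39,32,37] (q [[1,0,1,1],[0,1,1,1],[0,0,1],[1,2,3,1],[0,0,0,0,0,0,0,1]]++u [10,23,70,72,75,86,9,12,73]) [1,-1,-2,1,1,0,0],
.A [25,33,37,27] (q [[1,0,0,0,0,1],[1,1,0,0,0,2],[1,1,1,0,0,1],[1,1,1,0,0,2]]++u [9,10,18,23,72,73,75,81,86,12]) [1,-1,-1,0,1,0,0],
.A [22,38,39,25] (q [[-1,-2,0,-1],[1,2,3,1],[-1,1,0,2],[2,1,3,2],[0,0,0,0,0,0,0,1]]++u [8,14,18,70,73,77,12]) [1,0,-1,0,1,0,0],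
.A [20,34,35,25] (q [[-1,-2,0,-1],[0,0,1],[-1,-1],[0,-1,1]]++u [8,10,12,18,71,73,75,81]) [-1,-1,1,0,0,0,0],
.A [19,29,25,33,21] (q [[1,0,0,0,1],[1,1,1,2,2],[1,1,1,2,1],[1,1,0,1,1],[1,0,0,1,2],[0,0,0,0,0,0,0,1]]++u [10,18,70,73,75,81]) [-1,0,1,0,-1,1,0],
.A [28,31,19,14,22] (q [[-1,1,0,-1],[0,1,1,1],[0,0,0,-1],[-1,0,0,-1,-1],[-1,1,1]]++u [10,12,18,75,81]) [1,-1,-1,1,0,0,0],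
.A [34,19,22] (q [[-1,2,1],[1,0,1],[-1,-2,1],[0,0,0,0,0,0,0,1]]++u [8,12,14,72,78]) [1,0,-1,1,0,0,0],
.A [33,27,19,24] (q [[-1,0,-1,-2],[-2,-1,-1,-3],[0,0,0,-1],[0,1,1,1]]++u [9,12,71,78,75]) [-1,1,1,-2,1,0,0],
.A [29,26,19,17,28] (q [[-2,-2,-1,-3,0,1],[-3,-4,-2,-5,0,2],[-2,-3,-1,-4,0,2],[-1,-1,0,-1,0,1],[-2,-2,-1,-3,0,2],[0,0,0,0,0,0,0,1]]++u [9,12,70]) [-1,0,1,-1,0,1,0],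
.A [20,28,17,29,19] (q [[-1,-1,-1,-2,-1],[-1,0,-1,-2,-2],[-2,-1,-1,-3,-3],[0,1,1,1,1],[0,0,0,-1,-1]]++u [9,12,72,75]) [-1,1,1,-1,-1,1,0],
.A [28,24,19,16] (q [[1,1,0,1],[1,1,1,2],[2,1,1,2],[2,1,1,3],[0,0,0,0,0,0,0,1]]++u [8,12,14,75]) [-1,0,1,-1,1,0,0],
.A [21,17,23,19,20] (q [[1,-1,0,1,1],[0,0,1,1,1],[1,1,2,3,3],[1,0,1,1,1],[-1,-1,0,-1,1]]++u [8,12,71]) [0,1,0,0,-1,1,0],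
.A [20,23,19,17] (q [[-1,0,0,-1],[-1,2,1],[0,1,1],[-1,1,1]]++u [12,70,75]) [1,-1,-1,1,0,0,0],
.A [15,14,19,23,17] (q [[-1,0,0,-1],[-1,1,0,-1,-1],[0,1,1],[-1,2,1],[-1,1,1]]++u [12,75]) [1,-1,-1,1,0,0,0],
.A [60,41] (q [[1,-1],[1],[0,0,0,0,0,0,0,1]]++u [8,10,15,16,17,22,26,32,70,71,73,78,79,80,85,89,95]) [-1,1,0,0,0,0,0]
]
set_option maxHeartbeats 2000000 in
def dat3 : List (List ℕ × Cert) := ((bins 7).drop 97).zip [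
.A [48,55,46,40] (q [[0,0,-1,0,1],[1,1,0,0,1],[1,1,-1,0,1],[0,-1]]++u [8,9,10,11,71,72,73,78,79,84,85,90]) [0,1,0,-1,0,1,0],
.A [31,44,33,40] (q [[1,1,1,0,1],[1,1,1,0,2],[0,0,-1],[1,0,0,0,1],[0,0,0,0,0,0,0,1]]++u [9,11,16,17,22,72,79,85,70]) [-1,1,2,-2,0,1,0],
.A [42,36,26,34,31] (q [[1,2,-2,0,3,1],[1,0,0,0,1,1],[-1,0,-2,0,-1,1],[0,1,-1,0,1,1],[0,0,0,0,-1]]++u [9,10,16,22,73,74,79,11]) [-1,-1,2,0,0,-1,1],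
.A [39,33,40,29,31] (q [[-1,1,3,5,0,0,2],[-1,1,-1,1,0,0,2],[0,0,1,1,0,0,1],[-1,1,3,1,0,0,2],[1,1,1,1],[0,0,0,0,0,0,0,1]]++u [8,10,11,74,77,80,70]) [-1,1,2,-2,-1,2,0],
.A [35,34,30,26,31] (q [[0,0,1,1],[1,-1,4,3,0,2],[1,-1,3,2,0,1],[1,-1,3,3,0,2],[1,0,2,2,0,1]]++u [10,11,71,73,74,80,8]) [-1,-2,2,1,-2,1,0],
.A [31,20,27,23,30] (q [[1,2,3,1,1],[0,0,0,-1],[0,1,2,1,1],[0,1,1,1,1],[1,0,1,1,1],[0,0,0,0,0,0,0,1]]++u [10,11,17,70,74]) [1,-1,-2,2,-1,1,0],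
.A [30,31,14,35,15] (q [[1,0,0,2,1,1],[1,1,0,2,1,1],[1,0,0,3,1,2],[1,1,0,4,2,2],[1,1,0,3,2,2]]++u [10,17,73,80]) [1,1,-2,0,1,-1,1],
.A [23,36,24] (q [[1,1],[2,1,1],[1,1,1],[0,0,0,0,0,0,0,1]]++u [8,9,14,15,20,71,72,78]) [-1,-1,0,1,0,0,0],
.A [32,34,23,25] (q [[-1,0,0,1],[0,1,1,1],[-1,1,0,2],[0,1,1,2]]++u [8,9,11,15,72,74,78]) [1,0,0,-1,1,0,0],
.A [29,30,21,18,32] (q [[-1,1,0,1,2],[2,1,3,4,2],[-2,-1,-3,-1,1],[1,2,3,5,1],[0,0,1,1],[0,0,0,0,0,0,0,1]]++u [9,70,11,72]) [1,1,0,-1,0,1,0],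
.A [24,20,23,21,27,25] (q [[-1,0,0,1,0,0,1],[-2,-1,0,2,1,0,3],[0,1,2,4,3,0,1],[-2,-1,-2,0,-1,0,1],[0,0,1,1,1],[0,0,1,2,1,0,1]]++u [11,74,9,72]) [-1,-1,0,1,0,-1,1],
.A [27,25,18,16] (q [[-1,0,1,1],[1,0,1,1],[-1,2,1,3],[-1,-2,-3,-1],[0,0,0,0,0,0,0,1]]++u [8,14,71,11]) [1,1,0,-1,1,0,0],
.A [22,18,20,21,25] (q [[1,1,1,2,2],[2,2,1,3,3],[3,2,1,3,4],[-1,-1,-1,-1,-1],[2,1,1,2,2]]++u [8,11,71]) [-1,0,1,0,-1,1,0],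
.A [22,18,15,25] (q [[-1,-1,-1],[-1,-1,-2],[-1,-2,-3,-1],[0,-1,-1],[0,0,0,0,0,0,0,1]]++u [11,74]) [0,-1,-1,1,0,0,0],
.A [15,14,22,18,25] (q [[-1,-2,-3,-1],[-1,-1,-1,-1,-1],[-1,-1,-1],[-1,-1,-2],[0,-1,-1]]++u [11,74]) [0,-1,-1,1,0,0,0],
.A [40,39,29] (q [[0,-1,1],[-1,-1],[0,0,1],[0,0,0,0,0,0,0,1]]++u [8,9,10,14,20,26,70,72,77,83,89]) [-1,-1,1,0,0,0,0],
.A [19,35,33,32,34] (q [[0,0,0,-1,0,-1],[0,1,1,1,0,-1],[-2,-1,-3,-5,0,-3],[-1,-1,-1,-2,0,-1],[0,1,1,1,0,1]]++u [8,10,15,16,21,71,78]) [-1,1,1,0,-2,0,1],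
.A [32,25,28,29] (q [[-1,0,0,1],[0,1,1,2],[-1,1,0,2],[0,1,1,1],[0,0,0,0,0,0,0,1]]++u [9,10,70,72,73]) [1,0,0,-1,1,0,0],
.A [24,19,26,27,30,28] (q [[2,2,3,5,1,1],[2,0,1,1,-1,1],[2,0,1,3,-1,1],[0,0,1,1,1,1],[2,2,3,5,3,1],[1,1,1,2,1,1]]++u [9,10,16,73,79]) [-1,1,1,-2,2,-1,1],
.A [32,24,25,23] (q [[-2,-1,-1,1],[0,1,1,1],[0,0,0,1],[-1,0,-1,1]]++u [8,14,70,73,77]) [1,1,1,-2,1,0,0],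
.A [27,25,20,23,24] (q [[0,0,1,1,1],[2,1,3,2,2],[2,1,3,1,2],[1,1,2,2,2],[1,1,2,1,1]]++u [8,10,71,73]) [0,0,-1,1,-1,1,0],
.A [25,23,21,22,20,24] (q [[0,0,0,1,0,0,1],[0,1,0,2,1,0,1],[-2,-1,-2,0,-1,0,1],[0,0,1,1,1],[-2,-1,-2,0,-1,0,3],[-2,0,-1,1,-1,0,2],[0,0,0,0,0,0,0,1]]++u [70,73]) [-1,-1,-1,2,-1,-1,2],
.A [24,14,23,15,25,22] (q [[0,1,1,2,1,1],[-2,0,-1,3,1,2],[-1,1,0,4,2,2],[0,1,1,3,2,2],[0,1,1,4,2,2],[-1,0,0,2,1,1]]++u [10,73]) [1,1,1,-2,1,-1,1],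
.A [32,18,19] (q [[-1,1,1],[-1,2,1],[0,1,1]]++u [9,15,20,70,77,83]) [1,-1,-1,1,0,0,0],
.A [23,26,19,17] (q [[2,2,1,3],[1,0,0,1],[2,1,1,2],[1,1,1,2]]++u [8,9,15,72]) [-1,0,1,-1,1,0,0],
.A [22,19,18,21] (q [[0,0,1,1],[1,0,1,1],[1,1,2,3],[1,-1,0,1],[0,0,0,0,0,0,0,1]]++u [9,72]) [0,1,0,-1,1,0,0],
.A [23,17,21,14,19,20] (q [[4,1,2,6,3,0,3],[1,0,1,2,1,0,1],[2,-1,0,2,1,0,1],[1,0,0,1,0,0,1],[2,0,1,2,1,0,1],[0,-1,0,0,1,0,1]]++u [9,72]) [1,-1,-1,1,0,-1,1],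
.A [21,18,17,19] (q [[2,-2,-1,1],[2,2,1,3],[0,0,1,1],[2,0,1,1],[0,0,0,0,0,0,0,1]]++u [71]) [-1,1,1,-1,1,0,0],
.A [20,18,17,16,19] (q [[-2,2,1,-1,0,-4],[-1,2,1,0,0,-3],[-1,1,1,0,0,-2],[0,0,0,0,0,-1],[0,1,1,0,0,-2]]++u [8]) [1,-1,-1,1,-1,1,0],
.A [19,17,16,15,18] (q [[4,-1,1,2,0,2],[1,-1,1,2,0,2],[2,-2,-1,1,0,1],[2,-2,-1,1,0,4],[1,0,0,1,0,1],[0,0,0,0,0,0,0,1]]) [1,-1,-1,1,-1,1,0],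
.A [18,16,15,14,19,17] (q [[1,1,1,2,1,1],[2,-1,0,2,1,1],[2,2,3,5,4,4],[0,-1,-1,-1,-1],[4,1,3,4,2,2],[1,1,3,4,2,2]]) [-1,1,1,-1,1,-1,1]
]
lemma tt0 : (dat0.all fun p => D.chk p.1 p.2) = true := by decide +kernel
lemma tt1 : (dat1.all fun p => D.chk p.1 p.2) = true := by decide +kernel
lemma tt2 : (dat2.all fun p => D.chk p.1 p.2) = true := by decide +kernel
lemma tt3 : (dat3.all fun p => D.chk p.1 p.2) = true := by decide +kernel
def dat : List (List ℕ × Cert) := dat0 ++ (dat1 ++ (dat2 ++ (dat3)))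
lemma tt : (dat.all fun p => D.chk p.1 p.2) = true := by
  simp only [dat, List.all_append, tt0, tt1, tt2, tt3, Bool.and_self]
theorem main : PanyushevProperty ℂ (Matrix.ToLieAlgebra ℂ CartanMatrix.E₇) :=
  fin md ck ![34, 49, 66, 96, 75, 52, 27] (by decide +kernel) dat tt (by decide +kernel)
end PaperStmt.E7

namespace PaperStmt.E8
open Chk Pres E8m
attribute [local instance] LieRing.ofAssociativeRing

def rk : List ℕ := rp [4398046511104,68719476736,1073741824,16777216,262144,4096,64,1,4466765987840,69793218560,1090519040,17039360,266240,262208,4097,4467839729664,69809995776,1090781184,17043456,17039424,266304,266241,4467856506880,69810257920,1090785280,1090781248,17043520,17043457,266305,4467856769024,69810262016,69810257984,1090785344,17305664,1090785281,17043521,4467856773120,4467856769088,69810262080,1091047488,69810262017,1090785345,17305665,4467856773184,69810524224,1107824704,4467856773121,69810262081,1091047489,17309761,4467857035328,69827301440,4467856773185,69810524225,1107824705,1091051585,4467873812544,70901043264,4467857035329,69827301441,69810528321,1107828801,4468947554368,4467873812545,70901043265,4467857039425,69827305537,1108090945,4537667031104,4468947554369,4467873816641,70901047361,69827567681,1108091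009,4537667031105,4468947558465,4467874078785,70901309505,69827567745,4537667035201,4468947820609,70918086721,4467874078849,70901309569,4537667297345,4468964597825,4468947820673,70918086785,4537684074561,4537667297409,4468964597889,70918348929,4538757816385,4537684074625,4468964860033,70918353025,4538757816449,4537684336769,4468964864129,70918353026,4538758078593,4537684340865,4468964864130,4538774855809,4538758082689,4537684340866,4538774859905,4538758082690,4538775122049,4538774859906,4538775122113,4538775122050,4538775126146,4538775122114,4538775126210,4538775388354,4538792165570,4539865907394,4608585384130,9006631895234]
def A : List (List ℤ) := [[2,0,-1,0,0,0,0,0],[0,2,0,-1,0,0,0,0],[-1,0,2,-1,0,0,0,0],[0,-1,-1,2,-1,0,0,0],[0,0,0,-1,2,-1,0,0],[0,0,0,0,-1,2,-1,0],[0,0,0,0,0,-1,2,-1],[0,0,0,0,0,0,-1,2]]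
def G : List (List ℤ) := [[240,300,420,600,480,360,240,120],[300,480,600,900,720,540,360,180],[420,600,840,1200,960,720,480,240],[600,900,1200,1800,1440,1080,720,360],[480,720,960,1440,1200,900,600,300],[360,540,720,1080,900,720,480,240],[240,360,480,720,600,480,360,180],[120,180,240,360,300,240,180,120]]
def D : RD := ⟨8, A, G, rk, NE⟩
lemma md : Md 8 D X8 := mdE (by norm_num) A G rk (by decide +kernel) (by decide +kernel)
lemma ck : Ck CartanMatrix.E₈ D where
  hn := rfl
  n8 := by norm_num
  diag := by decide +kernel
  rk8 := by decide +kernel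
  nodup := by decide +kernel
  row := by decide +kernel
  sgn := by decide +kernel
  inv := ⟨![![4, 5, 7, 10, 8, 6, 4, 2], ![5, 8, 10, 15, 12, 9, 6, 3], ![7, 10, 14, 20, 16, 12, 8, 4], ![10, 15, 20, 30, 24, 18, 12, 6], ![8, 12, 16, 24, 20, 15, 10, 5], ![6, 9, 12, 18, 15, 12, 8, 4], ![4, 6, 8, 12, 10, 8, 6, 3], ![2, 3, 4, 6, 5, 4, 3, 2]],
    1, by decide +kernel⟩
  pos := ⟨![92, 136, 182, 270, 220, 168, 114, 58], by decide +kernel⟩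
  dgk := by decide +kernel
  gram := by decide +kernel
  smp := by decide +kernel
  vecp := by decide +kernel
  vecn := by decide +kernel
  off := by decide +kernel
  op := by decide +kernel
  gen := by decide +kernel
  stab := by decide +kernel
  sre := by decide +kernel
set_option maxHeartbeats 2000000 in
def dat0 : List (List ℕ × Cert) := ((bins 8).drop 1).zip [
.C [127] (q [[0,0,0,0,0,0,0,1]]) (u [8,16,23,30,37,44,45,51,54,58,60,64,66,70,71,73,76,77,78,82,83,84,87,88,90,92,93,94,96,97,98,100,101,102,104,105,106,108,109,110,111,112,113,114,115,116,117,118,119,120,121,122,123,124,125,126]) [[[(0,55,-1)]]],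
.C [92,101,125] (q [[0,0,0,0,0,1,1],[0,1,0,0,0,1,1],[0,1,0,0,0,2,1]]++u [10,11,12,14,18,20,25,29,32,33,40,42,47,49,53,56,62,63,69,75,81,132,140,149]) (u [17,23,24,30,31,37,38,39,44,45,46,48,51,52,54,55,58,59,60,61,64,65,66,67,68,70,71,72,73,74,77,78,79,80,83,84]++[[(9,1),(95,-1)]]++u [86]++[[(16,1),(98,-1)]]++u [89,90,91,93,94]++[[(95,-1),(85,1)],[(98,-1),(88,1)]]++u [99,102,103,106,107,110]) [[[(0,20,1)],[(0,26,1)],[(0,31,1)],[(0,35,1)],[(0,38,1)],[(0,40,1)],[(0,42,-1)],[(0,47,-1)],[(0,49,-1)],[(0,51,-1)],[(2,35,-1)],[(2,40,-1)],[(2,47,1)],[(2,49,1)],[(2,51,1)],[(4,40,1)],[(4,49,-1)],[(4,51,-1)],[(6,40,-1)],[(6,51,1)],[(7,49,-1)],[(7,51,-1)],[(10,51,1)],[(11,40,1)],[(13,51,-1)],[(17,51,1)],[(21,51,-1)]],[[(0,25,1)],[(1,25,-1)]]],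
.A [37,73,98] (q [[0,-1,0,0,0,0,-1],[0,-1,1,0,0,0,-1],[0,0,0,0,0,0,-1]]++u [11,12,13,14,18,19,20,22,25,27,28,29,33,34,36,40,43,49,69,132,139,140,145,149]) [0,1,0,-1,0,0,0,1],
.C [70,82,103,110] (q [[0,0,0,0,0,1],[1,0,1,0,0,2,1],[1,0,2,0,0,2,1],[1,0,1,0,0,1]]++u [8,13,16,20,22,26,28,29,34,35,36,41,43,50,57,129,133,135,136,140,146,148,154,161,177,15]) (u [10,18,25,33,42,44]++[[(48,-1),(32,1)]]++u [49,51]++[[(54,1),(38,1)],[(55,-1),(40,1)]]++u [56,58]++[[(60,1),(46,1)],[(61,-1),(47,1)]]++u [62]++[[(63,-1),(17,1)]]++u [64]++[[(66,1),(52,1)],[(67,-1),(53,1)],[(68,1),(23,1)],[(69,1),(24,1)],[(71,1),(59,1)]]++u [73]++[[(74,-1),(30,1)],[(75,-1),(31,1)]]++u [78]++[[(80,1),(37,1)],[(81,1),(39,1)]]++u [84]++[[(86,-1),(45,1)]]++u [90]) [[[(0,17,1)],[(0,19,-1)],[(0,22,1)],[(0,24,-1)],[(0,26,1)],[(0,2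7,1)],[(0,29,1)],[(0,30,-1)],[(0,31,1)],[(1,27,-1)],[(1,29,-1)],[(1,30,1)],[(1,31,-1)],[(2,30,-1)],[(2,31,1)],[(4,30,-1)],[(4,31,1)],[(5,10,1)],[(5,14,1)],[(5,19,1)],[(5,28,1)],[(5,30,-1)],[(6,30,1),(0,17,1)],[(6,31,-1)],[(8,14,-1)],[(8,19,-1)],[(12,19,-1)]],[[(0,19,1)],[(0,21,1)],[(0,23,1)],[(0,25,1)],[(0,26,1)],[(1,21,-1)],[(1,23,-1)],[(1,26,-1)],[(2,21,1)],[(2,23,1)],[(3,21,1)],[(3,23,1)],[(4,21,-1)],[(7,21,-1)],[(11,21,1)],[(15,21,-1)]],[[(0,15,-1)],[(5,11,-1)],[(6,10,-1)]]],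
.B [37,78,89,91] (q [[0,-1,1,0,0,2,0,1],[0,-1,2,0,0,2,0,1],[0,-1,1,0,0,1],[0,-1,2,0,0,3,0,1]]++u [11,12,13,14,19,21,22,26,28,34,35,36,43,132,134,141,148,156,131,139,146,155]) (u [18,24,32,38,42,48,53,59,62,67]++[[(69,-1),(25,1)],[(74,-1),(31,1)]]++u [75,80]) (u [9,15,20,27,29,41,50]++[[(57,1),(12,1)]]++u [129]++[[(133,1),(43,-1)]]++u [135,140]++[[(142,1),(34,1)]]++u [147,149]++[[(154,1),(22,1)]]++u [161]++[[(163,1),(13,-1)]]++u [170]++[[(177,1),(132,1)]]++q [[1]]++[[(3,1),(2,1)],[(4,1),(1,1),(3,1)]]++q [[0,0,0,0,0,0,1]]) [(78,1),(37,1)],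
.A [31,51,86,54] (q [[-1,-1,0,0,0,-1],[-1,-1,1,0,0,-1],[0,0,0,0,0,-1],[0,-1,1,0,0,-1]]++u [12,13,15,19,21,22,27,29,35,36,41,43,50,57,128,132,133,134,139,141,142,147,148,154,156,161,163,177]) [2,2,-2,-1,0,0,1,0],
.A [24,86,16] (q [[0,0,0,-1],[0,1],[0,-1,0,0,0,-1]]++u [12,20,21,28,29,36,41,50,57,131,134,147,154,163]) [-2,1,0,0,0,0,0,0],
.C [64,74,82,81,85,83] (q [[0,0,0,1,2,1],[1,0,1,1,1],[1,0,0,1,2,1],[1,1,1,2,2,1],[1,0,1,2,2,1],[0,0,0,0,1,1]]++u [13,14,15,17,20,22,23,28,29,36,130,132,134,140,141,143,148,149,156,8,9,10,128,129]) (u [18]++[[(25,1),(11,1)],[(32,1),(30,1),(49,-1)],[(33,-1),(24,1)]]++u [35]++[[(40,-1),(39,1)],[(42,1),(19,1)]]++u [46]++[[(38,1),(34,-1),(55,1)],[(48,-1),(26,1),(43,1)],[(49,-1),(31,1),(27,-1),(32,-1)],[(52,-1),(51,1)],[(54,1),(50,1)],[(55,2),(34,-1),(47,1),(45,1)],[(56,1),(37,1),(43,-2),(48,1)],[(60,-1),(44,1),(63,1)],[(63,-1),(60,2),(61,-1),(41,1)],[(66,1),(57,1)],[(68,-1),(58,1)]]++u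 [73]) [[[(0,11,-1)],[(0,12,-1)],[(0,16,-1)],[(0,17,1)],[(0,18,1)],[(0,19,1)],[(1,11,-1),(0,18,1)],[(1,16,-1),(0,17,2)],[(1,17,1)],[(1,18,1)],[(1,19,1)],[(2,11,1)],[(2,16,1),(0,19,-3),(1,18,1)],[(2,18,1)],[(4,7,-1)],[(4,11,1),(1,19,1)],[(4,18,-1)],[(5,17,-1)],[(5,19,1)],[(8,17,1)]],[[(0,15,-1)],[(0,16,-1)],[(0,17,-1)],[(0,18,1)],[(0,19,1)],[(1,17,-1)],[(1,18,1)],[(1,19,1)],[(2,15,-1),(1,19,1)],[(2,16,-1)],[(2,17,1),(1,18,-1)],[(2,18,1)],[(2,19,-1)],[(4,18,-1)],[(5,16,1),(2,19,1)],[(7,16,-1)]],[[(0,13,-1)],[(0,14,-1)],[(0,15,-1)],[(1,13,1)],[(1,15,1)],[(2,13,-1)],[(2,14,1),(1,15,-1)],[(2,15,1)],[(3,15,-1)],[(11,9,1)]],[[(0,9,1)],[(1,9,-1)],[(2,9,1)],[(3,9,-1)]]],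
.A [30,86,58,62,85] (q [[-1,-1,-2,-1,0,0,1],[0,0,-1,0,0,0,1],[-1,0,-1],[0,0,-1],[0,-1,-1,0,0,0,1]]++u [9,10,12,13,15,17,21,22,29,36,129,130,135,137,149,156,20,28,132,141]) [1,1,-1,0,-1,1,0,0],
.A [60,81,39,48,44] (q [[0,0,0,-1],[1,2,3,3,0,0,1],[0,1,1,1,0,0,1],[1,1,2,2,0,0,1],[0,1,2,1,0,0,1]]++u [12,13,15,22,28,29,36,128,133,135,140,148,149,156,8,20,21,141,142,134]) [0,0,0,1,-2,1,0,0],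
.A [68,31,53,23] (q [[0,-1,1],[0,-1],[-1],[-1,1,-1,0,-1]]++u [13,14,15,28,29,130,132,133,140,148,149,22,36]) [-1,-1,1,0,0,0,0,0],
.A [63,46,61,60,25,44] (q [[1,1,2,2,1,1],[-1,0,-1,-1,-1],[-1,-1,-2,-2,-3,-1],[0,-1,-1,-2,-1],[-1,-1,-2,-2,-1,1],[-1,-3,-2,-4,-3,-1]]++u [20,21,22,28,29,36,129,141,142,148,149,9,13,16,136,140]++[[(8,1),(135,1),(12,-1)],[(12,1),(135,1),(8,-1)],[(14,-2),(8,-1),(135,-1),(12,1)],[(15,-1),(134,-1),(128,-1)],[(128,-1),(15,1),(134,1)],[(132,2),(15,-1),(134,-1),(128,-1)],[(134,1),(128,1),(15,-1)],[(135,-1),(8,1),(12,1)]]) [0,0,0,0,-1,1,0,0],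
.A [42,61,46,33,23] (q [[1,0,0,-1],[1,1,1,1],[1,1,1],[0,0,-1,-1],[-1,-1,-1,-1,-1]]++u [12,14,15,20,21,28,29,129,133,135,142,148,149,156,9,134]) [-1,-1,0,1,0,0,0,0],
.A [49,47,17] (q [[0,1],[-1,1],[1,-1,0,0,-1]]++u [8,12,20,132,134,140,141,148,156]) [0,-1,1,0,0,0,0,0],
.A [17,56,18,16] (q [[0,0,0,-1,-1],[1],[1,0,0,-1],[2,0,0,-2,-1,-1]]++u [12,13,20,21,28,29,36,135]) [-1,1,0,0,0,0,0,0],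
.C [87,69,71,52,56,70] (q [[1,0,1,2,3,3,2],[1,0,2,3,3,2,1],[1,0,1,3,4,3,2],[1,0,2,4,4,3,2],[1,0,1,2,2,2,1],[0,0,0,1,2,2,1]]++u [8,10,15,18,23,24,30,128,129,135,138,142,143,144,22,130]++[[(11,2),(136,1),(17,1),(133,-1)],[(13,-1),(131,1),(16,1)],[(16,1),(13,1),(131,-1)],[(17,-1),(133,1),(136,1)],[(131,-1),(16,-1),(13,-1)],[(133,1),(136,1),(17,1)],[(136,-1),(17,-1),(133,1)],[(137,-2),(13,1),(131,-1),(16,-1)]]) [[(37,1),(32,-1)],[(42,1),(38,-1),(19,1)],[(44,1),(29,1)],[(45,1),(40,-1)],[(48,1),(25,1)],[(49,1),(46,-1),(27,1)],[(51,1),(36,1)],[(54,-1),(12,1),(26,-1)],[(55,1),(33,1)],[(60,-1),(21,1),(34,-1)]] [[[(0,3,1)],[(0,5,-1)],[(0,6,-1)],[(0,8,-1)],[(0,9,-1)],[(1,5,-1)],[(1,6,1)],[(1,8,-1)],[(1,9,-1)],[(2,6,-1)],[(2,8,-2),(0,3,1)],[(2,9,1)],[(4,8,1)],[(4,9,1)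,(0,5,1)],[(7,9,-1),(0,6,2)]],[[(0,2,-1)],[(0,3,1)],[(0,6,-1)],[(0,7,1)],[(0,11,1)],[(0,13,-1)],[(1,6,-1)],[(3,2,1)],[(3,3,-1)],[(3,6,1)],[(3,7,-1)],[(3,11,-1)],[(3,13,1)],[(5,6,1)]],[[(0,9,-1)],[(0,10,-1)],[(0,11,1)],[(0,12,-1)],[(0,13,-1)],[(1,9,2),(0,13,1)],[(1,11,1)],[(1,12,-1)],[(1,13,1)],[(2,12,1)]],[[(0,4,-1)],[(0,8,1)],[(0,9,1)],[(3,4,-1)],[(3,8,1)],[(3,9,1)]],[[(0,4,1)],[(0,5,-1)],[(1,4,-1)],[(1,5,1)],[(2,3,-1)]]],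
.C [59,79,50,51,37,47] (q [[0,0,1,1,1],[2,-1,7,5,3,0,0,1],[2,0,6,5,3,0,0,1],[1,0,4,3,2,0,0,1],[1,-1,4,3,2,0,0,1],[0,0,1,1]]++u [9,11,14,17,18,133,134,135,137,138,142,144,10,13,24,130,15,22]) (u [20,26,33,39]++[[(42,1),(19,1),(8,1),(34,-2)],[(43,1),(30,1),(25,2),(40,-1)],[(46,-1),(36,-1),(31,2),(23,1)],[(48,-1),(16,1),(12,1),(28,-2)]]) [[[(0,2,-1)],[(0,3,-1)],[(0,5,-1)],[(1,2,-1)],[(1,3,-1)],[(2,7,-1)],[(4,6,1),(1,3,-5)],[(4,7,1)],[(5,6,-1)]],[[(0,5,-1)],[(0,8,1)],[(1,5,-1)],[(1,8,1)],[(2,2,-1)],[(2,7,1)],[(3,2,-1)],[(3,7,1)]],[[(0,5,-1)],[(0,7,-1)],[(1,5,-1)],[(1,7,-1)],[(2,1,1)],[(2,3,1)],[(3,1,1)],[(3,3,1)],[(4,6,1)]],[[(0,5,-1)],[(0,7,-1)],[(2,1,-1)],[(2,3,-1)],[(4,6,-1)],[(4,7,1)],[(4,8,1)],[(5,1,-1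)]],[[(0,3,1)],[(0,5,1)],[(2,1,1)],[(2,7,1)],[(4,4,-1)]],[[(0,3,-1)],[(1,3,1)],[(2,1,1)],[(3,1,-1)]],[[(4,3,-1)]]],
.C [50,63,60,31,44,46,53] (q [[2,1,3,3,3,1,1],[2,1,3,3,3,2,1],[4,1,5,4,6,3,2],[3,1,4,4,5,3,2],[2,0,3,2,3,1,1],[1,1,2,2,2,1,1],[2,1,3,3,4,2,1]]++u [10,11,18,22,130,131,138,142,13,128,134,135,8,14]) [[(33,-1),(23,1),(12,-1),(28,1)],[(34,-3),(29,2),(9,2),(19,1),(30,1),(32,1)],[(40,-1),(27,2),(20,-3),(16,2),(36,1),(17,-1)],[(43,1),(24,1),(26,-1),(42,-1)]] [[[(0,1,1)],[(0,2,1)],[(0,3,1)],[(1,2,-1),(0,3,1)],[(1,3,-1)],[(2,3,1)]],[[(0,0,1)],[(0,2,1)],[(0,4,1)],[(0,5,1)],[(1,0,-2),(0,5,-1)],[(1,2,-1)],[(1,4,1)],[(1,5,1)]],[[(0,2,1)],[(0,5,-4),(0,2,1)],[(0,6,-1)],[(0,7,-1)],[(1,2,-5),(0,6,1)],[(1,3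,-1),(0,7,5)]],[[(0,2,-1)],[(0,3,1)],[(0,4,1)],[(1,2,1)],[(1,3,-1)],[(1,5,1)]],[[(0,0,1)],[(0,3,1)],[(0,4,-1)],[(1,0,-1),(0,3,-2)],[(1,3,-1)],[(1,4,1)]],[[(0,1,1)],[(0,4,-1)],[(0,5,-1)],[(1,5,-1)]],[[(0,1,1)],[(0,3,-1)],[(1,1,1)]],[[(0,2,-1)],[(1,1,-1)]]],
.A [55,56,31,53,23,57] (q [[-1,3,0,2,0,0,1],[0,1,0,1],[-1,2,0,2,0,0,1],[-2,4,0,3,0,0,1],[-2,3,0,2,-1,0,1],[-1,3,1,3,0,0,1]]++u [10,13,14,15,18,22,131,133,135,138,11,130]) [1,0,-1,0,1,-1,0,1],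
.B [25,57,31,51,39,40,54] (q [[1,2,2,4,0,2,1,1],[2,3,4,6,0,3,2,1],[0,0,1,1,0,1,1],[0,1,1,2,0,1,1,1],[2,3,3,5,0,3,2,1],[1,1,2,2,0,2,1],[2,2,3,4,0,3,2,1]]++u [9,16,128,129,135,136,142,8,14,15,22,133,134,13]) [] (u [11,131]++q [[0,0,0,0,1]]) [(25,1)],
.A [55,42,31,33,57,38,30] (q [[1,1,1,1,1,1,1],[1,0,1,1,1,1],[1,1,1,3,3,1,1],[1,3,3,5,5,3,1],[2,3,4,6,6,2,1],[0,1,2,2,2,2,1],[0,0,0,0,1]]++u [13,15,22,131,133,134,9,14,129,142]) [0,0,0,1,-2,1,0,1],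
.A [23,49,32,50,24] (q [[0,-1,-1,-1,-1],[1,0,1],[1,-1,1],[1,-1],[0,-1,-1,-1]]++u [8,13,14,15,128,133,135,142]) [-1,1,0,0,0,0,0,0],
.A [42,33,24,41,16] (q [[0,-1,-1],[0,0,-1],[-1,-1,-1,-1],[-1,-1,-1],[1,0,-1,0,0,-1]]++u [13,14,15,22,131,134,135]) [0,-1,-1,1,0,0,0,0],
.A [35,34,49,39,44,25] (q [[0,-2,-2,-3,0,-1],[0,2,2,3,3,1],[0,-1,-1,-3,0,1],[-3,-4,-7,-9,-3,-2],[-3,-5,-5,-9,-3,-1],[0,1,1,3,3,2]]++u [8,128,129,136,137,142,143,13,17,130,133,135,10,14,15,16,22,134]) [0,0,0,-1,1,0,0,0],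
.A [42,49,34,31,30] (q [[1,0,1,1,1],[1,1,0,1,1],[1,1,1,2,2],[1,1,0,2,2],[-1,-1,-1,-2,-1]]++u [10,13,14,15,17,22,129,130,133,134,135,137,142,9]) [-1,0,1,0,-1,1,0,0],
.A [32,34,19,49,30] (q [[2,-1,3,1,1],[0,1,1,1,1],[1,0,1,1,1],[2,0,2,1,1],[-2,-1,-3,-3,-1]]++u [13,22,128,130,134,135,142,10,14]) [-1,1,-1,1,-1,1,0,0],
.A [24,35,40,27,16,25] (q [[0,-1,-2,-3,-1],[0,0,1,1,1],[-1,0,1,1,1],[0,1,0,1,1],[-2,-1,0,0,0,-1],[-2,-1,0,1,1]]++u [15,133,135,142,14,22,130,134,10]) [2,1,-1,0,-1,1,0,0],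
.A [35,30,27] (q [[1],[0,0,0,-1],[1,1]]++u [13,14,128,134,135,136]) [-1,0,1,0,0,0,0,0],
.A [35,27,24,23] (q [[1],[1,1],[0,0,0,-1],[2,1,0,-1,-1]]++u [13,14,129,134,135]) [-1,0,1,0,0,0,0,0],
.A [35,27,18,23] (q [[1],[1,1],[0,0,0,-1],[2,1,0,-1,-1]]++u [13,14,128,134,135]) [-1,0,1,0,0,0,0,0],
.A [35,27,17,18,16] (q [[1],[1,1],[2,1,0,-1,-1],[0,0,0,-1],[0,0,0,-2,-1,-1]]++u [13,14,134,135]) [-1,0,1,0,0,0,0,0],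
.C [78,99,92,63,104] (q [[0,2,2,2,1,0,1],[0,3,2,3,1,0,1],[0,1,1,1,0,0,1],[0,1,1,1],[0,2,1,1,0,0,1]]++u [8,9,10,14,17,18,21,23,24,25,30,33,37,45,128,131,132,137,139,141,143,145,147,150,151,159,16,31,39,136]) (u [28,32,36,38]++[[(20,1),(76,-1)]]++u [42,46,48]++[[(29,1),(82,-1)],[(51,1),(41,-1)],[(52,-1),(34,1)],[(53,1),(44,1)]]++u [55,58]++[[(59,-1),(13,1)],[(60,1),(50,-1)],[(61,-1),(43,1)],[(62,1),(54,1)],[(64,-1),(47,1)],[(65,-1),(26,1)]]++u [66]++[[(67,-1),(22,1)]]++u [70]++[[(71,-1),(56,1)],[(72,-1),(35,1)],[(76,1),(40,1)]]++u [77]++[[(82,1),(49,1)]]) [[[(0,5,-1)],[(0,7,-1)],[(0,8,-1)],[(0,17,-1)],[(0,21,-1)],[(0,23,-1)],[(0,24,-1)],[(0,26,1)],[(1,8,1)],[(1,12,1)],[(1,15,1)],[(1,16,-1)],[(1,20,1)],[(1,21,-1)],[(1,23,-1)],[(3,15,1)],[(3,16,-1)],[(3,20,1)],[(3,23,-1)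],[(4,15,1),(0,17,1)],[(4,16,-1),(0,24,-1)],[(4,17,-1)],[(4,23,1)],[(4,27,-1),(0,5,-1),(3,20,-1)],[(6,17,1),(3,15,1)],[(9,17,1),(4,23,-1)],[(9,24,1),(4,27,-1),(0,5,-1),(3,20,-1)],[(9,26,-1)]],[[(0,8,-1)],[(0,13,-1)],[(0,14,-1)],[(0,18,-1)],[(0,21,1)],[(1,19,1)],[(1,20,1)],[(2,8,1)],[(2,13,1)],[(2,14,1)],[(2,18,1)],[(2,21,-1)],[(5,19,-1)],[(5,20,-1)]],[[(0,12,1)],[(0,13,-1)],[(1,10,-1)],[(1,11,-1)],[(3,11,1)],[(4,9,-1)],[(9,13,-1)]]]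
]
set_option maxHeartbeats 2000000 in
def dat1 : List (List ℕ × Cert) := ((bins 8).drop 33).zip [
.C [57,79,60,44,99] (q [[1,0,1,1],[1,0,1,1,0,1],[3,0,2,3,0,2,0,1],[2,0,2,3,0,2,0,1],[4,0,3,5,0,3,0,1]]++u [10,14,15,17,18,24,132,139,141,145,147,151,153,159,12,19,21,25,27,31,33,39]) (u [28,29,34,35]++[[(36,-1),(20,1)]]++u [40,42]++[[(43,-1),(26,1)]]++u [46,48]++[[(49,-1),(32,1)],[(55,-1),(38,1)],[(65,1),(13,2),(45,1),(41,1)],[(72,-1),(22,-2),(50,-1),(37,1)]]) [[[(0,3,-1)],[(0,6,-1)],[(0,9,-1)],[(0,13,1)],[(1,12,-1)],[(2,6,-1)],[(2,9,-1)],[(2,13,1)],[(3,12,-1)],[(5,9,-1)],[(5,13,1)],[(6,12,-1)],[(8,13,1)],[(9,12,-1)],[(12,13,-1),(0,3,-4),(5,9,-4)]],[[(0,8,1)],[(0,11,1)],[(0,13,1)],[(1,7,1)],[(1,10,1)],[(1,12,1)],[(2,11,1)],[(2,13,1)],[(3,10,1)],[(3,12,1)],[(5,13,1)],[(6,12,1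)],[(12,4,-1)],[(12,8,-1)],[(12,11,-1)],[(12,13,-1)]],[[(0,8,-1)],[(0,9,-1)],[(0,11,-1)],[(0,13,-1)],[(1,6,1)],[(1,7,1)],[(1,10,1)],[(1,13,1)],[(2,11,-1)],[(3,10,1)],[(4,13,-1)]],[[(0,7,1)],[(0,9,-1)],[(1,8,-1)],[(2,7,-1)],[(5,7,1)],[(8,7,-1)]],[[(12,2,1)]]],
.A [44,57,60,70,52,72] (q [[0,-1,0,-1,-1],[1,1,2,2,1,1],[0,0,0,-1,-1],[0,1,1,1,1,1],[0,0,0,0,-1],[1,0,1,1,0,1]]++u [10,11,12,14,19,21,27,33,130,132,134,135,138,141,145,153,8,18,25]) [0,0,-1,0,2,-2,1,0],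
.A [16,72,38,81] (q [[0,1,0,0,0,0,1],[0,1,0,0,0,1,1],[-1,1,0,0,0,1,1],[-1,2,0,0,0,1,1]]++u [10,14,15,18,21,25,27,130,134,135,138,141,145,147,153,33]) [-1,0,-1,1,0,0,0,0],
.B [58,38,71,61,49,53,57] (q [[3,-1,4,6,3,4,0,2],[5,-3,6,8,5,6,0,2],[2,-1,2,3,2,2,0,1],[1,0,1,2,1,1],[5,-1,6,8,5,6,0,2],[1,1,2,4,3,2],[1,1,2,2,1]]++u [12,14,19,21,27,128,129,134,136,147,9,11,16,131,132,135,8,15]) [[(29,-1),(25,1)],[(37,1),(10,1),(20,-1),(35,2)],[(39,1),(34,-1)],[(41,-3),(33,-1),(30,1),(17,1),(13,-1),(36,-2)],[(45,-1),(24,1),(28,-2),(43,1)],[(50,-3),(26,2),(31,1),(23,1),(18,1),(22,-1)]] [[(139,1),(16,1),(11,-2),(135,1),(21,3),(128,-2)],[(141,1),(8,-1),(136,2),(131,-2),(19,3),(15,1)],[(6,-2),(1,-3),(0,1),(4,-1)]] [(71,2),(61,1),(58,2),(57,2),(53,1),(38,3),(49,3)],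
.B [47,30,46,62,45,48,57] (q [[3,2,3,1,0,3,0,1],[2,1,2,0,0,2,0,1],[1,1,1,0,0,1],[1,1,1,1,1,1],[3,2,2,0,-1,2,0,1],[4,2,3,0,-1,3,0,1],[3,2,3,1,0,2,0,1]]++u [11,14,15,19,21,27,131,132,135,139,141,147,9,12]) [[(36,1),(22,-1),(10,1)],[(41,1),(26,1),(31,1)],[(43,-2),(28,1),(18,1),(13,-1),(33,-1),(17,1)],[(50,1),(35,1),(25,1),(24,1),(34,-2),(39,-1)]] [[(135,1),(11,-1),(134,-1),(12,-1),(9,1),(27,1)],[(147,1),(132,-1),(129,1),(131,-1),(15,1),(14,-1)],[(6,-1),(0,1),(4,-2),(3,-2)]] [(45,1),(30,1)],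
.A [45,53,17,42,57] (q [[1,2,1,0,1,1],[0,1,1,0,1,1],[0,1,1,0,0,1],[1,1,1,0,1,1],[1,2,2,0,1,1]]++u [8,11,14,15,19,21,27,131,134,135,139,141]) [0,-2,-1,2,0,-1,1,0],
.A [53,56,24,16,57] (q [[0,0,0,1,1],[1,0,0,1,1],[1,0,0,0,1],[0,0,-1,0,0,-1],[1,0,1,1,1]]++u [11,12,21,132,135,139,141,147,131]) [-1,0,1,0,-1,1,0,0],
.A [47,48,34,49,44,66] (q [[1,1,2,3,2,1],[2,1,3,4,3,1],[1,1,2,2,1],[0,0,0,-1,-1],[-1,-1,-1,-3,-3,-1],[0,0,0,-1,-2,-1]]++u [8,10,17,23,129,132,134,137,141,143,14,16,21,128,136,9,12,15]) [0,0,-1,0,1,0,0,0],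
.A [38,26,41,47,45,55,42] (q [[0,0,0,1,1,1,1],[0,1,1,1,2,1],[1,1,1,3,2,1,1],[0,1,1,1,1,1],[0,1,0,2,3,2,1],[1,2,2,3,3,2,1],[1,1,1,3,3,2,1]]++u [10,12,17,21,129,130,135,137,141,9,14,15,132,134]) [0,0,1,0,-1,0,0,1],
.A [37,41,50,43,42,40,24] (q [[-1,-1,-2,-2,-1,-1,-1],[0,0,1,1,1],[1,2,1,3,2,2,1],[-1,-2,-2,-4,-2,-3,-2],[1,0,2,2,2,1],[0,1,0,1,1,1],[1,2,2,4,4,3,2]]++u [8,15,128,132,135,12,14,130,141,10,21]) [0,0,1,0,-1,0,1,0],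
.A [50,34,26,49,16,31,47] (q [[1,1,1,2,1],[-1,1,-1,0,1],[0,0,0,1,2,1,0,1],[-1,1,-3,2,7,4,0,4],[-1,0,-2,0,2,1,0,2],[-1,0,-2,0,2,1,0,1],[-1,1,-1,2,3,2,0,2]]++u [14,21,130,134,135,12,15,132,141,10]) [0,0,-1,0,1,0,-1,1],
.A [26,39,18,43,37] (q [[-1,1,1,2,2],[-2,2,-1,1,1],[-1,-2,-2,-4,-1],[2,1,1,2,2],[1,-1,-1,1,1]]++u [8,9,14,15,16,128,129,136,12,21]) [0,0,1,0,-1,1,0,0],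
.A [23,41,43,24,25] (q [[-1,1,-2,-1,-1],[-1,1,-1],[0,1,-1],[-1,0,-1,-1],[0,0,-1]]++u [9,12,14,21,129,132,134,141]) [0,-1,1,0,0,0,0,0],
.A [41,43,25,17] (q [[-1,1,-1],[0,1,-1],[0,0,-1],[0,1,-1,0,-1]]++u [8,12,14,134,135,141,132]) [0,-1,1,0,0,0,0,0],
.A [41,43,17,25,16] (q [[-1,1,-1],[0,1,-1],[0,1,-1,0,-1],[0,0,-1],[1,-1,0,0,-1,-1]]++u [12,14,134,135,141,132]) [0,-1,1,0,0,0,0,0],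
.A [42,55,51,20] (q [[0,-1,0,-1],[1,1,1,1],[-1,-1,0,-2],[1,1,2,2]]++u [8,9,11,15,16,18,24,30,128,129,130,136,137,143,144,150]) [0,0,-1,1,0,0,0,0],
.A [20,49,48,34,37] (q [[-1,-1,0,-1,0,1],[-2,-2,-1,-3,0,2],[0,-1,0,-1],[-2,-2,-1,-3,0,1],[-3,-3,-2,-4,0,2]]++u [9,10,11,17,18,24,129,130,131,137,138,144,14]) [-1,0,1,-1,0,1,0,0],
.A [39,32,37,28,29,43] (q [[1,2,1,3,2,2],[1,2,2,4,3,2],[0,1,1,3,2],[0,1,1,2,1],[1,1,1,2,1,1],[1,2,2,4,3,1]]++u [8,10,128,130,131,138,14,15,134,135]) [0,0,1,-1,0,0,1,0],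
.A [31,20,30,35,36,34,49] (q [[1,1,2,2,2,2,2],[1,0,3,1,1,2,2],[0,-1,0,-2,-1,0,1],[1,0,1,1,1],[1,0,1,-1,-1,0,2],[1,2,3,3,3,2,2],[1,1,2,2,2,2,1]]++u [18,130,138,11,15,134,10,135,14,131]) [0,0,-1,1,0,0,-1,1],
.A [37,36,39,26] (q [[0,0,0,1],[0,1,1,2],[-1,1,0,1],[-1,1,1,2]]++u [8,11,14,15,128,129,131,134,135,136]) [1,0,0,-1,1,0,0,0],
.A [30,36,43,20,31,33] (q [[1,0,0,2,1,0,0,2],[1,0,0,1,0,0,0,1],[1,1,1,3,2,0,0,1],[1,1,1,4,2,0,0,2],[1,0,0,2,1,0,0,1],[0,1,0,2,1,0,0,1]]++u [9,11,14,15,129,131,134,135]) [-1,1,0,0,0,-1,1,0],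
.A [28,35,43,17,25,30] (q [[1,1,3,2,2,2],[1,0,2,1,1,1],[1,1,1,1,1,1],[1,0,1,0,0,1],[1,1,2,2,2,2],[0,0,1,0,1,1]]++u [8,14,15,128,131,134,11,135]) [0,0,-1,1,0,-1,1,0],
.A [36,25,26,24,17,33,16] (q [[2,3,3,6,4,2,2],[1,1,1,3,2,1,1],[1,3,3,6,4,2,2],[1,1,1,2,2,1,1],[0,1,1,2,1,1,1],[0,2,1,3,2,1,1],[0,1,0,2,1,0,1]]++u [11,14,15,131,134,135]) [0,0,1,-1,0,1,-1,1],
.A [20,36,25,27] (q [[-1,1,1,2],[2,1,1,2],[1,-1,-1,1],[-2,2,-1,1]]++u [9,10,14,15,16,17,23,130]) [0,0,1,-1,1,0,0,0],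
.A [36,20,27,31,30] (q [[2,-1,1,0,0,-2],[1,-1,1,0,0,-2],[0,0,0,0,0,-1],[1,-1,0,0,0,-1],[2,-2,1,-1,0,-3]]++u [10,15,17,129,134,135]) [-1,1,0,0,-1,1,0,0],
.A [30,33,20,19,36] (q [[2,-2,1,-1,0,0,-3],[0,0,0,0,0,0,-1],[1,-1,1,0,0,0,-2],[1,-1,0,0,0,0,-1],[2,-1,1,0,0,0,-2]]++u [10,15,128,130,135]) [1,-1,-1,1,-1,1,0,0],
.A [27,25,36,16,24,20] (q [[-2,2,-1,1,0,1,1],[0,0,-1,1,0,1,1],[0,1,0,1,0,1,1],[1,-1,0,0,0,-1],[-2,2,-1,1,0,3,3],[-1,1,0,1,0,1,1]]++u [15,130,135,14,10]) [-1,1,0,0,-1,1,0,0],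
.A [30,28,19,29] (q [[-1,-2,1,-1],[-1,-1,1],[-1,-1],[0,-1,1]]++u [15,128,134,136,14]) [-1,-1,1,0,0,0,0,0],
.A [29,27,23,24,28] (q [[2,1,1],[1,1],[0,0,-1,-1,-1],[2,1,1,-1],[1,1,1]]++u [14,129,135,134]) [-1,-1,0,1,0,0,0,0],
.A [29,27,18,23,28] (q [[2,1,1],[1,1],[2,1,1,-1],[0,0,-1,-1,-1],[1,1,1]]++u [14,128,135,134]) [-1,-1,0,1,0,0,0,0],
.A [29,27,17,18,16,28] (q [[2,1,1],[1,1],[0,0,-1,-1,-1],[2,1,1,-1],[1,0,0,-2,-1,-1],[1,1,1]]++u [14,135,134]) [-1,-1,0,1,0,0,0,0],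
.C [91,106,113,111] (q [[0,1],[0,1,1,0,1],[1,1,1,0,1],[0,1,0,0,1]]++u [8,9,10,11,13,15,16,17,18,19,20,25,26,30,32,35,37,130,133,137,138,140,145,152]) (u [14,21,27,34]++[[(33,1),(71,1)],[(39,1),(64,1)]]++u [41,43,45,46,49,50,51,52]++[[(40,1),(78,1)]]++u [56]++[[(57,1),(53,1)]]++u [58,59,60]++[[(47,1),(84,1)]]++u [62]++[[(64,-1),(28,1)]]++u [66]++[[(67,1),(57,-1)],[(65,1),(96,1)]]++u [69]++[[(71,-1),(36,1)],[(72,1),(93,1)],[(73,-1),(70,1)]]++u [74,75,76,77]++[[(78,-1),(55,1)]]++u [79,80]++[[(82,1),(73,1)]]++u [83]++[[(84,-1),(61,1)]]++u [85,87,88,89,92]++[[(93,1),(63,1)],[(96,1),(68,1)]]++u [100]) [[[(0,20,1)],[(0,25,1)],[(0,28,1)],[(0,31,1)],[(0,36,1)],[(0,40,1)],[(0,42,1)],[(0,43,1)],[(0,44,1)],[(0,47,1)],[(1,25,1)],[(1,28,1)],[(1,43,1)],[(1,47,1)],[(2,47,1)],[(3,40,1)],[(3,42,1)],[(3,44,1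)],[(3,47,-1)],[(4,35,1)],[(4,40,1)],[(4,45,-1)],[(4,46,-1),(0,40,1),(2,47,-1)],[(5,40,-1)],[(7,40,-1)],[(9,42,-1)],[(10,44,-1)],[(14,40,-1)]],[[(0,20,-1)],[(0,23,-1)],[(0,27,-1)],[(1,27,1)],[(2,27,-1)],[(4,25,1)],[(4,27,1)],[(5,27,-1)]]]
]
set_option maxHeartbeats 2000000 in
def dat2 : List (List ℕ × Cert) := ((bins 8).drop 65).zip [
.A [60,93,91,58] (q [[0,1,0,0,0,-1,-1],[0,0,0,0,0,0,-1],[0,0,0,0,0,1],[-1,1,0,0,0,-1,-1]]++u [9,12,17,18,20,24,25,31,32,38,42,48,130,132,137,138,140,145,152,162,11,19,26,35]) [0,0,-1,0,0,1,0,0],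
.C [51,73,72,59,84,81] (q [[0,1,-1,0,0,0,1,1],[1,1,1,1,0,0,1],[1,2,-1,1,0,0,2,1],[0,1,0,1,0,0,1],[0,1,-1,1,0,0,1,1],[0,1,0,1]]++u [11,12,13,19,20,22,26,29,42,130,131,135,138,139,145,162,8,10,15,18,25,128,140,146,133]) (u [21]++[[(14,1),(50,1)],[(36,1),(9,1)],[(41,2),(31,1),(23,1),(17,1),(28,1),(56,-1)]]++u [43,47]++[[(50,1),(27,1)],[(40,1),(75,-1)],[(56,1),(33,1),(37,1),(41,-1)],[(57,-1),(48,1),(24,1),(34,-2),(54,1),(49,1)],[(62,1),(30,1),(49,-1),(34,1)],[(63,1),(38,1)]]++u [69]++[[(75,-1),(53,1)]]) [[[(0,9,-1)],[(0,10,-1)],[(0,11,-1)],[(0,12,-1)],[(1,9,-1)],[(1,10,1)],[(1,11,-1)],[(2,11,1)],[(2,12,1)],[(2,13,1),(0,12,-1)],[(3,7,-1)],[(3,9,-1),(0,12,-8),(1,11,3),(2,11,-1),(2,13,4)],[(3,10,1),(0,12,-3),(1,11,1),(2,13,1)],[(3,12,-1)],[(3,13,-1),(3,7,1)],[(7,1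0,1)]],[[(0,8,-1)],[(0,13,-1)],[(0,15,1)],[(1,13,-1)],[(1,15,1)],[(2,10,-1),(0,13,1)],[(2,12,-1)],[(2,13,1)],[(2,14,1)],[(2,15,1)],[(3,13,-1)],[(3,15,2),(3,13,-1)]],[[(0,7,-1)],[(0,9,1)],[(0,10,1)],[(1,7,1)],[(1,9,1)],[(1,10,1)],[(2,10,1)],[(3,4,2),(1,10,1)],[(3,10,-1)],[(3,11,-3),(3,10,-1)],[(4,10,1)],[(7,7,-1)],[(7,9,1)]],[[(0,10,1)],[(0,11,1)],[(0,12,1)],[(1,11,-1)],[(1,12,1)],[(3,12,1)]],[[(2,5,-1)],[(3,4,-1),(2,5,-1)]]],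
.A [59,85,16,81,55] (q [[-2,1,0,0,0,1,1],[0,1,0,2,0,1,1],[1,0,0,1,0,-1],[0,1,0,1],[0,1,0,0,0,1,1]]++u [11,12,15,18,20,22,29,42,131,132,135,140,142,149,10,25,32]) [2,-1,-2,0,2,0,-1,1],
.A [84,63,60,46,33,67] (q [[0,1,0,1,-1,-1],[1,1,2,2,2,1],[0,0,-1,-1,-2,-1],[0,1,1,1,1],[0,1,0,1],[1,1,2,2,3,1]]++u [11,15,22,128,131,132,136,139,140,146,8,12,16,19,20,26]++[[(9,1),(133,-1),(29,-1)],[(13,-1),(35,1),(129,-1)],[(29,-1),(9,-1),(133,1)],[(35,-1),(129,1),(13,-1)],[(129,-1),(13,1),(35,-1)],[(133,1),(29,1),(9,1)],[(149,-2),(13,-1),(35,1),(129,-1)],[(155,2),(133,-1),(29,-1),(9,-1)]]) [0,-1,0,0,0,1,0,0],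
.A [61,30,75,40,74] (q [[2,0,1,0,0,1],[1,-1,0,-1,0,1],[1,-1,1,0,0,1],[1,0,1,0,0,1],[1,0,1]]++u [11,13,15,19,20,26,35,129,131,132,133,135,139,140,142,149,9,29,155,12]) [0,-1,1,0,-1,1,0,0],
.A [53,24,63,37] (q [[-1],[0,-1,0,-1],[0,-1,1],[0,-1]]++u [8,11,12,13,15,19,20,22,29,133,140,142,146,149,131,139]) [-1,-1,1,0,0,0,0,0],
.A [53,38,49,16] (q [[-1,1],[0,0,1],[0,1,1],[0,1,1,0,0,-1]]++u [12,19,20,22,29,131,133,135,140,142,146,15]) [1,-1,-1,1,0,0,0,0],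
.A [33,73,41,55] (q [[0,0,-1,0,-1],[0,0,0,0,-1],[-1,1,1,0,1],[0,1,1,0,1]]++u [8,9,10,12,13,15,16,17,20,23,29,129,130,132,133,135,136,137,143,149]) [1,-1,-1,1,0,0,0,0],
.A [52,44,34,30,50,49] (q [[-1,1,-1,0,-1,0,0,1],[0,1,1,1,-1,0,0,2],[0,1,1,1,1],[-2,1,-3,-1,-1,0,0,2],[0,1,0,1,0,0,0,1],[0,1,0,0,-1,0,0,1]]++u [9,13,20,22,29,129,130,132,137,140,142,149,15,133,135,10]) [1,1,1,-1,-1,-1,2,0],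
.A [38,31,57,37,49,30,41] (q [[0,0,1,1,1,1],[1,1,1,2,2,1,1],[1,0,1,1,1],[0,-1,0,0,0,0,-1],[1,1,2,3,3,2],[0,0,0,0,1],[0,1,1,2,2,1]]++u [8,12,20,29,128,130,132,133,135,140,142,10,15]) [0,1,0,0,-1,0,1,0],
.A [38,43,48,47,41,23] (q [[0,0,1],[1,1,2,1],[1,0,1,1],[1,1,2,2,1,1],[0,0,0,0,-1,-1],[0,0,0,-1,-2,-1]]++u [10,12,15,20,22,130,133,135,142,149,132,140]) [0,0,-1,0,1,0,0,0],
.A [18,43,54,31,41] (q [[-1,-1,0,-1,1],[1,1,0,1,1],[1,-1,2,1,1],[0,0,-1],[0,0,1,1,1]]++u [8,9,13,15,16,29,128,129,132,135,140,22,20]) [0,1,0,0,-1,1,0,0],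
.A [23,42,41,43,24] (q [[-1,-1,0,-1,1,0,0,2],[0,-1,0,0,1,0,0,1],[-1,-1,0,0,2,0,0,2],[0,0,0,0,1,0,0,1],[-1,-1,0,-1,1,0,0,1]]++u [9,15,22,129,132,135,140,142,12,20]) [0,-1,1,0,0,-1,1,0],
.A [43,42,41,23] (q [[1,1,0,1],[1,0,0,1],[1,1,0,2],[1,1,0,1,-1]]++u [12,20,128,132,135,140,142,149]) [0,0,-1,0,1,0,0,0],
.A [43,16,42,41,17] (q [[1,1,0,1],[0,-1,0,-1,-1,-1],[1,0,0,1],[1,1,0,2],[1,1,0,1,-1]]++u [12,20,132,135,140,142,149]) [0,0,-1,0,1,0,0,0],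
.A [45,49,28] (q [[-1,1,-2],[2,1,1],[-1,1,1]]++u [9,11,13,15,16,18,24,128,130,133,136,143]) [0,-1,0,1,0,0,0,0],
.A [44,36,46,33] (q [[-1,1,1,3],[0,1,1,2],[0,0,0,-1],[-1,1,0,2]]++u [9,11,13,18,24,130,133,135,137,138,15]) [1,0,0,-1,1,0,0,0],
.A [31,43,44,21,40] (q [[-1,0,-1,0,1],[0,1,1,2,2],[0,1,2,3,2],[0,1,1,2,1],[-1,0,-1,-1]]++u [8,10,11,15,18,128,130,131,138,22]) [1,0,0,0,-1,1,0,0],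
.A [27,38,40,30,36] (q [[1,1,2,2,2],[2,1,4,3,3],[-1,0,-1,-1,-1],[1,0,1,0,1],[2,1,3,2,2]]++u [10,11,13,18,133,135,138,142,15,131]) [0,0,-1,1,-1,1,0,0],
.A [42,38,43,28,37] (q [[1,0,1,1],[0,0,1,1,1],[1,1,2,3,2],[1,1,2,3,1],[1,1,2,4,2]]++u [8,9,11,15,16,128,129,133,136,142]) [0,1,0,-1,0,1,0,0],
.A [34,21,48,25,23] (q [[-3,-1,-1,0,0,0,2],[-1,0,-1,0,0,0,1],[-2,-1,-1,0,0,0,2],[-2,-1,-1,0,0,0,1],[-2,-1,0,0,-1,0,1]]++u [9,15,129,131,133,135,11,13,22]) [1,1,-1,-1,1,0,0,0],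
.A [21,34,42,23,24] (q [[1,1],[1,1,1],[2,1,1],[0,0,0,-1,-1],[0,0,-1,-1]]++u [8,11,13,15,22,128,135,142]) [-1,-1,0,1,0,0,0,0],
.A [17,34,42,21,16] (q [[0,0,1,0,-1],[1,1,1],[2,1,1],[1,1],[1,0,1,0,-1,-1]]++u [13,15,22,133,135,142,11]) [-1,-1,0,1,0,0,0,0],
.A [21,31,42,26] (q [[1,1,2,3],[-1,-1,-2,-1],[1,0,1,1],[0,0,1,1]]++u [8,9,10,15,16,17,22,23,129,133,13]) [0,1,0,-1,1,0,0,0],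
.A [26,36,31,30,42] (q [[1,1,1,2,2],[2,2,1,3,3],[1,1,0,2,2],[1,1,0,1,2],[0,-1,0,-1,-1]]++u [9,10,13,15,129,133,135,142]) [-1,0,1,0,-1,1,0,0],
.A [35,28,25,30] (q [[0,-1,1],[-1,-1,1],[-1,-1],[-1,-1,0,-1]]++u [10,13,15,128,130,133,135]) [-1,-1,1,0,0,0,0,0],
.A [19,32,36,23,24] (q [[1,-1],[1,-1,1],[2,-1,1],[0,-1,-1,-1,-1],[1,-1,0,-1]]++u [10,13,15,22,130,135,142]) [-1,1,0,0,0,0,0,0],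
.A [35,28,24] (q [[1,0,1],[0,0,1],[0,0,0,-1]]++u [8,15,129,133,135,142]) [-1,-1,1,0,0,0,0,0],
.A [35,23,24,21] (q [[1],[1,0,0,-1,-1],[1,1,0,-1],[1,1]]++u [13,22,129,135,142]) [-1,0,1,0,0,0,0,0],
.A [35,18,21,23] (q [[1],[1,1,0,-1],[1,1],[1,0,0,-1,-1]]++u [13,22,128,135,142]) [-1,0,1,0,0,0,0,0],
.A [35,17,21,18,16] (q [[1],[1,0,0,-1,-1],[1,1],[1,1,0,-1],[1,1,0,-2,-1,-1]]++u [13,22,135,142]) [-1,0,1,0,0,0,0,0],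
.A [55,66,47,64,53] (q [[0,1],[0,0,-1],[0,1,1,1],[0,1,1,1,0,-1],[-1,-1,-3,-2,0,1]]++u [8,10,11,12,16,18,19,25,37,128,129,130,132,135,136,137,139,143,144,157,9,15,24,145,17]) [0,-1,1,0,0,0,0,0]
]
set_option maxHeartbeats 2000000 in
def dat3 : List (List ℕ × Cert) := ((bins 8).drop 97).zip [
.A [65,67,54,49,28,45] (q [[-1,-1,-1,-3,-1,0,1],[0,0,0,-1,0,0,1],[0,-1,-1,-2,-2,0,1],[0,0,0,-1],[0,0,0,-1,-1,0,1],[0,0,-1,0,-1]]++u [9,10,11,12,15,18,24,25,31,129,131,137,144,151,19,130,135]) [-1,1,2,-3,2,-1,1,0],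
.B [41,38,54,48,45,49] (q [[2,3,4,3,0,0,2,1],[1,2,3,1,0,0,2,1],[1,1,2,1,0,0,1,1],[1,1,1,1,0,0,1],[1,2,2,1,0,0,2,1],[2,3,4,2,0,0,2,1]]++u [8,10,12,15,18,19,128,130,132,135,138,139]) [] (u [11,25,131,145]++q [[0,0,0,0,1]]++[[(5,1),(3,1)]]) [(38,1)],
.A [39,30,56,47,36,34,48] (q [[0,1,0,1,1,1,1],[0,0,0,-1,0,1],[1,1,1,2,2,1],[0,1,2,1,1,3,1],[0,0,0,-1,-1],[2,3,4,5,5,3,1],[1,1,2,2,2,2,1]]++u [10,15,18,19,25,130,138,145,11,12,131,135]) [0,-1,-1,2,0,-2,1,1],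
.A [33,48,41,44,36] (q [[-1,-1,-2,-1,-2],[0,-1,-1,0,-1],[0,0,0,1],[-1,-1,-1,-1,-2],[0,0,0,0,-1]]++u [8,9,11,15,16,128,129,132,135,136]) [0,-1,-1,2,-2,1,0,0],
.A [36,34,38,33,37,42] (q [[1,2,3,5,2,1],[1,2,3,5,3,1],[0,1,2,3,1,1],[0,1,1,2,1,1],[1,2,3,6,3,1],[1,1,2,3,2,1]]++u [11,12,15,19,129,131,132,139,9]) [1,1,0,-2,1,0,1,0],
.A [23,36,41,24,33,42] (q [[0,-1,-2,0,-1,0,1],[1,0,-1,1,0,0,1],[1,-1,-3,2,0,0,2],[1,-1,-3,1,0,0,2],[0,0,-1],[1,-1,-2,1,0,0,1]]++u [8,11,12,15,19,128,132,139,135]) [2,-1,-3,2,0,-1,1,0],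
.A [17,41,32,43,16,33] (q [[0,1,1,0,-1],[0,1,1,1],[-1,0,0,-1],[0,1,1],[-2,-1,-2,-3,-1,-1],[-1,0,-1,-1]]++u [11,12,15,19,131,132,139]) [1,-1,-1,1,0,0,0,0],
.A [35,45,28,38] (q [[0,1,1,0,2],[-1,1,0,0,2],[0,1,1,0,1],[-1,0,0,0,1]]++u [8,10,17,23,128,129,135,136,143,15]) [1,1,1,-2,0,1,0,0],
.A [27,38,42,28,37] (q [[1,1,2,3,2],[0,0,1,1,1],[2,1,3,4,2],[1,1,2,3,1],[0,0,0,1]]++u [9,10,15,17,129,130,132,137]) [0,1,0,-1,0,1,0,0],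
.A [24,28,35,32,33,37] (q [[-2,0,-1,-1,1,-1],[-2,2,1,3,3,-1],[0,1,1,2,2],[0,0,1,1,1,1],[0,2,1,3,3,1],[-2,0,-1,1,1,-1]]++u [8,10,12,15,135,130]) [1,0,0,0,-1,1,0,0],
.A [35,28,33,27,32,23,24] (q [[0,-1,-1,-4,-2,-2,-2],[0,0,0,-2,-1,-1,-1],[1,1,1,1,1,1],[-2,-2,-3,-5,-3,-3,-2],[-1,-1,-1,-2,-1,-1,-1],[-2,-3,-4,-8,-5,-4,-3],[0,0,0,-1]]++u [10,12,15,135,130]) [0,1,1,-2,1,0,-1,1],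
.A [35,24,28,27,37] (q [[0,0,1,1,1],[-2,-1,0,-1,1],[-1,0,1,1,1],[0,1,0,1,1],[-2,-1,0,1,1]]++u [8,12,15,129,135,136]) [2,1,-1,0,-1,1,0,0],
.A [31,28,35,18,27,23] (q [[-2,-1,0,1,1,0,0,1],[-3,-1,1,2,2,0,0,2],[-2,-1,1,2,2,0,0,2],[-2,-1,0,0,1,0,0,1],[-1,0,0,1,1,0,0,1],[-2,-1,0,1,1,0,0,2]]++u [9,12,15,135]) [-1,0,1,-1,1,-1,1,0],
.A [28,35,23,25,27] (q [[1,1,1,2],[2,1,1,2],[2,1,0,1,-1],[0,0,0,1],[1,1,0,1]]++u [15,128,132,135]) [-1,0,1,-1,1,0,0,0],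
.A [28,35,16,17,25,27] (q [[1,1,1,2],[2,1,1,2],[-1,-1,-1,-1,-1,-1],[2,1,0,1,-1],[0,0,0,1],[1,1,0,1]]++u [15,132,135]) [-1,0,1,-1,1,0,0,0],
.A [42,44,27] (q [[0,-1,-1],[-1,-1,-1],[-1,-1,-2]]++u [9,10,15,17,23,128,130,131,135,138,143,150]) [0,-1,-1,1,0,0,0,0],
.A [39,42,26,37] (q [[-1,-1,-2,-3],[0,-1,-1,-2],[-1,-1,-1,-2],[0,0,0,1]]++u [9,10,15,17,129,131,137,138,144]) [0,0,0,-1,1,0,0,0],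
.A [27,32,37,29] (q [[-1,2,1,3],[-1,1,1,2],[0,-1,-1,-1],[0,1,1,2]]++u [10,11,15,128,130,131,135]) [1,0,0,-1,1,0,0,0],
.A [20,33,27,35,23,31] (q [[1,1,1,2],[1,1,1,2,1,1],[1,1,0,1,-1,-1],[2,1,1,2],[2,1,0,1,-2,-1],[-1,-1,-1,-1]]++u [10,15,18,130,131,135,11]) [-1,0,1,-1,1,0,0,0],
.A [35,21,25,20] (q [[2,0,1,1],[2,2,1,3],[-2,-2,-3,-1],[0,0,1,1]]++u [9,15,16,135,11]) [-1,1,1,-1,1,0,0,0],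
.A [30,31,21,26,29] (q [[3,2,1,3,4],[-1,-1,-1,-1,-1],[2,2,1,3,3],[1,1,1,2,2],[2,1,1,2,2]]++u [15,129,135,11,131]) [-1,0,1,0,-1,1,0,0],
.A [26,25,30,27,17,29] (q [[-1,-1,-1,-1,-1,-1],[0,0,0,1,1,1],[0,-2,-2,-3,-1,-1],[-2,-2,-4,-3,-3,-3],[-2,-2,-3,-3,-3,-2],[0,-1,-1,-1,-1,-1]]++u [8,15,128,135,131]) [0,-1,-1,1,0,-1,1,0],
.A [27,29,17,25,16,26] (q [[-1,2,1,3],[0,1,1,2],[-2,2,1,3,-1],[0,-1,-1,-1],[0,-2,-2,-3,-1,-1],[-1,1,1,2]]++u [15,135,11,131]) [1,0,0,-1,1,0,0,0],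
.A [29,21,19] (q [[1],[1,1,-1],[-1,-1,-1]]++u [10,17,23,135]) [-1,0,1,0,0,0,0,0],
.A [29,21,19,30] (q [[1],[1,1,-1],[-1,-1,-1],[1,0,-1,-1]]++u [10,17,135]) [-1,0,1,0,0,0,0,0],
.A [25,21,20,24] (q [[0,-1,-1],[-2,1,-1],[-1],[-2,0,-1,-1]]++u [8,15,130]) [1,0,0,0,0,0,0,0],
.A [23,19,24,20,21] (q [[0,-1,-1,-1,-1],[0,-1,-1],[-2,0,-1,-1],[-1],[-2,1,-1]]++u [10,15,130]) [1,0,0,0,0,0,0,0],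
.A [24,20,19,21] (q [[-2,0,-1,-1],[-1],[0,-1,-1],[-2,1,-1]]++u [8,15,129]) [1,0,0,0,0,0,0,0],
.A [23,20,19,18,21] (q [[0,-1,-1,-1,-1],[-1],[0,-1,-1],[-2,0,-1,-1],[-2,1,-1]]++u [9,15]) [1,0,0,0,0,0,0,0],
.A [21,19,18,17,20] (q [[-2,1,-1],[0,-1,-1],[-2,0,-1,-1],[0,-1,-1,-1,-1],[-1]]++u [8,15]) [1,0,0,0,0,0,0,0],
.A [20,18,17,16,21,19] (q [[-1],[-2,0,-1,-1],[0,-1,-1,-1,-1],[-4,-1,-3,-4,-2,-2],[-2,1,-1],[0,-1,-1]]++u [15]) [1,0,0,0,0,0,0,0],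
.C [125,113] (q [[1,0,0,0,0,1],[1]]++u [9,10,16,18,25,32,33,40,47,53,129,136]) (u [15,22,29,35,36,42,43,48,49,50,54,55,56,57,60,61,62,63,66,67,68,69,71,72,73,74,75,77,78,79,80,81,82,83,84,85,86,87,88,89,90,91,92,93,94,95,96,97,98,99,100,101,102,103,104,105,106,108,109,111,112,114,116,118]) [[[(0,53,1)],[(0,56,1)],[(0,58,1)],[(0,60,1)],[(0,61,1)],[(0,62,1)],[(0,63,1)],[(1,62,1)],[(1,63,1)],[(2,63,-1)],[(3,63,1)],[(5,63,-1)],[(7,63,1)],[(10,63,-1)]]]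
]
set_option maxHeartbeats 2000000 in
def dat4 : List (List ℕ × Cert) := ((bins 8).drop 129).zip [
.C [96,94,107] (q [[1,-1,0,0,0,0,0,1],[1,0,0,0,0,0,0,1],[1]]++u [9,10,11,14,19,21,24,26,28,31,33,38,40,47,59,129,130,131,134,139,141,144,146,148,151,153,158,160,167,179]) (u [15,22,29]++[[(35,1),(8,1)],[(36,1),(16,1)]]++u [42,43]++[[(48,-1),(23,1)],[(49,-1),(30,1)]]++u [50,55]++[[(56,1),(37,1)]]++u [57,61,62]++[[(63,1),(44,1)],[(67,-1),(45,1)]]++u [68,69,72]++[[(74,-1),(51,1)]]++u [75,79]++[[(80,-1),(58,1)],[(81,-1),(64,1)]]++u [85,86]++[[(89,1),(70,1)],[(91,1),(76,1)]]++u [95,99,103]) [[[(0,15,-1)],[(0,20,-1)],[(0,23,-1)],[(0,24,-1)],[(0,27,-1)],[(0,28,-1)],[(0,31,1)],[(1,23,1)],[(1,24,1)],[(1,27,1)],[(1,28,1)],[(2,24,1)],[(2,27,1)],[(2,28,1)],[(3,26,1)],[(3,27,1)],[(3,28,1),(0,31,1)],[(3,29,1)],[(3,30,1)],[(3,31,1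)],[(4,28,-1)],[(4,29,-1)],[(4,30,-1)],[(4,31,-1)],[(5,28,1)],[(7,29,1)],[(7,30,1)],[(7,31,1)],[(8,30,-1)],[(8,31,-1)],[(11,31,1)],[(16,31,1)]],[[(0,19,1)],[(0,23,1)],[(0,27,1)],[(0,29,1)],[(0,30,1)],[(0,31,1)],[(1,30,1)],[(1,31,1)],[(2,31,-1)],[(3,31,1)],[(5,31,-1)],[(7,31,-1)]],[[(3,11,-1)]]],
.C [68,89,90,77,76] (q [[1,0,0,0,0,0,1],[1,0,0,0,1,0,1],[1,1,0,0,1,0,1],[1,0,-1,0,0,0,1],[0,0,-1,0,0,0,1]]++u [10,11,13,14,19,20,21,26,27,28,32,33,34,41,128,130,131,133,134,138,139,140,141,145,147,148,152,153]) ([[(15,1),(9,1)],[(30,1),(22,1)],[(35,1),(16,1)],[(37,1),(29,-1)]]++u [39]++[[(43,-1),(24,1)]]++u [44]++[[(49,-1),(46,1)],[(50,1),(31,1)],[(56,-1),(52,1)],[(57,-1),(42,-1),(23,1),(64,1)],[(59,1),(17,1),(62,-1),(36,1)],[(62,1),(36,-1),(45,1),(59,-2)],[(64,2),(38,1),(57,-1),(42,-1)],[(69,-1),(51,1)],[(70,1),(63,-1)],[(75,-1),(58,1)],[(81,1),(65,1)]])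 [[[(0,6,-1)],[(0,7,-1)],[(0,9,-1)],[(0,10,-1)],[(0,11,-1)],[(0,14,-1)],[(0,15,1)],[(0,16,-1)],[(0,17,-1)],[(1,10,1)],[(1,15,1)],[(1,16,1)],[(1,17,1)],[(2,16,-1)],[(2,17,-1),(0,15,-1)],[(3,15,-1)],[(3,17,-1)],[(4,6,-1),(2,17,1)],[(4,14,1)],[(4,15,1)],[(4,16,1)],[(6,17,1)],[(7,16,-1)]],[[(0,6,-1)],[(0,10,1)],[(0,11,-1)],[(0,12,1)],[(0,15,1)],[(0,16,1)],[(0,21,1)],[(0,22,1)],[(1,16,1)],[(1,19,1)],[(1,20,-1)],[(1,22,-1)],[(3,19,-1)],[(3,22,1)],[(4,21,-1)],[(6,19,1)]],[[(0,6,1)],[(0,11,1)],[(0,13,1)],[(0,14,1)],[(0,15,1)],[(1,13,1)],[(1,14,1)],[(2,14,1)],[(3,14,1)],[(7,13,-1)]],[[(0,9,-1)],[(1,8,1)]]],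
.A [91,48,64,23] (q [[0,1,0,0,0,0,1],[0,0,0,0,0,0,1],[-1,0,0,0,0,0,1],[-1,-1,0,0,-1]]++u [10,14,21,28,33,40,47,53,131,139,146,147,154,161,173,11,19,26,27,34,41,130]) [2,1,-1,0,0,-1,0,1],
.B [62,76,86,48,71,63] (q [[1,2,-2,0,0,3,1],[1,2,-1,0,0,3,2,1],[1,2,0,0,0,1,1],[1,0,0,0,0,1,1],[1,1,0,0,0,1,1,1],[3,4,0,0,0,5,3,2]]++u [11,13,14,16,19,20,21,34,41,128,133,136,140,148,9,27,28,129,131,139,147]) [[(33,-1),(17,1),(15,1)],[(39,1),(10,1),(23,1),(36,-1)],[(46,1),(18,1),(43,-1)],[(51,-1),(40,-1),(24,1),(22,1)],[(52,-1),(25,1),(50,1)],[(53,-1),(38,1),(35,-1)],[(58,1),(47,1),(31,1),(29,-1)],[(59,1),(32,1),(44,1),(57,-1)]] (u [12,26,132]++[[(134,1),(41,-1)],[(141,1),(34,1)]]++u [146]++[[(148,1),(9,-2),(147,-1),(28,-1),(27,1),(8,1),(128,-4)],[(154,1),(21,1)],[(161,1),(14,-1)]]++q [[0,0,0,1]]++[[(4,1),(2,1)]])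 [(86,1),(63,3),(62,1),(48,1),(71,2),(73,-2)],
.C [67,63,44,65,45] (q [[2,-4,-3,0,0,3,0,1],[2,-3,-2,0,0,3,0,1],[1,-3,-2,0,0,2,0,1],[0,-1,-1,0,0,1],[1,-2,-2,0,0,2,0,1]]++u [9,11,14,19,21,26,27,28,129,131,134,139,141,146,147,148,13,20,133,140]) (u [17,18,25]++[[(35,1),(32,-1),(8,1),(33,2)],[(39,1),(36,-1),(16,1),(38,-2)]]++u [46,52,53]) [[[(0,3,-1)],[(0,7,-1)],[(1,4,-1)],[(2,4,-1)],[(3,4,-1),(0,7,-5)],[(3,5,1)],[(3,6,1)],[(4,7,1)]],[[(0,7,1)],[(1,6,1)],[(3,0,-1)],[(3,5,-1)],[(3,6,-1)],[(4,2,1)],[(4,3,-1)],[(4,7,1)]],[[(0,3,1)],[(0,4,1)],[(0,7,1)],[(1,4,-1)],[(1,6,1)],[(1,7,-1)],[(2,7,1)],[(3,0,1)],[(4,7,1)]],[[(0,3,-1)],[(0,5,-1)],[(0,6,-1)],[(1,8,-1)],[(2,8,1)],[(3,2,-1)],[(3,7,-1)],[(3,8,1)]],[[(0,6,1)],[(1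,5,-1)],[(2,5,1)],[(3,5,1)],[(3,7,1)],[(4,3,1)],[(4,4,-1)]],[[(0,4,1)],[(1,6,1)]],[[(3,0,-1)]]],
.A [58,81,24,42] (q [[-1,0,0,0,0,1],[0,1,0,0,0,1],[-1,0,0,-1,0,1],[0,0,0,0,0,1]]++u [8,11,12,14,20,27,34,128,131,132,134,140,141,147,148,154,161,21,28,41]) [2,1,-1,0,-1,0,1,0],
.A [16,52,69,24,56] (q [[2,0,2,1,0,0,1],[1,0,2,1,0,1,1],[2,0,3,1,0,1,1],[1,0,1,0,0,1,1],[2,0,2,1,0,1,1]]++u [13,20,26,28,34,41,131,132,133,140,141,148]) [-1,1,-1,0,1,0,-1,1],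
.C [57,53,48,56,76,60] (q [[1,2,1,3,2,0,1],[1,2,0,3,3,0,1],[1,1,0,2,2,0,1],[1,2,0,3,2,0,1],[1,3,0,4,3,0,2],[1,2,0,2,2,0,1]]++u [8,10,12,14,16,20,21,23,28,129,130,132,136,137,140,143]) [[(45,1),(41,1),(31,1),(15,2),(11,2)],[(51,-1),(22,2),(18,2),(47,1),(38,-1)],[(52,2),(36,2),(33,-1),(34,-1),(24,1)],[(58,2),(29,-2),(25,1),(30,1),(26,1)]] [[[(0,1,1)],[(0,2,1)],[(0,3,1)],[(1,2,1)],[(1,3,1)],[(2,3,2),(0,1,1)]],[[(0,0,-1)],[(0,1,-1)],[(0,2,-1)],[(0,3,-1)],[(0,4,-1)],[(1,0,1)],[(1,1,3),(0,3,-2)],[(1,2,3),(0,4,-2)],[(1,3,1)],[(1,4,1)],[(2,1,-1)],[(2,2,-2),(0,0,-1)],[(2,3,-1)],[(2,4,-2),(1,0,-1)],[(3,2,-1)],[(3,4,-1)]],[[(0,0,-1)],[(0,3,1)],[(0,4,1)],[(0,5,1)],[(0,8,-1)],[(0,9,-1)],[(0,12,1)],[(0,13,1)],[(0,15,1)],[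(1,5,1)]],[[(0,3,1)],[(0,4,1)],[(0,5,-1)],[(0,9,1)]],[[(0,1,1)],[(0,2,1)],[(0,3,1)],[(1,1,1)],[(1,2,1)],[(2,2,16),(0,3,5)]],[[(0,2,1)],[(0,3,1)],[(0,4,1)],[(1,2,-1)]]],
.A [35,45,56,53,55,44] (q [[0,-1,-1,-1],[-1,-2,-3,-3,-1],[0,-1,-1,-1,0,1],[0,0,0,0,1,1],[0,-1,-1,-2,0,1],[-1,-3,-3,-4,-1,1]]++u [10,12,28,129,130,133,134,137,140,9,14,17,21,13,20]) [-1,1,1,1,-1,-2,1,0],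
.B [42,43,45,39,44,52,53] (q [[2,-1,0,5,4,0,2,1],[2,0,1,5,4,0,2,1],[1,0,0,3,2,0,1,1],[0,-1,-1,0,1,0,1],[1,-1,0,3,3,0,2,1],[2,0,1,6,4,0,2,1],[0,0,0,1,1]]++u [8,10,12,14,20,21,28,128,130,132,133,134,140,141]) (u [19]++[[(27,-1),(26,1),(11,1),(25,1)],[(34,-1),(32,1),(33,-1),(18,1)]]++u [40]) [[(132,1),(14,1),(10,1),(13,-1)],[(148,1),(134,1),(130,1),(133,-1)],[(5,1),(1,1),(2,1)]] [(39,1),(24,1)],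
.A [39,50,49,53,16,38] (q [[0,0,-1,0,1,1,1],[2,-2,-1,0,3,1,1],[2,0,1,0,3,1,1],[0,0,0,0,1],[0,1,1,0,0,-1],[1,-1,0,0,2,1,1]]++u [12,14,21,130,133,134,140,141,10,13,20]) [2,-3,-3,2,0,2,-1,1],
.A [39,30,45,52,32,57,25] (q [[1,2,2,3,3,2,1],[-1,-1,-1,-1,0,-1],[-1,0,-1,-1,-1,-1,-1],[-1,-1,-1,-1,-1,-1],[0,1,1,1,1,1],[0,1,1,2,2],[0,0,0,1,1]]++u [8,12,16,21,28,128,129,133,134,136,140,141,148,13,14]) [1,0,0,0,-1,1,0,0],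
.A [43,40,47,31,23] (q [[0,1,-1],[-1,0,-1,-1],[0,1,0,1],[-1,0,-2,-1],[0,0,-1,-1,-1]]++u [12,13,14,20,28,129,132,133,141,148,9,134]) [0,-1,1,0,0,0,0,0],
.A [18,47,50,17] (q [[-1,0,-2,-1],[-1,0,-1],[0,0,-1],[0,0,-1,-1,-1]]++u [8,12,13,20,21,28,132,141]) [0,-1,1,0,0,0,0,0],
.A [17,47,50,18,16] (q [[0,0,-1,-1,-1],[-1,0,-1],[0,0,-1],[-1,0,-2,-1],[-2,0,-3,-2,-1,-1]]++u [12,13,20,21,28,132,141]) [0,-1,1,0,0,0,0,0],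
.A [58,59,36,42] (q [[0,0,0,1],[1,1,0,3,2],[1,1,0,2,1],[1,0,0,2,1]]++u [8,9,10,11,14,16,18,23,24,30,128,129,130,134,136,143]) [1,1,-2,0,0,1,0,0],
.B [51,59,43,48,37,47] (q [[1,0,4,3,2,0,0,1],[0,0,1,1,1],[2,1,5,5,3,0,0,1],[2,0,6,5,3,0,0,1],[1,0,3,3,2,0,0,1],[2,1,6,6,3,0,0,1]]++u [9,11,13,17,24,129,130,131,133,134,144,10]) (u [26]++[[(38,1),(19,1),(34,-1)]]++u [39]++[[(46,-1),(27,-1),(31,1)]]) (u [18]++[[(133,1),(17,1),(14,1)],[(137,1),(134,1),(13,1)]]++u [138]++[[(5,1),(4,1)],[(6,1),(2,-1),(1,1),(5,1)]]) [(47,1)],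
.A [31,45,46,51,41,36,42] (q [[-1,-1,-1,-1,-2],[0,1,0,1,1,1],[1,2,2,3,3,2,1],[-2,-2,-2,-3,-4,-1,-1],[0,1,1,2,1,1],[0,0,0,0,-1],[0,1,1,2,1,2]]++u [8,10,11,13,128,130,138,14,18,134]) [1,0,0,-1,2,-2,1,0],
.A [42,23,41,43,38,39] (q [[2,0,1,2,0,0,1],[2,1,2,2,-1,0,1],[2,1,2,3,0,0,1],[2,1,2,2,0,0,1],[1,0,1,1,0,0,1],[1,0,0,1,0,0,1]]++u [11,13,14,18,131,133,134,138,10,130]) [1,-1,-1,1,0,-1,1,0],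
.B [25,39,51,36,35,41,38] (q [[4,7,9,12,11,8,2],[1,2,2,3,3,2,1],[2,4,5,6,6,4,1],[2,3,4,5,4,3,1],[2,3,4,5,5,3,1],[0,1,1,2,1],[2,3,5,6,5,4,2]]++u [9,11,16,128,131,133,134,136,13,14]) [[(28,-1),(27,-3),(24,1),(22,1),(10,1),(26,2)],[(30,1),(15,1),(19,1),(21,-2),(20,3),(17,1)]] [[(129,1),(14,-1),(11,-1),(13,-1),(128,2)],[(134,1),(9,-2),(133,1),(8,-1),(131,1)],[(7,-2),(2,1),(1,1),(6,-2),(4,1)]] [(41,1),(36,7),(35,7)],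
.B [32,36,31,39,35,30,41] (q [[2,3,2,6,5,4,0,1],[3,4,2,8,6,5,0,2],[1,1,0,3,2,2,0,1],[1,2,1,3,3,2],[1,1,1,2,2,1],[2,3,1,6,5,4,0,2],[1,2,1,4,3,2,0,1]]++u [9,11,13,14,133,134,129,131]) [[(21,1),(19,-2),(12,1),(8,1),(15,1),(10,1)],[(34,2),(24,1),(22,1),(17,1),(20,1),(16,1),(26,1)]] [[(6,1),(2,1)]] [(35,1),(30,3)],
.B [25,35,36,30,17,40,41] (q [[1,2,1,3,3,2,1],[2,3,3,5,5,3,2],[2,4,2,5,5,3,2],[2,5,2,6,7,4,3],[2,4,3,6,6,4,3],[1,2,2,3,3,2,1],[2,5,3,7,7,4,3]]++u [8,13,128,131,133,11]) [] [[(133,1),(14,1),(11,1),(128,-1)],[(134,1),(131,1),(8,-1),(13,1)],[(7,-1),(2,-1),(4,1),(1,1)]] [(30,1),(17,1)],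
.A [40,16,25,36,35,41,17] (q [[-1,-3,0,-3,-4,-2,-2],[-2,-5,-2,-6,-7,-4,-3],[-1,-3,-1,-3,-4,-2,-2],[0,-1,0,-1,-2,-1,-1],[0,-2,1,-1,-2,-1,-1],[0,0,1,1],[0,-1,1,0,-1]]++u [13,131,133,14,11]) [-1,-2,2,1,-2,1,-1,1],
.A [36,19,46,45,32] (q [[0,1,1,2],[0,1,1,2,1],[0,1,1,1,1],[-1,0,-1,0,-1],[-1,0,0,1,-1]]++u [8,9,10,13,16,17,23,128,129,134,136,137,143]) [1,0,0,-1,1,0,0,0],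
.A [27,36,38,30,40,25] (q [[-2,0,-3,-2,-2,0,1],[-4,-1,-7,-6,-6,0,2],[-4,-1,-6,-5,-5,0,2],[-2,-1,-4,-4,-3,0,1],[-1,0,-1,-1,-1],[-3,-1,-5,-4,-4,0,1]]++u [10,14,17,129,133,137,13,130,134]) [-1,1,-1,1,-2,1,1,0],
.A [34,26,33,29,24] (q [[1,1,1,1,1],[0,0,0,1,1],[1,1,0,2,2],[2,1,1,2,2],[1,0,0,0,1]]++u [8,13,14,130,133,134,10]) [-1,0,1,0,-1,1,0,0],
.A [29,19,23,24,36,40,16] (q [[2,0,2,1,2,1,0,1],[3,1,2,2,4,2,0,2],[1,0,0,0,1,1,0,1],[2,0,1,0,2,1,0,1],[2,1,1,1,2,1,0,1],[3,1,3,2,4,2,0,2],[1,0,1,0,1,0,0,1]]++u [10,13,14,130,133,134]) [1,0,0,-1,1,0,-1,1],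
.A [34,29,19,24] (q [[-1,-1,1],[0,-1,1],[-1,-1],[0,-1,0,-1]]++u [8,13,129,133,14]) [-1,-1,1,0,0,0,0,0],
.A [34,19,24,23,36] (q [[-1,1,-1],[-1,1,-2],[0,0,-1,-1],[-2,1,-3,-1,-1],[0,1,-1]]++u [13,14,129,134]) [0,-1,1,0,0,0,0,0],
.A [34,18,23,19,36] (q [[-1,1,-1],[0,0,-1,-1],[-2,1,-3,-1,-1],[-1,1,-2],[0,1,-1]]++u [13,14,128,134]) [0,-1,1,0,0,0,0,0],
.A [34,17,19,18,16,36] (q [[-1,1,-1],[-2,1,-3,-1,-1],[-1,1,-2],[0,0,-1,-1],[0,-1,-1,-2,-1,-1],[0,1,-1]]++u [13,14,134]) [0,-1,1,0,0,0,0,0],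
.A [55,77,35] (q [[1,1,1],[0,0,-1],[1,-1,1]]++u [8,9,10,12,14,17,19,21,23,25,33,45,129,131,138,139,144,150]) [-1,0,1,0,0,0,0,0]
]
set_option maxHeartbeats 2000000 in
def dat5 : List (List ℕ × Cert) := ((bins 8).drop 161).zip [
.A [51,72,22,50] (q [[0,1],[0,0,-1,-1],[1,0,1],[1,2,1,2]]++u [10,17,18,21,24,27,33,39,134,141,147,153,159,12,19,25,31]) [-1,-2,1,1,0,0,0,0],
.A [50,65,58,22] (q [[1,0,0,1,0,1],[1,0,0,1,0,2],[0,0,1,1],[1,0,1,1,0,1]]++u [8,10,11,12,18,19,21,25,27,33,128,130,132,141,145,153]) [1,1,-1,0,-1,1,0,0],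
.A [36,59,23,42,37] (q [[1,0,0,0,0,0,1],[1,-1,1,0,0,0,2],[0,-1,1,0,-1,0,1],[1,-1,1,0,0,0,1],[0,0,-1]]++u [10,18,19,21,131,132,134,139,141,145,147,11,14,27,130]) [1,1,-1,-1,1,0,0,0],
.A [50,22,59,32,58] (q [[1,0,1,2,1],[1,2,3,2,1],[0,1,1,1,1],[0,-1],[0,1,1,1]]++u [8,9,12,14,16,19,128,129,136,21,27,132,139]) [1,0,-1,0,0,1,0,0],
.A [37,59,36,52,35,40] (q [[1,2,1,4,3,2],[0,1,0,1,1],[1,2,1,3,2,1],[0,0,1,1],[1,1,2,3,2,1],[1,2,2,4,3,2]]++u [9,11,12,14,21,129,131,132,134,147,141,139]) [0,0,1,-1,0,0,1,0],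
.A [32,37,50,39,36,22] (q [[1,1,1,2,2,2],[0,-1,-1,-1,-1],[1,1,1,2,2,1],[1,1,0,1,2,2],[0,0,0,0,-1],[1,0,0,0,1,1]]++u [8,11,12,14,19,21,27,128,132,139,141,147]) [-1,0,1,0,0,-1,1,0],
.A [35,36,32,16,39] (q [[1,-1,0,0,0,1,1],[1,0,1,0,0,1,1],[1,-1,1,0,0,2,2],[0,0,1,0,0,0,1],[1,-1,0,0,0,2,2]]++u [11,14,19,21,27,131,134,139,141,147]) [1,0,0,-1,0,1,0,0],
.A [46,44,47,29] (q [[1,2,3,1],[-1,-2,0,-1],[-1,1,0,2],[2,1,3,2]]++u [8,9,14,16,128,129,130,132,136,137,143]) [1,0,-1,0,1,0,0,0],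
.A [41,40,45,29,38] (q [[0,1,1,2,1],[0,1,1,0,-1],[-2,-1,-3,-2,-3],[0,0,0,0,-1],[-1,-1,-1,-1,-1]]++u [9,10,14,17,129,130,132,134,137,141]) [-1,0,0,1,-2,1,0,0],
.A [32,31,36,30,34,47] (q [[-1,-1,0,-2,-2,0,1],[-2,-1,-1,-3,-3,0,2],[-2,-1,-1,-4,-4,0,2],[-2,-1,-2,-4,-3,0,1],[-1,0,0,-1,-1,0,1],[-1,0,-1,-1,-1]]++u [8,10,12,14,21,128,130,134,141]) [-1,0,1,0,-1,0,1,0],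
.A [31,40,39,16,26,29] (q [[-1,-1,-1,-1,-1],[-1,0,0,0,-1],[0,2,1,3,1],[-1,-1,-1,-2,-2,-1],[0,1,1,2,1],[0,1,1,2]]++u [12,21,130,134,141,10,14,132]) [1,0,0,-1,1,0,0,0],
.A [24,45,36,26,25] (q [[1,0,0,0,1],[0,1,0,1,1],[2,1,1,2,2],[1,1,1,2,2],[1,0,0,1,1]]++u [8,9,16,128,129,134,136,141,14,21]) [-1,0,1,0,-1,1,0,0],
.A [36,25,24,26,23,39] (q [[2,-1,1,2,0,0,2],[1,-1,0,1,0,0,1],[1,-1,0,0,0,0,1],[1,-1,1,2,0,0,2],[0,-1,0,0,-1,0,1],[0,0,0,1,0,0,1]]++u [9,21,132,134,141,129,14]) [1,-1,-1,1,0,-1,1,0],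
.A [29,34,22,17,25] (q [[0,0,1,1],[-1,-1,1],[0,-1,0,-1],[-1,-1,0,-1,-1],[-1,-2,0,-1]]++u [8,12,21,132,134,14]) [-1,-1,1,0,0,0,0,0],
.A [22,16,18,41,29,17] (q [[0,0,1],[-1,-2,-1,-2,-1,-1],[-1,-2,0,-1],[-1,-1,1],[0,-1],[-1,-1,0,-1,-1]]++u [12,14,21,132,141]) [-1,-1,1,0,0,0,0,0],
.A [22,26,40] (q [[1,0,1],[-1,-2,1],[-1,2,1]]++u [9,10,14,16,17,23,131,138]) [1,0,-1,1,0,0,0,0],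
.A [45,22,28,38] (q [[-1,0,-1,-2],[0,0,0,-1],[0,1,1,1],[-2,-1,-1,-3]]++u [11,14,18,129,137,144,134]) [-1,1,1,-2,1,0,0,0],
.A [39,22,32,28,37] (q [[-1,-1,-2,-3,-2],[0,-1,-1,-2,-2],[-1,-1,-1,-2,-1],[0,0,0,0,-1],[0,-1,-1,-1,-2]]++u [8,11,14,128,130,134]) [0,0,0,0,-1,1,0,0],
.A [34,23,32,31,22] (q [[-1,-1,-2,-3],[-1,-1,-2,-3,-1],[0,0,1,1],[-1,-2,-3,-4],[0,-1,-1,-2]]++u [10,11,14,131,134,138,130]) [0,0,0,-1,1,0,0,0],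
.A [39,22,25,26,28] (q [[-3,-1,-2,-5,0,2],[-2,-1,-1,-4,0,2],[-2,-1,-1,-3,0,2],[-2,-1,-1,-3,0,1],[-1,0,0,-1,0,1]]++u [8,9,11,14,16,131]) [-1,0,1,-1,0,1,0,0],
.A [30,28,39,22,26,25] (q [[-1,-1,-1,-2,-1],[0,1,1,1,1,1],[2,4,3,5,5,2],[2,3,3,4,4,2],[1,2,2,3,3,1],[1,2,2,3,3,2]]++u [9,11,14,134,131]) [0,-1,0,1,-1,0,1,0],
.A [26,25,28,17,22,30] (q [[-1,-2,0,-1,-1,-1],[1,2,3,4,4,4],[0,1,1,1,1,1],[-2,-4,-3,-5,-5,-2],[2,1,3,2,2,2],[-1,1,0,-1,2,2]]++u [8,128,131,11,14]) [1,0,-1,1,0,-1,1,0],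
.A [28,33,17,22,16,26] (q [[0,1,1,1],[-1,0,-1,-2],[-1,-1,-1,-2,-1],[0,0,0,-1],[-2,-1,-3,-5,-2,-2],[-2,-1,-1,-3]]++u [14,131,134,11]) [-1,1,1,-2,1,0,0,0],
.A [22,28,25,27] (q [[2,1,1,2],[1,1,1,2],[2,1,1,3],[1,1,0,1]]++u [9,10,16,17,23,130,134]) [-1,0,1,-1,1,0,0,0],
.A [31,33,20,22,30] (q [[0,-1,-1,-1,-1],[-1,-1,-2,-3,-3],[-1,-1,-1,-2,-2],[0,-1,-1,-2,-2],[-1,-1,-1,-2,-1]]++u [9,14,129,130,137]) [0,0,0,0,-1,1,0,0],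
.A [30,27,20,25,22] (q [[-1,-1,0,-1,1],[1,1,2,3,3],[0,0,1,1,1],[1,-1,0,1,1],[1,0,1,1,1]]++u [10,14,128,130]) [0,1,0,0,-1,1,0,0],
.A [27,25,28,16,22,24] (q [[0,1,-1,-1,0,1,0,1],[-1,1,-2,-3,0,3,0,3],[-1,1,-1,-2,0,2,0,2],[-1,0,-1,-2,0,1,0,2],[0,1,-1,-2,0,2,0,2],[-1,0,-1,-2,0,1,0,1]]++u [14,130,134,10]) [1,1,-1,0,-1,1,0,0],
.A [19,22,30,28] (q [[-1,-2,1],[0,-1,1],[-1,-1,0,-1],[-1,-1,1]]++u [14,128,134,136]) [-1,-1,1,0,0,0,0,0],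
.A [19,24,22,28,23] (q [[-1,-2,1],[-1,-1,0,-1],[0,-1,1],[-1,-1,1],[-1,-2,0,-1,-1]]++u [14,129,134]) [-1,-1,1,0,0,0,0,0],
.A [18,23,20,22,27] (q [[-1,0,0,-1],[-1,1,0,-1,-1],[-1,1,1],[0,1,1],[-1,2,1]]++u [14,128,134]) [1,-1,-1,1,0,0,0,0],
.A [17,22,19,28,16,18] (q [[-1,-2,0,-1,-1],[0,-1,1],[-1,-2,1],[-1,-1,1],[-1,-1,-1,-2,-1,-1],[-1,-1,0,-1]]++u [14,134]) [-1,-1,1,0,0,0,0,0],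
.A [60,85,93,50,74] (q [[1,-1,-1,-2,-1],[1,-1,1,0,-1],[0,-1,-1,-1],[1,1,1,2,1],[1,1,3,2,1]]++u [9,11,13,16,18,19,20,24,25,26,30,31,44,128,129,130,136,137,140,143,145,150,151,152,158,8,10,12,23,32]) [-1,1,0,0,0,0,0,0]
]
set_option maxHeartbeats 2000000 in
def dat6 : List (List ℕ × Cert) := ((bins 8).drop 193).zip [
.A [50,79,67,58,54] (q [[1,1,1,1],[1,1,2,1,0,0,1],[0,0,0,0,0,0,1],[0,0,1,1,0,0,1],[0,-1]]++u [11,12,17,19,20,24,32,129,130,133,137,138,140,144,151,152,158,10,13,18,132,139]) [1,3,0,-2,0,0,0,1],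
.A [70,63,43,52,54] (q [[0,1,0,1,0,0,0,1],[0,0,1],[1,2,0,2,0,0,0,1],[1,2,0,3,0,0,0,1],[1,1,0,2,0,0,0,1]]++u [8,10,12,18,19,20,25,32,128,130,131,132,133,140,145,152,11]) [-1,1,2,-2,0,0,1,0],
.A [43,63,30,48,37,52] (q [[0,-1,3,1,0,-3,0,1],[0,-1,3,1,0,-2,0,1],[-1,-2,3,0,0,-3,0,1],[0,-1,1,0,0,-1],[0,-1,2,1,0,-2,0,1],[-1,-2,4,1,0,-4,0,1]]++u [10,12,13,18,19,20,25,32,132,133,138,139,140,152,11]) [1,1,0,0,-2,0,1,1],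
.A [48,51,33,50,59] (q [[1,0,0,-1,1],[1,1,1,0,1],[0,0,-1,-1],[1,1,1,1,1],[0,0,0,0,1]]++u [9,12,16,19,20,26,128,129,131,132,136,139,8,13]) [-1,-1,0,2,-2,1,0,0],
.A [46,40,50,44,48,33] (q [[0,1,1,2,0,1,1],[1,1,2,2,0,1],[1,2,3,5,0,2,1],[0,1,2,4,0,2,1],[1,1,2,3,0,2,1],[0,1,1,3,0,2,1]]++u [9,13,20,26,129,132,133,139,140,146,12,19]) [1,1,0,-1,0,0,0,1],
.A [36,43,42,47,30,31] (q [[0,0,-1,-1,-1],[1,2,1,3,3,1],[1,0,1,1,1,1],[0,1,0,1,1,1],[-1,0,-3,-3,-1,1],[0,0,-1]]++u [8,11,12,13,26,128,131,132,139,140,20]) [-1,-1,2,0,0,-1,1,0],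
.A [38,57,16,33,36,42] (q [[-1,0,1,0,-1,1,0,1],[0,1,2,0,1,1,0,1],[-1,0,1,0,-1,1,0,2],[-1,1,2,0,0,2,0,2],[0,0,0,0,-1],[0,0,1,0,0,1,0,1]]++u [11,13,19,20,26,133,140,146]) [-1,1,2,-2,0,1,-1,1],
.A [47,51,35,36,39] (q [[0,1,1,2,1],[0,1,1,1,1],[1,3,3,5,4],[1,1,1,1],[0,1,0,1,1]]++u [8,9,10,12,13,17,23,129,130,132,137,143]) [1,-1,0,0,-1,2,0,0],
.A [42,36,30,41,33,46] (q [[1,1,2,2,2,1],[1,1,1,1,1],[1,1,1,1,2],[2,3,4,5,5,1],[0,1,0,1,1,1],[0,1,2,1,1,1]]++u [10,13,17,20,132,133,140,9,12,130]) [0,-1,-1,2,-2,1,1,0],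
.A [35,41,44,24,33,36] (q [[1,1,2,2,2,1],[0,1,1,1,1],[1,2,4,3,3,2],[0,1,1,0,1],[1,2,3,3,3,2],[1,2,3,2,2,1]]++u [8,12,13,128,130,132,133,20,10]) [1,-1,-2,2,-1,0,1,0],
.A [23,38,33,41,24,35,36] (q [[0,-1,-2,0,-1,0,1],[1,1,2,3,2,2,1],[1,1,1,3,2,2,1],[0,0,-1,1,0,0,1],[0,0,-1,0,0,0,1],[1,0,0,2,1,1,1],[1,1,1,2,1,1,1]]++u [12,13,20,132,140,10,130]) [-1,1,2,-2,1,0,-1,1],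
.A [27,35,37,32,36,24] (q [[1,2,1,3,3,2],[1,0,1,1,1],[1,0,-1,1,1,2],[1,1,1,2,2,2],[3,2,1,3,3,4],[1,0,-1,-1,1,2]]++u [8,9,12,16,20,129,133,13]) [-1,0,1,0,0,-1,1,0],
.A [23,36,35,24,25,34] (q [[1,0,3,1,1,2],[1,1,1,1,1,1],[1,0,2,1,1,1],[0,0,-1,-1],[1,1,2,2,2,2],[1,1,3,2,2,2]]++u [9,12,13,20,129,133]) [0,0,-1,1,0,-1,1,0],
.A [32,27,36,17,35] (q [[1,1,1,0,2,2],[1,1,0,0,2,2],[1,1,1,0,1,1],[1,0,-1,0,1,2],[1,0,0,0,1,1]]++u [8,13,20,133,140]) [-1,0,1,0,0,-1,1,0],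
.A [35,36,17,32,27,16] (q [[1,1,2,0,2,1,1],[1,2,3,0,2,1,1],[1,2,3,0,3,2,2],[1,3,5,0,4,2,2],[1,3,4,0,4,2,2],[0,1,2,0,1,0,1]]++u [13,20,133,140]) [1,0,-1,0,0,1,-1,1],
.A [45,46,29] (q [[1,1],[1,1,1],[2,1,1]]++u [8,11,18,24,30,128,129,136,137,143,144,150]) [-1,-1,0,1,0,0,0,0],
.A [42,44,28,39] (q [[0,-1,-1,0,-2],[-1,-1,-1,0,-1],[0,0,0,0,-1],[-1,-1,-2,0,-2]]++u [9,11,13,18,129,130,137,138,144,133]) [0,1,1,-2,1,0,0,0],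
.A [27,38,42,28,37] (q [[1,1,2,3,2],[0,0,1,1,1],[2,1,3,4,2],[1,1,2,3,1],[0,0,0,1]]++u [8,10,11,18,128,130,131,138]) [0,1,0,-1,0,1,0,0],
.A [40,38,29,21,30,35] (q [[0,1,2,2,1,0,0,1],[-1,0,1,2,1,0,0,1],[0,0,1,1,0,0,0,1],[-1,1,2,4,2,0,0,2],[-1,0,1,2,1,0,0,2],[0,1,2,3,2,0,0,1]]++u [10,11,13,18,130,131,133,138]) [0,1,1,-1,0,-1,1,0],
.A [37,35,38,27,28] (q [[0,0,0,1],[2,1,3,4,2],[-2,-1,0,-1,1],[-1,1,0,1,2],[1,2,3,5,1]]++u [8,11,128,129,133,136,131]) [1,1,0,-1,0,1,0,0],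
.A [34,21,32,30,29,31] (q [[1,1,1,3,3,0,-1],[1,1,0,3,3,0,-2],[0,0,0,1,1,0,-1],[2,1,0,4,5,0,-3],[2,1,1,4,4,0,-2],[0,0,0,1,1]]++u [9,13,129,131,133,11]) [-1,0,1,0,-1,0,1,0],
.A [32,17,30,28,27,29] (q [[-2,-1,-2,0,-1,0,0,1],[-2,-1,-3,-1,-2,0,0,1],[-2,-1,-3,-1,-2,0,0,2],[-1,0,-1,0,-1,0,0,1],[-3,-1,-4,0,-2,0,0,2],[-2,-1,-3,0,-2,0,0,2]]++u [8,13,128,131,133,11]) [-1,-1,0,1,0,-1,1,0],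
.A [24,16,29,21,34,35,32] (q [[1,2,3,5,4,3,3],[-1,-1,-1,-1,-1,-1],[1,1,2,2,1,1,1],[0,1,1,3,2,1,1],[1,2,3,3,2,1,1],[0,0,0,1,1],[-1,0,1,3,2,1,1]]++u [11,13,131,133]) [1,1,0,-1,0,1,-1,1],
.A [21,25,29,26] (q [[-1,2,1,3],[-1,-2,-3,-1],[1,0,1,1],[-1,0,1,1]]++u [9,10,13,16,17,23,130]) [1,1,0,-1,1,0,0,0],
.A [31,32,21,29,30] (q [[0,0,0,1,1],[-1,-1,-1,-2,-2],[-1,-1,-2,-3,-3],[0,-1,-1,-2,-2],[-1,-2,-3,-5,-4]]++u [9,13,129,130,137]) [0,0,0,0,-1,1,0,0],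
.A [30,28,25,26,29] (q [[-1,-2,-1,-3,-2],[-2,-2,-1,-3,-3],[-1,-1,-1,-1,-1],[0,0,1,1,1],[0,-1,0,-1,-1]]++u [10,128,130,133]) [-1,-1,1,0,-1,1,0,0],
.A [28,29,19,23,24,32] (q [[-2,-2,-1,-3,-3,-3],[0,-1,0,-1,-1,-1],[-1,-1,-1,-1,-1,-1],[-2,-2,-3,-3,-3,-1],[-1,-2,-1,-3,-2,-2],[0,0,1,1,1,1]]++u [10,13,130,133]) [-1,-1,1,0,0,-1,1,0],
.A [29,18,28,19] (q [[0,-1,1],[-1,-2,1,-1],[-1,-1,1],[-1,-1]]++u [9,13,16,133]) [-1,-1,1,0,0,0,0,0],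
.A [19,23,29,24,28] (q [[-1,-1],[-1,-1,-1,-1,-1],[0,-1,1],[-1,-2,1,-1],[-1,-1,1]]++u [13,129,133]) [-1,-1,1,0,0,0,0,0],
.A [23,18,26,21,29] (q [[-1,-1,-1,-1,-1],[-1,-2,-3,-1],[-1,-1,-1],[-1,-1,-2],[0,-1,-1]]++u [13,128,133]) [0,-1,-1,1,0,0,0,0],
.A [21,17,26,18,16,29] (q [[-1,-1,-2],[-1,-1,-1,-1,-1],[-1,-1,-1],[-1,-2,-3,-1],[-1,-2,-3,-2,-1,-1],[0,-1,-1]]++u [13,133]) [0,-1,-1,1,0,0,0,0],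
.A [48,70,34,52] (q [[0,-1,1],[-1,-1,-1,-1],[0,0,1],[0,0,1,1]]++u [9,10,11,12,17,18,23,25,37,131,137,138,144,150,151,8,129]) [-1,-1,1,0,0,0,0,0]
]
set_option maxHeartbeats 2000000 in
def dat7 : List (List ℕ × Cert) := ((bins 8).drop 225).zip [
.A [47,46,35,45,44] (q [[0,1,1,2,1],[0,1,1,1,1],[0,1,1,2,2],[-1,0,-1,0,1],[-1,-1,-1,-1]]++u [9,10,11,17,19,24,129,130,131,137,139,144]) [1,0,0,0,-1,1,0,0],
.A [34,44,39,22,47] (q [[0,1,1,1,1],[-1,-1,-1,-2,-1],[-2,-1,-3,-5,-3],[0,0,0,-1,-1],[0,1,1,1,-1]]++u [8,10,11,19,25,128,130,131,12]) [-1,1,1,-1,-1,1,0,0],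
.A [35,39,23,38,40,41] (q [[-4,-3,-5,-4,2,0,0,2],[-3,-2,-4,-3,1,0,0,1],[-4,-3,-5,-4,1,0,0,2],[-1,-1,-1,-1],[-2,-1,-2,-2,1,0,0,1],[-2,-1,-2,-1,1,0,0,1]]++u [11,12,18,19,131,132,138,139,10,130]) [-1,0,0,-1,2,-1,0,1],
.A [39,34,29,32] (q [[-1,1,0,2],[0,1,1,1],[0,1,1,2],[-1,0,0,1]]++u [8,9,11,12,16,129,131,132]) [1,0,0,-1,1,0,0,0],
.A [32,37,22,29,39,34] (q [[-1,-1,0,-1,-1,0,1],[0,-1,0,0,1,0,1],[0,-1,0,-1,0,0,1],[0,0,1,1,0,0,1],[-1,-1,0,-1,-1,0,2],[0,0,1,1,1,0,1]]++u [9,11,12,129,131,132,139]) [-1,0,1,0,-1,0,1,0],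
.A [30,32,17,41,28,33,35] (q [[0,1,1,1,2,1,1],[0,0,1,1,1,1],[2,4,5,7,7,5,4],[0,1,1,2,2,1,1],[2,4,5,5,5,3,2],[1,2,2,3,3,2,1],[2,3,4,5,5,3,2]]++u [8,12,19,128,131,132,139]) [1,-1,-1,2,-2,1,-1,2],
.A [17,34,33,29,35,32,16] (q [[2,0,1,-3,-1,1,0,1],[2,1,2,-1,0,1,0,1],[3,1,2,-2,0,2,0,2],[2,1,2,0,0,1,0,1],[2,0,1,-2,0,1,0,1],[1,0,1,-1,0,1,0,1],[2,0,1,-3,-1,1,0,2]]++u [11,12,19,131,132]) [1,1,1,-2,0,1,-1,1],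
.A [27,32,28,22] (q [[-1,0,-1,-2],[-2,-1,-1,-3],[0,1,1,1],[0,0,0,-1]]++u [9,10,12,16,17,23,130]) [-1,1,1,-2,1,0,0,0],
.A [26,30,28,33,29] (q [[-1,-1,0,0,0,1],[0,-1,1,-1,0,2],[0,0,1,0,0,1],[-1,-1,0,0,0,2],[0,-1,1,0,0,2]]++u [9,10,12,17,130,132]) [-1,-1,0,1,-1,1,0,0],
.A [33,24,26,29,28,37] (q [[0,0,1,1,1,2],[-1,-2,0,-2,-1,2],[0,0,1,1,1,1],[0,-1,1,0,0,2],[-1,-1,0,-1,-1,1],[-1,-1,-1,-1,-1]]++u [8,10,12,130,132]) [1,1,-1,0,1,-2,1,0],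
.A [31,32,22,23,27,26,28] (q [[0,1,1,1,2,2,2],[0,1,1,1,2,2,1],[0,1,1,0,2,2,2],[-2,-1,-2,-4,-1,0,1],[-1,1,0,-1,2,2,2],[-1,-1,-1,-2,-1,-1],[0,1,1,1,1,1,1]]++u [10,12,130,132]) [1,-1,-1,2,-1,0,-1,1],
.A [22,24,27,25,26,28] (q [[2,2,3,3,3,2],[-2,0,-1,-3,1,2],[2,4,3,5,5,2],[2,4,5,7,7,6],[0,0,1,1,1],[0,1,1,1,1,1]]++u [8,9,12,16,129]) [1,-1,-1,2,-1,-1,2,0],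
.A [28,29,26,24,25,23,27] (q [[0,1,1,2,1,1,1],[0,0,0,1,0,0,1],[-1,-1,-1,-1,-1,-1],[0,1,1,3,2,2,3],[0,1,1,3,2,2,1],[-2,-2,-3,-3,-3,-2],[-2,-1,-3,-1,-2,-2,1]]++u [9,129,132]) [1,1,1,-2,1,1,-2,1],
.A [27,28,29,18,23,26] (q [[-1,1,0,4,2,2],[0,1,1,2,1,1],[0,1,1,4,2,2],[0,1,1,3,2,2],[-2,0,-1,3,1,2],[-1,0,0,2,1,1]]++u [12,128,132]) [1,1,1,-2,1,-1,1,0],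
.A [28,26,17,22,25,16,27] (q [[2,2,3,5,2,1,1],[1,1,2,3,2,1,1],[2,2,3,5,3,2,2],[4,3,5,8,4,2,2],[4,3,5,9,4,2,2],[2,1,2,4,1,0,1],[3,3,4,7,4,2,2]]++u [12,132]) [-1,1,1,-2,1,1,-1,1],
.A [21,22,38] (q [[-1,2,1],[0,1,1],[-1,1,1]]++u [8,11,18,24,30,129,137,144]) [1,-1,-1,1,0,0,0,0],
.A [37,38,21,22] (q [[1,-1,0,1],[0,0,1,1],[1,1,2,3],[1,0,1,1]]++u [11,18,24,129,137,144]) [0,1,0,-1,1,0,0,0],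
.A [33,31,26,22] (q [[-1,-1,-2,-3],[0,-1,-1,-1],[-1,-1,-1,-2],[0,-1,-1,-2]]++u [8,10,130,131,138]) [0,0,0,-1,1,0,0,0],
.A [31,20,21,26,22,30] (q [[0,-1,-1,-1,-1,-1],[-1,-1,-1,-2,-2,-1],[-1,-1,-2,-3,-3,-3],[0,0,0,0,0,-1],[0,-1,-1,-2,-2,-2],[-2,-2,-3,-5,-4,-3]]++u [10,11,18,131,138]) [0,0,0,0,0,-1,1,0],
.A [26,21,22,25] (q [[0,0,1,1],[1,1,2,3],[1,0,1,1],[1,-1,0,1]]++u [9,11,16,131]) [0,1,0,-1,1,0,0,0],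
.A [27,30,20,22,21,25] (q [[0,1,1,1,1,0,-1],[-2,1,0,-2,-1,0,-3],[-1,1,1,0,0,0,-2],[0,1,1,0,0,0,-2],[-1,1,0,-1,-1,0,-2],[0,0,0,0,0,0,-1]]++u [9,11,131]) [1,-1,-1,1,0,-1,1,0],
.A [24,23,27,25,20,22] (q [[-1,-1,0,-1,1,0,0,1],[-1,-1,0,-1,1,0,0,2],[-1,-1,1,0,3,0,0,3],[0,-1,0,0,1,0,0,1],[-1,-1,1,0,2,0,0,2],[0,-1,1,0,2,0,0,2]]++u [8,11,128,131]) [1,-1,-1,1,0,-1,1,0],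
.A [25,26,16,27,20,17,22] (q [[2,0,1,3,2,1,1],[0,0,1,1,2,1,1],[0,-1,-1,-1,-1,-1],[4,4,5,9,6,3,3],[2,2,3,5,2,1,1],[2,2,3,5,4,3,3],[2,1,2,3,2,1,1]]++u [11,131]) [-1,1,1,-1,0,1,-1,1],
.A [25,21,20,22] (q [[2,-2,-1,1],[2,2,1,3],[0,0,1,1],[2,0,1,1]]++u [9,16,130]) [-1,1,1,-1,1,0,0,0],
.A [25,21,20,30,22] (q [[0,-1,-1,-1,-1],[-1,-1,-2,-3,-3],[-1,-1,-1,-2,-2],[-2,-2,-3,-5,-4],[0,-1,-1,-2,-2]]++u [9,130]) [0,0,0,0,-1,1,0,0],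
.A [24,21,20,19,22] (q [[-2,2,1,-1,0,-4],[-1,2,1,0,0,-3],[-1,1,1,0,0,-2],[0,0,0,0,0,-1],[0,1,1,0,0,-2]]++u [8,10]) [1,-1,-1,1,-1,1,0,0],
.A [22,19,23,20,21,24] (q [[0,-1,-1,-2,-2,-2],[0,-1,-1,-1,-1,-1],[0,-1,-1,-1,-1],[-1,-1,-1,-2,-2,-2],[-1,-1,-2,-3,-3,-3],[-2,-2,-3,-5,-4,-4]]++u [10,130]) [0,0,0,0,0,-1,1,0],
.A [22,20,19,18,21] (q [[4,-1,1,2,0,2],[1,-1,1,2,0,2],[2,-2,-1,1,0,1],[2,-2,-1,1,0,4],[1,0,0,1,0,1]]++u [9,16]) [1,-1,-1,1,-1,1,0,0],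
.A [22,20,19,18,23,21] (q [[4,1,3,4,2,2],[1,1,3,4,2,2],[2,-1,0,2,1,1],[2,2,3,5,4,4],[0,-1,-1,-1,-1],[1,1,1,2,1,1]]++u [9]) [-1,1,1,-1,1,-1,1,0],
.A [21,19,18,17,22,20] (q [[1,1,1,2,1,1],[2,-1,0,2,1,1],[2,2,3,5,4,4],[0,-1,-1,-1,-1],[4,1,3,4,2,2],[1,1,3,4,2,2]]++u [8]) [-1,1,1,-1,1,-1,1,0],
.A [20,18,17,16,21,19,22] (q [[-1,-3,-3,-4,-4,-2,-2],[-2,-6,-7,-9,-8,-4,-4],[0,-1,-1,-1,-1],[-2,-5,-6,-8,-7,-4,-3],[-1,-4,-5,-6,-6,-3,-3],[0,-2,-2,-2,-2,-1,-1],[0,-3,-3,-4,-4,-2,-2]]) [1,-1,-1,1,-1,1,-1,1]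
]
lemma tt0 : (dat0.all fun p => D.chk p.1 p.2) = true := by decide +kernel
lemma tt1 : (dat1.all fun p => D.chk p.1 p.2) = true := by decide +kernel
lemma tt2 : (dat2.all fun p => D.chk p.1 p.2) = true := by decide +kernel
lemma tt3 : (dat3.all fun p => D.chk p.1 p.2) = true := by decide +kernel
lemma tt4 : (dat4.all fun p => D.chk p.1 p.2) = true := by decide +kernel
lemma tt5 : (dat5.all fun p => D.chk p.1 p.2) = true := by decide +kernel
lemma tt6 : (dat6.all fun p => D.chk p.1 p.2) = true := by decide +kernel
lemma tt7 : (dat7.all fun p => D.chk p.1 p.2) = true := by decide +kernel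
def dat : List (List ℕ × Cert) := dat0 ++ (dat1 ++ (dat2 ++ (dat3 ++ (dat4 ++ (dat5 ++ (dat6 ++ (dat7)))))))
lemma tt : (dat.all fun p => D.chk p.1 p.2) = true := by
  simp only [dat, List.all_append, tt0, tt1, tt2, tt3, tt4, tt5, tt6, tt7, Bool.and_self]
theorem main : PanyushevProperty ℂ (Matrix.ToLieAlgebra ℂ CartanMatrix.E₈) :=
  fin md ck ![92, 136, 182, 270, 220, 168, 114, 58] (by decide +kernel) dat tt (by decide +kernel)
end PaperStmt.E8

namespace PaperStmt

open LieAlgebra Module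

/-- The simple complex Lie algebras of exceptional type `E₆`, `E₇`, `E₈`, `F₄`, `G₂`
all have the Panyushev property. -/
theorem panyushevProperty_of_exceptional :
    PanyushevProperty ℂ (LieAlgebra.e₆ ℂ) ∧ PanyushevProperty ℂ (LieAlgebra.e₇ ℂ) ∧
    PanyushevProperty ℂ (LieAlgebra.e₈ ℂ) ∧ PanyushevProperty ℂ (LieAlgebra.f₄ ℂ) ∧
    PanyushevProperty ℂ (LieAlgebra.g₂ ℂ) := by
  exact ⟨E6.main, E7.main, E8.main, F4.main, G2.main⟩

end PaperStmt
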